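/- For every ε > 0 there exists a homotopically non-trivial C¹ map from S^6 to S^4 with 4-dilation less than ε. (The class of such a map is the non-trivial element of π_6(S^4) ≅ ℤ/2, a double suspension of a class in π_4(S^2).) -/

import Mathlib

/-!
Basic notions: the unit sphere `S^{d-1} ⊆ ℝ^d`, the norm `‖Λ^k A‖` of the induced map on
`k`-th exterior powers of a linear map between inner product spaces, and the `k`-dilation of a
`C¹` map between unit spheres.  A (`C¹`) map from `S^{d₁-1}` to `S^{d₂-1}` is represented by a
(`C¹`) ambient map `F : ℝ^{d₁} → ℝ^{d₂}` mapping the unit sphere into the unit sphere; its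
`k`-dilation only depends on the restriction of `F` to the sphere, since the derivative is
restricted to the tangent space of the sphere.
-/

open scoped RealInnerProductSpace
open Set

noncomputable section

abbrev EucA (d : ℕ) := EuclideanSpace ℝ (Fin d)

/-- The unit sphere `S^{d-1}` in `ℝ^d` (with the round metric induced from `ℝ^d`). -/
def usph (d : ℕ) : Set (EucA d) := Metric.sphere 0 1

/-- The operator norm `‖Λ^k A‖` of the induced map on `k`-th exterior powers (with their induced
inner products): the supremum, over orthonormal `k`-frames `v` of the domain, of the `k`-volume
`√ det (⟪A vᵢ, A vⱼ⟫)` of the image frame `A v₁, …, A v_k`. -/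
noncomputable def lamNorm {E F : Type*} [NormedAddCommGroup E] [InnerProductSpace ℝ E]
    [NormedAddCommGroup F] [InnerProductSpace ℝ F] (k : ℕ) (A : E →ₗ[ℝ] F) : ℝ :=
  ⨆ v : {v : Fin k → E // Orthonormal ℝ v},
    Real.sqrt (Matrix.of fun (i j : Fin k) => ⟪A (v.1 i), A (v.1 j)⟫).det

/-- The `k`-dilation of a map of the unit sphere `S^{d-1}` into an inner product space (e.g. into
`ℝ^{d₂}`, for a map to the sphere `S^{d₂-1}`), the map being given by an ambient map `F`: the
supremum over points `x` of the sphere of `‖Λ^k df_x‖`, where `df_x` is the derivative of `F` at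
`x` restricted to the tangent space `(ℝ∙x)ᗮ` of the sphere at `x`. -/
noncomputable def kDilation {d : ℕ} {F' : Type*} [NormedAddCommGroup F']
    [InnerProductSpace ℝ F'] (k : ℕ) (F : EucA d → F') : ℝ :=
  ⨆ x : usph d,
    lamNorm k ((fderiv ℝ F (x : EucA d)).toLinearMap ∘ₗ ((ℝ ∙ (x : EucA d))ᗮ).subtype)

/-- A free homotopy, through maps of the unit sphere `S^{d-1}` into `T`, between (the
restrictions to the sphere of) `f` and `g`: a map `H` on `[0,1] × S^{d-1}`, continuous there,
with values in `T`, starting at `f` and ending at `g`. -/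
def FreelyHomotopic {d : ℕ} {E : Type*} [NormedAddCommGroup E] (T : Set E)
    (f g : EucA d → E) : Prop :=
  ∃ H : ℝ → EucA d → E,
    ContinuousOn (fun q : ℝ × EucA d => H q.1 q.2) (Icc (0:ℝ) 1 ×ˢ usph d) ∧
    (∀ t ∈ Icc (0:ℝ) 1, MapsTo (H t) (usph d) T) ∧
    EqOn (H 0) f (usph d) ∧ EqOn (H 1) g (usph d)

/-- A based homotopy (rel the basepoint `x₀` of the sphere, with basepoint value `y₀`), through
maps of the unit sphere `S^{d-1}` into `T`, between `f` and `g`. -/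
def BasedHomotopic {d : ℕ} {E : Type*} [NormedAddCommGroup E] (T : Set E)
    (x₀ : EucA d) (y₀ : E) (f g : EucA d → E) : Prop :=
  ∃ H : ℝ → EucA d → E,
    ContinuousOn (fun q : ℝ × EucA d => H q.1 q.2) (Icc (0:ℝ) 1 ×ˢ usph d) ∧
    (∀ t ∈ Icc (0:ℝ) 1, MapsTo (H t) (usph d) T) ∧
    (∀ t ∈ Icc (0:ℝ) 1, H t x₀ = y₀) ∧
    EqOn (H 0) f (usph d) ∧ EqOn (H 1) g (usph d)

/-- A sphere-valued map is nullhomotopic if it is freely homotopic, through sphere maps, to a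
constant map; a map is homotopically non-trivial if it is not nullhomotopic. -/
def SphereNullhomotopic {d₁ d₂ : ℕ} (F : EucA d₁ → EucA d₂) : Prop :=
  ∃ y ∈ usph d₂, FreelyHomotopic (usph d₂) F (fun _ => y)

set_option linter.unusedSectionVars false

section DiracOperators

open scoped Quaternion

section LinearAlgebra

open Filter Topology

theorem det_nonneg_of_commute_complex_structure {V : Type*} [AddCommGroup V] [Module ℝ V]
    [FiniteDimensional ℝ V] (N J : V →ₗ[ℝ] V) (hJ : J * J = -1) (hc : N * J = J * N) :
    0 ≤ LinearMap.det N := by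
  let φ : ℂ →ₐ[ℝ] Module.End ℝ V := Complex.lift ⟨J, hJ⟩
  let : Module ℂ V := Module.compHom V φ.toRingHom
  have hsm : ∀ (z : ℂ) (v : V), z • v = z.re • v + z.im • J v := by
    intro z v
    change φ z v = _
    simp [φ, Complex.liftAux_apply, Algebra.algebraMap_eq_smul_one]
  have : IsScalarTower ℝ ℂ V := by
    refine ⟨fun r z v => ?_⟩
    simp [hsm, smul_add, mul_smul]
  let N' : V →ₗ[ℂ] V :=
    { toFun := N
      map_add' := map_add N
      map_smul' := by
        intro z v
        have h := LinearMap.congr_fun hc v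
        simp only [Module.End.mul_apply] at h
        simp [hsm, h] }
  have h1 : N = N'.restrictScalars ℝ := by ext v; rfl
  have : FiniteDimensional ℂ V := FiniteDimensional.right ℝ ℂ V
  rw [h1, LinearMap.det_restrictScalars, Algebra.norm_complex_apply]
  exact Complex.normSq_nonneg _

open Matrix in
/-- Rim's argument: a real matrix preserving a nondegenerate alternating form has positive
determinant, in a basis in which the square of the form is diagonal. -/
theorem det_pos_of_preserves_of_sq_diagonal {n : Type*} [Fintype n] [DecidableEq n]
    (A S : Matrix n n ℝ) (d : n → ℝ) (hd : ∀ i, 0 < d i)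
    (hsq : A * A = -diagonal (fun i => d i ^ 2)) (hS : Sᵀ * A * S = A) : 0 < S.det := by
  set P : Matrix n n ℝ := diagonal d with hP
  have hPP : P * P = diagonal (fun i => d i ^ 2) := by
    simp [hP, diagonal_mul_diagonal, sq]
  have hAPP : A * A = -(P * P) := by rw [hsq, hPP]
  have hcomm : A * P = P * A := by
    have h1 : A * (P * P) = (P * P) * A := by
      have : P * P = -(A * A) := by rw [hAPP, neg_neg]
      rw [this]; simp [mul_assoc]
    ext i j
    have h2 := congr_fun (congr_fun h1 i) j
    rw [hPP, mul_diagonal, diagonal_mul] at h2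
    rw [hP, mul_diagonal, diagonal_mul]
    by_cases hij : A i j = 0
    · simp [hij]
    · have h3 : d j ^ 2 = d i ^ 2 := by
        have : A i j * (d j ^ 2 - d i ^ 2) = 0 := by linarith
        rcases mul_eq_zero.1 this with h | h
        · exact absurd h hij
        · linarith
      have h4 : d j = d i := by
        exact (pow_left_inj₀ (hd j).le (hd i).le two_ne_zero).1 h3
      rw [h4, mul_comm]
  set R : Matrix n n ℝ := diagonal (fun i => (d i)⁻¹) with hR
  have hPR : P * R = 1 := by
    rw [hP, hR, diagonal_mul_diagonal, ← diagonal_one]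
    congr 1; ext i; exact mul_inv_cancel₀ (hd i).ne'
  have hRP : R * P = 1 := mul_eq_one_comm.1 hPR
  have hRA : R * A = A * R := by
    calc R * A = R * (A * P) * R := by rw [mul_assoc, mul_assoc, hPR, mul_one]
      _ = A * R := by rw [hcomm, ← mul_assoc, hRP, one_mul]
  set J : Matrix n n ℝ := A * R with hJ
  have hJJ : J * J = -1 := by
    calc J * J = A * (R * A) * R := by simp [hJ, mul_assoc]
      _ = A * (A * R) * R := by rw [hRA]
      _ = (A * A) * (R * R) := by simp only [mul_assoc]
      _ = -(P * (P * R) * R) := by rw [hAPP]; simp [mul_assoc]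
      _ = -1 := by rw [hPR, mul_one, hPR]
  have hdetA : IsUnit A.det := by
    have : (A * A).det ≠ 0 := by
      have h : A * A * (R * R) = -1 := by
        calc A * A * (R * R) = A * (A * R) * R := by simp only [mul_assoc]
          _ = A * (R * A) * R := by rw [hRA]
          _ = J * J := by simp only [hJ, mul_assoc]
          _ = -1 := hJJ
      intro h0
      have h5 := congr_arg det h
      rw [det_mul, h0, zero_mul, det_neg, det_one, mul_one] at h5
      exact (pow_ne_zero _ (by norm_num : (-1 : ℝ) ≠ 0)) h5.symm
    rw [det_mul] at this
    exact isUnit_iff_ne_zero.2 (left_ne_zero_of_mul this)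
  have hAi : A * A⁻¹ = 1 := mul_nonsing_inv A hdetA
  set Y : Matrix n n ℝ := P * S with hY
  set N : Matrix n n ℝ := Y - J * Y * J with hN
  have hNJ : N * J = J * N := by
    simp only [hN, sub_mul, mul_sub, mul_assoc, hJJ]
    have : J * (J * (Y * J)) = -(Y * J) := by rw [← mul_assoc J J, hJJ]; simp
    rw [this]; simp; abel
  have hkey : Sᵀ * P * S + P = Sᵀ * N := by
    have hJA : J * P = A := by rw [hJ, mul_assoc, hRP, mul_one]
    have hJP : P * J = A := by rw [hJ, ← mul_assoc, ← hcomm, mul_assoc, hPR, mul_one]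
    have h1 : Sᵀ * (J * Y * J) = -P := by
      calc Sᵀ * (J * Y * J) = (Sᵀ * (J * P) * S) * J := by simp [hY, mul_assoc]
        _ = A * J := by rw [hJA, hS]
        _ = P * (J * J) := by rw [← hJP, mul_assoc]
        _ = -P := by rw [hJJ]; simp
    rw [hN, mul_sub, h1, hY]; simp [mul_assoc]
  have hpos : 0 < (Sᵀ * P * S + P).det := by
    have hPd : P.PosDef := PosDef.diagonal hd
    have h2 : (Sᵀ * P * S).PosSemidef := by
      have := hPd.posSemidef.conjTranspose_mul_mul_same S
      simpa [conjTranspose_eq_transpose_of_trivial] using this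
    exact (PosDef.posSemidef_add h2 hPd).det_pos
  have hNnn : 0 ≤ N.det := by
    have := det_nonneg_of_commute_complex_structure (Matrix.toLin' N) (Matrix.toLin' J)
      (by rw [Module.End.mul_eq_comp, ← Matrix.toLin'_mul, hJJ]; ext; simp)
      (by rw [Module.End.mul_eq_comp, Module.End.mul_eq_comp, ← Matrix.toLin'_mul,
        ← Matrix.toLin'_mul, hNJ])
    rwa [LinearMap.det_toLin'] at this
  rw [hkey, det_mul, det_transpose] at hpos
  exact pos_of_mul_pos_left hpos hNnn

open Matrix in
theorem det_pos_of_preserves_skew {n : Type*} [Fintype n] [DecidableEq n]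
    (A S : Matrix n n ℝ) (hA : Aᵀ = -A) (hdet : A.det ≠ 0) (hS : Sᵀ * A * S = A) :
    0 < S.det := by
  have hinj : Function.Injective A.mulVec := by
    apply Matrix.mulVec_injective_of_isUnit
    exact (Matrix.isUnit_iff_isUnit_det A).2 (isUnit_iff_ne_zero.2 hdet)
  have hpd : (Aᵀ * A).PosDef := by
    have := Matrix.PosDef.conjTranspose_mul_self A hinj
    simpa [conjTranspose_eq_transpose_of_trivial] using this
  have hH := hpd.isHermitian
  set U : Matrix n n ℝ := ↑hH.eigenvectorUnitary with hU
  have hUU : U * Uᵀ = 1 := by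
    have := (Matrix.mem_unitaryGroup_iff (A := U)).1 hH.eigenvectorUnitary.2
    simpa [star_eq_conjTranspose, conjTranspose_eq_transpose_of_trivial] using this
  have hUU' : Uᵀ * U = 1 := mul_eq_one_comm.1 hUU
  have hspec : Aᵀ * A = U * diagonal hH.eigenvalues * Uᵀ := by
    have := hH.spectral_theorem
    simpa [Unitary.conjStarAlgAut_apply, star_eq_conjTranspose,
      conjTranspose_eq_transpose_of_trivial, Function.comp_def] using this
  have hsq : (Uᵀ * A * U) * (Uᵀ * A * U) =
      -diagonal (fun i => Real.sqrt (hH.eigenvalues i) ^ 2) := by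
    have h1 : (fun i => Real.sqrt (hH.eigenvalues i) ^ 2) = hH.eigenvalues := by
      ext i; exact Real.sq_sqrt (hpd.eigenvalues_pos i).le
    rw [h1]
    calc (Uᵀ * A * U) * (Uᵀ * A * U) = Uᵀ * A * (U * Uᵀ) * A * U := by
          simp only [Matrix.mul_assoc]
      _ = -(Uᵀ * (Aᵀ * A) * U) := by rw [hUU, hA]; simp [Matrix.mul_assoc]
      _ = -((Uᵀ * U) * diagonal hH.eigenvalues * (Uᵀ * U)) := by
          have h2 := congr_arg (fun X => -(Uᵀ * X * U)) hspec
          simp only [Matrix.mul_assoc] at h2 ⊢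
          exact h2
      _ = _ := by rw [hUU']; simp
  have hS' : (Uᵀ * S * U)ᵀ * (Uᵀ * A * U) * (Uᵀ * S * U) = Uᵀ * A * U := by
    calc (Uᵀ * S * U)ᵀ * (Uᵀ * A * U) * (Uᵀ * S * U)
        = Uᵀ * Sᵀ * (U * Uᵀ) * A * (U * Uᵀ) * S * U := by
          simp only [transpose_mul, transpose_transpose, Matrix.mul_assoc]
      _ = Uᵀ * (Sᵀ * A * S) * U := by rw [hUU]; simp only [Matrix.mul_assoc, Matrix.mul_one]
      _ = _ := by rw [hS]
  have := det_pos_of_preserves_of_sq_diagonal (Uᵀ * A * U) (Uᵀ * S * U)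
    (fun i => Real.sqrt (hH.eigenvalues i)) (fun i => Real.sqrt_pos.2 (hpd.eigenvalues_pos i))
    hsq hS'
  have h2 : (Uᵀ * S * U).det = S.det := by
    rw [det_mul, det_mul, mul_right_comm, ← det_mul, hUU', det_one, one_mul]
  rwa [h2] at this

section Forms

variable {V : Type*} [AddCommGroup V] [Module ℝ V] [FiniteDimensional ℝ V]

/-- A bilinear form is nondegenerate on the right. -/
def Nondeg (B : V →ₗ[ℝ] V →ₗ[ℝ] ℝ) : Prop := ∀ v, (∀ u, B u v = 0) → v = 0

def SkewForm (B : V →ₗ[ℝ] V →ₗ[ℝ] ℝ) : Prop := ∀ u v, B u v = - B v u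

/-- Congruence of bilinear forms by an orientation preserving automorphism. -/
def Cong (B B' : V →ₗ[ℝ] V →ₗ[ℝ] ℝ) : Prop :=
  ∃ g : V →ₗ[ℝ] V, 0 < LinearMap.det g ∧ ∀ u v, B' u v = B (g u) (g v)

theorem Cong.trans {B B' B'' : V →ₗ[ℝ] V →ₗ[ℝ] ℝ} (h : Cong B B') (h' : Cong B' B'') :
    Cong B B'' := by
  obtain ⟨g, hg, h⟩ := h
  obtain ⟨g', hg', h'⟩ := h'
  refine ⟨g ∘ₗ g', ?_, fun u v => by rw [h', h]; rfl⟩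
  rw [LinearMap.det_comp]; positivity

theorem Cong.symm {B B' : V →ₗ[ℝ] V →ₗ[ℝ] ℝ} (h : Cong B B') : Cong B' B := by
  obtain ⟨g, hg, h⟩ := h
  let e := LinearMap.equivOfDetNeZero g hg.ne'
  have he : ∀ u, g (e.symm u) = u := fun u => e.apply_symm_apply u
  refine ⟨e.symm.toLinearMap, ?_, fun u v => ?_⟩
  · have h1 : LinearMap.det (g ∘ₗ e.symm.toLinearMap) = 1 := by
      have : g ∘ₗ e.symm.toLinearMap = LinearMap.id := by ext u; exact he u
      rw [this, LinearMap.det_id]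
    rw [LinearMap.det_comp] at h1
    exact pos_of_mul_pos_right (by rw [h1]; norm_num) hg.le
  · rw [h]; simp [he]

theorem toMatrix_transpose_of_skew {ι : Type*} [Fintype ι] [DecidableEq ι]
    (b : Module.Basis ι ℝ V) {B : V →ₗ[ℝ] V →ₗ[ℝ] ℝ} (hB : SkewForm B) :
    (LinearMap.toMatrix₂ b b B).transpose = -LinearMap.toMatrix₂ b b B := by
  ext i j
  simp [LinearMap.toMatrix₂_apply, hB (b j) (b i)]

theorem toMatrix_det_ne_zero_of_nondeg {ι : Type*} [Fintype ι] [DecidableEq ι]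
    (b : Module.Basis ι ℝ V) {B : V →ₗ[ℝ] V →ₗ[ℝ] ℝ} (hB : Nondeg B) :
    (LinearMap.toMatrix₂ b b B).det ≠ 0 := by
  intro h
  obtain ⟨v, hv, h0⟩ := Matrix.exists_mulVec_eq_zero_iff.2 h
  have h1 : b.equivFun.symm v = 0 := by
    apply hB
    intro u
    rw [← b.sum_repr u]
    simp only [map_sum, map_smul, LinearMap.sum_apply, LinearMap.smul_apply]
    apply Finset.sum_eq_zero
    intro i _
    have h2 := congr_fun h0 i
    simp only [Matrix.mulVec, dotProduct, LinearMap.toMatrix₂_apply, Pi.zero_apply] at h2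
    rw [Module.Basis.equivFun_symm_apply]
    simp only [map_sum, map_smul, smul_eq_mul]
    simp only [mul_comm _ (v _)] at h2
    rw [h2, mul_zero]
  exact hv (b.equivFun.symm.map_eq_zero_iff.1 h1)

theorem toMatrix_comp {ι : Type*} [Fintype ι] [DecidableEq ι]
    (b : Module.Basis ι ℝ V) (B : V →ₗ[ℝ] V →ₗ[ℝ] ℝ) (g : V →ₗ[ℝ] V) :
    LinearMap.toMatrix₂ b b (B.compl₁₂ g g) =
      (LinearMap.toMatrix b b g).transpose * LinearMap.toMatrix₂ b b B *
        LinearMap.toMatrix b b g :=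
  LinearMap.toMatrix₂_compl₁₂ b b b b B g g

theorem det_pos_of_preserves {B : V →ₗ[ℝ] V →ₗ[ℝ] ℝ} (hB : SkewForm B) (hn : Nondeg B)
    (g : V →ₗ[ℝ] V) (hg : ∀ u v, B (g u) (g v) = B u v) : 0 < LinearMap.det g := by
  classical
  let b := Module.finBasis ℝ V
  rw [← LinearMap.det_toMatrix b]
  apply det_pos_of_preserves_skew (LinearMap.toMatrix₂ b b B) _ (toMatrix_transpose_of_skew b hB)
    (toMatrix_det_ne_zero_of_nondeg b hn)
  rw [← toMatrix_comp]
  congr 1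
  ext u v
  exact hg u v

end Forms

end LinearAlgebra

section PathLemma

open Filter Topology

section SquareRoot

variable {𝔸 : Type*} [NormedRing 𝔸] [NormedAlgebra ℝ 𝔸] [CompleteSpace 𝔸]

/-- A continuous local square root near `1`, unique near `1`. -/
theorem exists_local_sqrt : ∃ s : 𝔸 → 𝔸, Tendsto s (𝓝 1) (𝓝 1) ∧
    (∀ᶠ c in 𝓝 (1 : 𝔸), s c * s c = c) ∧
    ∃ U ∈ 𝓝 (1 : 𝔸), ∀ x ∈ U, ∀ y ∈ U, x * x = y * y → x = y := by
  let f' : 𝔸 ≃L[ℝ] 𝔸 := ContinuousLinearEquiv.smulLeft (Units.mk0 (2 : ℝ) two_ne_zero)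
  have hf : HasStrictFDerivAt (fun x : 𝔸 => x * x) (f' : 𝔸 →L[ℝ] 𝔸) 1 := by
    have h := (hasStrictFDerivAt_id (𝕜 := ℝ) (1 : 𝔸)).mul' (hasStrictFDerivAt_id (1 : 𝔸))
    have h2 : (f' : 𝔸 →L[ℝ] 𝔸) = id (1 : 𝔸) • ContinuousLinearMap.id ℝ 𝔸 +
        MulOpposite.op (id (1 : 𝔸)) • ContinuousLinearMap.id ℝ 𝔸 := by
      ext x
      change (2 : ℝ) • x = (1 : 𝔸) • x + MulOpposite.op (1 : 𝔸) • x
      simp [two_smul]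
    rw [h2]; exact h
  refine ⟨hf.localInverse _ _ _, ?_, ?_, ?_⟩
  · have := hf.localInverse_tendsto
    simpa using this
  · have := hf.eventually_right_inverse
    simpa using this
  · exact ⟨(hf.toOpenPartialHomeomorph _).source,
      (hf.toOpenPartialHomeomorph _).open_source.mem_nhds hf.mem_toOpenPartialHomeomorph_source,
      fun x hx y hy h =>
      (hf.toOpenPartialHomeomorph _).injOn hx hy h⟩

end SquareRoot

open Matrix in
theorem eventually_exists_congr {n : Type*} [Fintype n] [DecidableEq n]
    (A : Matrix n n ℝ) (hA : Aᵀ = -A) (hdet : A.det ≠ 0) :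
    ∀ᶠ B in 𝓝 A, Bᵀ = -B → ∃ h : Matrix n n ℝ, 0 < h.det ∧ B = h * A * hᵀ := by
  let : NormedRing (Matrix n n ℝ) := Matrix.linftyOpNormedRing
  let : NormedAlgebra ℝ (Matrix n n ℝ) := Matrix.linftyOpNormedAlgebra
  obtain ⟨s, hs1, hs2, U, hU, hinj⟩ := exists_local_sqrt (𝔸 := Matrix n n ℝ)
  have hu : IsUnit A.det := isUnit_iff_ne_zero.2 hdet
  have hAi : A * A⁻¹ = 1 := mul_nonsing_inv A hu
  have hAi' : A⁻¹ * A = 1 := nonsing_inv_mul A hu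
  have hAiT : (A⁻¹)ᵀ = -A⁻¹ := by
    rw [transpose_nonsing_inv, hA]
    apply inv_eq_right_inv; simp [hAi]
  have hC : Tendsto (fun B => B * A⁻¹) (𝓝 A) (𝓝 1) := by
    have : Continuous (fun B : Matrix n n ℝ => B * A⁻¹) := by fun_prop
    have := this.tendsto A
    rwa [hAi] at this
  have hsC := hs1.comp hC
  have hdet1 : ∀ᶠ x in 𝓝 (1 : Matrix n n ℝ), 0 < x.det := by
    have : Continuous (fun x : Matrix n n ℝ => x.det) := Continuous.matrix_det continuous_id
    have := this.tendsto 1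
    rw [det_one] at this
    exact this.eventually (lt_mem_nhds zero_lt_one)
  have hconj : Tendsto (fun x : Matrix n n ℝ => A * xᵀ * A⁻¹) (𝓝 1) (𝓝 1) := by
    have : Continuous (fun x : Matrix n n ℝ => A * xᵀ * A⁻¹) := by fun_prop
    have := this.tendsto 1
    rwa [transpose_one, mul_one, hAi] at this
  filter_upwards [hsC.eventually hdet1, hC.eventually hs2, hsC.eventually hU,
    (hconj.comp hsC).eventually hU] with B h1 h2 h3 h4 hB
  simp only [Function.comp_apply] at h1 h2 h3 h4
  set h := s (B * A⁻¹)
  refine ⟨h, h1, ?_⟩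
  have h5 : A * hᵀ * A⁻¹ = h := by
    apply hinj _ h4 _ h3
    calc A * hᵀ * A⁻¹ * (A * hᵀ * A⁻¹) = A * hᵀ * (A⁻¹ * A) * hᵀ * A⁻¹ := by
          simp only [mul_assoc]
      _ = A * (h * h)ᵀ * A⁻¹ := by rw [hAi', transpose_mul]; simp only [mul_assoc, one_mul]
      _ = A * (A⁻¹ * B) * A⁻¹ := by rw [h2, transpose_mul, hB, hAiT]; simp
      _ = h * h := by rw [← mul_assoc, hAi, one_mul, h2]
  have h6 : A * hᵀ = h * A := by
    calc A * hᵀ = A * hᵀ * A⁻¹ * A := by rw [mul_assoc _ A⁻¹, hAi', mul_one]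
      _ = h * A := by rw [h5]
  rw [mul_assoc, h6, ← mul_assoc, h2, mul_assoc, hAi', mul_one]

theorem cong_of_path {V : Type*} [AddCommGroup V] [Module ℝ V] [FiniteDimensional ℝ V]
    (B : ℝ → V →ₗ[ℝ] V →ₗ[ℝ] ℝ) (hc : ∀ u v, ContinuousOn (fun t => B t u v) (Icc 0 1))
    (hs : ∀ t ∈ Icc (0 : ℝ) 1, SkewForm (B t)) (hn : ∀ t ∈ Icc (0 : ℝ) 1, Nondeg (B t)) :
    Cong (B 0) (B 1) := by
  classical
  let b := Module.finBasis ℝ V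
  refine isPreconnected_Icc.induction₂ (s := Icc (0 : ℝ) 1) (fun s t => Cong (B s) (B t))
    ?_ (fun _ _ _ _ _ _ => Cong.trans) (fun _ _ _ _ => Cong.symm) (by simp) (by simp)
  intro t ht
  have hM : Tendsto (fun s => LinearMap.toMatrix₂ b b (B s)) (𝓝[Icc 0 1] t)
      (𝓝 (LinearMap.toMatrix₂ b b (B t))) := by
    refine tendsto_pi_nhds.2 fun i => tendsto_pi_nhds.2 fun j => ?_
    simp only [LinearMap.toMatrix₂_apply]
    exact hc _ _ t ht
  filter_upwards [hM.eventually (eventually_exists_congr _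
    (toMatrix_transpose_of_skew b (hs t ht)) (toMatrix_det_ne_zero_of_nondeg b (hn t ht))),
    self_mem_nhdsWithin] with s h1 h2
  obtain ⟨h, hd, he⟩ := h1 (toMatrix_transpose_of_skew b (hs s h2))
  refine ⟨Matrix.toLin b b h.transpose, by rwa [LinearMap.det_toLin, Matrix.det_transpose], ?_⟩
  have h3 : B s = (B t).compl₁₂ (Matrix.toLin b b h.transpose) (Matrix.toLin b b h.transpose) := by
    apply (LinearMap.toMatrix₂ b b).injective
    rw [toMatrix_comp, LinearMap.toMatrix_toLin, he, Matrix.transpose_transpose]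
  intro u v
  rw [h3]; rfl

end PathLemma

/-- The group of unit quaternions. -/
abbrev UnitQuat := Metric.sphere (0 : ℍ[ℝ]) 1

abbrev TorusQuat := Circle × Circle × UnitQuat

section Integral

open MeasureTheory

local instance : MeasurableSpace TorusQuat := borel TorusQuat
local instance : BorelSpace TorusQuat := ⟨rfl⟩

def mu : Measure TorusQuat := Measure.haarMeasure ⊤

local instance : Measure.IsHaarMeasure mu := by unfold mu; infer_instance
local instance : IsProbabilityMeasure mu := by
  refine ⟨?_⟩
  have := Measure.haarMeasure_self (K₀ := (⊤ : TopologicalSpace.PositiveCompacts TorusQuat))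
  simpa [mu] using this

/-- The normalized invariant mean of a function on `TorusQuat`. -/
def mean (f : TorusQuat → ℝ) : ℝ := ∫ g, f g ∂mu

theorem mean_eq (f : TorusQuat → ℝ) : mean f = ∫ g, f g ∂mu := rfl

theorem integrable_of_continuous {f : TorusQuat → ℝ} (hf : Continuous f) : Integrable f mu := by
  exact hf.integrable_of_hasCompactSupport (HasCompactSupport.of_compactSpace f)

theorem mean_add {f g : TorusQuat → ℝ} (hf : Continuous f) (hg : Continuous g) :
    mean (fun x => f x + g x) = mean f + mean g :=
  integral_add (integrable_of_continuous hf) (integrable_of_continuous hg)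

theorem mean_smul (c : ℝ) (f : TorusQuat → ℝ) : mean (fun x => c * f x) = c * mean f :=
  integral_const_mul c f

theorem mean_const (c : ℝ) : mean (fun _ => c) = c := by
  rw [mean_eq]; simp

theorem mean_mono {f g : TorusQuat → ℝ} (hf : Continuous f) (hg : Continuous g)
    (h : ∀ x, f x ≤ g x) : mean f ≤ mean g :=
  integral_mono (integrable_of_continuous hf) (integrable_of_continuous hg) h

theorem mean_nonneg {f : TorusQuat → ℝ} (h : ∀ x, 0 ≤ f x) : 0 ≤ mean f :=
  integral_nonneg h

theorem eq_zero_of_mean_eq_zero {f : TorusQuat → ℝ} (hf : Continuous f) (h : ∀ x, 0 ≤ f x)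
    (h0 : mean f = 0) : f = 0 := by
  have := (integral_eq_zero_iff_of_nonneg h (integrable_of_continuous hf)).1 h0
  exact (Continuous.ae_eq_iff_eq mu hf continuous_const).1 this

theorem mean_mul_left (g : TorusQuat) (f : TorusQuat → ℝ) : mean (fun x => f (g * x)) = mean f :=
  integral_mul_left_eq_self f g

theorem mean_mul_right (g : TorusQuat) (f : TorusQuat → ℝ) :
    mean (fun x => f (x * g)) = mean f := by
  have : Measure.map (· * g) mu = mu := by
    have : IsProbabilityMeasure (Measure.map (· * g) mu) :=
      Measure.isProbabilityMeasure_map (by fun_prop)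
    exact Measure.isHaarMeasure_eq_of_isProbabilityMeasure _ _
  rw [mean_eq, mean_eq]
  conv_rhs => rw [← this]
  exact ((Homeomorph.mulRight g).measurableEmbedding.integral_map f).symm

theorem mean_deriv_eq_zero (γ : ℝ → TorusQuat) (h0 : γ 0 = 1) {f f' : TorusQuat → ℝ}
    (hf : Continuous f) (hf' : Continuous f')
    (h : ∀ t g, HasDerivAt (fun t => f (γ t * g)) (f' (γ t * g)) t) : mean f' = 0 := by
  obtain ⟨C, hC⟩ := isCompact_univ.exists_bound_of_continuousOn hf'.continuousOn
  have key := hasDerivAt_integral_of_dominated_loc_of_deriv_le (μ := mu)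
    (F := fun t g => f (γ t * g)) (F' := fun t g => f' (γ t * g)) (x₀ := (0 : ℝ)) (s := univ)
    (bound := fun _ => C) Filter.univ_mem
    (Filter.Eventually.of_forall fun t =>
      (integrable_of_continuous (by fun_prop)).aestronglyMeasurable)
    (integrable_of_continuous (by fun_prop))
    (integrable_of_continuous (by fun_prop)).aestronglyMeasurable
    (Filter.Eventually.of_forall fun g t _ => hC _ (mem_univ _))
    (integrable_const C)
    (Filter.Eventually.of_forall fun g t _ => h t g)
  have h1 := key.2
  have h2 : (fun t => ∫ g, f (γ t * g) ∂mu) = fun _ => mean f := by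
    ext t; exact mean_mul_left (γ t) f
  rw [h2] at h1
  have h3 := h1.unique (hasDerivAt_const (0 : ℝ) (mean f))
  simpa [h0, mean_eq] using h3

end Integral

section PolynomialFunctions

/-- The real coordinates of a point of `TorusQuat`. -/
def coordFun : Fin 8 → TorusQuat → ℝ :=
  ![fun g => (g.1 : ℂ).re, fun g => (g.1 : ℂ).im, fun g => (g.2.1 : ℂ).re,
    fun g => (g.2.1 : ℂ).im, fun g => (g.2.2 : ℍ[ℝ]).re, fun g => (g.2.2 : ℍ[ℝ]).imI,
    fun g => (g.2.2 : ℍ[ℝ]).imJ, fun g => (g.2.2 : ℍ[ℝ]).imK]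

/-- The algebra of polynomial functions on `TorusQuat`. -/
def polSubalgebra : Subalgebra ℝ (TorusQuat → ℝ) := Algebra.adjoin ℝ (range coordFun)

def Pol : Type := polSubalgebra

instance : CommRing Pol := inferInstanceAs (CommRing polSubalgebra)
instance : Algebra ℝ Pol := inferInstanceAs (Algebra ℝ polSubalgebra)

def polEval : Pol →ₐ[ℝ] (TorusQuat → ℝ) := polSubalgebra.val

instance : CoeFun Pol (fun _ => TorusQuat → ℝ) := ⟨fun f => polEval f⟩

@[ext] theorem Pol.ext {f h : Pol} (H : ∀ g, f g = h g) : f = h := Subtype.ext (funext H)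

@[simp] theorem Pol.add_apply (f h : Pol) (g : TorusQuat) : (f + h) g = f g + h g := rfl
@[simp] theorem Pol.mul_apply (f h : Pol) (g : TorusQuat) : (f * h) g = f g * h g := rfl
@[simp] theorem Pol.neg_apply (f : Pol) (g : TorusQuat) : (-f) g = -f g := rfl
@[simp] theorem Pol.sub_apply (f h : Pol) (g : TorusQuat) : (f - h) g = f g - h g := rfl
@[simp] theorem Pol.smul_apply (c : ℝ) (f : Pol) (g : TorusQuat) : (c • f) g = c * f g := rfl
@[simp] theorem Pol.zero_apply (g : TorusQuat) : (0 : Pol) g = 0 := rfl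
@[simp] theorem Pol.one_apply (g : TorusQuat) : (1 : Pol) g = 1 := rfl
@[simp] theorem Pol.pow_apply (f : Pol) (n : ℕ) (g : TorusQuat) : (f ^ n) g = f g ^ n := rfl
@[simp] theorem Pol.algebraMap_apply (c : ℝ) (g : TorusQuat) : (algebraMap ℝ Pol c) g = c := rfl

def coord (i : Fin 8) : Pol := ⟨coordFun i, Algebra.subset_adjoin ⟨i, rfl⟩⟩

theorem coord_apply (i : Fin 8) (g : TorusQuat) : coord i g = coordFun i g := rfl

theorem Pol.induction {p : Pol → Prop} (hc : ∀ i, p (coord i))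
    (ha : ∀ c : ℝ, p (algebraMap ℝ Pol c))
    (hadd : ∀ f h, p f → p h → p (f + h)) (hmul : ∀ f h, p f → p h → p (f * h)) (f : Pol) :
    p f := by
  obtain ⟨f, hf⟩ := f
  refine Algebra.adjoin_induction (p := fun f hf => p ⟨f, hf⟩) ?_ ?_ ?_ ?_ hf
  · rintro _ ⟨i, rfl⟩; exact hc i
  · intro r; exact ha r
  · intro x y hx hy h1 h2; exact hadd _ _ h1 h2
  · intro x y hx hy h1 h2; exact hmul _ _ h1 h2

theorem Pol.continuous (f : Pol) : Continuous (f : TorusQuat → ℝ) := by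
  refine Pol.induction (p := fun f => Continuous (f : TorusQuat → ℝ)) ?_ ?_ ?_ ?_ f
  · intro i
    fin_cases i
    · exact Complex.continuous_re.comp (continuous_subtype_val.comp continuous_fst)
    · exact Complex.continuous_im.comp (continuous_subtype_val.comp continuous_fst)
    · exact Complex.continuous_re.comp
        (continuous_subtype_val.comp (continuous_fst.comp continuous_snd))
    · exact Complex.continuous_im.comp
        (continuous_subtype_val.comp (continuous_fst.comp continuous_snd))
    · exact Quaternion.continuous_re.comp
        (continuous_subtype_val.comp (continuous_snd.comp continuous_snd))
    · exact Quaternion.continuous_imI.comp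
        (continuous_subtype_val.comp (continuous_snd.comp continuous_snd))
    · exact Quaternion.continuous_imJ.comp
        (continuous_subtype_val.comp (continuous_snd.comp continuous_snd))
    · exact Quaternion.continuous_imK.comp
        (continuous_subtype_val.comp (continuous_snd.comp continuous_snd))
  · intro c; exact continuous_const
  · intro f h hf hh; exact hf.add hh
  · intro f h hf hh; exact hf.mul hh

/-- A one-parameter subgroup whose left translations differentiate polynomials to polynomials. -/
structure PolFlow where
  γ : ℝ → TorusQuat
  zero : γ 0 = 1
  add : ∀ s t, γ (s + t) = γ s * γ t
  coordDeriv : Fin 8 → Pol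
  hasDeriv : ∀ i g, HasDerivAt (fun t => coordFun i (γ t * g)) (coordDeriv i g) 0

namespace PolFlow

variable (F : PolFlow)

theorem exists_deriv (f : Pol) : ∃ f' : Pol, ∀ g, HasDerivAt (fun t => f (F.γ t * g)) (f' g) 0 := by
  refine Pol.induction (p := fun f => ∃ f' : Pol, ∀ g, HasDerivAt (fun t => f (F.γ t * g)) (f' g) 0)
    ?_ ?_ ?_ ?_ f
  · intro i; exact ⟨F.coordDeriv i, F.hasDeriv i⟩
  · intro c; exact ⟨0, fun g => hasDerivAt_const _ _⟩
  · rintro f h ⟨f', hf⟩ ⟨h', hh⟩; exact ⟨f' + h', fun g => (hf g).add (hh g)⟩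
  · rintro f h ⟨f', hf⟩ ⟨h', hh⟩
    refine ⟨f' * h + f * h', fun g => ?_⟩
    have := (hf g).fun_mul (hh g)
    simpa [F.zero] using this

def derivFun (f : Pol) : Pol := (F.exists_deriv f).choose

theorem derivFun_spec (f : Pol) (g : TorusQuat) :
    HasDerivAt (fun t => f (F.γ t * g)) (F.derivFun f g) 0 := (F.exists_deriv f).choose_spec g

theorem derivFun_eq {f f' : Pol} (h : ∀ g, HasDerivAt (fun t => f (F.γ t * g)) (f' g) 0) :
    F.derivFun f = f' := Pol.ext fun g => (F.derivFun_spec f g).unique (h g)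

/-- The derivation of the algebra of polynomials generated by a one-parameter subgroup. -/
def deriv : Derivation ℝ Pol Pol where
  toFun := F.derivFun
  map_add' f h := F.derivFun_eq fun g => (F.derivFun_spec f g).add (F.derivFun_spec h g)
  map_smul' c f := F.derivFun_eq fun g => (F.derivFun_spec f g).const_mul c
  map_one_eq_zero' := F.derivFun_eq fun g => hasDerivAt_const _ _
  leibniz' f h := F.derivFun_eq fun g => by
    have := (F.derivFun_spec f g).fun_mul (F.derivFun_spec h g)
    simp only [F.zero, one_mul] at this
    have e : (f • F.derivFun h + h • F.derivFun f) g =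
        F.derivFun f g * h g + f g * F.derivFun h g := by
      change (f g * F.derivFun h g + h g * F.derivFun f g) = _
      ring
    exact this.congr_deriv e.symm

theorem deriv_coord (i : Fin 8) : F.deriv (coord i) = F.coordDeriv i :=
  F.derivFun_eq (F.hasDeriv i)

theorem mean_deriv (f : Pol) : mean (F.deriv f) = 0 := by
  refine mean_deriv_eq_zero F.γ F.zero f.continuous (F.deriv f).continuous fun t g => ?_
  have h := F.derivFun_spec f (F.γ t * g)
  have h1 : HasDerivAt (fun s => f (F.γ (s - t) * (F.γ t * g))) (F.deriv f (F.γ t * g)) t := by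
    have h2 : HasDerivAt (fun s => f (F.γ s * (F.γ t * g))) (F.derivFun f (F.γ t * g)) (t - t) := by
      simpa using h
    exact h2.comp_sub_const t t
  have h3 : (fun s => f (F.γ (s - t) * (F.γ t * g))) = fun s => f (F.γ s * g) := by
    ext s; rw [← mul_assoc, ← F.add, sub_add_cancel]
  rwa [h3] at h1

end PolFlow

def flowθ : PolFlow where
  γ t := (Circle.exp t, 1, 1)
  zero := by simp
  add s t := by simp [Circle.exp_add]
  coordDeriv := ![-coord 1, coord 0, 0, 0, 0, 0, 0, 0]
  hasDeriv i g := by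
    have hc := Real.hasDerivAt_cos 0
    have hs := Real.hasDerivAt_sin 0
    have e : ∀ t : ℝ, ((Circle.exp t : Circle) : ℂ) = ⟨Real.cos t, Real.sin t⟩ := by
      intro t; rw [Circle.coe_exp, Complex.exp_mul_I]; apply Complex.ext <;>
        simp [Complex.cos_ofReal_re, Complex.sin_ofReal_re]
    fin_cases i
    · have := (hc.mul_const (g.1 : ℂ).re).fun_sub (hs.mul_const (g.1 : ℂ).im)
      simpa [coordFun, e, coord_apply] using this
    · have := (hc.mul_const (g.1 : ℂ).im).fun_add (hs.mul_const (g.1 : ℂ).re)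
      simpa [coordFun, e, coord_apply] using this
    all_goals simpa [coordFun] using hasDerivAt_const (0 : ℝ) _

def flowφ : PolFlow where
  γ t := (1, Circle.exp t, 1)
  zero := by simp
  add s t := by simp [Circle.exp_add]
  coordDeriv := ![0, 0, -coord 3, coord 2, 0, 0, 0, 0]
  hasDeriv i g := by
    have hc := Real.hasDerivAt_cos 0
    have hs := Real.hasDerivAt_sin 0
    have e : ∀ t : ℝ, ((Circle.exp t : Circle) : ℂ) = ⟨Real.cos t, Real.sin t⟩ := by
      intro t; rw [Circle.coe_exp, Complex.exp_mul_I]; apply Complex.ext <;>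
        simp [Complex.cos_ofReal_re, Complex.sin_ofReal_re]
    fin_cases i
    · simpa [coordFun] using hasDerivAt_const (0 : ℝ) _
    · simpa [coordFun] using hasDerivAt_const (0 : ℝ) _
    · have := (hc.mul_const (g.2.1 : ℂ).re).fun_sub (hs.mul_const (g.2.1 : ℂ).im)
      simpa [coordFun, e, coord_apply] using this
    · have := (hc.mul_const (g.2.1 : ℂ).im).fun_add (hs.mul_const (g.2.1 : ℂ).re)
      simpa [coordFun, e, coord_apply] using this
    all_goals simpa [coordFun] using hasDerivAt_const (0 : ℝ) _

/-- The quaternion with given components. -/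
def qmk {R : Type*} [CommRing R] (a b c d : R) : ℍ[R] := ⟨a, b, c, d⟩

section
variable {R : Type*} [CommRing R] (a b c d : R)
@[simp] theorem qmk_re : (qmk a b c d).re = a := rfl
@[simp] theorem qmk_imI : (qmk a b c d).imI = b := rfl
@[simp] theorem qmk_imJ : (qmk a b c d).imJ = c := rfl
@[simp] theorem qmk_imK : (qmk a b c d).imK = d := rfl
end

/-- The imaginary units. -/
def imUnit (R : Type*) [CommRing R] : Fin 3 → ℍ[R] :=
  ![qmk 0 1 0 0, qmk 0 0 1 0, qmk 0 0 0 1]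

def quatExp (a : Fin 3) (t : ℝ) : UnitQuat :=
  ⟨(Real.cos t : ℍ[ℝ]) + (Real.sin t : ℍ[ℝ]) * imUnit ℝ a, by
    rw [mem_sphere_zero_iff_norm, ← sq_eq_sq₀ (norm_nonneg _) zero_le_one, sq,
      ← Quaternion.normSq_eq_norm_mul_self, Quaternion.normSq_def']
    fin_cases a <;> simp [imUnit]⟩

theorem coe_quatExp (a : Fin 3) (t : ℝ) :
    (quatExp a t : ℍ[ℝ]) = (Real.cos t : ℍ[ℝ]) + (Real.sin t : ℍ[ℝ]) * imUnit ℝ a := rfl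

def flowQ (a : Fin 3) : PolFlow where
  γ t := (1, 1, quatExp a t)
  zero := by
    refine Prod.ext rfl (Prod.ext rfl (Subtype.ext ?_))
    simp [quatExp]
  add s t := by
    refine Prod.ext (by simp) (Prod.ext (by simp) (Subtype.ext ?_))
    change _ = ((quatExp a s : UnitQuat) : ℍ[ℝ]) * (quatExp a t : UnitQuat)
    simp only [quatExp, Real.cos_add, Real.sin_add]
    fin_cases a <;> ext <;> simp [imUnit] <;> ring
  coordDeriv := ![![0, 0, 0, 0, -coord 5, coord 4, -coord 7, coord 6],
    ![0, 0, 0, 0, -coord 6, coord 7, coord 4, -coord 5],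
    ![0, 0, 0, 0, -coord 7, -coord 6, coord 5, coord 4]] a
  hasDeriv i g := by
    have hc := fun x : ℝ => (Real.hasDerivAt_cos 0).mul_const x
    have hs := fun x : ℝ => (Real.hasDerivAt_sin 0).mul_const x
    have e1 : ∀ t : ℝ, (((1, 1, quatExp a t) : TorusQuat) * g).1 = g.1 := fun _ => one_mul _
    have e2 : ∀ t : ℝ, (((1, 1, quatExp a t) : TorusQuat) * g).2.1 = g.2.1 := fun _ => one_mul _
    set x : ℍ[ℝ] := (g.2.2 : ℍ[ℝ]) with hx
    fin_cases i
    · simp only [coordFun]; fin_cases a <;> simpa [e1] using hasDerivAt_const (0 : ℝ) _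
    · simp only [coordFun]; fin_cases a <;> simpa [e1] using hasDerivAt_const (0 : ℝ) _
    · simp only [coordFun]; fin_cases a <;> simpa [e2] using hasDerivAt_const (0 : ℝ) _
    · simp only [coordFun]; fin_cases a <;> simpa [e2] using hasDerivAt_const (0 : ℝ) _
    · fin_cases a
      · simpa [coordFun, coord_apply, coe_quatExp, imUnit] using (hc x.re).fun_sub (hs x.imI)
      · simpa [coordFun, coord_apply, coe_quatExp, imUnit] using (hc x.re).fun_sub (hs x.imJ)
      · simpa [coordFun, coord_apply, coe_quatExp, imUnit] using (hc x.re).fun_sub (hs x.imK)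
    · fin_cases a
      · simpa [coordFun, coord_apply, coe_quatExp, imUnit] using (hc x.imI).fun_add (hs x.re)
      · simpa [coordFun, coord_apply, coe_quatExp, imUnit] using (hc x.imI).fun_add (hs x.imK)
      · simpa [coordFun, coord_apply, coe_quatExp, imUnit] using (hc x.imI).fun_sub (hs x.imJ)
    · fin_cases a
      · simpa [coordFun, coord_apply, coe_quatExp, imUnit] using (hc x.imJ).fun_sub (hs x.imK)
      · simpa [coordFun, coord_apply, coe_quatExp, imUnit] using (hc x.imJ).fun_add (hs x.re)
      · simpa [coordFun, coord_apply, coe_quatExp, imUnit] using (hc x.imJ).fun_add (hs x.imI)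
    · fin_cases a
      · simpa [coordFun, coord_apply, coe_quatExp, imUnit] using (hc x.imK).fun_add (hs x.imJ)
      · simpa [coordFun, coord_apply, coe_quatExp, imUnit] using (hc x.imK).fun_sub (hs x.imI)
      · simpa [coordFun, coord_apply, coe_quatExp, imUnit] using (hc x.imK).fun_add (hs x.re)

end PolynomialFunctions

section InnerPol

theorem mean_pol_add (f h : Pol) : mean (f + h : Pol) = mean f + mean h :=
  mean_add f.continuous h.continuous

theorem mean_pol_smul (c : ℝ) (f : Pol) : mean (c • f : Pol) = c * mean f := mean_smul c f

@[reducible] def polCore : InnerProductSpace.Core ℝ Pol where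
  inner f h := mean (f * h : Pol)
  conj_inner_symm f h := by simp [mul_comm]
  re_inner_nonneg f := mean_nonneg fun g => mul_self_nonneg (f g)
  add_left f h k := by simp only [add_mul, mean_pol_add]
  smul_left f h c := by simp only [smul_mul_assoc, mean_pol_smul]; rfl
  definite f h := by
    have := eq_zero_of_mean_eq_zero (f * f : Pol).continuous (fun g => mul_self_nonneg (f g)) h
    ext g
    have := congrFun this g
    simpa using this

instance : NormedAddCommGroup Pol := polCore.toNormedAddCommGroup
instance : InnerProductSpace ℝ Pol := InnerProductSpace.ofCore polCore.toCore

theorem Pol.inner_def (f h : Pol) : ⟪f, h⟫ = mean (f * h : Pol) := rfl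

theorem PolFlow.inner_deriv (F : PolFlow) (f h : Pol) : ⟪F.deriv f, h⟫ = -⟪f, F.deriv h⟫ := by
  have := F.mean_deriv (f * h)
  rw [Derivation.leibniz, mean_pol_add] at this
  simp only [Pol.inner_def]
  simp only [smul_eq_mul] at this
  rw [mul_comm (F.deriv f) h]
  linarith

theorem Pol.derivation_ext {D D' : Derivation ℝ Pol Pol} (h : ∀ i, D (coord i) = D' (coord i)) :
    D = D' := by
  ext f : 1
  refine Pol.induction (p := fun f => D f = D' f) h ?_ ?_ ?_ f
  · intro c; simp
  · intro f h hf hh; simp [hf, hh]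
  · intro f h hf hh; simp [hf, hh]

end InnerPol

section OrthogonalSplitting

variable {H : Type*} [NormedAddCommGroup H] [InnerProductSpace ℝ H]

theorem exists_orth_decomp (E : Submodule ℝ H) [FiniteDimensional ℝ E] (w : H) :
    ∃ w₁ ∈ E, ∃ w₂, w = w₁ + w₂ ∧ ∀ e ∈ E, ⟪e, w₂⟫ = 0 := by
  obtain ⟨y, hy, z, hz, h⟩ := E.exists_add_mem_mem_orthogonal w
  exact ⟨y, hy, z, h, fun e he => (Submodule.mem_orthogonal E z).1 hz e he⟩

/-- Lower bounds of quadratic forms add up along an invariant subspace. -/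
theorem lower_bound_of_split {T : H →ₗ[ℝ] H} (hT : ∀ u v, ⟪T u, v⟫ = ⟪u, T v⟫)
    {F E G : Submodule ℝ H} [FiniteDimensional ℝ E] (hFE : F ≤ E) (hEG : E ≤ G)
    (hE : ∀ u ∈ E, T u ∈ E) {c : ℝ}
    (h₁ : ∀ w ∈ E, (∀ e ∈ F, ⟪e, w⟫ = 0) → c * ‖w‖ ^ 2 ≤ ⟪w, T w⟫)
    (h₂ : ∀ w ∈ G, (∀ e ∈ E, ⟪e, w⟫ = 0) → c * ‖w‖ ^ 2 ≤ ⟪w, T w⟫)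
    {w : H} (hw : w ∈ G) (hwF : ∀ e ∈ F, ⟪e, w⟫ = 0) : c * ‖w‖ ^ 2 ≤ ⟪w, T w⟫ := by
  obtain ⟨u, hu, v, rfl, hv⟩ := exists_orth_decomp E w
  have hvG : v ∈ G := by simpa using G.sub_mem hw (hEG hu)
  have huF : ∀ e ∈ F, ⟪e, u⟫ = 0 := by
    intro e he
    have := hwF e he
    rwa [inner_add_right, hv e (hFE he), add_zero] at this
  have e1 := h₁ u hu huF
  have e2 := h₂ v hvG hv
  have e3 := hv u hu
  have e4 : ⟪u, T v⟫ = 0 := by rw [← hT]; exact hv _ (hE u hu)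
  have e5 : ⟪v, T u⟫ = 0 := by rw [real_inner_comm]; exact hv _ (hE u hu)
  have e6 : ‖u + v‖ ^ 2 = ‖u‖ ^ 2 + ‖v‖ ^ 2 := by
    rw [norm_add_sq_real, e3]; ring
  rw [e6, map_add, inner_add_left, inner_add_right, inner_add_right, e4, e5]
  linarith

end OrthogonalSplitting

section Filtration

theorem deriv_mem_mul (D : Derivation ℝ Pol Pol) {S S' : Submodule ℝ Pol}
    (h : ∀ f ∈ S, D f ∈ S) (h' : ∀ f ∈ S', D f ∈ S') : ∀ f ∈ S * S', D f ∈ S * S' := by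
  intro f hf
  induction hf using Submodule.mul_induction_on' with
  | mem_mul_mem m hm n hn =>
    rw [Derivation.leibniz, smul_eq_mul, smul_eq_mul, mul_comm n]
    exact add_mem (Submodule.mul_mem_mul hm (h' _ hn)) (Submodule.mul_mem_mul (h _ hm) hn)
  | add x _ y _ hx hy => rw [map_add]; exact add_mem hx hy

theorem deriv_mem_pow (D : Derivation ℝ Pol Pol) {S : Submodule ℝ Pol}
    (h : ∀ f ∈ S, D f ∈ S) (p : ℕ) : ∀ f ∈ S ^ p, D f ∈ S ^ p := by
  induction p with
  | zero =>
    intro f hf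
    rw [pow_zero, Submodule.mem_one] at hf
    obtain ⟨c, rfl⟩ := hf
    simp
  | succ p ih => rw [pow_succ]; exact deriv_mem_mul D ih h

theorem deriv_zero_mul (D : Derivation ℝ Pol Pol) {S S' : Submodule ℝ Pol}
    (h : ∀ f ∈ S, D f = 0) (h' : ∀ f ∈ S', D f = 0) : ∀ f ∈ S * S', D f = 0 := by
  intro f hf
  induction hf using Submodule.mul_induction_on' with
  | mem_mul_mem m hm n hn => rw [Derivation.leibniz, h _ hm, h' _ hn]; simp
  | add x _ y _ hx hy => rw [map_add, hx, hy, add_zero]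

theorem deriv_zero_pow (D : Derivation ℝ Pol Pol) {S : Submodule ℝ Pol}
    (h : ∀ f ∈ S, D f = 0) (p : ℕ) : ∀ f ∈ S ^ p, D f = 0 := by
  induction p with
  | zero =>
    intro f hf
    rw [pow_zero, Submodule.mem_one] at hf
    obtain ⟨c, rfl⟩ := hf
    simp
  | succ p ih => rw [pow_succ]; exact deriv_zero_mul D ih h

/-- A factor of `TorusQuat`: the vector fields along it and its linear coordinate functions. -/
structure PolFactor where
  n : ℕ
  X : Fin n → PolFlow
  C : Submodule ℝ Pol
  fg : C.FG
  κ : ℝ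
  κ_pos : 0 ≤ κ
  one_mem : 1 ∈ C
  gradient : ∀ l ∈ C, ∀ m ∈ C, ∑ a, (X a).deriv l * (X a).deriv m + l * m ∈ C
  laplace : ∀ l ∈ C, ∑ a, (X a).deriv ((X a).deriv l) + κ • l ∈ C ^ 0

namespace PolFactor

variable (B : PolFactor)

/-- The Laplacian along the factor. -/
def T : Pol →ₗ[ℝ] Pol := -∑ a, ((B.X a).deriv : Pol →ₗ[ℝ] Pol) ∘ₗ (B.X a).deriv

theorem T_apply (f : Pol) : B.T f = -∑ a, (B.X a).deriv ((B.X a).deriv f) := by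
  simp [T, LinearMap.sum_apply]

theorem inner_T (f h : Pol) : ⟪f, B.T h⟫ = ∑ a, ⟪(B.X a).deriv f, (B.X a).deriv h⟫ := by
  rw [T_apply, inner_neg_right, inner_sum, ← Finset.sum_neg_distrib]
  refine Finset.sum_congr rfl fun a _ => ?_
  rw [PolFlow.inner_deriv]

theorem T_symm (f h : Pol) : ⟪B.T f, h⟫ = ⟪f, B.T h⟫ := by
  rw [inner_T, real_inner_comm, inner_T]
  exact Finset.sum_congr rfl fun a _ => real_inner_comm _ _

theorem inner_T_nonneg (f : Pol) : 0 ≤ ⟪f, B.T f⟫ := by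
  rw [inner_T]; exact Finset.sum_nonneg fun a _ => real_inner_self_nonneg

theorem pow_mono {p q : ℕ} (h : p ≤ q) : B.C ^ p ≤ B.C ^ q :=
  pow_le_pow_right₀ (Submodule.one_le.2 B.one_mem) h

theorem gradient_pow (p : ℕ) : ∀ l ∈ B.C, ∀ h ∈ B.C ^ p,
    ∑ a, (B.X a).deriv l * (B.X a).deriv h + (p : ℝ) • (l * h) ∈ B.C ^ p := by
  induction p with
  | zero =>
    intro l _ h hh
    rw [pow_zero, Submodule.mem_one] at hh
    obtain ⟨c, rfl⟩ := hh
    simp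
  | succ p ih =>
    intro l hl h hh
    rw [pow_succ] at hh
    induction hh using Submodule.mul_induction_on' with
    | mem_mul_mem h' hh' m hm =>
      have e : ∑ a, (B.X a).deriv l * (B.X a).deriv (h' * m) + ((p + 1 : ℕ) : ℝ) • (l * (h' * m)) =
          h' * (∑ a, (B.X a).deriv l * (B.X a).deriv m + l * m) +
          (∑ a, (B.X a).deriv l * (B.X a).deriv h' + (p : ℝ) • (l * h')) * m := by
        simp only [Derivation.leibniz, smul_eq_mul, mul_add, add_mul, Finset.sum_add_distrib,
          Finset.mul_sum, Finset.sum_mul, Nat.cast_add, Nat.cast_one, add_smul, one_smul,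
          smul_mul_assoc]
        have e1 : ∀ a, (B.X a).deriv l * (h' * (B.X a).deriv m) =
          h' * ((B.X a).deriv l * (B.X a).deriv m) := fun a => by ring
        have e2 : ∀ a, (B.X a).deriv l * (m * (B.X a).deriv h') =
          (B.X a).deriv l * (B.X a).deriv h' * m := fun a => by ring
        simp only [e1, e2]
        rw [show l * (h' * m) = l * h' * m by ring, show h' * (l * m) = l * h' * m by ring]
        abel
      rw [e, pow_succ]
      exact add_mem (Submodule.mul_mem_mul hh' (B.gradient l hl m hm))
        (Submodule.mul_mem_mul (ih l hl h' hh') hm)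
    | add x _ y _ hx hy =>
      have := add_mem hx hy
      convert this using 1
      simp only [map_add, mul_add, Finset.sum_add_distrib, smul_add]
      abel

theorem laplace_pow (p : ℕ) : ∀ h ∈ B.C ^ (p + 1),
    ∑ a, (B.X a).deriv ((B.X a).deriv h) + (((p : ℝ) + 1) * (p + B.κ)) • h ∈ B.C ^ p := by
  induction p with
  | zero => intro h hh; rw [zero_add, pow_one] at hh; simpa using B.laplace h hh
  | succ p ih =>
    intro h hh
    rw [pow_succ'] at hh
    induction hh using Submodule.mul_induction_on' with
    | mem_mul_mem l hl h' hh' =>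
      have e : ∑ a, (B.X a).deriv ((B.X a).deriv (l * h')) +
          ((((p + 1 : ℕ) : ℝ) + 1) * ((p + 1 : ℕ) + B.κ)) • (l * h') =
          (∑ a, (B.X a).deriv ((B.X a).deriv l) + B.κ • l) * h' +
          (2 : ℝ) • (∑ a, (B.X a).deriv l * (B.X a).deriv h' + ((p + 1 : ℕ) : ℝ) • (l * h')) +
          l * (∑ a, (B.X a).deriv ((B.X a).deriv h') + (((p : ℝ) + 1) * (p + B.κ)) • h') := by
        have e1 : ∀ a, (B.X a).deriv ((B.X a).deriv (l * h')) =
            (B.X a).deriv ((B.X a).deriv l) * h' + (2 : ℝ) • ((B.X a).deriv l * (B.X a).deriv h') +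
            l * (B.X a).deriv ((B.X a).deriv h') := fun a => by
          simp only [Derivation.leibniz, smul_eq_mul, map_add, two_smul]; ring
        simp only [e1, Finset.sum_add_distrib, ← Finset.sum_mul, ← Finset.mul_sum,
          ← Finset.smul_sum, mul_add, add_mul, smul_add, smul_mul_assoc, mul_smul_comm, smul_smul]
        push_cast
        module
      rw [e]
      refine add_mem (add_mem ?_ (Submodule.smul_mem _ _ (B.gradient_pow _ l hl h' hh'))) ?_
      · have := Submodule.mul_mem_mul (B.laplace l hl) hh'
        rwa [pow_zero, one_mul] at this
      · rw [pow_succ']; exact Submodule.mul_mem_mul hl (ih h' hh')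
    | add x _ y _ hx hy =>
      have := add_mem hx hy
      convert this using 1
      simp only [map_add, Finset.sum_add_distrib, smul_add]
      abel

variable {Y : Submodule ℝ Pol}

theorem T_mul (hY : ∀ a, ∀ y ∈ Y, (B.X a).deriv y = 0)
    {h y : Pol} (hy : y ∈ Y) : B.T (h * y) = B.T h * y := by
  have e : ∀ a, ∀ f : Pol, (B.X a).deriv (f * y) = (B.X a).deriv f * y := fun a f => by
    rw [Derivation.leibniz, hY a y hy, smul_zero, zero_add, smul_eq_mul, mul_comm]
  simp only [T_apply, e, neg_mul, Finset.sum_mul]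

theorem T_sub_mem (hY : ∀ a, ∀ y ∈ Y, (B.X a).deriv y = 0)
    (p : ℕ) : ∀ w ∈ B.C ^ (p + 1) * Y,
    B.T w - (((p : ℝ) + 1) * (p + B.κ)) • w ∈ B.C ^ p * Y := by
  intro w hw
  induction hw using Submodule.mul_induction_on' with
  | mem_mul_mem h hh y hy =>
    rw [B.T_mul hY hy, ← smul_mul_assoc, ← sub_mul]
    refine Submodule.mul_mem_mul ?_ hy
    have := neg_mem (B.laplace_pow p h hh)
    rwa [neg_add, ← T_apply, ← sub_eq_add_neg] at this
  | add x _ y _ hx hy =>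
    have := add_mem hx hy
    convert this using 1
    rw [map_add, smul_add]; abel

theorem T_mem (hY : ∀ a, ∀ y ∈ Y, (B.X a).deriv y = 0)
    (p : ℕ) : ∀ w ∈ B.C ^ p * Y, B.T w ∈ B.C ^ p * Y := by
  intro w hw
  cases p with
  | zero =>
    rw [pow_zero, one_mul] at hw ⊢
    have := B.T_mul hY (h := 1) hw
    rw [one_mul] at this
    rw [this]; simp [T_apply]
  | succ p =>
    have h1 := B.T_sub_mem hY p w hw
    have h2 : B.C ^ p * Y ≤ B.C ^ (p + 1) * Y := mul_le_mul_left (B.pow_mono (by omega)) Y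
    have := add_mem (h2 h1) (Submodule.smul_mem _ (((p : ℝ) + 1) * (p + B.κ)) hw)
    simpa using this

theorem T_eigen (hY : ∀ a, ∀ y ∈ Y, (B.X a).deriv y = 0)
    {p : ℕ} {w : Pol} (hw : w ∈ B.C ^ (p + 1) * Y)
    (ho : ∀ e ∈ B.C ^ p * Y, ⟪e, w⟫ = 0) : B.T w = (((p : ℝ) + 1) * (p + B.κ)) • w := by
  set μ := (((p : ℝ) + 1) * (p + B.κ))
  have hr := B.T_sub_mem hY p w hw
  set r := B.T w - μ • w with hrd
  have h1 : ⟪r, r⟫ = 0 := by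
    conv_lhs => rw [hrd]
    rw [inner_sub_left, T_symm, real_inner_smul_left, real_inner_comm _ w, real_inner_comm _ w,
      ho _ hr, ho _ (B.T_mem hY p _ hr)]
    simp
  have h2 : r = 0 := inner_self_eq_zero.1 h1
  exact sub_eq_zero.1 h2

theorem lower_bound (hY : ∀ a, ∀ y ∈ Y, (B.X a).deriv y = 0)
    (hfg : Y.FG) (N M : ℕ) : ∀ w ∈ B.C ^ M * Y,
    (∀ e ∈ B.C ^ N * Y, ⟪e, w⟫ = 0) → (((N : ℝ) + 1) * (N + B.κ)) * ‖w‖ ^ 2 ≤ ⟪w, B.T w⟫ := by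
  induction M with
  | zero =>
    intro w hw h
    have h2 : B.C ^ 0 * Y ≤ B.C ^ N * Y := mul_le_mul_left (B.pow_mono (by omega)) Y
    have : w = 0 := inner_self_eq_zero.1 (h w (h2 hw))
    simp [this]
  | succ M ih =>
    by_cases hMN : M + 1 ≤ N
    · intro w hw h
      have h2 : B.C ^ (M + 1) * Y ≤ B.C ^ N * Y := mul_le_mul_left (B.pow_mono hMN) Y
      have : w = 0 := inner_self_eq_zero.1 (h w (h2 hw))
      simp [this]
    · intro w hw h
      have : FiniteDimensional ℝ (B.C ^ M * Y : Submodule ℝ Pol) :=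
        Module.Finite.iff_fg.2 ((B.fg.pow M).mul hfg)
      refine lower_bound_of_split B.T_symm (F := B.C ^ N * Y) (E := B.C ^ M * Y)
        (G := B.C ^ (M + 1) * Y) (mul_le_mul_left (B.pow_mono (by omega)) Y)
        (mul_le_mul_left (B.pow_mono (by omega)) Y) (B.T_mem hY M) ih ?_ hw h
      intro w hw ho
      rw [B.T_eigen hY hw ho, real_inner_smul_right, real_inner_self_eq_norm_sq]
      refine mul_le_mul_of_nonneg_right ?_ (sq_nonneg _)
      have h3 : (N : ℝ) ≤ M := by exact_mod_cast (by omega : N ≤ M)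
      have := B.κ_pos
      have h4 : (0 : ℝ) ≤ N := Nat.cast_nonneg _
      gcongr

end PolFactor

end Filtration

section Factors

def PolFactor.ofCoords {n k : ℕ} (X : Fin n → PolFlow) (x : Fin k → Pol) (κ : ℝ) (hκ : 0 ≤ κ)
    (h₁ : ∀ i j, ∑ a, (X a).deriv (x i) * (X a).deriv (x j) + x i * x j = if i = j then 1 else 0)
    (h₂ : ∀ i, ∑ a, (X a).deriv ((X a).deriv (x i)) + κ • x i = 0) : PolFactor where
  n := n
  X := X
  C := Submodule.span ℝ (insert 1 (range x))
  fg := Submodule.fg_span ((finite_range x).insert 1)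
  κ := κ
  κ_pos := hκ
  one_mem := Submodule.subset_span (mem_insert _ _)
  gradient := by
    have hx : ∀ i, x i ∈ Submodule.span ℝ (insert 1 (range x)) := fun i =>
      Submodule.subset_span (mem_insert_of_mem _ ⟨i, rfl⟩)
    have h1 : (1 : Pol) ∈ Submodule.span ℝ (insert 1 (range x)) :=
      Submodule.subset_span (mem_insert _ _)
    intro l hl m hm
    induction hl using Submodule.span_induction with
    | zero => simp
    | add a b _ _ ha hb =>
      convert add_mem ha hb using 1
      simp only [map_add, add_mul, Finset.sum_add_distrib]; abel
    | smul c a _ ha =>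
      convert Submodule.smul_mem _ c ha using 1
      simp only [Derivation.map_smul, smul_mul_assoc, smul_add, Finset.smul_sum]
    | mem l hl =>
      rcases hl with rfl | ⟨i, rfl⟩
      · simpa using hm
      induction hm using Submodule.span_induction with
      | zero => simp
      | add a b _ _ ha hb =>
        convert add_mem ha hb using 1
        simp only [map_add, mul_add, Finset.sum_add_distrib]; abel
      | smul c a _ ha =>
        convert Submodule.smul_mem _ c ha using 1
        simp only [Derivation.map_smul, mul_smul_comm, smul_add, Finset.smul_sum]
      | mem m hm =>
        rcases hm with rfl | ⟨j, rfl⟩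
        · simpa using hx i
        · rw [h₁]; split_ifs
          · exact h1
          · exact zero_mem _
  laplace := by
    intro l hl
    rw [pow_zero]
    induction hl using Submodule.span_induction with
    | zero => simp
    | add a b _ _ ha hb =>
      convert add_mem ha hb using 1
      simp only [map_add, smul_add, Finset.sum_add_distrib]; abel
    | smul c a _ ha =>
      convert Submodule.smul_mem _ c ha using 1
      simp only [Derivation.map_smul, smul_add, Finset.smul_sum, smul_comm c κ]
    | mem l hl =>
      rcases hl with rfl | ⟨i, rfl⟩
      · simp only [Derivation.map_one_eq_zero, map_zero, Finset.sum_const_zero, zero_add]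
        exact Submodule.smul_mem _ _ (Submodule.mem_one.2 ⟨1, by simp⟩)
      · rw [h₂]; exact zero_mem _

theorem coord_sq_θ : coord 0 * coord 0 + coord 1 * coord 1 = (1 : Pol) := by
  ext g
  have h : ‖(g.1 : ℂ)‖ = 1 := g.1.norm_coe
  rw [← sq_eq_sq₀ (norm_nonneg _) zero_le_one, Complex.sq_norm, Complex.normSq_apply] at h
  simpa [coord_apply, coordFun] using h

theorem coord_sq_φ : coord 2 * coord 2 + coord 3 * coord 3 = (1 : Pol) := by
  ext g
  have h : ‖(g.2.1 : ℂ)‖ = 1 := g.2.1.norm_coe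
  rw [← sq_eq_sq₀ (norm_nonneg _) zero_le_one, Complex.sq_norm, Complex.normSq_apply] at h
  simpa [coord_apply, coordFun] using h

theorem coord_sq_Q : coord 4 * coord 4 + coord 5 * coord 5 + coord 6 * coord 6 +
    coord 7 * coord 7 = (1 : Pol) := by
  ext g
  have h : ‖(g.2.2 : ℍ[ℝ])‖ = 1 := by simp
  rw [← sq_eq_sq₀ (norm_nonneg _) zero_le_one, sq, ← Quaternion.normSq_eq_norm_mul_self,
    Quaternion.normSq_def'] at h
  simp only [coord_apply, coordFun, Pol.add_apply, Pol.mul_apply, Pol.one_apply]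
  simp
  linarith

def derivθ : Derivation ℝ Pol Pol := flowθ.deriv
def derivφ : Derivation ℝ Pol Pol := flowφ.deriv
def derivQ (a : Fin 3) : Derivation ℝ Pol Pol := (flowQ a).deriv

theorem derivθ_coord (i : Fin 8) :
    derivθ (coord i) = ![-coord 1, coord 0, 0, 0, 0, 0, 0, 0] i := flowθ.deriv_coord i
theorem derivφ_coord (i : Fin 8) :
    derivφ (coord i) = ![0, 0, -coord 3, coord 2, 0, 0, 0, 0] i := flowφ.deriv_coord i
theorem derivQ_coord (a : Fin 3) (i : Fin 8) :
    derivQ a (coord i) = (![![0, 0, 0, 0, -coord 5, coord 4, -coord 7, coord 6],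
    ![0, 0, 0, 0, -coord 6, coord 7, coord 4, -coord 5],
    ![0, 0, 0, 0, -coord 7, -coord 6, coord 5, coord 4]] a : Fin 8 → Pol) i :=
  (flowQ a).deriv_coord i

theorem derivQ_comm (a b : Fin 3) (f : Pol) :
    derivQ a (derivQ b f) - derivQ b (derivQ a f) =
      ![![0, -(2 : ℝ) • derivQ 2, (2 : ℝ) • derivQ 1],
        ![(2 : ℝ) • derivQ 2, 0, -(2 : ℝ) • derivQ 0],
        ![-(2 : ℝ) • derivQ 1, (2 : ℝ) • derivQ 0, 0]] a b f := by
  rw [← Derivation.commutator_apply]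
  congr 1
  refine Pol.derivation_ext fun i => ?_
  rw [Derivation.commutator_apply]
  fin_cases a <;> fin_cases b <;> fin_cases i <;>
    simp [derivQ_coord, two_smul] <;> abel

theorem derivθ_comm (f : Pol) : derivθ (derivφ f) = derivφ (derivθ f) := by
  rw [← sub_eq_zero, ← Derivation.commutator_apply]
  have : ⁅derivθ, derivφ⁆ = 0 := by
    refine Pol.derivation_ext fun i => ?_
    rw [Derivation.commutator_apply]
    fin_cases i <;> simp [derivθ_coord, derivφ_coord]
  rw [this]; rfl

theorem derivθ_comm_derivQ (a : Fin 3) (f : Pol) : derivθ (derivQ a f) = derivQ a (derivθ f) := by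
  rw [← sub_eq_zero, ← Derivation.commutator_apply]
  have : ⁅derivθ, derivQ a⁆ = 0 := by
    refine Pol.derivation_ext fun i => ?_
    rw [Derivation.commutator_apply]
    fin_cases a <;> fin_cases i <;> simp [derivθ_coord, derivQ_coord]
  rw [this]; rfl

theorem derivφ_comm_derivQ (a : Fin 3) (f : Pol) : derivφ (derivQ a f) = derivQ a (derivφ f) := by
  rw [← sub_eq_zero, ← Derivation.commutator_apply]
  have : ⁅derivφ, derivQ a⁆ = 0 := by
    refine Pol.derivation_ext fun i => ?_
    rw [Derivation.commutator_apply]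
    fin_cases a <;> fin_cases i <;> simp [derivφ_coord, derivQ_coord]
  rw [this]; rfl

def factorθ : PolFactor := PolFactor.ofCoords (n := 1) (k := 2) (fun _ => flowθ)
  ![coord 0, coord 1] 1 zero_le_one
  (by
    have h := coord_sq_θ
    change ∀ i j, ∑ a : Fin 1, derivθ _ * derivθ _ + _ = _
    intro i j
    fin_cases i <;> fin_cases j <;> simp [derivθ_coord] <;>
      first | linear_combination h | ring1)
  (by
    change ∀ i, ∑ a : Fin 1, derivθ (derivθ _) + _ = _
    intro i; fin_cases i <;> simp [derivθ_coord])

def factorφ : PolFactor := PolFactor.ofCoords (n := 1) (k := 2) (fun _ => flowφ)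
  ![coord 2, coord 3] 1 zero_le_one
  (by
    have h := coord_sq_φ
    change ∀ i j, ∑ a : Fin 1, derivφ _ * derivφ _ + _ = _
    intro i j
    fin_cases i <;> fin_cases j <;> simp [derivφ_coord] <;>
      first | linear_combination h | ring1)
  (by
    change ∀ i, ∑ a : Fin 1, derivφ (derivφ _) + _ = _
    intro i; fin_cases i <;> simp [derivφ_coord])

def factorQ : PolFactor := PolFactor.ofCoords (n := 3) (k := 4) flowQ
  ![coord 4, coord 5, coord 6, coord 7] 3 (by norm_num)
  (by
    have h := coord_sq_Q
    change ∀ i j, ∑ a : Fin 3, derivQ a _ * derivQ a _ + _ = _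
    intro i j
    fin_cases i <;> fin_cases j <;> simp [derivQ_coord, Fin.sum_univ_three] <;>
      first | linear_combination h | ring1)
  (by
    change ∀ i, ∑ a : Fin 3, derivQ a (derivQ a _) + _ = _
    intro i; fin_cases i <;> simp [derivQ_coord, Fin.sum_univ_three] <;> module)

end Factors

section Fil

theorem deriv_zero_span (D : Derivation ℝ Pol Pol) {k : ℕ} {x : Fin k → Pol}
    (h : ∀ i, D (x i) = 0) : ∀ f ∈ Submodule.span ℝ (insert 1 (range x)), D f = 0 := by
  intro f hf
  induction hf using Submodule.span_induction with
  | zero => simp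
  | add a b _ _ ha hb => rw [map_add, ha, hb, add_zero]
  | smul c a _ ha => rw [Derivation.map_smul, ha, smul_zero]
  | mem l hl =>
    rcases hl with rfl | ⟨i, rfl⟩
    · simp
    · exact h i

theorem deriv_mem_span (D : Derivation ℝ Pol Pol) {k : ℕ} {x : Fin k → Pol}
    (h : ∀ i, D (x i) ∈ Submodule.span ℝ (insert 1 (range x))) :
    ∀ f ∈ Submodule.span ℝ (insert 1 (range x)), D f ∈ Submodule.span ℝ (insert 1 (range x)) := by
  intro f hf
  induction hf using Submodule.span_induction with
  | zero => simp
  | add a b _ _ ha hb => rw [map_add]; exact add_mem ha hb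
  | smul c a _ ha => rw [Derivation.map_smul]; exact Submodule.smul_mem _ _ ha
  | mem l hl =>
    rcases hl with rfl | ⟨i, rfl⟩
    · simp
    · exact h i

theorem mem_factorθ (i : Fin 2) : (![coord 0, coord 1] i : Pol) ∈ factorθ.C :=
  Submodule.subset_span (mem_insert_of_mem _ ⟨i, rfl⟩)
theorem mem_factorφ (i : Fin 2) : (![coord 2, coord 3] i : Pol) ∈ factorφ.C :=
  Submodule.subset_span (mem_insert_of_mem _ ⟨i, rfl⟩)
theorem mem_factorQ (i : Fin 4) :
    (![coord 4, coord 5, coord 6, coord 7] i : Pol) ∈ factorQ.C :=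
  Submodule.subset_span (mem_insert_of_mem _ ⟨i, rfl⟩)

theorem derivθ_factorφ : ∀ f ∈ factorφ.C, derivθ f = 0 :=
  deriv_zero_span _ fun i => by fin_cases i <;> simp [derivθ_coord]
theorem derivθ_factorQ : ∀ f ∈ factorQ.C, derivθ f = 0 :=
  deriv_zero_span _ fun i => by fin_cases i <;> simp [derivθ_coord]
theorem derivφ_factorθ : ∀ f ∈ factorθ.C, derivφ f = 0 :=
  deriv_zero_span _ fun i => by fin_cases i <;> simp [derivφ_coord]
theorem derivφ_factorQ : ∀ f ∈ factorQ.C, derivφ f = 0 :=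
  deriv_zero_span _ fun i => by fin_cases i <;> simp [derivφ_coord]
theorem derivQ_factorθ (a : Fin 3) : ∀ f ∈ factorθ.C, derivQ a f = 0 :=
  deriv_zero_span _ fun i => by fin_cases a <;> fin_cases i <;> simp [derivQ_coord]
theorem derivQ_factorφ (a : Fin 3) : ∀ f ∈ factorφ.C, derivQ a f = 0 :=
  deriv_zero_span _ fun i => by fin_cases a <;> fin_cases i <;> simp [derivQ_coord]

theorem derivθ_mem_factorθ : ∀ f ∈ factorθ.C, derivθ f ∈ factorθ.C :=
  deriv_mem_span _ fun i => by
    change derivθ _ ∈ factorθ.C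
    have h0 := mem_factorθ 0
    have h1 := mem_factorθ 1
    fin_cases i
    · simpa [derivθ_coord] using h1
    · simpa [derivθ_coord] using h0
theorem derivφ_mem_factorφ : ∀ f ∈ factorφ.C, derivφ f ∈ factorφ.C :=
  deriv_mem_span _ fun i => by
    change derivφ _ ∈ factorφ.C
    have h0 := mem_factorφ 0
    have h1 := mem_factorφ 1
    fin_cases i
    · simpa [derivφ_coord] using h1
    · simpa [derivφ_coord] using h0
theorem derivQ_mem_factorQ (a : Fin 3) : ∀ f ∈ factorQ.C, derivQ a f ∈ factorQ.C :=
  deriv_mem_span _ fun i => by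
    change derivQ a _ ∈ factorQ.C
    have h0 := mem_factorQ 0
    have h1 := mem_factorQ 1
    have h2 := mem_factorQ 2
    have h3 := mem_factorQ 3
    simp at h0 h1 h2 h3
    fin_cases a <;> fin_cases i <;> simp [derivQ_coord] <;> assumption

/-- Polynomials of bounded degrees along the three factors. -/
def Fil (p q r : ℕ) : Submodule ℝ Pol := factorθ.C ^ p * (factorφ.C ^ q * factorQ.C ^ r)

theorem Fil_eq_φ (p q r : ℕ) : Fil p q r = factorφ.C ^ q * (factorθ.C ^ p * factorQ.C ^ r) :=
  mul_left_comm _ _ _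

theorem Fil_eq_Q (p q r : ℕ) : Fil p q r = factorQ.C ^ r * (factorθ.C ^ p * factorφ.C ^ q) := by
  rw [Fil, ← mul_assoc, mul_comm]

theorem Fil_fg (p q r : ℕ) : (Fil p q r).FG :=
  (factorθ.fg.pow p).mul ((factorφ.fg.pow q).mul (factorQ.fg.pow r))

instance (p q r : ℕ) : FiniteDimensional ℝ (Fil p q r) := Module.Finite.iff_fg.2 (Fil_fg p q r)

theorem Fil_mono {p q r p' q' r' : ℕ} (hp : p ≤ p') (hq : q ≤ q') (hr : r ≤ r') :
    Fil p q r ≤ Fil p' q' r' :=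
  mul_le_mul' (factorθ.pow_mono hp)
    (mul_le_mul' (factorφ.pow_mono hq) (factorQ.pow_mono hr))

theorem derivθ_Fil (p q r : ℕ) : ∀ f ∈ Fil p q r, derivθ f ∈ Fil p q r :=
  deriv_mem_mul _ (deriv_mem_pow _ derivθ_mem_factorθ p)
    (deriv_mem_mul _ (deriv_mem_pow _ (fun f hf => by
      rw [derivθ_factorφ f hf]; exact zero_mem _) q)
      (deriv_mem_pow _ (fun f hf => by rw [derivθ_factorQ f hf]; exact zero_mem _) r))
theorem derivφ_Fil (p q r : ℕ) : ∀ f ∈ Fil p q r, derivφ f ∈ Fil p q r :=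
  deriv_mem_mul _ (deriv_mem_pow _ (fun f hf => by
      rw [derivφ_factorθ f hf]; exact zero_mem _) p)
    (deriv_mem_mul _ (deriv_mem_pow _ derivφ_mem_factorφ q)
      (deriv_mem_pow _ (fun f hf => by rw [derivφ_factorQ f hf]; exact zero_mem _) r))
theorem derivQ_Fil (a : Fin 3) (p q r : ℕ) : ∀ f ∈ Fil p q r, derivQ a f ∈ Fil p q r :=
  deriv_mem_mul _ (deriv_mem_pow _ (fun f hf => by
      rw [derivQ_factorθ a f hf]; exact zero_mem _) p)
    (deriv_mem_mul _ (deriv_mem_pow _ (fun f hf => by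
      rw [derivQ_factorφ a f hf]; exact zero_mem _) q)
      (deriv_mem_pow _ (derivQ_mem_factorQ a) r))

theorem derivθ_zero (q r : ℕ) : ∀ f ∈ factorφ.C ^ q * factorQ.C ^ r, derivθ f = 0 :=
  deriv_zero_mul _ (deriv_zero_pow _ derivθ_factorφ q) (deriv_zero_pow _ derivθ_factorQ r)
theorem derivφ_zero (p r : ℕ) : ∀ f ∈ factorθ.C ^ p * factorQ.C ^ r, derivφ f = 0 :=
  deriv_zero_mul _ (deriv_zero_pow _ derivφ_factorθ p) (deriv_zero_pow _ derivφ_factorQ r)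
theorem derivQ_zero (a : Fin 3) (p q : ℕ) :
    ∀ f ∈ factorθ.C ^ p * factorφ.C ^ q, derivQ a f = 0 :=
  deriv_zero_mul _ (deriv_zero_pow _ (derivQ_factorθ a) p) (deriv_zero_pow _ (derivQ_factorφ a) q)

theorem one_le_pow (B : PolFactor) (p : ℕ) : (1 : Submodule ℝ Pol) ≤ B.C ^ p := by
  have := B.pow_mono (Nat.zero_le p)
  rwa [pow_zero] at this

theorem exists_mem_Fil (f : Pol) : ∃ N, f ∈ Fil N N N := by
  refine Pol.induction (p := fun f => ∃ N, f ∈ Fil N N N) ?_ ?_ ?_ ?_ f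
  · have hθ : factorθ.C ≤ Fil 1 1 1 := by
      have := mul_le_mul' (pow_one factorθ.C).ge
        (mul_le_mul' (one_le_pow factorφ 1) (one_le_pow factorQ 1))
      rwa [mul_one, mul_one] at this
    have hφ : factorφ.C ≤ Fil 1 1 1 := by
      have := mul_le_mul' (one_le_pow factorθ 1)
        (mul_le_mul' (pow_one factorφ.C).ge (one_le_pow factorQ 1))
      rwa [mul_one, one_mul] at this
    have hQ : factorQ.C ≤ Fil 1 1 1 := by
      have := mul_le_mul' (one_le_pow factorθ 1)
        (mul_le_mul' (one_le_pow factorφ 1) (pow_one factorQ.C).ge)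
      rwa [one_mul, one_mul] at this
    intro i
    refine ⟨1, ?_⟩
    fin_cases i
    · exact hθ (mem_factorθ 0)
    · exact hθ (mem_factorθ 1)
    · exact hφ (mem_factorφ 0)
    · exact hφ (mem_factorφ 1)
    · exact hQ (mem_factorQ 0)
    · exact hQ (mem_factorQ 1)
    · exact hQ (mem_factorQ 2)
    · exact hQ (mem_factorQ 3)
  · intro c
    refine ⟨0, ?_⟩
    simp only [Fil, pow_zero, mul_one]
    exact Submodule.mem_one.2 ⟨c, rfl⟩
  · rintro f h ⟨N, hf⟩ ⟨M, hh⟩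
    exact ⟨max N M, add_mem (Fil_mono (le_max_left _ _) (le_max_left _ _) (le_max_left _ _) hf)
      (Fil_mono (le_max_right _ _) (le_max_right _ _) (le_max_right _ _) hh)⟩
  · rintro f h ⟨N, hf⟩ ⟨M, hh⟩
    refine ⟨N + M, ?_⟩
    have := Submodule.mul_mem_mul hf hh
    have e : Fil N N N * Fil M M M = Fil (N + M) (N + M) (N + M) := by
      simp only [Fil, pow_add]; ring
    rwa [e] at this

theorem exists_mem_Fil_ge (f : Pol) (N : ℕ) : ∃ M, N ≤ M ∧ f ∈ Fil M M M := by
  obtain ⟨M, h⟩ := exists_mem_Fil f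
  exact ⟨max N M, le_max_left _ _,
    Fil_mono (le_max_right _ _) (le_max_right _ _) (le_max_right _ _) h⟩

/-- The Laplacian on polynomials. -/
def lapP : Pol →ₗ[ℝ] Pol := factorθ.T + factorφ.T + factorQ.T

theorem factorθ_T_apply (f : Pol) : factorθ.T f = -derivθ (derivθ f) := by
  rw [PolFactor.T_apply]
  change -∑ a : Fin 1, derivθ (derivθ f) = _
  simp
theorem factorφ_T_apply (f : Pol) : factorφ.T f = -derivφ (derivφ f) := by
  rw [PolFactor.T_apply]
  change -∑ a : Fin 1, derivφ (derivφ f) = _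
  simp
theorem factorQ_T_apply (f : Pol) : factorQ.T f = -∑ a, derivQ a (derivQ a f) :=
  factorQ.T_apply f

theorem lapP_apply (f : Pol) : lapP f =
    -derivθ (derivθ f) - derivφ (derivφ f) - ∑ a, derivQ a (derivQ a f) := by
  rw [lapP, LinearMap.add_apply, LinearMap.add_apply, factorθ_T_apply, factorφ_T_apply,
    factorQ_T_apply]
  abel

theorem lapP_symm (f h : Pol) : ⟪lapP f, h⟫ = ⟪f, lapP h⟫ := by
  simp only [lapP, LinearMap.add_apply, inner_add_left, inner_add_right, PolFactor.T_symm]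

theorem lapP_mem (p q r : ℕ) : ∀ f ∈ Fil p q r, lapP f ∈ Fil p q r := by
  intro f hf
  rw [lapP_apply]
  exact sub_mem (sub_mem (neg_mem (derivθ_Fil _ _ _ _ (derivθ_Fil _ _ _ _ hf)))
    (derivφ_Fil _ _ _ _ (derivφ_Fil _ _ _ _ hf)))
    (sum_mem fun a _ => derivQ_Fil a _ _ _ _ (derivQ_Fil a _ _ _ _ hf))

theorem lower_θ (N M q r : ℕ) {w : Pol} (hw : w ∈ Fil M q r) (h : ∀ e ∈ Fil N q r, ⟪e, w⟫ = 0) :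
    ((N : ℝ) + 1) * (N + 1) * ‖w‖ ^ 2 ≤ ⟪w, factorθ.T w⟫ :=
  factorθ.lower_bound (fun _ => derivθ_zero q r) ((factorφ.fg.pow q).mul (factorQ.fg.pow r))
    N M w hw h

theorem lower_φ (N M p r : ℕ) {w : Pol} (hw : w ∈ Fil p M r) (h : ∀ e ∈ Fil p N r, ⟪e, w⟫ = 0) :
    ((N : ℝ) + 1) * (N + 1) * ‖w‖ ^ 2 ≤ ⟪w, factorφ.T w⟫ := by
  rw [Fil_eq_φ] at hw h
  exact factorφ.lower_bound (fun _ => derivφ_zero p r)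
    ((factorθ.fg.pow p).mul (factorQ.fg.pow r)) N M w hw h

theorem lower_Q (N M p q : ℕ) {w : Pol} (hw : w ∈ Fil p q M) (h : ∀ e ∈ Fil p q N, ⟪e, w⟫ = 0) :
    ((N : ℝ) + 1) * (N + 3) * ‖w‖ ^ 2 ≤ ⟪w, factorQ.T w⟫ := by
  rw [Fil_eq_Q] at hw h
  exact factorQ.lower_bound (fun a => derivQ_zero a p q)
    ((factorθ.fg.pow p).mul (factorφ.fg.pow q)) N M w hw h

theorem lapP_lower (N : ℕ) {w : Pol} (h : ∀ e ∈ Fil N N N, ⟪e, w⟫ = 0) :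
    ((N : ℝ) + 1) * (N + 1) * ‖w‖ ^ 2 ≤ ⟪w, lapP w⟫ := by
  obtain ⟨M, hNM, hw⟩ := exists_mem_Fil_ge w N
  have hθ : ∀ w : Pol, ⟪w, factorθ.T w⟫ ≤ ⟪w, lapP w⟫ := fun w => by
    have h1 := factorφ.inner_T_nonneg w
    have h2 := factorQ.inner_T_nonneg w
    simp only [lapP, LinearMap.add_apply, inner_add_right]; linarith
  have hφ : ∀ w : Pol, ⟪w, factorφ.T w⟫ ≤ ⟪w, lapP w⟫ := fun w => by
    have h1 := factorθ.inner_T_nonneg w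
    have h2 := factorQ.inner_T_nonneg w
    simp only [lapP, LinearMap.add_apply, inner_add_right]; linarith
  have hQ : ∀ w : Pol, ⟪w, factorQ.T w⟫ ≤ ⟪w, lapP w⟫ := fun w => by
    have h1 := factorφ.inner_T_nonneg w
    have h2 := factorθ.inner_T_nonneg w
    simp only [lapP, LinearMap.add_apply, inner_add_right]; linarith
  refine lower_bound_of_split lapP_symm (F := Fil N N N) (E := Fil N M M) (G := Fil M M M)
    (Fil_mono le_rfl hNM hNM) (Fil_mono hNM le_rfl le_rfl) (lapP_mem _ _ _) ?_
    (fun w hw h => (lower_θ N M M M hw h).trans (hθ w)) hw h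
  intro w hw h
  refine lower_bound_of_split lapP_symm (F := Fil N N N) (E := Fil N N M) (G := Fil N M M)
    (Fil_mono le_rfl le_rfl hNM) (Fil_mono le_rfl hNM le_rfl) (lapP_mem _ _ _) ?_
    (fun w hw h => (lower_φ N M N M hw h).trans (hφ w)) hw h
  intro w hw h
  refine le_trans ?_ ((lower_Q N M N N hw h).trans (hQ w))
  gcongr
  norm_num

theorem exists_kernel_decomp_θ (v : Pol) : ∃ v₀ v₁, v = v₀ + v₁ ∧ derivθ v₀ = 0 ∧
    ‖v₁‖ ≤ ‖derivθ v₁‖ := by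
  obtain ⟨M, hv⟩ := exists_mem_Fil v
  obtain ⟨v₀, h₀, v₁, rfl, h⟩ := exists_orth_decomp (Fil 0 M M) v
  refine ⟨v₀, v₁, rfl, ?_, ?_⟩
  · rw [Fil, pow_zero, one_mul] at h₀; exact derivθ_zero M M v₀ h₀
  · have h1 : v₁ ∈ Fil M M M := by
      simpa using sub_mem hv (Fil_mono (Nat.zero_le M) le_rfl le_rfl h₀)
    have := lower_θ 0 M M M h1 h
    rw [PolFactor.inner_T] at this
    change _ ≤ ∑ a : Fin 1, ⟪derivθ v₁, derivθ v₁⟫ at this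
    rw [← sq_le_sq₀ (norm_nonneg _) (norm_nonneg _)]
    simpa using this

theorem exists_kernel_decomp_φ (v : Pol) : ∃ v₀ v₁, v = v₀ + v₁ ∧ derivφ v₀ = 0 ∧
    ‖v₁‖ ≤ ‖derivφ v₁‖ := by
  obtain ⟨M, hv⟩ := exists_mem_Fil v
  obtain ⟨v₀, h₀, v₁, rfl, h⟩ := exists_orth_decomp (Fil M 0 M) v
  refine ⟨v₀, v₁, rfl, ?_, ?_⟩
  · rw [Fil_eq_φ, pow_zero, one_mul] at h₀; exact derivφ_zero M M v₀ h₀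
  · have h1 : v₁ ∈ Fil M M M := by
      simpa using sub_mem hv (Fil_mono le_rfl (Nat.zero_le M) le_rfl h₀)
    have := lower_φ 0 M M M h1 h
    rw [PolFactor.inner_T] at this
    change _ ≤ ∑ a : Fin 1, ⟪derivφ v₁, derivφ v₁⟫ at this
    rw [← sq_le_sq₀ (norm_nonneg _) (norm_nonneg _)]
    simpa using this

theorem lapP_algebraMap (c : ℝ) : lapP (algebraMap ℝ Pol c) = 0 := by simp [lapP_apply]

theorem eq_const_of_lapP_eq_zero {f : Pol} (hf : lapP f = 0) : ∃ c, f = algebraMap ℝ Pol c := by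
  obtain ⟨v₀, h₀, v₁, rfl, h⟩ := exists_orth_decomp (Fil 0 0 0) f
  have e : Fil 0 0 0 = 1 := by simp [Fil]
  obtain ⟨c, rfl⟩ : ∃ c, algebraMap ℝ Pol c = v₀ := by
    rw [e] at h₀; exact Submodule.mem_one.1 h₀
  have h1 := lapP_lower 0 h
  rw [map_add, lapP_algebraMap, zero_add] at hf
  rw [hf] at h1
  have h2 : v₁ = 0 := by
    have : ‖v₁‖ ^ 2 ≤ 0 := by simpa using h1
    simpa using this
  exact ⟨c, by rw [h2, add_zero]⟩

end Fil

section Adjoints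

variable {H : Type*} [NormedAddCommGroup H] [InnerProductSpace ℝ H]

/-- `A'` is a formal adjoint of `A`. -/
def IsAdj (A A' : Module.End ℝ H) : Prop := ∀ u v, ⟪A u, v⟫ = ⟪u, A' v⟫

def IsSkew (A : Module.End ℝ H) : Prop := IsAdj A (-A)

def Bdd (A : Module.End ℝ H) : Prop := ∃ C, ∀ v, ‖A v‖ ≤ C * ‖v‖

def BddBelow' (c : ℝ) (A : Module.End ℝ H) : Prop := ∀ v, c * ‖v‖ ≤ ‖A v‖

theorem IsAdj.symm {A A' : Module.End ℝ H} (h : IsAdj A A') : IsAdj A' A := fun u v => by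
  rw [real_inner_comm, ← h, real_inner_comm]

theorem IsAdj.add {A A' B B' : Module.End ℝ H} (h : IsAdj A A') (h' : IsAdj B B') :
    IsAdj (A + B) (A' + B') := fun u v => by
  simp only [LinearMap.add_apply, inner_add_left, inner_add_right, h u v, h' u v]

theorem IsAdj.neg {A A' : Module.End ℝ H} (h : IsAdj A A') : IsAdj (-A) (-A') := fun u v => by
  simp only [LinearMap.neg_apply, inner_neg_left, inner_neg_right, h u v]

theorem IsAdj.sub {A A' B B' : Module.End ℝ H} (h : IsAdj A A') (h' : IsAdj B B') :
    IsAdj (A - B) (A' - B') := fun u v => by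
  simp only [LinearMap.sub_apply, inner_sub_left, inner_sub_right, h u v, h' u v]

theorem IsAdj.smul {A A' : Module.End ℝ H} (c : ℝ) (h : IsAdj A A') : IsAdj (c • A) (c • A') :=
  fun u v => by
    simp only [LinearMap.smul_apply, real_inner_smul_left, real_inner_smul_right, h u v]

theorem IsAdj.mul {A A' B B' : Module.End ℝ H} (h : IsAdj A A') (h' : IsAdj B B') :
    IsAdj (A * B) (B' * A') := fun u v => by
  rw [Module.End.mul_apply, Module.End.mul_apply, h, h']

theorem IsAdj.one : IsAdj (1 : Module.End ℝ H) 1 := fun _ _ => rfl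
theorem IsAdj.zero : IsAdj (0 : Module.End ℝ H) 0 := fun u v => by simp

theorem IsSkew.inner {A : Module.End ℝ H} (h : IsSkew A) (u v : H) : ⟪A u, v⟫ = -⟪u, A v⟫ := by
  rw [h u v, LinearMap.neg_apply, inner_neg_right]

theorem IsSkew.of_inner {A : Module.End ℝ H} (h : ∀ u v, ⟪A u, v⟫ = -⟪u, A v⟫) : IsSkew A :=
  fun u v => by rw [h u v, LinearMap.neg_apply, inner_neg_right]

theorem IsSkew.add {A B : Module.End ℝ H} (h : IsSkew A) (h' : IsSkew B) : IsSkew (A + B) := by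
  have := IsAdj.add h h'; rwa [← neg_add] at this

theorem IsSkew.sub {A B : Module.End ℝ H} (h : IsSkew A) (h' : IsSkew B) : IsSkew (A - B) := by
  have := IsAdj.sub h h'
  unfold IsSkew
  convert this using 1
  abel

theorem IsSkew.smul {A : Module.End ℝ H} (c : ℝ) (h : IsSkew A) : IsSkew (c • A) := by
  have := IsAdj.smul c h; rwa [smul_neg] at this

theorem IsSkew.neg {A : Module.End ℝ H} (h : IsSkew A) : IsSkew (-A) := IsAdj.neg h

theorem Bdd.add {A B : Module.End ℝ H} : Bdd A → Bdd B → Bdd (A + B) := by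
  rintro ⟨C, h⟩ ⟨C', h'⟩
  refine ⟨C + C', fun v => ?_⟩
  rw [add_mul]; exact (norm_add_le _ _).trans (add_le_add (h v) (h' v))

theorem Bdd.neg {A : Module.End ℝ H} : Bdd A → Bdd (-A) := by
  rintro ⟨C, h⟩
  exact ⟨C, fun v => by simpa using h v⟩

theorem Bdd.sub {A B : Module.End ℝ H} (h : Bdd A) (h' : Bdd B) : Bdd (A - B) := by
  rw [sub_eq_add_neg]; exact h.add h'.neg

theorem Bdd.smul {A : Module.End ℝ H} (c : ℝ) : Bdd A → Bdd (c • A) := by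
  rintro ⟨C, h⟩
  refine ⟨|c| * C, fun v => ?_⟩
  rw [LinearMap.smul_apply, norm_smul, Real.norm_eq_abs, mul_assoc]
  exact mul_le_mul_of_nonneg_left (h v) (abs_nonneg c)

theorem Bdd.exists_pos {A : Module.End ℝ H} : Bdd A → ∃ C, 0 < C ∧ ∀ v, ‖A v‖ ≤ C * ‖v‖ := by
  rintro ⟨C, h⟩
  exact ⟨max C 1, by positivity, fun v => (h v).trans (by gcongr; exact le_max_left _ _)⟩

theorem Bdd.mul {A B : Module.End ℝ H} : Bdd A → Bdd B → Bdd (A * B) := by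
  intro h h'
  obtain ⟨C, hC, h⟩ := h.exists_pos
  obtain ⟨C', hC', h'⟩ := h'.exists_pos
  refine ⟨C * C', fun v => (h _).trans ?_⟩
  rw [mul_assoc]
  exact mul_le_mul_of_nonneg_left (h' v) hC.le

theorem Bdd.one : Bdd (1 : Module.End ℝ H) := ⟨1, fun v => by simp⟩
theorem Bdd.zero : Bdd (0 : Module.End ℝ H) := ⟨0, fun v => by simp⟩

theorem Bdd.of_bounds_family {A B : Module.End ℝ H} (h : Bdd A) (h' : Bdd B) :
    ∃ C, 0 < C ∧ ∀ t ∈ Icc (0 : ℝ) 1, ∀ v, ‖((1 - t) • A + t • B) v‖ ≤ C * ‖v‖ := by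
  obtain ⟨C, hC, h⟩ := h.exists_pos
  obtain ⟨C', hC', h'⟩ := h'.exists_pos
  refine ⟨C + C', by positivity, fun t ht v => ?_⟩
  have h1 := h v
  have h2 := h' v
  have h3 : 0 ≤ 1 - t := by linarith [ht.2]
  calc ‖((1 - t) • A + t • B) v‖ ≤ ‖(1 - t) • A v‖ + ‖t • B v‖ := norm_add_le _ _
    _ = (1 - t) * ‖A v‖ + t * ‖B v‖ := by
      rw [norm_smul, norm_smul, Real.norm_of_nonneg h3, Real.norm_of_nonneg ht.1]
    _ ≤ 1 * ‖A v‖ + 1 * ‖B v‖ := by gcongr <;> linarith [ht.1, ht.2]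
    _ ≤ (C + C') * ‖v‖ := by linarith

/-- Anticommuting skew operators: Pythagoras. -/
theorem norm_sq_add_of_anticomm {A B : Module.End ℝ H} (hA : IsSkew A) (hB : IsSkew B)
    (h : A * B + B * A = 0) (v : H) : ‖(A + B) v‖ ^ 2 = ‖A v‖ ^ 2 + ‖B v‖ ^ 2 := by
  rw [LinearMap.add_apply, norm_add_sq_real]
  have h1 : (A * B + B * A) v = 0 := by rw [h]; rfl
  have h2 : ⟪A v, B v⟫ = -⟪v, A (B v)⟫ := hA.inner _ _
  have h3 : ⟪A v, B v⟫ = -⟪v, B (A v)⟫ := by rw [real_inner_comm, hB.inner]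
  have h4 : ⟪v, A (B v) + B (A v)⟫ = 0 := by
    have : A (B v) + B (A v) = 0 := h1
    rw [this, inner_zero_right]
  rw [inner_add_right] at h4
  linarith

theorem norm_sq_half_twist {a N : Module.End ℝ H} (ha : IsSkew a) (hc : Commute a N)
    (hN : ∀ v, ‖N v‖ ≤ ‖v‖) (hk : ∀ v, ∃ v₀ v₁, v = v₀ + v₁ ∧ a v₀ = 0 ∧ ‖v₁‖ ≤ ‖a v₁‖)
    (v : H) : ‖N v‖ ^ 2 ≤ 4 * ‖(a - (1 / 2 : ℝ) • N) v‖ ^ 2 := by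
  have key : ⟪a v, N v⟫ ≤ ‖a v‖ ^ 2 := by
    obtain ⟨v₀, v₁, rfl, h₀, h₁⟩ := hk v
    have e : ⟪a v₁, N v₀⟫ = 0 := by
      have : a (N v₀) = N (a v₀) := congrArg (fun f : Module.End ℝ H => f v₀) hc.eq
      rw [ha.inner, this, h₀, map_zero, inner_zero_right, neg_zero]
    rw [map_add, map_add, h₀, zero_add, inner_add_right, e, zero_add]
    calc ⟪a v₁, N v₁⟫ ≤ ‖a v₁‖ * ‖N v₁‖ := real_inner_le_norm _ _
      _ ≤ ‖a v₁‖ * ‖a v₁‖ := by gcongr; exact (hN v₁).trans h₁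
      _ = _ := by ring
  rw [LinearMap.sub_apply, norm_sub_sq_real, LinearMap.smul_apply, real_inner_smul_right,
    norm_smul, mul_pow]
  norm_num
  linarith

end Adjoints

section Truncation

variable {H : Type*} [NormedAddCommGroup H] [InnerProductSpace ℝ H]

/-- A skew operator with discrete spectrum: an exhaustion by invariant finite-dimensional
subspaces, with growing spectral gaps on the orthogonal complements. -/
structure SpecFilt (D : Module.End ℝ H) where
  F : ℕ → Submodule ℝ H
  fin : ∀ N, FiniteDimensional ℝ (F N)
  mono : Monotone F
  exh : ∀ v, ∃ N, v ∈ F N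
  skew : IsSkew D
  inv : ∀ N, ∀ v ∈ F N, D v ∈ F N
  gap : ∀ N w, (∀ e ∈ F N, ⟪e, w⟫ = 0) → (N + 1 : ℝ) * ‖w‖ ≤ ‖D w‖

/-- The bilinear form `⟪u, A v⟫` on a subspace. -/
def formOn (V : Submodule ℝ H) (A : Module.End ℝ H) : V →ₗ[ℝ] V →ₗ[ℝ] ℝ :=
  (innerₗ H).compl₁₂ V.subtype (A ∘ₗ V.subtype)

theorem formOn_apply (V : Submodule ℝ H) (A : Module.End ℝ H) (u v : V) :
    formOn V A u v = ⟪(u : H), A v⟫ := rfl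

theorem formOn_skew (V : Submodule ℝ H) {A : Module.End ℝ H} (h : IsSkew A) :
    SkewForm (formOn V A) := fun u v => by
  rw [formOn_apply, formOn_apply, real_inner_comm, h.inner]

variable {D : Module.End ℝ H} (SF : SpecFilt D)

namespace SpecFilt

instance (N : ℕ) : FiniteDimensional ℝ (SF.F N) := SF.fin N

theorem exists_preimage (N : ℕ) {h : H} (hh : ∀ e ∈ SF.F N, ⟪e, h⟫ = 0) :
    ∃ w, (∀ e ∈ SF.F N, ⟪e, w⟫ = 0) ∧ D w = h ∧ (N + 1 : ℝ) * ‖w‖ ≤ ‖h‖ := by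
  obtain ⟨M, hM⟩ := SF.exh h
  let K : Submodule ℝ H := SF.F M ⊓ (SF.F N)ᗮ
  have hK : ∀ v ∈ K, D v ∈ K := by
    rintro v ⟨h1, h2⟩
    refine ⟨SF.inv M v h1, (Submodule.mem_orthogonal _ _).2 fun e he => ?_⟩
    rw [← neg_eq_zero, ← SF.skew.inner]
    exact (Submodule.mem_orthogonal _ _).1 h2 _ (SF.inv N e he)
  have : FiniteDimensional ℝ K := Submodule.finiteDimensional_inf_left _ _
  have hinj : Function.Injective (D.restrict hK) := by
    rw [← LinearMap.ker_eq_bot, LinearMap.ker_eq_bot']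
    rintro ⟨v, hv⟩ h
    have h1 : D v = 0 := congrArg Subtype.val h
    have h2 := SF.gap N v (fun e he => (Submodule.mem_orthogonal _ _).1 hv.2 e he)
    rw [h1, norm_zero] at h2
    have h3 : ‖v‖ = 0 := by
      have := norm_nonneg v
      have : (0 : ℝ) < N + 1 := by positivity
      nlinarith
    simpa using h3
  obtain ⟨⟨w, hw⟩, e⟩ := LinearMap.injective_iff_surjective.1 hinj
    ⟨h, hM, (Submodule.mem_orthogonal _ _).2 hh⟩
  have e' : D w = h := congrArg Subtype.val e
  refine ⟨w, fun e he => (Submodule.mem_orthogonal _ _).1 hw.2 e he, e', ?_⟩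
  rw [← e']
  exact SF.gap N w fun e he => (Submodule.mem_orthogonal _ _).1 hw.2 e he

theorem nondeg {W : Module.End ℝ H} {g w₀ : ℝ} (hg : 0 < g) (hw0 : 0 ≤ w₀)
    (hW : ∀ v, ‖W v‖ ≤ w₀ * ‖v‖) (hgap : BddBelow' g (D + W)) (N : ℕ)
    (hN : w₀ * w₀ < g * (N + 1)) : Nondeg (formOn (SF.F N) (D + W)) := by
  intro v hv
  set h := (D + W) (v : H) with hh
  have ho : ∀ e ∈ SF.F N, ⟪e, h⟫ = 0 := fun e he => hv ⟨e, he⟩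
  obtain ⟨w, hwo, hw1, hw2⟩ := SF.exists_preimage N ho
  have h1 : ‖h‖ ≤ w₀ * ‖(v : H)‖ := by
    have e1 : ‖h‖ * ‖h‖ = ⟪W v, h⟫ := by
      have : ⟪h, h⟫ = ⟪D v, h⟫ + ⟪W v, h⟫ := by rw [← inner_add_left]; rfl
      rw [← real_inner_self_eq_norm_mul_norm, this, ho _ (SF.inv N v v.2), zero_add]
    have e2 : ⟪W v, h⟫ ≤ ‖W v‖ * ‖h‖ := real_inner_le_norm _ _
    by_cases hz : ‖h‖ = 0
    · rw [hz]; positivity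
    · have : 0 < ‖h‖ := lt_of_le_of_ne (norm_nonneg _) (Ne.symm hz)
      exact (le_of_mul_le_mul_right (e1.le.trans e2) this).trans (hW v)
  have h2 : (D + W) ((v : H) - w) = -W w := by
    rw [map_sub, ← hh, LinearMap.add_apply, hw1]; abel
  have h3 : g * ‖(v : H) - w‖ ≤ w₀ * ‖w‖ := by
    refine (hgap _).trans ?_
    rw [h2, norm_neg]; exact hW w
  have h4 : ‖(v : H)‖ ≤ ‖(v : H) - w‖ := by
    rw [← sq_le_sq₀ (norm_nonneg _) (norm_nonneg _), norm_sub_sq_real, hwo _ v.2]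
    nlinarith [sq_nonneg ‖w‖]
  have hN' : (0 : ℝ) < N + 1 := by positivity
  have h5 : g * (N + 1) * ‖(v : H)‖ ≤ w₀ * w₀ * ‖(v : H)‖ := by
    calc g * (N + 1) * ‖(v : H)‖ ≤ (N + 1) * (g * ‖(v : H) - w‖) := by
          rw [mul_comm g, mul_assoc]; gcongr
      _ ≤ (N + 1) * (w₀ * ‖w‖) := by gcongr
      _ = w₀ * ((N + 1) * ‖w‖) := by ring
      _ ≤ w₀ * (w₀ * ‖(v : H)‖) := mul_le_mul_of_nonneg_left (hw2.trans h1) hw0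
      _ = _ := by ring
  have h6 : ‖(v : H)‖ = 0 := by
    have := norm_nonneg (v : H)
    by_contra hne
    have : 0 < ‖(v : H)‖ := lt_of_le_of_ne this (Ne.symm hne)
    nlinarith
  simpa using h6

/-- The forms of two perturbations are positively congruent on all large truncations. -/
def Rel (W W' : Module.End ℝ H) : Prop :=
  ∀ᶠ N in Filter.atTop, Cong (formOn (SF.F N) (D + W)) (formOn (SF.F N) (D + W'))

variable {SF}
theorem Rel.symm {W W' : Module.End ℝ H} (h : SF.Rel W W') : SF.Rel W' W :=
  Filter.Eventually.mono h fun _ h => h.symm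
theorem Rel.trans {W W' W'' : Module.End ℝ H} (h : SF.Rel W W') (h' : SF.Rel W' W'') :
    SF.Rel W W'' := by
  filter_upwards [h, h'] with N h h' using h.trans h'
variable (SF)

theorem cong_segment (N : ℕ) {A B : Module.End ℝ H} (hA : IsSkew A) (hB : IsSkew B)
    (hn : ∀ t ∈ Icc (0 : ℝ) 1, Nondeg (formOn (SF.F N) ((1 - t) • A + t • B))) :
    Cong (formOn (SF.F N) A) (formOn (SF.F N) B) := by
  have := cong_of_path (fun t => formOn (SF.F N) ((1 - t) • A + t • B)) ?_
    (fun t _ => formOn_skew _ ((hA.smul _).add (hB.smul _))) hn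
  · simpa using this
  · intro u v
    simp only [formOn_apply, LinearMap.add_apply, LinearMap.smul_apply, inner_add_right,
      real_inner_smul_right]
    fun_prop

theorem rel_of_segment {W W' : Module.End ℝ H} (hW : IsSkew W) (hW' : IsSkew W')
    (hb : Bdd W) (hb' : Bdd W') {g : ℝ} (hg : 0 < g)
    (h : ∀ t ∈ Icc (0 : ℝ) 1, BddBelow' g (D + ((1 - t) • W + t • W'))) : SF.Rel W W' := by
  obtain ⟨C, hC, hCb⟩ := hb.of_bounds_family hb'
  obtain ⟨N₀, hN₀⟩ := exists_nat_gt (C * C / g)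
  filter_upwards [Filter.eventually_ge_atTop N₀] with N hN
  refine SF.cong_segment N (SF.skew.add hW) (SF.skew.add hW') fun t ht => ?_
  have e : (1 - t) • (D + W) + t • (D + W') = D + ((1 - t) • W + t • W') := by module
  rw [e]
  refine SF.nondeg hg hC.le (hCb t ht) (h t ht) N ?_
  have : (N₀ : ℝ) ≤ N := by exact_mod_cast hN
  rw [div_lt_iff₀ hg] at hN₀
  nlinarith

end SpecFilt

end Truncation

section Doubling

theorem IsSkew.zero {H : Type*} [NormedAddCommGroup H] [InnerProductSpace ℝ H] :
    IsSkew (0 : Module.End ℝ H) := fun u v => by simp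

/-- The Hilbert sum of two copies of `H`. -/
abbrev Dbl (H : Type*) := WithLp 2 (H × H)

variable {H : Type*} [NormedAddCommGroup H] [InnerProductSpace ℝ H]

theorem Dbl.inner_def (u v : Dbl H) : ⟪u, v⟫ = ⟪u.fst, v.fst⟫ + ⟪u.snd, v.snd⟫ :=
  WithLp.prod_inner_apply u v

theorem Dbl.norm_sq (u : Dbl H) : ‖u‖ ^ 2 = ‖u.fst‖ ^ 2 + ‖u.snd‖ ^ 2 :=
  WithLp.prod_norm_sq_eq_of_L2 u

def Dbl.mk (x y : H) : Dbl H := WithLp.toLp 2 (x, y)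

@[simp] theorem Dbl.mk_fst (x y : H) : (Dbl.mk x y).fst = x := rfl
@[simp] theorem Dbl.mk_snd (x y : H) : (Dbl.mk x y).snd = y := rfl

theorem Dbl.ext' {u v : Dbl H} (h : u.fst = v.fst) (h' : u.snd = v.snd) : u = v :=
  WithLp.ofLp_injective 2 (Prod.ext h h')

/-- Operators on `Dbl H` given by a `2 × 2` matrix of operators. -/
def bmat (A B C E : Module.End ℝ H) : Module.End ℝ (Dbl H) where
  toFun v := Dbl.mk (A v.fst + B v.snd) (C v.fst + E v.snd)
  map_add' u v := by apply Dbl.ext' <;> simp [map_add] <;> abel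
  map_smul' c v := by apply Dbl.ext' <;> simp [smul_add]

@[simp] theorem bmat_fst (A B C E : Module.End ℝ H) (v : Dbl H) :
    (bmat A B C E v).fst = A v.fst + B v.snd := rfl
@[simp] theorem bmat_snd (A B C E : Module.End ℝ H) (v : Dbl H) :
    (bmat A B C E v).snd = C v.fst + E v.snd := rfl

theorem bmat_add (A B C E A' B' C' E' : Module.End ℝ H) :
    bmat A B C E + bmat A' B' C' E' = bmat (A + A') (B + B') (C + C') (E + E') := by
  ext v : 1; apply Dbl.ext' <;> simp <;> abel

theorem bmat_neg (A B C E : Module.End ℝ H) : -bmat A B C E = bmat (-A) (-B) (-C) (-E) := by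
  ext v : 1; apply Dbl.ext' <;> simp <;> abel

theorem bmat_sub (A B C E A' B' C' E' : Module.End ℝ H) :
    bmat A B C E - bmat A' B' C' E' = bmat (A - A') (B - B') (C - C') (E - E') := by
  ext v : 1; apply Dbl.ext' <;> simp <;> abel

theorem bmat_smul (c : ℝ) (A B C E : Module.End ℝ H) :
    c • bmat A B C E = bmat (c • A) (c • B) (c • C) (c • E) := by
  ext v : 1; apply Dbl.ext' <;> simp

theorem bmat_mul (A B C E A' B' C' E' : Module.End ℝ H) :
    bmat A B C E * bmat A' B' C' E' =
      bmat (A * A' + B * C') (A * B' + B * E') (C * A' + E * C') (C * B' + E * E') := by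
  ext v : 1; apply Dbl.ext' <;> simp <;> abel

theorem bmat_one : bmat (1 : Module.End ℝ H) 0 0 1 = 1 := by
  ext v : 1; apply Dbl.ext' <;> simp

theorem bmat_zero : bmat (0 : Module.End ℝ H) 0 0 0 = 0 := by
  ext v : 1; apply Dbl.ext' <;> simp

/-- The same operator on both copies. -/
def dia (A : Module.End ℝ H) : Module.End ℝ (Dbl H) := bmat A 0 0 A

theorem isAdj_bmat {A A' B B' C C' E E' : Module.End ℝ H} (hA : IsAdj A A') (hB : IsAdj B B')
    (hC : IsAdj C C') (hE : IsAdj E E') : IsAdj (bmat A B C E) (bmat A' C' B' E') := fun u v => by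
  simp only [Dbl.inner_def, bmat_fst, bmat_snd, inner_add_left, inner_add_right, hA u.fst, hB u.snd,
    hC u.fst, hE u.snd]
  ring

theorem isSkew_bmat {A B B' E : Module.End ℝ H} (hA : IsSkew A) (hB : IsAdj B B')
    (hE : IsSkew E) : IsSkew (bmat A B (-B') E) := by
  have := isAdj_bmat hA hB hB.symm.neg hE
  unfold IsSkew
  rwa [bmat_neg, neg_neg]

theorem Dbl.norm_fst_le (v : Dbl H) : ‖v.fst‖ ≤ ‖v‖ := by
  rw [← sq_le_sq₀ (norm_nonneg _) (norm_nonneg _), Dbl.norm_sq]; nlinarith [sq_nonneg ‖v.snd‖]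
theorem Dbl.norm_snd_le (v : Dbl H) : ‖v.snd‖ ≤ ‖v‖ := by
  rw [← sq_le_sq₀ (norm_nonneg _) (norm_nonneg _), Dbl.norm_sq]; nlinarith [sq_nonneg ‖v.fst‖]
theorem Dbl.norm_le (v : Dbl H) : ‖v‖ ≤ ‖v.fst‖ + ‖v.snd‖ := by
  rw [← sq_le_sq₀ (norm_nonneg _) (by positivity), Dbl.norm_sq]
  nlinarith [mul_nonneg (norm_nonneg v.fst) (norm_nonneg v.snd)]

theorem bdd_bmat {A B C E : Module.End ℝ H} (hA : Bdd A) (hB : Bdd B) (hC : Bdd C) (hE : Bdd E) :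
    Bdd (bmat A B C E) := by
  obtain ⟨a, ha, hA⟩ := hA.exists_pos
  obtain ⟨b, hb, hB⟩ := hB.exists_pos
  obtain ⟨c, hc, hC⟩ := hC.exists_pos
  obtain ⟨e, he, hE⟩ := hE.exists_pos
  refine ⟨(a + b) + (c + e), fun v => (Dbl.norm_le _).trans ?_⟩
  rw [bmat_fst, bmat_snd, add_mul, add_mul, add_mul]
  have h1 := v.norm_fst_le
  have h2 := v.norm_snd_le
  refine add_le_add ((norm_add_le _ _).trans (add_le_add ?_ ?_))
    ((norm_add_le _ _).trans (add_le_add ?_ ?_))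
  · exact (hA _).trans (by gcongr)
  · exact (hB _).trans (by gcongr)
  · exact (hC _).trans (by gcongr)
  · exact (hE _).trans (by gcongr)

end Doubling

section Coupling

variable {H : Type*} [NormedAddCommGroup H] [InnerProductSpace ℝ H]

/-- The off-diagonal skew operator built from `Q` and its adjoint. -/
def couple (Q Q' : Module.End ℝ H) : Module.End ℝ (Dbl H) := bmat 0 (-Q') Q 0

theorem isSkew_couple {Q Q' : Module.End ℝ H} (h : IsAdj Q Q') : IsSkew (couple Q Q') := by
  have := isSkew_bmat IsSkew.zero h.symm.neg IsSkew.zero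
  simpa [couple] using this

theorem bdd_couple {Q Q' : Module.End ℝ H} (h : Bdd Q) (h' : Bdd Q') : Bdd (couple Q Q') :=
  bdd_bmat Bdd.zero h'.neg h Bdd.zero

/-- Bounded operators with bounded adjoint and bounded commutator with `S`. -/
structure GoodOp (S Q Q' : Module.End ℝ H) : Prop where
  adj : IsAdj Q Q'
  bdd : Bdd Q
  bdd' : Bdd Q'
  comm : Bdd (S * Q - Q * S)

namespace GoodOp

variable {S Q Q' P P' : Module.End ℝ H}

theorem one : GoodOp S 1 1 := ⟨IsAdj.one, Bdd.one, Bdd.one, by simpa using Bdd.zero⟩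
theorem zero : GoodOp S 0 0 := ⟨IsAdj.zero, Bdd.zero, Bdd.zero, by simpa using Bdd.zero⟩

theorem add (h : GoodOp S Q Q') (h' : GoodOp S P P') : GoodOp S (Q + P) (Q' + P') :=
  ⟨h.adj.add h'.adj, h.bdd.add h'.bdd, h.bdd'.add h'.bdd', by
    have := h.comm.add h'.comm
    convert this using 1
    rw [mul_add, add_mul]; abel⟩

theorem smul (c : ℝ) (h : GoodOp S Q Q') : GoodOp S (c • Q) (c • Q') :=
  ⟨h.adj.smul c, h.bdd.smul c, h.bdd'.smul c, by
    have := h.comm.smul c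
    convert this using 1
    rw [mul_smul_comm, smul_mul_assoc, smul_sub]⟩

theorem mul (h : GoodOp S Q Q') (h' : GoodOp S P P') : GoodOp S (Q * P) (P' * Q') :=
  ⟨h.adj.mul h'.adj, h.bdd.mul h'.bdd, h'.bdd'.mul h.bdd', by
    have := (h.comm.mul h'.bdd).add (h.bdd.mul h'.comm)
    convert this using 1
    noncomm_ring⟩

end GoodOp

variable {S : Module.End ℝ H}

/-- The doubled operator `S ⊕ -S`. -/
def gradOp (S : Module.End ℝ H) : Module.End ℝ (Dbl H) := bmat S 0 0 (-S)

theorem inner_gradOp_couple (hS : IsSkew S) {Q Q' : Module.End ℝ H} (h : IsAdj Q Q') (v : Dbl H) :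
    ⟪gradOp S v, couple Q Q' v⟫ = ⟪v.snd, (S * Q - Q * S) v.fst⟫ := by
  simp only [gradOp, couple, Dbl.inner_def, bmat_fst, bmat_snd, LinearMap.zero_apply, zero_add,
    add_zero, LinearMap.neg_apply, inner_neg_left, inner_neg_right, LinearMap.sub_apply,
    Module.End.mul_apply, inner_sub_right]
  rw [← h, hS.inner v.snd, real_inner_comm v.snd]
  ring

theorem norm_sq_ge_of_large (hS : IsSkew S) {Q Q' : Module.End ℝ H} (h : IsAdj Q Q') {c C l : ℝ}
    (hc : 0 ≤ c) (hl : 0 ≤ l) (hQ : BddBelow' c Q) (hQ' : BddBelow' c Q')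
    (hC : ∀ v, ‖(S * Q - Q * S) v‖ ≤ C * ‖v‖) (hC0 : 0 ≤ C) (v : Dbl H) :
    (l ^ 2 * c ^ 2 - 2 * l * C) * ‖v‖ ^ 2 ≤ ‖(gradOp S + l • couple Q Q') v‖ ^ 2 := by
  rw [LinearMap.add_apply, LinearMap.smul_apply, norm_add_sq_real, real_inner_smul_right,
    inner_gradOp_couple hS h, norm_smul, mul_pow, Real.norm_of_nonneg hl]
  have h1 : c ^ 2 * ‖v‖ ^ 2 ≤ ‖couple Q Q' v‖ ^ 2 := by
    rw [Dbl.norm_sq, Dbl.norm_sq]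
    simp only [couple, bmat_fst, bmat_snd, LinearMap.zero_apply, zero_add, add_zero,
      LinearMap.neg_apply, norm_neg]
    have e1 := pow_le_pow_left₀ (by positivity) (hQ v.fst) 2
    have e2 := pow_le_pow_left₀ (by positivity) (hQ' v.snd) 2
    rw [mul_pow] at e1 e2
    linarith
  have h2 : -(C * ‖v‖ ^ 2) ≤ ⟪v.snd, (S * Q - Q * S) v.fst⟫ := by
    have e1 := neg_le_of_abs_le (abs_real_inner_le_norm v.snd ((S * Q - Q * S) v.fst))
    have e2 : ‖v.snd‖ * ‖(S * Q - Q * S) v.fst‖ ≤ ‖v‖ * (C * ‖v‖) := by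
      gcongr
      · exact v.norm_snd_le
      · exact (hC _).trans (by gcongr; exact v.norm_fst_le)
    nlinarith
  have h3 : l * -(C * ‖v‖ ^ 2) ≤ l * ⟪v.snd, (S * Q - Q * S) v.fst⟫ := by gcongr
  have h4 : l ^ 2 * (c ^ 2 * ‖v‖ ^ 2) ≤ l ^ 2 * ‖couple Q Q' v‖ ^ 2 := by gcongr
  nlinarith [sq_nonneg ‖gradOp S v‖]

/-- Uniform gaps for large coupling. -/
theorem eventually_gap (hS : IsSkew S) {Q₀ Q₀' Q₁ Q₁' : Module.End ℝ H} (h₀ : GoodOp S Q₀ Q₀')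
    (h₁ : GoodOp S Q₁ Q₁') {W₀ W₁ : Module.End ℝ (Dbl H)} (hW₀ : Bdd W₀) (hW₁ : Bdd W₁)
    {c : ℝ} (hc : 0 < c)
    (hb : ∀ t ∈ Icc (0 : ℝ) 1, BddBelow' c ((1 - t) • Q₀ + t • Q₁))
    (hb' : ∀ t ∈ Icc (0 : ℝ) 1, BddBelow' c ((1 - t) • Q₀' + t • Q₁')) :
    ∀ᶠ l : ℝ in Filter.atTop, ∀ t ∈ Icc (0 : ℝ) 1, BddBelow' 1
      (gradOp S + ((1 - t) • (l • couple Q₀ Q₀' + W₀) + t • (l • couple Q₁ Q₁' + W₁))) := by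
  obtain ⟨w, hw, hwb⟩ := hW₀.of_bounds_family hW₁
  obtain ⟨C, hC, hCb⟩ := h₀.comm.of_bounds_family h₁.comm
  filter_upwards [Filter.eventually_ge_atTop (max 1 ((2 * C + (w + 1) ^ 2) / c ^ 2))] with l hl
  intro t ht v
  have hl1 : 1 ≤ l := (le_max_left _ _).trans hl
  have hl2 : (2 * C + (w + 1) ^ 2) / c ^ 2 ≤ l := (le_max_right _ _).trans hl
  rw [div_le_iff₀ (by positivity)] at hl2
  have e : gradOp S + ((1 - t) • (l • couple Q₀ Q₀' + W₀) + t • (l • couple Q₁ Q₁' + W₁)) =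
      (gradOp S + l • couple ((1 - t) • Q₀ + t • Q₁) ((1 - t) • Q₀' + t • Q₁')) +
        ((1 - t) • W₀ + t • W₁) := by
    have : couple ((1 - t) • Q₀ + t • Q₁) ((1 - t) • Q₀' + t • Q₁') =
        (1 - t) • couple Q₀ Q₀' + t • couple Q₁ Q₁' := by
      simp only [couple, bmat_smul, bmat_add, smul_zero, add_zero, smul_neg, neg_add]
    rw [this, smul_add, smul_add, smul_add, smul_comm l, smul_comm l]; abel
  have hcomm : ∀ v, ‖(S * ((1 - t) • Q₀ + t • Q₁) - ((1 - t) • Q₀ + t • Q₁) * S) v‖ ≤ C * ‖v‖ := by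
    intro v
    convert hCb t ht v using 3
    simp only [mul_add, add_mul, mul_smul_comm, smul_mul_assoc, smul_sub]; abel
  have key := norm_sq_ge_of_large hS ((h₀.smul (1 - t)).add (h₁.smul t)).adj hc.le
    (by linarith : 0 ≤ l) (hb t ht) (hb' t ht) hcomm hC.le v
  have h5 : (w + 1) * ‖v‖ ≤
      ‖(gradOp S + l • couple ((1 - t) • Q₀ + t • Q₁) ((1 - t) • Q₀' + t • Q₁')) v‖ := by
    rw [← sq_le_sq₀ (by positivity) (norm_nonneg _), mul_pow]
    refine le_trans ?_ key
    gcongr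
    nlinarith [mul_le_mul_of_nonneg_left hl2 (by linarith : (0:ℝ) ≤ l),
      mul_nonneg (sub_nonneg.2 hl1) (sq_nonneg (w + 1))]
  rw [e, LinearMap.add_apply]
  have h6 := hwb t ht v
  have h7 := norm_sub_le_norm_add
    ((gradOp S + l • couple ((1 - t) • Q₀ + t • Q₁) ((1 - t) • Q₀' + t • Q₁')) v)
    (((1 - t) • W₀ + t • W₁) v)
  linarith

variable (SF : SpecFilt (gradOp S))

/-- Equivalence of couplings. -/
def QRel (Q Q' P P' : Module.End ℝ H) : Prop :=
  ∀ᶠ l : ℝ in Filter.atTop, SF.Rel (l • couple Q Q') (l • couple P P')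

variable {SF}

theorem QRel.symm {Q Q' P P' : Module.End ℝ H} (h : QRel SF Q Q' P P') : QRel SF P P' Q Q' :=
  Filter.Eventually.mono h fun _ h => h.symm

theorem QRel.trans {Q Q' P P' R R' : Module.End ℝ H} (h : QRel SF Q Q' P P')
    (h' : QRel SF P P' R R') : QRel SF Q Q' R R' := by
  filter_upwards [h, h'] with N h h' using h.trans h'

theorem eventually_rel (hS : IsSkew S) {Q₀ Q₀' Q₁ Q₁' : Module.End ℝ H} (h₀ : GoodOp S Q₀ Q₀')
    (h₁ : GoodOp S Q₁ Q₁') {W₀ W₁ : Module.End ℝ (Dbl H)} (hW₀ : Bdd W₀) (hW₁ : Bdd W₁)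
    (hs₀ : IsSkew W₀) (hs₁ : IsSkew W₁) {c : ℝ} (hc : 0 < c)
    (hb : ∀ t ∈ Icc (0 : ℝ) 1, BddBelow' c ((1 - t) • Q₀ + t • Q₁))
    (hb' : ∀ t ∈ Icc (0 : ℝ) 1, BddBelow' c ((1 - t) • Q₀' + t • Q₁')) :
    ∀ᶠ l : ℝ in Filter.atTop, SF.Rel (l • couple Q₀ Q₀' + W₀) (l • couple Q₁ Q₁' + W₁) := by
  filter_upwards [eventually_gap hS h₀ h₁ hW₀ hW₁ hc hb hb'] with l hl
  exact SF.rel_of_segment (((isSkew_couple h₀.adj).smul l).add hs₀)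
    (((isSkew_couple h₁.adj).smul l).add hs₁) (((bdd_couple h₀.bdd h₀.bdd').smul l).add hW₀)
    (((bdd_couple h₁.bdd h₁.bdd').smul l).add hW₁) one_pos hl

theorem QRel.of_segment (hS : IsSkew S) {Q₀ Q₀' Q₁ Q₁' : Module.End ℝ H} (h₀ : GoodOp S Q₀ Q₀')
    (h₁ : GoodOp S Q₁ Q₁') {c : ℝ} (hc : 0 < c)
    (hb : ∀ t ∈ Icc (0 : ℝ) 1, BddBelow' c ((1 - t) • Q₀ + t • Q₁))
    (hb' : ∀ t ∈ Icc (0 : ℝ) 1, BddBelow' c ((1 - t) • Q₀' + t • Q₁')) :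
    QRel SF Q₀ Q₀' Q₁ Q₁' := by
  have := eventually_rel (SF := SF) hS h₀ h₁ Bdd.zero Bdd.zero IsSkew.zero
    IsSkew.zero hc hb hb'
  unfold QRel
  simpa only [add_zero] using this

theorem eventually_rel_add (hS : IsSkew S) {Q Q' : Module.End ℝ H} (h : GoodOp S Q Q')
    {W : Module.End ℝ (Dbl H)} (hW : Bdd W) (hs : IsSkew W) {c : ℝ} (hc : 0 < c)
    (hb : BddBelow' c Q) (hb' : BddBelow' c Q') :
    ∀ᶠ l : ℝ in Filter.atTop, SF.Rel (l • couple Q Q') (l • couple Q Q' + W) := by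
  have e : ∀ (t : ℝ) (P : Module.End ℝ H), (1 - t) • P + t • P = P := fun t P => by module
  have := eventually_rel (SF := SF) hS h h Bdd.zero hW IsSkew.zero hs hc
    (fun t _ => by rwa [e]) (fun t _ => by rwa [e])
  simpa only [add_zero] using this

end Coupling

section DoubledFiltration

variable {H : Type*} [NormedAddCommGroup H] [InnerProductSpace ℝ H]

def dblSub (V : Submodule ℝ H) : Submodule ℝ (Dbl H) where
  carrier := {v | v.fst ∈ V ∧ v.snd ∈ V}
  add_mem' := fun h h' => ⟨add_mem h.1 h'.1, add_mem h.2 h'.2⟩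
  zero_mem' := ⟨zero_mem _, zero_mem _⟩
  smul_mem' := fun c _ h => ⟨Submodule.smul_mem _ c h.1, Submodule.smul_mem _ c h.2⟩

instance (V : Submodule ℝ H) [FiniteDimensional ℝ V] : FiniteDimensional ℝ (dblSub V) := by
  let f : dblSub V →ₗ[ℝ] V × V :=
    { toFun := fun v => (⟨v.1.fst, v.2.1⟩, ⟨v.1.snd, v.2.2⟩)
      map_add' := fun _ _ => rfl
      map_smul' := fun _ _ => rfl }
  refine FiniteDimensional.of_injective f fun u v h => ?_
  have h1 := congrArg (fun z : V × V => (z.1 : H)) h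
  have h2 := congrArg (fun z : V × V => (z.2 : H)) h
  exact Subtype.ext (Dbl.ext' h1 h2)

theorem dblSub_mono {V W : Submodule ℝ H} (h : V ≤ W) : dblSub V ≤ dblSub W :=
  fun _ hv => ⟨h hv.1, h hv.2⟩

theorem bmat_mem_dblSub {V : Submodule ℝ H} {A B C E : Module.End ℝ H} (hA : ∀ v ∈ V, A v ∈ V)
    (hB : ∀ v ∈ V, B v ∈ V) (hC : ∀ v ∈ V, C v ∈ V) (hE : ∀ v ∈ V, E v ∈ V) :
    ∀ v ∈ dblSub V, bmat A B C E v ∈ dblSub V := fun _ hv =>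
  ⟨add_mem (hA _ hv.1) (hB _ hv.2), add_mem (hC _ hv.1) (hE _ hv.2)⟩

theorem orth_dblSub {V : Submodule ℝ H} {w : Dbl H} (h : ∀ e ∈ dblSub V, ⟪e, w⟫ = 0) :
    (∀ e ∈ V, ⟪e, w.fst⟫ = 0) ∧ ∀ e ∈ V, ⟪e, w.snd⟫ = 0 := by
  constructor
  · intro e he
    simpa [Dbl.inner_def] using h (Dbl.mk e 0) ⟨he, zero_mem _⟩
  · intro e he
    simpa [Dbl.inner_def] using h (Dbl.mk 0 e) ⟨zero_mem _, he⟩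

theorem norm_sq_diag (A E : Module.End ℝ H) (v : Dbl H) :
    ‖bmat A 0 0 E v‖ ^ 2 = ‖A v.fst‖ ^ 2 + ‖E v.snd‖ ^ 2 := by
  simp [Dbl.norm_sq]

theorem isAdj_dia {A A' : Module.End ℝ H} (h : IsAdj A A') : IsAdj (dia A) (dia A') :=
  isAdj_bmat h IsAdj.zero IsAdj.zero h

/-- Doubling a discrete skew operator. -/
def SpecFilt.double {A E : Module.End ℝ H} (SA : SpecFilt A) (SE : SpecFilt E)
    (h : SE.F = SA.F) : SpecFilt (bmat A 0 0 E) where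
  F N := dblSub (SA.F N)
  fin N := by have := SA.fin N; infer_instance
  mono := fun _ _ h => dblSub_mono (SA.mono h)
  exh v := by
    obtain ⟨N, hN⟩ := SA.exh v.fst
    obtain ⟨M, hM⟩ := SA.exh v.snd
    exact ⟨max N M, SA.mono (le_max_left _ _) hN, SA.mono (le_max_right _ _) hM⟩
  skew := by
    simpa using isSkew_bmat SA.skew (IsAdj.zero (H := H)) SE.skew
  inv N := bmat_mem_dblSub (SA.inv N) (by simp) (by simp) (by rw [← h]; exact SE.inv N)
  gap N w hw := by
    obtain ⟨h1, h2⟩ := orth_dblSub hw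
    rw [← sq_le_sq₀ (by positivity) (norm_nonneg _), norm_sq_diag, mul_pow, Dbl.norm_sq]
    have e1 := pow_le_pow_left₀ (by positivity) (SA.gap N _ h1) 2
    rw [← h] at h2
    have e2 := pow_le_pow_left₀ (by positivity) (SE.gap N _ h2) 2
    rw [mul_pow] at e1 e2
    linarith

def SpecFilt.neg {A : Module.End ℝ H} (SA : SpecFilt A) : SpecFilt (-A) where
  F := SA.F
  fin := SA.fin
  mono := SA.mono
  exh := SA.exh
  skew := SA.skew.neg
  inv N v hv := neg_mem (SA.inv N v hv)
  gap N w hw := by simpa using SA.gap N w hw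

end DoubledFiltration

section Dirac

variable {Y : Type*} [NormedAddCommGroup Y] [InnerProductSpace ℝ Y]

/-- The Dirac-type operator assembled from `b`, `a` (skew) and `D` (symmetric). -/
def dirac (b a D : Module.End ℝ Y) : Module.End ℝ (Dbl Y) := bmat b (a - D) (a + D) (-b)

/-- Commuting operators, `a`, `b` skew and `D` symmetric. -/
structure DiracData (b a D : Module.End ℝ Y) : Prop where
  skew_b : IsSkew b
  skew_a : IsSkew a
  symm_D : IsAdj D D
  comm_ba : Commute b a
  comm_bD : Commute b D
  comm_aD : Commute a D

variable {b a D : Module.End ℝ Y}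

theorem dirac_skew (hb : IsSkew b) (ha : IsSkew a) (hD : IsAdj D D) : IsSkew (dirac b a D) := by
  have h : IsAdj (a - D) (-a - D) := IsAdj.sub ha hD
  have := isSkew_bmat hb h hb.neg
  rwa [neg_sub, sub_neg_eq_add, add_comm] at this

theorem DiracData.skew (h : DiracData b a D) : IsSkew (dirac b a D) :=
  dirac_skew h.skew_b h.skew_a h.symm_D

theorem dirac_split (b a D : Module.End ℝ Y) :
    dirac b a D = dirac b 0 0 + (dirac 0 a 0 + dirac 0 0 D) := by
  simp only [dirac, bmat_add]
  congr 1 <;> simp [sub_eq_add_neg]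

theorem DiracData.norm_sq (h : DiracData b a D) (v : Dbl Y) : ‖dirac b a D v‖ ^ 2 =
    (‖b v.fst‖ ^ 2 + ‖a v.fst‖ ^ 2 + ‖D v.fst‖ ^ 2) +
    (‖b v.snd‖ ^ 2 + ‖a v.snd‖ ^ 2 + ‖D v.snd‖ ^ 2) := by
  have s1 := dirac_skew h.skew_b IsSkew.zero IsAdj.zero
  have s2 := dirac_skew IsSkew.zero h.skew_a IsAdj.zero
  have s3 := dirac_skew IsSkew.zero IsSkew.zero h.symm_D
  have a1 : dirac b 0 0 * (dirac 0 a 0 + dirac 0 0 D) + (dirac 0 a 0 + dirac 0 0 D) * dirac b 0 0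
      = 0 := by
    have e1 := h.comm_ba.eq
    have e2 := h.comm_bD.eq
    simp only [dirac, bmat_add, bmat_mul, ← bmat_zero]
    congr 1 <;> simp [mul_add, add_mul, e1, e2] <;> abel
  have a2 : dirac 0 a 0 * dirac 0 0 D + dirac 0 0 D * dirac 0 a 0 = 0 := by
    have e1 := h.comm_aD.eq
    simp only [dirac, bmat_add, bmat_mul, ← bmat_zero]
    congr 1 <;> simp [e1]
  rw [dirac_split, norm_sq_add_of_anticomm s1 (s2.add s3) a1, norm_sq_add_of_anticomm s2 s3 a2]
  simp only [dirac, Dbl.norm_sq]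
  simp
  ring

/-- The filtration of the assembled operator. -/
def DiracData.specFilt (h : DiracData b a D) (F : ℕ → Submodule ℝ Y)
    (fin : ∀ N, FiniteDimensional ℝ (F N)) (mono : Monotone F) (exh : ∀ v, ∃ N, v ∈ F N)
    (invb : ∀ N, ∀ v ∈ F N, b v ∈ F N) (inva : ∀ N, ∀ v ∈ F N, a v ∈ F N)
    (invD : ∀ N, ∀ v ∈ F N, D v ∈ F N)
    (gap : ∀ N w, (∀ e ∈ F N, ⟪e, w⟫ = 0) →
      (N + 1 : ℝ) ^ 2 * ‖w‖ ^ 2 ≤ ‖b w‖ ^ 2 + ‖a w‖ ^ 2 + ‖D w‖ ^ 2) :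
    SpecFilt (dirac b a D) where
  F N := dblSub (F N)
  fin N := by have := fin N; infer_instance
  mono := fun _ _ h => dblSub_mono (mono h)
  exh v := by
    obtain ⟨N, hN⟩ := exh v.fst
    obtain ⟨M, hM⟩ := exh v.snd
    exact ⟨max N M, mono (le_max_left _ _) hN, mono (le_max_right _ _) hM⟩
  skew := h.skew
  inv N := bmat_mem_dblSub (invb N) (fun v hv => sub_mem (inva N v hv) (invD N v hv))
    (fun v hv => add_mem (inva N v hv) (invD N v hv)) (fun v hv => neg_mem (invb N v hv))
  gap N w hw := by
    obtain ⟨h1, h2⟩ := orth_dblSub hw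
    rw [← sq_le_sq₀ (by positivity) (norm_nonneg _), h.norm_sq, mul_pow, Dbl.norm_sq]
    have := gap N _ h1
    have := gap N _ h2
    linarith

/-- The gap of `dirac` coupled by an operator commuting with one of the skew constituents. -/
theorem DiracData.couple_gap_b (h : DiracData b a D) {P P' : Module.End ℝ Y} (hP : IsAdj P P')
    (hc : Commute b P) (hc' : Commute b P') {g : ℝ} (hg : 0 ≤ g) (hb : BddBelow' g b) :
    BddBelow' g (gradOp (dirac b a D) + couple (dia P) (dia P')) := by
  intro v
  have e : gradOp (dirac b a D) + couple (dia P) (dia P') = gradOp (dirac b 0 0) +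
      (gradOp (dirac 0 a D) + couple (dia P) (dia P')) := by
    rw [← add_assoc]
    congr 1
    simp only [gradOp, dirac, bmat_add, bmat_neg]
    congr 2 <;> simp [sub_eq_add_neg]
  have sk : ∀ {A : Module.End ℝ (Dbl Y)}, IsSkew A → IsSkew (gradOp A) := fun hA => by
    simpa [gradOp] using isSkew_bmat hA (IsAdj.zero (H := Dbl Y)) hA.neg
  have anti : gradOp (dirac b 0 0) * (gradOp (dirac 0 a D) + couple (dia P) (dia P')) +
      (gradOp (dirac 0 a D) + couple (dia P) (dia P')) * gradOp (dirac b 0 0) = 0 := by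
    have e1 := h.comm_ba.eq
    have e2 := h.comm_bD.eq
    have e3 := hc.eq
    have e4 := hc'.eq
    simp only [gradOp, couple, dia, dirac, bmat_neg, ← bmat_zero, bmat_add, bmat_mul]
    congr 2 <;> simp [mul_add, add_mul, mul_sub, sub_mul, e1, e2, e3, e4] <;> abel
  rw [e, ← sq_le_sq₀ (by positivity) (norm_nonneg _),
    norm_sq_add_of_anticomm (sk (dirac_skew h.skew_b IsSkew.zero IsAdj.zero))
    ((sk (dirac_skew IsSkew.zero h.skew_a h.symm_D)).add
      (isSkew_couple (isAdj_dia hP))) anti]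
  refine le_trans ?_ (le_add_of_nonneg_right (sq_nonneg _))
  have hb' : ∀ w : Y, g ^ 2 * ‖w‖ ^ 2 ≤ ‖b w‖ ^ 2 := fun w => by
    rw [← mul_pow]; exact pow_le_pow_left₀ (by positivity) (hb w) 2
  simp only [gradOp, dirac, Dbl.norm_sq, mul_pow]
  simp
  have := hb' v.fst.fst
  have := hb' v.fst.snd
  have := hb' v.snd.fst
  have := hb' v.snd.snd
  linarith

theorem DiracData.couple_gap_a (h : DiracData b a D) {P P' : Module.End ℝ Y} (hP : IsAdj P P')
    (hc : Commute a P) (hc' : Commute a P') {g : ℝ} (hg : 0 ≤ g) (hb : BddBelow' g a) :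
    BddBelow' g (gradOp (dirac b a D) + couple (dia P) (dia P')) := by
  intro v
  have e : gradOp (dirac b a D) + couple (dia P) (dia P') = gradOp (dirac 0 a 0) +
      (gradOp (dirac b 0 D) + couple (dia P) (dia P')) := by
    rw [← add_assoc]
    congr 1
    simp only [gradOp, dirac, bmat_add, bmat_neg]
    congr 2 <;> simp [sub_eq_add_neg, add_comm]
  have sk : ∀ {A : Module.End ℝ (Dbl Y)}, IsSkew A → IsSkew (gradOp A) := fun hA => by
    simpa [gradOp] using isSkew_bmat hA (IsAdj.zero (H := Dbl Y)) hA.neg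
  have anti : gradOp (dirac 0 a 0) * (gradOp (dirac b 0 D) + couple (dia P) (dia P')) +
      (gradOp (dirac b 0 D) + couple (dia P) (dia P')) * gradOp (dirac 0 a 0) = 0 := by
    have e1 := h.comm_ba.eq
    have e2 := h.comm_aD.eq
    have e3 := hc.eq
    have e4 := hc'.eq
    simp only [gradOp, couple, dia, dirac, bmat_neg, ← bmat_zero, bmat_add, bmat_mul]
    congr 2 <;> simp [e1, e2, e3, e4]
  rw [e, ← sq_le_sq₀ (by positivity) (norm_nonneg _),
    norm_sq_add_of_anticomm (sk (dirac_skew IsSkew.zero h.skew_a IsAdj.zero))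
    ((sk (dirac_skew h.skew_b IsSkew.zero h.symm_D)).add
      (isSkew_couple (isAdj_dia hP))) anti]
  refine le_trans ?_ (le_add_of_nonneg_right (sq_nonneg _))
  have hb' : ∀ w : Y, g ^ 2 * ‖w‖ ^ 2 ≤ ‖a w‖ ^ 2 := fun w => by
    rw [← mul_pow]; exact pow_le_pow_left₀ (by positivity) (hb w) 2
  simp only [gradOp, dirac, Dbl.norm_sq, mul_pow]
  simp
  have := hb' v.fst.fst
  have := hb' v.fst.snd
  have := hb' v.snd.fst
  have := hb' v.snd.snd
  linarith

end Dirac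

section Blocks

variable {U : Type*} [NormedAddCommGroup U] [InnerProductSpace ℝ U]

theorem BddBelow'.mul {c d : ℝ} {A B : Module.End ℝ U} (hc : 0 ≤ c) (h : BddBelow' c A)
    (h' : BddBelow' d B) : BddBelow' (c * d) (A * B) := fun v => by
  rw [mul_assoc, Module.End.mul_apply]
  exact (mul_le_mul_of_nonneg_left (h' v) hc).trans (h _)

theorem BddBelow'.one : BddBelow' 1 (1 : Module.End ℝ U) := fun v => by simp

theorem BddBelow'.mono {c d : ℝ} {A : Module.End ℝ U} (h : BddBelow' c A) (hd : d ≤ c) :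
    BddBelow' d A := fun v => (mul_le_mul_of_nonneg_right hd (norm_nonneg v)).trans (h v)

theorem BddBelow'.diag {c : ℝ} {A E : Module.End ℝ U} (hc : 0 ≤ c) (h : BddBelow' c A)
    (h' : BddBelow' c E) : BddBelow' c (bmat A 0 0 E) := fun v => by
  rw [← sq_le_sq₀ (by positivity) (norm_nonneg _), norm_sq_diag, mul_pow, Dbl.norm_sq]
  have e1 := pow_le_pow_left₀ (by positivity) (h v.fst) 2
  have e2 := pow_le_pow_left₀ (by positivity) (h' v.snd) 2
  rw [mul_pow] at e1 e2
  linarith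

/-- Good operators bounded below together with their adjoints. -/
structure GoodInv (S Q Q' : Module.End ℝ U) : Prop extends GoodOp S Q Q' where
  below : ∃ c > 0, BddBelow' c Q ∧ BddBelow' c Q'

theorem GoodInv.one {S : Module.End ℝ U} : GoodInv S 1 1 :=
  ⟨GoodOp.one, 1, one_pos, BddBelow'.one, BddBelow'.one⟩

theorem GoodOp.blk {S P P' R R' : Module.End ℝ U} (h : GoodOp S P P') (h' : GoodOp S R R') :
    GoodOp (dia S) (bmat P 0 0 R) (bmat P' 0 0 R') where
  adj := isAdj_bmat h.adj IsAdj.zero IsAdj.zero h'.adj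
  bdd := bdd_bmat h.bdd Bdd.zero Bdd.zero h'.bdd
  bdd' := bdd_bmat h.bdd' Bdd.zero Bdd.zero h'.bdd'
  comm := by
    have := bdd_bmat h.comm Bdd.zero Bdd.zero h'.comm
    convert this using 1
    simp [dia, bmat_mul, bmat_sub]

theorem GoodInv.blk {S P P' R R' : Module.End ℝ U} (h : GoodInv S P P') (h' : GoodInv S R R') :
    GoodInv (dia S) (bmat P 0 0 R) (bmat P' 0 0 R') := by
  obtain ⟨c, hc, h1, h2⟩ := h.below
  obtain ⟨d, hd, h3, h4⟩ := h'.below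
  have hm : 0 < min c d := lt_min hc hd
  refine ⟨h.toGoodOp.blk h'.toGoodOp, min c d, hm, ?_, ?_⟩
  · exact BddBelow'.diag hm.le (h1.mono (min_le_left _ _)) (h3.mono (min_le_right _ _))
  · exact BddBelow'.diag hm.le (h2.mono (min_le_left _ _)) (h4.mono (min_le_right _ _))

theorem isSkew_dia {S : Module.End ℝ U} (hS : IsSkew S) : IsSkew (dia S) := by
  have := isSkew_bmat hS (IsAdj.zero (H := U)) hS
  rwa [neg_zero] at this

/-- Quarter turn exchanging the two copies. -/
def turn (U : Type*) [NormedAddCommGroup U] [InnerProductSpace ℝ U] : Module.End ℝ (Dbl U) :=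
  bmat 0 (-1) 1 0

def turn' (U : Type*) [NormedAddCommGroup U] [InnerProductSpace ℝ U] : Module.End ℝ (Dbl U) :=
  bmat 0 1 (-1) 0

theorem norm_sq_turn (s t : ℝ) (v : Dbl U) :
    ‖(s • (1 : Module.End ℝ (Dbl U)) + t • turn U) v‖ ^ 2 = (s ^ 2 + t ^ 2) * ‖v‖ ^ 2 := by
  rw [Dbl.norm_sq, Dbl.norm_sq v]
  simp only [turn, LinearMap.add_apply, LinearMap.smul_apply, Module.End.one_apply, WithLp.add_fst,
    WithLp.add_snd, WithLp.smul_fst, WithLp.smul_snd, bmat_fst, bmat_snd, LinearMap.zero_apply,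
    LinearMap.neg_apply, zero_add, add_zero, norm_add_sq_real, real_inner_smul_left,
    real_inner_smul_right, norm_smul, smul_neg, inner_neg_right, norm_neg, mul_pow,
    Real.norm_eq_abs, sq_abs]
  rw [real_inner_comm]
  ring

theorem norm_sq_turn' (s t : ℝ) (v : Dbl U) :
    ‖(s • (1 : Module.End ℝ (Dbl U)) + t • turn' U) v‖ ^ 2 = (s ^ 2 + t ^ 2) * ‖v‖ ^ 2 := by
  have : turn' U = -turn U := by simp [turn, turn', bmat_neg]
  rw [this, smul_neg, ← neg_smul, norm_sq_turn, neg_sq]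

theorem half_bddBelow {A : Module.End ℝ (Dbl U)} {t : ℝ}
    (h : ∀ v, ‖A v‖ ^ 2 = ((1 - t) ^ 2 + t ^ 2) * ‖v‖ ^ 2) : BddBelow' (1 / 2) A := fun v => by
  rw [← sq_le_sq₀ (by positivity) (norm_nonneg _), h, mul_pow]
  gcongr
  nlinarith [sq_nonneg (2 * t - 1)]

variable {S : Module.End ℝ U} {SF : SpecFilt (gradOp (dia S))}

theorem goodOp_turn : GoodOp (dia S) (turn U) (turn' U) where
  adj := isAdj_bmat IsAdj.zero IsAdj.one.neg IsAdj.one IsAdj.zero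
  bdd := bdd_bmat Bdd.zero Bdd.one.neg Bdd.one Bdd.zero
  bdd' := bdd_bmat Bdd.zero Bdd.one Bdd.one.neg Bdd.zero
  comm := by
    convert Bdd.zero
    simp [dia, turn, bmat_mul]

theorem QRel.insert_turn (hS : IsSkew S) {Q Q' P P' : Module.End ℝ (Dbl U)}
    (h : GoodInv (dia S) Q Q') (h' : GoodInv (dia S) P P') :
    QRel SF (Q * P) (P' * Q') (Q * turn U * P) (P' * (turn' U * Q')) := by
  obtain ⟨c, hc, h1, h2⟩ := h.below
  obtain ⟨d, hd, h3, h4⟩ := h'.below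
  refine QRel.of_segment (isSkew_dia hS) (h.toGoodOp.mul h'.toGoodOp)
    ((h.toGoodOp.mul goodOp_turn).mul h'.toGoodOp) (c := c * (1 / 2) * d) (by positivity)
    (fun t _ => ?_) (fun t _ => ?_)
  · have : (1 - t) • (Q * P) + t • (Q * turn U * P) = Q * ((1 - t) • 1 + t • turn U) * P := by
      simp [mul_add, add_mul]
    rw [this]
    exact (h1.mul hc.le (half_bddBelow (norm_sq_turn _ _))).mul (by positivity) h3
  · have : (1 - t) • (P' * Q') + t • (P' * (turn' U * Q')) =
        P' * ((1 - t) • 1 + t • turn' U) * Q' := by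
      simp [mul_add, add_mul, mul_assoc]
    rw [this, show c * (1 / 2) * d = d * (1 / 2) * c by ring]
    exact (h4.mul hd.le (half_bddBelow (norm_sq_turn' _ _))).mul (by positivity) h2

variable {P P' R R' : Module.End ℝ U}

theorem QRel.turn_right (hS : IsSkew S) (hP : GoodInv S P P') (hR : GoodInv S R R') :
    QRel SF (bmat P 0 0 R) (bmat P' 0 0 R') (bmat 0 (-P) R 0) (bmat 0 R' (-P') 0) := by
  have := QRel.insert_turn (SF := SF) hS (hP.blk hR) GoodInv.one
  simpa [turn, turn', bmat_mul] using this

theorem QRel.turn_left (hS : IsSkew S) (hP : GoodInv S P P') (hR : GoodInv S R R') :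
    QRel SF (bmat R 0 0 P) (bmat R' 0 0 P') (bmat 0 (-P) R 0) (bmat 0 R' (-P') 0) := by
  have := QRel.insert_turn (SF := SF) hS GoodInv.one (hR.blk hP)
  simpa [turn, turn', bmat_mul] using this

theorem QRel.swap (hS : IsSkew S) (hP : GoodInv S P P') (hR : GoodInv S R R') :
    QRel SF (bmat P 0 0 R) (bmat P' 0 0 R') (bmat R 0 0 P) (bmat R' 0 0 P') :=
  (QRel.turn_right hS hP hR).trans (QRel.turn_left hS hP hR).symm

theorem QRel.split (hS : IsSkew S) (hP : GoodInv S P P') (hR : GoodInv S R R') :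
    QRel SF (bmat (P * R) 0 0 1) (bmat (R' * P') 0 0 1) (bmat P 0 0 R) (bmat P' 0 0 R') := by
  have := QRel.insert_turn (SF := SF) hS (hP.blk GoodInv.one) (hR.blk GoodInv.one)
  have e1 : bmat P 0 0 1 * bmat R 0 0 1 = bmat (P * R) 0 0 1 := by simp [bmat_mul]
  have e2 : bmat R' 0 0 1 * bmat P' 0 0 1 = bmat (R' * P') 0 0 1 := by simp [bmat_mul]
  have e3 : bmat P 0 0 1 * turn U * bmat R 0 0 1 = bmat 0 (-P) R 0 := by simp [turn, bmat_mul]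
  have e4 : bmat R' 0 0 1 * (turn' U * bmat P' 0 0 1) = bmat 0 R' (-P') 0 := by
    simp [turn', bmat_mul]
  rw [e1, e2, e3, e4] at this
  exact QRel.trans this (QRel.symm (QRel.turn_right hS hP hR))

/-- Two decoupled systems. -/
theorem bddBelow_two_systems {S₀ T₀ S₁ T₁ : Module.End ℝ U} {g : ℝ} (hg : 0 ≤ g)
    (h₀ : BddBelow' g (bmat S₀ (-P') P T₀)) (h₁ : BddBelow' g (bmat S₁ (-R') R T₁)) :
    BddBelow' g (bmat (bmat S₀ 0 0 S₁) (-bmat P' 0 0 R') (bmat P 0 0 R) (bmat T₀ 0 0 T₁)) := by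
  intro v
  have e0 := pow_le_pow_left₀ (by positivity) (h₀ (Dbl.mk v.fst.fst v.snd.fst)) 2
  have e1 := pow_le_pow_left₀ (by positivity) (h₁ (Dbl.mk v.fst.snd v.snd.snd)) 2
  rw [mul_pow, Dbl.norm_sq, Dbl.norm_sq] at e0 e1
  rw [← sq_le_sq₀ (by positivity) (norm_nonneg _), mul_pow]
  simp only [Dbl.norm_sq]
  simp only [bmat_fst, bmat_snd, Dbl.mk_fst, Dbl.mk_snd, bmat_neg, WithLp.add_fst, WithLp.add_snd,
    LinearMap.zero_apply, LinearMap.neg_apply, neg_zero, add_zero, zero_add] at e0 e1 ⊢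
  calc _ = g ^ 2 * (‖v.fst.fst‖ ^ 2 + ‖v.snd.fst‖ ^ 2) +
      g ^ 2 * (‖v.fst.snd‖ ^ 2 + ‖v.snd.snd‖ ^ 2) := by ring
    _ ≤ _ := add_le_add e0 e1
    _ = _ := by ring

theorem bddBelow_coupled {S₀ T₀ Q Q' : Module.End ℝ U} (hT : IsSkew T₀)
    (hQ : IsAdj Q Q') (hc : Q * S₀ = T₀ * Q) {g : ℝ} (hg : 0 ≤ g) (h : BddBelow' g S₀)
    (h' : BddBelow' g T₀) : BddBelow' g (bmat S₀ (-Q') Q (-T₀)) := by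
  intro v
  have hz : ⟪S₀ v.fst, Q' v.snd⟫ = ⟪Q v.fst, T₀ v.snd⟫ * (-1) := by
    have := LinearMap.congr_fun hc v.fst
    simp only [Module.End.mul_apply] at this
    rw [← hQ, this, hT.inner]; ring
  rw [← sq_le_sq₀ (by positivity) (norm_nonneg _), mul_pow, Dbl.norm_sq, Dbl.norm_sq]
  simp only [bmat_fst, bmat_snd, LinearMap.neg_apply, norm_add_sq_real, inner_neg_right, norm_neg]
  have e1 := pow_le_pow_left₀ (by positivity) (h v.fst) 2
  have e2 := pow_le_pow_left₀ (by positivity) (h' v.snd) 2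
  rw [mul_pow] at e1 e2
  nlinarith [sq_nonneg ‖Q' v.snd‖, sq_nonneg ‖Q v.fst‖]

/-- Removing a coupling from the first system, after the perturbation `S'` of `S` there. -/
theorem eventually_rel_remove (hS : IsSkew S) {S' : Module.End ℝ U} (hS' : IsSkew S')
    (hb : Bdd (S' - S)) (hP : GoodOp S P P') (hR : GoodInv S R R') {g : ℝ} (hg : 0 < g)
    (hgap : ∀ s : ℝ, BddBelow' g (gradOp S' + s • couple P P')) :
    ∀ᶠ l : ℝ in Filter.atTop, SF.Rel
      (l • couple (bmat P 0 0 R) (bmat P' 0 0 R') + gradOp (bmat (S' - S) 0 0 0))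
      (l • couple (bmat 0 0 0 R) (bmat 0 0 0 R') + gradOp (bmat (S' - S) 0 0 0)) := by
  obtain ⟨c, hc, h1, h2⟩ := hR.below
  have e : ∀ (t : ℝ) (P : Module.End ℝ U), (1 - t) • P + t • P = P := fun t P => by module
  have := eventually_gap hS hR.toGoodOp hR.toGoodOp Bdd.zero Bdd.zero hc
    (fun t _ => by rwa [e]) (fun t _ => by rwa [e])
  filter_upwards [this] with l hl
  have hl' : BddBelow' 1 (gradOp S + l • couple R R') := by
    simpa using hl 0 (by simp)
  have hM : Bdd (gradOp (bmat (S' - S) 0 0 0)) :=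
    bdd_bmat (bdd_bmat hb Bdd.zero Bdd.zero Bdd.zero) Bdd.zero Bdd.zero
      (bdd_bmat hb Bdd.zero Bdd.zero Bdd.zero).neg
  have hMs : IsSkew (gradOp (bmat (S' - S) 0 0 0)) := by
    have h0 : IsSkew (bmat (S' - S) 0 0 0) := by
      simpa using isSkew_bmat (hS'.sub hS) (IsAdj.zero (H := U)) IsSkew.zero
    simpa [gradOp] using isSkew_bmat h0 (IsAdj.zero (H := Dbl U)) h0.neg
  have hPR := hP.blk hR.toGoodOp
  have hZR := (GoodOp.zero (S := S)).blk hR.toGoodOp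
  refine SF.rel_of_segment (((isSkew_couple hPR.adj).smul l).add hMs)
    (((isSkew_couple hZR.adj).smul l).add hMs) (((bdd_couple hPR.bdd hPR.bdd').smul l).add hM)
    (((bdd_couple hZR.bdd hZR.bdd').smul l).add hM) (lt_min hg one_pos) (fun t _ => ?_)
  have key := bddBelow_two_systems (P := (((1 - t) * l) • P)) (P' := (((1 - t) * l) • P'))
    (R := l • R) (R' := l • R') (S₀ := S') (T₀ := -S') (S₁ := S) (T₁ := -S)
    (g := min g 1) (lt_min hg one_pos).le ?_ ?_
  · convert key using 1
    ext v : 1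
    apply Dbl.ext' <;> apply Dbl.ext' <;> simp [gradOp, couple, dia] <;> module
  · have := (hgap ((1 - t) * l)).mono (min_le_left g 1)
    simpa [gradOp, couple, bmat_smul, bmat_add] using this
  · have := hl'.mono (min_le_right g 1)
    simpa [gradOp, couple, bmat_smul, bmat_add] using this

/-- A coupling adapted to a bounded perturbation of `S` can be replaced by the identity. -/
theorem QRel.trivialize (hS : IsSkew S) {S' : Module.End ℝ U} (hS' : IsSkew S')
    (hb : Bdd (S' - S)) (hP : GoodInv S P P') (hR : GoodInv S R R') {g : ℝ} (hg : 0 < g)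
    (hgap : ∀ s : ℝ, BddBelow' g (gradOp S' + s • couple P P'))
    (hgap' : ∀ s : ℝ, BddBelow' g (gradOp S' + s • couple (1 : Module.End ℝ U) 1)) :
    QRel SF (bmat P 0 0 R) (bmat P' 0 0 R') (bmat 1 0 0 R) (bmat 1 0 0 R') := by
  have hM : Bdd (gradOp (bmat (S' - S) 0 0 0)) :=
    bdd_bmat (bdd_bmat hb Bdd.zero Bdd.zero Bdd.zero) Bdd.zero Bdd.zero
      (bdd_bmat hb Bdd.zero Bdd.zero Bdd.zero).neg
  have hMs : IsSkew (gradOp (bmat (S' - S) 0 0 0)) := by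
    have h0 : IsSkew (bmat (S' - S) 0 0 0) := by
      simpa using isSkew_bmat (hS'.sub hS) (IsAdj.zero (H := U)) IsSkew.zero
    simpa [gradOp] using isSkew_bmat h0 (IsAdj.zero (H := Dbl U)) h0.neg
  have add : ∀ {P P' : Module.End ℝ U}, GoodInv S P P' → ∀ᶠ l : ℝ in Filter.atTop, SF.Rel
      (l • couple (bmat P 0 0 R) (bmat P' 0 0 R'))
      (l • couple (bmat P 0 0 R) (bmat P' 0 0 R') + gradOp (bmat (S' - S) 0 0 0)) := by
    intro P P' hP
    obtain ⟨c, hc, h1, h2⟩ := (hP.blk hR).below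
    exact eventually_rel_add (isSkew_dia hS) (hP.blk hR).toGoodOp hM hMs hc h1 h2
  unfold QRel
  filter_upwards [add hP, add (GoodInv.one (S := S)),
    eventually_rel_remove (SF := SF) hS hS' hb hP.toGoodOp hR hg hgap,
    eventually_rel_remove (SF := SF) hS hS' hb GoodOp.one hR hg hgap'] with l h1 h2 h3 h4
  exact ((h1.trans h3).trans h4.symm).trans h2.symm

/-- Conclusion drawn from a coupling `P` intertwining `S` and `T`. -/
theorem rel_of_QRel_one (hS : IsSkew S) {T : Module.End ℝ U} (hT : IsSkew T) (hb : Bdd (S - T))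
    (hP : GoodInv S P P') (hc : P * S = T * P) {g : ℝ} (hg : 0 < g) (hSg : BddBelow' g S)
    (hTg : BddBelow' g T)
    (h : QRel SF (bmat 1 0 0 1) (bmat 1 0 0 1) (bmat 1 0 0 P) (bmat 1 0 0 P')) :
    SF.Rel 0 (bmat 0 0 0 (bmat 0 0 0 (S - T))) := by
  have h1P := (GoodInv.one (S := S)).blk hP
  have h11 := (GoodInv.one (S := S)).blk (GoodInv.one (S := S))
  set M : Module.End ℝ (Dbl (Dbl U)) := bmat 0 0 0 (bmat 0 0 0 (S - T))
  have hM : Bdd M := bdd_bmat Bdd.zero Bdd.zero Bdd.zero (bdd_bmat Bdd.zero Bdd.zero Bdd.zero hb)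
  have hMs : IsSkew M := by
    have h0 : IsSkew (bmat 0 0 0 (S - T)) := by
      simpa using isSkew_bmat IsSkew.zero (IsAdj.zero (H := U)) (hS.sub hT)
    simpa using isSkew_bmat IsSkew.zero (IsAdj.zero (H := Dbl U)) h0
  obtain ⟨c, hc0, hc1, hc2⟩ := h1P.below
  have key := h.and (eventually_rel_add (SF := SF) (isSkew_dia hS) h1P.toGoodOp hM hMs hc0 hc1 hc2)
  obtain ⟨l, hl1, hl2⟩ := key.exists
  have r1 : SF.Rel 0 (l • couple (bmat 1 0 0 1) (bmat 1 0 0 1)) := by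
    refine SF.rel_of_segment IsSkew.zero ((isSkew_couple h11.adj).smul l) Bdd.zero
      ((bdd_couple h11.bdd h11.bdd').smul l) hg (fun t _ => ?_)
    have := bddBelow_coupled hS ((IsAdj.one (H := U)).smul (t * l)) (by simp) hg.le hSg hSg
    have := bddBelow_two_systems hg.le this this
    convert this using 1
    ext v : 1
    apply Dbl.ext' <;> apply Dbl.ext' <;> simp [gradOp, couple, dia, smul_smul] <;>
      exact add_comm _ _
  have r2 : SF.Rel M (l • couple (bmat 1 0 0 P) (bmat 1 0 0 P') + M) := by
    refine SF.rel_of_segment hMs (((isSkew_couple h1P.adj).smul l).add hMs) hM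
      (((bdd_couple h1P.bdd h1P.bdd').smul l).add hM) hg (fun t _ => ?_)
    have k1 := bddBelow_coupled hS ((IsAdj.one (H := U)).smul (t * l)) (by simp) hg.le hSg hSg
    have k2 := bddBelow_coupled hT (hP.adj.smul (t * l)) (by simp [hc]) hg.le hSg hTg
    have := bddBelow_two_systems hg.le k1 k2
    convert this using 1
    ext v : 1
    apply Dbl.ext' <;> apply Dbl.ext' <;> simp [M, gradOp, couple, dia, smul_smul] <;> module
  exact ((r1.trans hl1).trans hl2).trans r2.symm

end Blocks

section RightTranslation

/-- The group element whose right translation multiplies the quaternion coordinate by `i`. -/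
def elemI : TorusQuat := (1, 1, quatExp 0 (Real.pi / 2))

theorem coe_elemI : (elemI.2.2 : ℍ[ℝ]) = qmk 0 1 0 0 := by
  change (quatExp 0 (Real.pi / 2) : ℍ[ℝ]) = _
  rw [coe_quatExp]
  ext <;> simp [imUnit]

theorem coordFun_mul_elemI (i : Fin 8) (g : TorusQuat) : coordFun i (g * elemI) =
    (![coord 0, coord 1, coord 2, coord 3, -coord 5, coord 4, coord 7, -coord 6] i : Pol) g := by
  have e1 : (g * elemI).1 = g.1 := mul_one _
  have e2 : (g * elemI).2.1 = g.2.1 := mul_one _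
  have e3 : ((g * elemI).2.2 : ℍ[ℝ]) = (g.2.2 : ℍ[ℝ]) * qmk 0 1 0 0 := by
    rw [← coe_elemI]; rfl
  have key : ∀ (p : ℂ) (q : ℂ) (r : ℍ[ℝ]), ((g * elemI).1 : ℂ) = p → ((g * elemI).2.1 : ℂ) = q →
      ((g * elemI).2.2 : ℍ[ℝ]) = r → coordFun i (g * elemI) =
        ![p.re, p.im, q.re, q.im, r.re, r.imI, r.imJ, r.imK] i := by
    rintro p q r rfl rfl rfl; fin_cases i <;> rfl
  rw [key _ _ _ (congrArg _ e1) (congrArg _ e2) e3]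
  fin_cases i <;> simp [coord_apply] <;> rfl

theorem exists_transI (f : Pol) : ∃ f' : Pol, ∀ g, f' g = f (g * elemI) := by
  refine Pol.induction (p := fun f => ∃ f' : Pol, ∀ g, f' g = f (g * elemI)) ?_ ?_ ?_ ?_ f
  · intro i; exact ⟨_, fun g => (coordFun_mul_elemI i g).symm⟩
  · intro c; exact ⟨algebraMap ℝ Pol c, fun g => rfl⟩
  · rintro f h ⟨f', hf⟩ ⟨h', hh⟩; exact ⟨f' + h', fun g => by simp [hf, hh]⟩
  · rintro f h ⟨f', hf⟩ ⟨h', hh⟩; exact ⟨f' * h', fun g => by simp [hf, hh]⟩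

/-- Right translation by `elemI`. -/
def transI : Pol →ₐ[ℝ] Pol where
  toFun f := (exists_transI f).choose
  map_one' := Pol.ext fun g => (exists_transI 1).choose_spec g
  map_mul' f h := Pol.ext fun g => by
    rw [Pol.mul_apply, (exists_transI (f * h)).choose_spec, (exists_transI f).choose_spec,
      (exists_transI h).choose_spec, Pol.mul_apply]
  map_zero' := Pol.ext fun g => (exists_transI 0).choose_spec g
  map_add' f h := Pol.ext fun g => by
    rw [Pol.add_apply, (exists_transI (f + h)).choose_spec, (exists_transI f).choose_spec,
      (exists_transI h).choose_spec, Pol.add_apply]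
  commutes' c := Pol.ext fun g => (exists_transI _).choose_spec g

theorem transI_apply (f : Pol) (g : TorusQuat) : transI f g = f (g * elemI) :=
  (exists_transI f).choose_spec g

theorem transI_coord (i : Fin 8) : transI (coord i) =
    ![coord 0, coord 1, coord 2, coord 3, -coord 5, coord 4, coord 7, -coord 6] i :=
  Pol.ext fun g => (transI_apply _ g).trans (coordFun_mul_elemI i g)

theorem mean_transI (f : Pol) : mean (transI f) = mean f := by
  have : (transI f : TorusQuat → ℝ) = fun g => f (g * elemI) := funext (transI_apply f)
  rw [this, mean_mul_right]

theorem inner_transI (f h : Pol) : ⟪transI f, transI h⟫ = ⟪f, h⟫ := by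
  rw [Pol.inner_def, Pol.inner_def, ← map_mul, mean_transI]

theorem PolFlow.deriv_transI (F : PolFlow) (f : Pol) : F.deriv (transI f) = transI (F.deriv f) :=
  F.derivFun_eq fun g => by
    rw [transI_apply]
    have := F.derivFun_spec f (g * elemI)
    simp only [transI_apply, mul_assoc]
    exact this

/-- The antipodal map in the quaternion variable. -/
def parity (f : Pol) : Pol := transI (transI f)

theorem parity_coord (i : Fin 8) : parity (coord i) =
    ![coord 0, coord 1, coord 2, coord 3, -coord 4, -coord 5, -coord 6, -coord 7] i := by
  fin_cases i <;> simp [parity, transI_coord]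

theorem parity_mul (f h : Pol) : parity (f * h) = parity f * parity h := by simp [parity]
theorem parity_add (f h : Pol) : parity (f + h) = parity f + parity h := by simp [parity]

theorem parity_parity (f : Pol) : parity (parity f) = f := by
  refine Pol.induction (p := fun f => parity (parity f) = f) ?_ ?_ ?_ ?_ f
  · intro i
    rw [parity_coord]
    fin_cases i <;> simp [parity, transI_coord]
  · intro c; simp [parity]
  · intro f h hf hh; rw [parity_add, parity_add, hf, hh]
  · intro f h hf hh; rw [parity_mul, parity_mul, hf, hh]

theorem inner_parity (f h : Pol) : ⟪parity f, h⟫ = ⟪f, parity h⟫ := by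
  conv_lhs => rw [← parity_parity h]
  simp only [parity, inner_transI]

theorem mem_one_mul {S : Submodule ℝ Pol} {c : ℝ} {y : Pol} (hy : y ∈ S) :
    algebraMap ℝ Pol c * y ∈ S := by
  rw [← Algebra.smul_def]; exact S.smul_mem c hy

theorem alg_fix_span {T : Pol →ₐ[ℝ] Pol} {k : ℕ} {x : Fin k → Pol} (h : ∀ i, T (x i) = x i) :
    ∀ f ∈ Submodule.span ℝ (insert 1 (range x)), T f = f := by
  intro f hf
  induction hf using Submodule.span_induction with
  | zero => simp
  | add a b _ _ ha hb => rw [map_add, ha, hb]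
  | smul c a _ ha => rw [map_smul, ha]
  | mem l hl =>
    rcases hl with rfl | ⟨i, rfl⟩
    · simp
    · exact h i

theorem alg_fix_mul {T : Pol →ₐ[ℝ] Pol} {S S' : Submodule ℝ Pol} (h : ∀ f ∈ S, T f = f)
    (h' : ∀ f ∈ S', T f = f) : ∀ f ∈ S * S', T f = f := by
  intro f hf
  induction hf using Submodule.mul_induction_on' with
  | mem_mul_mem m hm n hn => rw [map_mul, h m hm, h' n hn]
  | add a _ b _ ha hb => rw [map_add, ha, hb]

theorem alg_fix_pow {T : Pol →ₐ[ℝ] Pol} {S : Submodule ℝ Pol} (h : ∀ f ∈ S, T f = f) (p : ℕ) :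
    ∀ f ∈ S ^ p, T f = f := by
  induction p with
  | zero =>
    intro f hf
    rw [pow_zero] at hf
    obtain ⟨c, rfl⟩ := Submodule.mem_one.1 hf
    simp
  | succ p ih => rw [pow_succ]; exact alg_fix_mul ih h

theorem alg_mem_mul {T : Pol →ₐ[ℝ] Pol} {S S' : Submodule ℝ Pol} (h : ∀ f ∈ S, T f ∈ S)
    (h' : ∀ f ∈ S', T f ∈ S') : ∀ f ∈ S * S', T f ∈ S * S' := by
  intro f hf
  induction hf using Submodule.mul_induction_on' with
  | mem_mul_mem m hm n hn => rw [map_mul]; exact Submodule.mul_mem_mul (h m hm) (h' n hn)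
  | add a _ b _ ha hb => rw [map_add]; exact add_mem ha hb

theorem alg_mem_pow {T : Pol →ₐ[ℝ] Pol} {S : Submodule ℝ Pol} (h : ∀ f ∈ S, T f ∈ S) (p : ℕ) :
    ∀ f ∈ S ^ p, T f ∈ S ^ p := by
  induction p with
  | zero =>
    intro f hf
    rw [pow_zero] at hf ⊢
    obtain ⟨c, rfl⟩ := Submodule.mem_one.1 hf
    exact Submodule.mem_one.2 ⟨c, by simp⟩
  | succ p ih => rw [pow_succ]; exact alg_mem_mul ih h

theorem transI_factorθφ (p q : ℕ) : ∀ f ∈ factorθ.C ^ p * factorφ.C ^ q, transI f = f := by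
  refine alg_fix_mul (alg_fix_pow ?_ p) (alg_fix_pow ?_ q)
  · refine alg_fix_span fun i => ?_
    fin_cases i <;> simp [transI_coord]
  · refine alg_fix_span fun i => ?_
    fin_cases i <;> simp [transI_coord]

theorem transI_factorQ : ∀ f ∈ factorQ.C, transI f ∈ factorQ.C := by
  intro f hf
  change f ∈ Submodule.span ℝ _ at hf
  induction hf using Submodule.span_induction with
  | zero => rw [map_zero]; exact zero_mem _
  | add a b _ _ ha hb => rw [map_add]; exact add_mem ha hb
  | smul c a _ ha => rw [map_smul]; exact Submodule.smul_mem _ c ha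
  | mem l hl =>
    rcases hl with rfl | ⟨i, rfl⟩
    · rw [map_one]; exact factorQ.one_mem
    · have h0 := mem_factorQ 0
      have h1 := mem_factorQ 1
      have h2 := mem_factorQ 2
      have h3 := mem_factorQ 3
      fin_cases i
      · change transI (coord 4) ∈ factorQ.C
        rw [transI_coord]; exact neg_mem h1
      · change transI (coord 5) ∈ factorQ.C
        rw [transI_coord]; exact h0
      · change transI (coord 6) ∈ factorQ.C
        rw [transI_coord]; exact h3
      · change transI (coord 7) ∈ factorQ.C
        rw [transI_coord]; exact neg_mem h2

theorem transI_Fil (p q r : ℕ) : ∀ f ∈ Fil p q r, transI f ∈ Fil p q r := by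
  rw [Fil_eq_Q]
  exact alg_mem_mul (alg_mem_pow transI_factorQ r) fun f hf => by
    rwa [transI_factorθφ p q f hf]

theorem add_parity_factorQ : ∀ f ∈ factorQ.C, ∃ c : ℝ, f + parity f = algebraMap ℝ Pol c := by
  intro f hf
  change f ∈ Submodule.span ℝ _ at hf
  induction hf using Submodule.span_induction with
  | zero => exact ⟨0, by simp [parity]⟩
  | add a b _ _ ha hb =>
    obtain ⟨c, hc⟩ := ha
    obtain ⟨d, hd⟩ := hb
    exact ⟨c + d, by rw [map_add, ← hc, ← hd, parity_add]; abel⟩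
  | smul c a _ ha =>
    obtain ⟨d, hd⟩ := ha
    exact ⟨c * d, by
      rw [map_mul, ← hd, ← Algebra.smul_def, smul_add]
      simp [parity]⟩
  | mem l hl =>
    rcases hl with rfl | ⟨i, rfl⟩
    · exact ⟨2, by simp [parity, map_ofNat]; norm_num⟩
    · refine ⟨0, ?_⟩
      fin_cases i
      · change coord 4 + parity (coord 4) = _; rw [parity_coord]; simp
      · change coord 5 + parity (coord 5) = _; rw [parity_coord]; simp
      · change coord 6 + parity (coord 6) = _; rw [parity_coord]; simp
      · change coord 7 + parity (coord 7) = _; rw [parity_coord]; simp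

theorem add_parity_mem (p q : ℕ) : ∀ f ∈ Fil p q 1, f + parity f ∈ Fil p q 0 := by
  intro f hf
  rw [Fil_eq_Q, pow_one] at hf
  rw [Fil_eq_Q, pow_zero, one_mul]
  induction hf using Submodule.mul_induction_on' with
  | mem_mul_mem m hm n hn =>
    have hn' : parity n = n := by simp [parity, transI_factorθφ p q n hn]
    obtain ⟨c, hc⟩ := add_parity_factorQ m hm
    rw [parity_mul, hn', ← add_mul, hc]
    exact mem_one_mul hn
  | add a _ b _ ha hb =>
    rw [parity_add, add_add_add_comm]
    exact add_mem ha hb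

/-- Even polynomials orthogonal to the functions independent of the quaternion variable. -/
theorem even_lower {f : Pol} (he : parity f = f) {M : ℕ} (hf : f ∈ Fil M M M)
    (h : ∀ e ∈ Fil M M 0, ⟪e, f⟫ = 0) : 8 * ‖f‖ ^ 2 ≤ ⟪f, factorQ.T f⟫ := by
  have := lower_Q 1 M M M hf fun e he' => by
    have h1 := h _ (add_parity_mem M M e he')
    rw [inner_add_left, inner_parity, he] at h1
    linarith
  norm_num at this
  exact this

end RightTranslation

section QuaternionFields

/-- Quaternion-valued polynomial functions. -/
abbrev QPol := ℍ[Pol]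

def meanLM : Pol →ₗ[ℝ] ℝ where
  toFun f := mean f
  map_add' f h := mean_pol_add f h
  map_smul' c f := mean_pol_smul c f

theorem meanLM_apply (f : Pol) : meanLM f = mean f := rfl

theorem meanLM_mono {f h : Pol} (hh : ∀ g, f g ≤ h g) : meanLM f ≤ meanLM h :=
  mean_mono f.continuous h.continuous hh

theorem Pol.inner_eq (f h : Pol) : ⟪f, h⟫ = meanLM (f * h) := rfl

@[reducible] def qPolCore : InnerProductSpace.Core ℝ QPol where
  inner f h := meanLM (star f * h).re
  conj_inner_symm f h := by
    simp [mul_comm]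
  re_inner_nonneg f := by
    have h1 := real_inner_self_nonneg (x := f.re)
    have h2 := real_inner_self_nonneg (x := f.imI)
    have h3 := real_inner_self_nonneg (x := f.imJ)
    have h4 := real_inner_self_nonneg (x := f.imK)
    rw [Pol.inner_eq] at h1 h2 h3 h4
    simp
    linarith
  add_left f h k := by
    rw [star_add, add_mul, Quaternion.re_add, map_add]
  smul_left f h c := by
    have : star (c • f) * h = c • (star f * h) := by
      rw [← smul_mul_assoc]; congr 1; ext <;> simp
    change meanLM (star (c • f) * h).re = c * meanLM (star f * h).re
    rw [this, Quaternion.re_smul, map_smul, smul_eq_mul]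
  definite f h := by
    have h1 := real_inner_self_nonneg (x := f.re)
    have h2 := real_inner_self_nonneg (x := f.imI)
    have h3 := real_inner_self_nonneg (x := f.imJ)
    have h4 := real_inner_self_nonneg (x := f.imK)
    have e : ⟪f.re, f.re⟫ + ⟪f.imI, f.imI⟫ + ⟪f.imJ, f.imJ⟫ + ⟪f.imK, f.imK⟫ = 0 := by
      have h' : meanLM (star f * f).re = 0 := h
      simp only [Pol.inner_eq]
      rw [← h']
      simp
    ext1
    · exact inner_self_eq_zero (𝕜 := ℝ).1 (by linarith)
    · exact inner_self_eq_zero (𝕜 := ℝ).1 (by linarith)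
    · exact inner_self_eq_zero (𝕜 := ℝ).1 (by linarith)
    · exact inner_self_eq_zero (𝕜 := ℝ).1 (by linarith)

instance : NormedAddCommGroup QPol := qPolCore.toNormedAddCommGroup
instance : InnerProductSpace ℝ QPol := InnerProductSpace.ofCore qPolCore.toCore

theorem QPol.inner_eq (f h : QPol) : ⟪f, h⟫ = meanLM (star f * h).re := rfl

theorem QPol.inner_def (f h : QPol) :
    ⟪f, h⟫ = ⟪f.re, h.re⟫ + ⟪f.imI, h.imI⟫ + ⟪f.imJ, h.imJ⟫ + ⟪f.imK, h.imK⟫ := by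
  simp only [QPol.inner_eq, Pol.inner_eq]
  simp

theorem QPol.norm_sq (f : QPol) :
    ‖f‖ ^ 2 = ‖f.re‖ ^ 2 + ‖f.imI‖ ^ 2 + ‖f.imJ‖ ^ 2 + ‖f.imK‖ ^ 2 := by
  simp only [← real_inner_self_eq_norm_sq]
  exact QPol.inner_def f f

/-- The squared length of a quaternion-valued function. -/
def lenSq (f : QPol) : Pol := (star f * f).re

theorem lenSq_eq (f : QPol) :
    lenSq f = f.re * f.re + f.imI * f.imI + f.imJ * f.imJ + f.imK * f.imK := by
  simp [lenSq]

theorem lenSq_mul (f h : QPol) : lenSq (f * h) = lenSq f * lenSq h := by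
  simp only [lenSq_eq, Quaternion.re_mul, Quaternion.imI_mul, Quaternion.imJ_mul,
    Quaternion.imK_mul]
  ring

theorem lenSq_star (f : QPol) : lenSq (star f) = lenSq f := by simp [lenSq_eq]

theorem QPol.norm_sq_eq (f : QPol) : ‖f‖ ^ 2 = meanLM (lenSq f) := by
  rw [← real_inner_self_eq_norm_sq]; rfl

theorem lenSq_nonneg (f : QPol) (g : TorusQuat) : 0 ≤ lenSq f g := by

  rw [lenSq_eq]; simp only [Pol.add_apply, Pol.mul_apply]
  have := mul_self_nonneg (f.re g)
  have := mul_self_nonneg (f.imI g)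
  have := mul_self_nonneg (f.imJ g)
  have := mul_self_nonneg (f.imK g)
  linarith

/-- Left multiplication. -/
abbrev mulL (q : QPol) : Module.End ℝ QPol := LinearMap.mulLeft ℝ q
/-- Right multiplication. -/
abbrev mulR (q : QPol) : Module.End ℝ QPol := LinearMap.mulRight ℝ q

theorem isAdj_mulL (q : QPol) : IsAdj (mulL q) (mulL (star q)) := fun u v => by
  simp only [QPol.inner_eq, LinearMap.mulLeft_apply, star_mul, mul_assoc]

theorem isAdj_mulR (q : QPol) : IsAdj (mulR q) (mulR (star q)) := fun u v => by
  simp only [QPol.inner_eq, LinearMap.mulRight_apply, star_mul]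
  congr 1
  simp
  ring

theorem norm_mulL_le {q : QPol} {C : ℝ} (hC : 0 ≤ C) (h : ∀ g, lenSq q g ≤ C ^ 2) (f : QPol) :
    ‖mulL q f‖ ≤ C * ‖f‖ := by
  rw [← sq_le_sq₀ (norm_nonneg _) (by positivity), mul_pow, QPol.norm_sq_eq, QPol.norm_sq_eq,
    ← smul_eq_mul, ← map_smul]
  refine meanLM_mono fun g => ?_
  rw [LinearMap.mulLeft_apply, lenSq_mul]
  exact mul_le_mul_of_nonneg_right (h g) (lenSq_nonneg f g)

theorem bddBelow_mulL {q : QPol} {c : ℝ} (hc : 0 ≤ c) (h : ∀ g, c ^ 2 ≤ lenSq q g) :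
    BddBelow' c (mulL q) := fun f => by
  rw [← sq_le_sq₀ (by positivity) (norm_nonneg _), mul_pow, QPol.norm_sq_eq, QPol.norm_sq_eq,
    ← smul_eq_mul, ← map_smul]
  refine meanLM_mono fun g => ?_
  rw [LinearMap.mulLeft_apply, lenSq_mul]
  exact mul_le_mul_of_nonneg_right (h g) (lenSq_nonneg f g)

theorem norm_mulR_le {q : QPol} {C : ℝ} (hC : 0 ≤ C) (h : ∀ g, lenSq q g ≤ C ^ 2) (f : QPol) :
    ‖mulR q f‖ ≤ C * ‖f‖ := by
  have := norm_mulL_le (q := star q) hC (fun g => by rw [lenSq_star]; exact h g) (star f)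
  have e : ∀ f : QPol, ‖star f‖ = ‖f‖ := fun f => by
    rw [← sq_eq_sq₀ (norm_nonneg _) (norm_nonneg _), QPol.norm_sq_eq, lenSq_star, QPol.norm_sq_eq]
  rwa [LinearMap.mulLeft_apply, ← star_mul, e, e] at this

theorem exists_bound (q : QPol) : ∃ C, 0 ≤ C ∧ ∀ g, lenSq q g ≤ C ^ 2 := by
  obtain ⟨M, hM⟩ := (isCompact_range (lenSq q).continuous).bddAbove
  refine ⟨|M| + 1, by positivity, fun g => (hM ⟨g, rfl⟩).trans ?_⟩
  nlinarith [le_abs_self M, abs_nonneg M]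

theorem bdd_mulL (q : QPol) : Bdd (mulL q) :=
  let ⟨C, hC, h⟩ := exists_bound q
  ⟨C, norm_mulL_le hC h⟩

theorem bdd_mulR (q : QPol) : Bdd (mulR q) :=
  let ⟨C, hC, h⟩ := exists_bound q
  ⟨C, norm_mulR_le hC h⟩

/-- Componentwise action of an operator. -/
def compMap (L : Module.End ℝ Pol) : Module.End ℝ QPol where
  toFun f := qmk (L f.re) (L f.imI) (L f.imJ) (L f.imK)
  map_add' f h := by ext1 <;> simp
  map_smul' c f := by ext1 <;> simp

section
variable (L : Module.End ℝ Pol) (f : QPol)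
@[simp] theorem compMap_re : (compMap L f).re = L f.re := rfl
@[simp] theorem compMap_imI : (compMap L f).imI = L f.imI := rfl
@[simp] theorem compMap_imJ : (compMap L f).imJ = L f.imJ := rfl
@[simp] theorem compMap_imK : (compMap L f).imK = L f.imK := rfl
end

theorem compMap_mul (L M : Module.End ℝ Pol) : compMap (L * M) = compMap L * compMap M := rfl
theorem compMap_add (L M : Module.End ℝ Pol) : compMap (L + M) = compMap L + compMap M := by
  ext1 f; ext1 <;> simp
theorem compMap_neg (L : Module.End ℝ Pol) : compMap (-L) = -compMap L := by
  ext1 f; ext1 <;> simp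
theorem compMap_sub (L M : Module.End ℝ Pol) : compMap (L - M) = compMap L - compMap M := by
  ext1 f; ext1 <;> simp

theorem isAdj_compMap {L L' : Module.End ℝ Pol} (h : IsAdj L L') :
    IsAdj (compMap L) (compMap L') := fun u v => by
  simp only [QPol.inner_def, compMap_re, compMap_imI, compMap_imJ, compMap_imK, h _ _]

theorem isSkew_compMap {L : Module.End ℝ Pol} (h : IsSkew L) : IsSkew (compMap L) := by
  have := isAdj_compMap h
  rwa [compMap_neg] at this

theorem commute_compMap {L M : Module.End ℝ Pol} (h : Commute L M) :
    Commute (compMap L) (compMap M) := by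
  rw [Commute, SemiconjBy, ← compMap_mul, h.eq, compMap_mul]

theorem compMap_deriv_mul (D : Derivation ℝ Pol Pol) (f h : QPol) :
    compMap D.toLinearMap (f * h) = compMap D.toLinearMap f * h + f * compMap D.toLinearMap h := by
  ext1 <;> simp <;> ring

theorem compMap_mulL (D : Derivation ℝ Pol Pol) (q : QPol) :
    compMap D.toLinearMap * mulL q = mulL (compMap D.toLinearMap q)
      + mulL q * compMap D.toLinearMap := by
  ext1 f; exact compMap_deriv_mul D q f

theorem compMap_mulR (D : Derivation ℝ Pol Pol) (q : QPol) :
    compMap D.toLinearMap * mulR q = mulR (compMap D.toLinearMap q)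
      + mulR q * compMap D.toLinearMap := by
  ext1 f
  exact (compMap_deriv_mul D f q).trans (add_comm _ _)

theorem compMap_deriv_imUnit (D : Derivation ℝ Pol Pol) (a : Fin 3) :
    compMap D.toLinearMap (imUnit Pol a) = 0 := by
  fin_cases a <;> ext1 <;> simp [imUnit]

theorem compMap_deriv_star (D : Derivation ℝ Pol Pol) (q : QPol) :
    compMap D.toLinearMap (star q) = star (compMap D.toLinearMap q) := by
  ext1 <;> simp

theorem mulL_mul (p q : QPol) : mulL (p * q) = mulL p * mulL q := LinearMap.mulLeft_mul _ _ p q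
theorem mulL_one : mulL (1 : QPol) = 1 := LinearMap.mulLeft_one ℝ QPol
theorem commute_mulL_mulR (p q : QPol) : Commute (mulL p) (mulR q) :=
  LinearMap.commute_mulLeft_right p q

/-- Quaternion-valued functions with components in `S`. -/
def quatSub (S : Submodule ℝ Pol) : Submodule ℝ QPol where
  carrier := {f | f.re ∈ S ∧ f.imI ∈ S ∧ f.imJ ∈ S ∧ f.imK ∈ S}
  zero_mem' := ⟨S.zero_mem, S.zero_mem, S.zero_mem, S.zero_mem⟩
  add_mem' := fun ⟨a, b, c, d⟩ ⟨a', b', c', d'⟩ =>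
    ⟨S.add_mem a a', S.add_mem b b', S.add_mem c c', S.add_mem d d'⟩
  smul_mem' k _ := fun ⟨a, b, c, d⟩ =>
    ⟨S.smul_mem k a, S.smul_mem k b, S.smul_mem k c, S.smul_mem k d⟩

theorem quatSub_mono {S S' : Submodule ℝ Pol} (h : S ≤ S') : quatSub S ≤ quatSub S' :=
  fun _ ⟨a, b, c, d⟩ => ⟨h a, h b, h c, h d⟩

instance (S : Submodule ℝ Pol) [FiniteDimensional ℝ S] : FiniteDimensional ℝ (quatSub S) := by
  let φ : quatSub S →ₗ[ℝ] S × S × S × S :=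
    { toFun f := (⟨_, f.2.1⟩, ⟨_, f.2.2.1⟩, ⟨_, f.2.2.2.1⟩, ⟨_, f.2.2.2.2⟩)
      map_add' _ _ := rfl
      map_smul' _ _ := rfl }
  refine FiniteDimensional.of_injective φ fun f h e => Subtype.ext ?_
  exact QuaternionAlgebra.ext (congrArg (fun x => (x.1 : Pol)) e)
    (congrArg (fun x => (x.2.1 : Pol)) e) (congrArg (fun x => (x.2.2.1 : Pol)) e)
    (congrArg (fun x => (x.2.2.2 : Pol)) e)

theorem compMap_mem {L : Module.End ℝ Pol} {S : Submodule ℝ Pol} (h : ∀ f ∈ S, L f ∈ S) :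
    ∀ f ∈ quatSub S, compMap L f ∈ quatSub S :=
  fun _ ⟨a, b, c, d⟩ => ⟨h _ a, h _ b, h _ c, h _ d⟩

theorem mulR_imUnit_mem (a : Fin 3) (S : Submodule ℝ Pol) :
    ∀ f ∈ quatSub S, mulR (imUnit Pol a) f ∈ quatSub S := by
  rintro f ⟨h1, h2, h3, h4⟩
  fin_cases a <;> refine ⟨?_, ?_, ?_, ?_⟩ <;> simpa [imUnit]

theorem mulL_imUnit_mem (a : Fin 3) (S : Submodule ℝ Pol) :
    ∀ f ∈ quatSub S, mulL (imUnit Pol a) f ∈ quatSub S := by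
  rintro f ⟨h1, h2, h3, h4⟩
  fin_cases a <;> refine ⟨?_, ?_, ?_, ?_⟩ <;> simpa [imUnit]

theorem orth_quatSub {S : Submodule ℝ Pol} {w : QPol} (h : ∀ e ∈ quatSub S, ⟪e, w⟫ = 0) :
    (∀ e ∈ S, ⟪e, w.re⟫ = 0) ∧ (∀ e ∈ S, ⟪e, w.imI⟫ = 0) ∧ (∀ e ∈ S, ⟪e, w.imJ⟫ = 0) ∧
      (∀ e ∈ S, ⟪e, w.imK⟫ = 0) := by
  have z := S.zero_mem
  refine ⟨fun e he => ?_, fun e he => ?_, fun e he => ?_, fun e he => ?_⟩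
  · simpa [QPol.inner_def] using h (qmk e 0 0 0) ⟨he, z, z, z⟩
  · simpa [QPol.inner_def] using h (qmk 0 e 0 0) ⟨z, he, z, z⟩
  · simpa [QPol.inner_def] using h (qmk 0 0 e 0) ⟨z, z, he, z⟩
  · simpa [QPol.inner_def] using h (qmk 0 0 0 e) ⟨z, z, z, he⟩

theorem compMap_kernel_decomp {L : Module.End ℝ Pol}
    (h : ∀ v, ∃ v₀ v₁, v = v₀ + v₁ ∧ L v₀ = 0 ∧ ‖v₁‖ ≤ ‖L v₁‖) (v : QPol) :
    ∃ v₀ v₁, v = v₀ + v₁ ∧ compMap L v₀ = 0 ∧ ‖v₁‖ ≤ ‖compMap L v₁‖ := by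
  obtain ⟨a, a', ea, ha, ha'⟩ := h v.re
  obtain ⟨b, b', eb, hb, hb'⟩ := h v.imI
  obtain ⟨c, c', ec, hc, hc'⟩ := h v.imJ
  obtain ⟨d, d', ed, hd, hd'⟩ := h v.imK
  refine ⟨qmk a b c d, qmk a' b' c' d', ?_, ?_, ?_⟩
  · ext1 <;> simpa
  · ext1 <;> simpa
  · rw [← sq_le_sq₀ (norm_nonneg _) (norm_nonneg _), QPol.norm_sq, QPol.norm_sq]
    simp only [compMap_re, compMap_imI, compMap_imJ, compMap_imK, qmk_re, qmk_imI, qmk_imJ, qmk_imK]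
    gcongr

end QuaternionFields

section DiracOperator

/-- Angular derivatives of quaternion-valued functions. -/
def opθ : Module.End ℝ QPol := compMap derivθ.toLinearMap
def opφ : Module.End ℝ QPol := compMap derivφ.toLinearMap
def opX (a : Fin 3) : Module.End ℝ QPol := compMap (derivQ a).toLinearMap

/-- The Dirac operator in the quaternion variable. -/
def dirQ : Module.End ℝ QPol := ∑ a, opX a * mulR (imUnit Pol a) - 1

theorem star_imUnit (a : Fin 3) : star (imUnit Pol a) = -imUnit Pol a := by
  fin_cases a <;> ext1 <;> simp [imUnit]

theorem isSkew_opθ : IsSkew opθ := isSkew_compMap (IsSkew.of_inner flowθ.inner_deriv)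
theorem isSkew_opφ : IsSkew opφ := isSkew_compMap (IsSkew.of_inner flowφ.inner_deriv)
theorem isSkew_opX (a : Fin 3) : IsSkew (opX a) :=
  isSkew_compMap (IsSkew.of_inner (flowQ a).inner_deriv)

theorem mulL_zero : mulL (0 : QPol) = 0 := by ext1 f; simp
theorem mulR_zero : mulR (0 : QPol) = 0 := by ext1 f; simp

theorem commute_compMap_mulR (D : Derivation ℝ Pol Pol) (a : Fin 3) :
    Commute (compMap D.toLinearMap) (mulR (imUnit Pol a)) := by
  rw [Commute, SemiconjBy, compMap_mulR, compMap_deriv_imUnit, mulR_zero, zero_add]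

theorem commute_compMap_mulL (D : Derivation ℝ Pol Pol) {q : QPol}
    (h : compMap D.toLinearMap q = 0) : Commute (compMap D.toLinearMap) (mulL q) := by
  rw [Commute, SemiconjBy, compMap_mulL, h, mulL_zero, zero_add]

theorem symm_dirQ : IsAdj dirQ dirQ := by
  have h : ∀ a, IsAdj (opX a * mulR (imUnit Pol a)) (opX a * mulR (imUnit Pol a)) := fun a => by
    have := (isSkew_opX a).mul (isAdj_mulR (imUnit Pol a))
    have e : mulR (star (imUnit Pol a)) * -opX a = opX a * mulR (imUnit Pol a) := by
      rw [opX, (commute_compMap_mulR (derivQ a) a).eq, star_imUnit]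
      ext1 f; simp
    rwa [e] at this
  rw [dirQ, Fin.sum_univ_three]
  exact (((h 0).add (h 1)).add (h 2)).sub IsAdj.one

section
variable (f : QPol)
theorem dirQ_re : (dirQ f).re =
    -(derivQ 0 f.imI + derivQ 1 f.imJ + derivQ 2 f.imK) - f.re := by
  simp [dirQ, Fin.sum_univ_three, opX, imUnit]; ring
theorem dirQ_imI : (dirQ f).imI =
    derivQ 0 f.re - derivQ 1 f.imK + derivQ 2 f.imJ - f.imI := by
  simp [dirQ, Fin.sum_univ_three, opX, imUnit]; ring
theorem dirQ_imJ : (dirQ f).imJ =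
    derivQ 0 f.imK + derivQ 1 f.re - derivQ 2 f.imI - f.imJ := by
  simp [dirQ, Fin.sum_univ_three, opX, imUnit]; ring
theorem dirQ_imK : (dirQ f).imK =
    -derivQ 0 f.imJ + derivQ 1 f.imI + derivQ 2 f.re - f.imK := by
  simp [dirQ, Fin.sum_univ_three, opX, imUnit]
end

theorem dirQ_sq : dirQ * dirQ = compMap factorQ.T + 1 := by
  have h01 : ∀ f, derivQ 0 (derivQ 1 f) = derivQ 1 (derivQ 0 f) - 2 * derivQ 2 f := fun f => by
    have := derivQ_comm 0 1 f
    simp [Algebra.smul_def, map_ofNat] at this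
    linear_combination this
  have h12 : ∀ f, derivQ 1 (derivQ 2 f) = derivQ 2 (derivQ 1 f) - 2 * derivQ 0 f := fun f => by
    have := derivQ_comm 1 2 f
    simp [Algebra.smul_def, map_ofNat] at this
    linear_combination this
  have h02 : ∀ f, derivQ 0 (derivQ 2 f) = derivQ 2 (derivQ 0 f) + 2 * derivQ 1 f := fun f => by
    have := derivQ_comm 0 2 f
    simp [Algebra.smul_def, map_ofNat] at this
    linear_combination this
  ext1 f
  ext1 <;> simp only [Module.End.mul_apply, dirQ_re, dirQ_imI, dirQ_imJ, dirQ_imK, map_sub, map_neg,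
    map_add, h01, h12, h02, LinearMap.add_apply, Module.End.one_apply, Quaternion.re_add,
    Quaternion.imI_add, Quaternion.imJ_add, Quaternion.imK_add, compMap_re, compMap_imI,
    compMap_imJ, compMap_imK, factorQ_T_apply, Fin.sum_univ_three] <;> ring

theorem commute_opθ_opX (a : Fin 3) : Commute opθ (opX a) :=
  commute_compMap (LinearMap.ext fun f => derivθ_comm_derivQ a f)
theorem commute_opφ_opX (a : Fin 3) : Commute opφ (opX a) :=
  commute_compMap (LinearMap.ext fun f => derivφ_comm_derivQ a f)
theorem commute_opφ_opθ : Commute opφ opθ :=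
  commute_compMap (LinearMap.ext fun f => (derivθ_comm f).symm)

theorem commute_opθ_dirQ : Commute opθ dirQ := by
  have h := fun a => (commute_opθ_opX a).mul_right (commute_compMap_mulR derivθ a)
  rw [dirQ, Fin.sum_univ_three]
  exact (((h 0).add_right (h 1)).add_right (h 2)).sub_right (Commute.one_right _)

theorem commute_opφ_dirQ : Commute opφ dirQ := by
  have h := fun a => (commute_opφ_opX a).mul_right (commute_compMap_mulR derivφ a)
  rw [dirQ, Fin.sum_univ_three]
  exact (((h 0).add_right (h 1)).add_right (h 2)).sub_right (Commute.one_right _)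

theorem diracData : DiracData opφ opθ dirQ :=
  ⟨isSkew_opφ, isSkew_opθ, symm_dirQ, commute_opφ_opθ, commute_opφ_dirQ, commute_opθ_dirQ⟩

theorem IsSkew.norm_sq_apply {H : Type*} [NormedAddCommGroup H] [InnerProductSpace ℝ H]
    {A : Module.End ℝ H} (h : IsSkew A) (v : H) : ‖A v‖ ^ 2 = -⟪v, (A * A) v⟫ := by
  rw [← real_inner_self_eq_norm_sq, h.inner]; rfl

theorem inner_compMap_factorQ (w : QPol) : ‖dirQ w‖ ^ 2 =
    ⟪w, compMap factorQ.T w⟫ + ‖w‖ ^ 2 := by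
  rw [← real_inner_self_eq_norm_sq, symm_dirQ, ← Module.End.mul_apply, dirQ_sq,
    LinearMap.add_apply, inner_add_right, Module.End.one_apply, real_inner_self_eq_norm_sq]

theorem sum_norm_sq (w : QPol) : ‖opφ w‖ ^ 2 + ‖opθ w‖ ^ 2 + ‖dirQ w‖ ^ 2 =
    ⟪w, compMap lapP w⟫ + ‖w‖ ^ 2 := by
  have e : compMap lapP = -(opθ * opθ) - opφ * opφ + compMap factorQ.T := by
    rw [opθ, opφ, ← compMap_mul, ← compMap_mul, ← compMap_neg, ← compMap_sub, ← compMap_add]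
    congr 1
    ext1 f
    simp only [lapP, LinearMap.add_apply, factorθ_T_apply, factorφ_T_apply]
    simp [sub_eq_add_neg]
  rw [isSkew_opφ.norm_sq_apply, isSkew_opθ.norm_sq_apply, inner_compMap_factorQ, e]
  simp only [LinearMap.add_apply, LinearMap.sub_apply, LinearMap.neg_apply, inner_add_right,
    inner_sub_right, inner_neg_right]
  ring

theorem dirQ_gap (N : ℕ) (w : QPol) (hw : ∀ e ∈ quatSub (Fil N N N), ⟪e, w⟫ = 0) :
    (N + 1 : ℝ) ^ 2 * ‖w‖ ^ 2 ≤ ‖opφ w‖ ^ 2 + ‖opθ w‖ ^ 2 + ‖dirQ w‖ ^ 2 := by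
  obtain ⟨h1, h2, h3, h4⟩ := orth_quatSub hw
  have h1 := lapP_lower N h1
  have h2 := lapP_lower N h2
  have h3 := lapP_lower N h3
  have h4 := lapP_lower N h4
  rw [sum_norm_sq, QPol.norm_sq, QPol.inner_def]
  simp only [compMap_re, compMap_imI, compMap_imJ, compMap_imK]
  nlinarith [sq_nonneg ‖w.re‖, sq_nonneg ‖w.imI‖, sq_nonneg ‖w.imJ‖, sq_nonneg ‖w.imK‖]

theorem dirQ_mem (p q r : ℕ) : ∀ f ∈ quatSub (Fil p q r), dirQ f ∈ quatSub (Fil p q r) := by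
  intro f hf
  have h : ∀ a, (opX a * mulR (imUnit Pol a)) f ∈ quatSub (Fil p q r) := fun a =>
    compMap_mem (derivQ_Fil a p q r) _ (mulR_imUnit_mem a _ f hf)
  rw [dirQ, Fin.sum_univ_three]
  exact sub_mem (add_mem (add_mem (h 0) (h 1)) (h 2)) hf

theorem opθ_mem (p q r : ℕ) : ∀ f ∈ quatSub (Fil p q r), opθ f ∈ quatSub (Fil p q r) :=
  compMap_mem (derivθ_Fil p q r)
theorem opφ_mem (p q r : ℕ) : ∀ f ∈ quatSub (Fil p q r), opφ f ∈ quatSub (Fil p q r) :=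
  compMap_mem (derivφ_Fil p q r)

theorem exists_mem_quatSub (f : QPol) : ∃ N, f ∈ quatSub (Fil N N N) := by
  obtain ⟨a, ha⟩ := exists_mem_Fil f.re
  obtain ⟨b, hb, hb'⟩ := exists_mem_Fil_ge f.imI a
  obtain ⟨c, hc, hc'⟩ := exists_mem_Fil_ge f.imJ b
  obtain ⟨d, hd, hd'⟩ := exists_mem_Fil_ge f.imK c
  have m : ∀ {x y}, x ≤ y → Fil x x x ≤ Fil y y y := fun h => Fil_mono h h h
  exact ⟨d, m (hb.trans (hc.trans hd)) ha, m (hc.trans hd) hb', m hd hc', hd'⟩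

/-- The operator `dirac opφ opθ dirQ` on pairs. -/
def opS : Module.End ℝ (Dbl QPol) := dirac opφ opθ dirQ

def filtS : SpecFilt opS :=
  diracData.specFilt (fun N => quatSub (Fil N N N)) (fun _ => inferInstance)
    (fun _ _ h => quatSub_mono (Fil_mono h h h)) exists_mem_quatSub
    (fun N => opφ_mem N N N) (fun N => opθ_mem N N N) (fun N => dirQ_mem N N N) dirQ_gap

def filtSS : SpecFilt (dia opS) := filtS.double filtS rfl

def filtG : SpecFilt (gradOp (dia opS)) := filtSS.double filtSS.neg rfl

theorem skew_opS : IsSkew opS := diracData.skew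

end DiracOperator

section Multiplication

theorem bdd_comm_opθ (q : QPol) : Bdd (opθ * mulL q - mulL q * opθ) := by
  rw [opθ, compMap_mulL, add_sub_cancel_right]; exact bdd_mulL _
theorem bdd_comm_opφ (q : QPol) : Bdd (opφ * mulL q - mulL q * opφ) := by
  rw [opφ, compMap_mulL, add_sub_cancel_right]; exact bdd_mulL _

theorem comm_dirQ_mulL (q : QPol) : dirQ * mulL q - mulL q * dirQ =
    ∑ a, mulL (opX a q) * mulR (imUnit Pol a) := by
  have h : ∀ a, opX a * mulR (imUnit Pol a) * mulL q = mulL (opX a q) * mulR (imUnit Pol a) +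
      mulL q * (opX a * mulR (imUnit Pol a)) := fun a => by
    rw [mul_assoc, ← (commute_mulL_mulR q (imUnit Pol a)).eq, ← mul_assoc, opX, compMap_mulL,
      add_mul, mul_assoc (mulL q)]
  rw [dirQ, sub_mul, mul_sub, Finset.sum_mul, Finset.mul_sum, one_mul, mul_one]
  simp only [h, Finset.sum_add_distrib]
  abel

theorem bdd_comm_dirQ (q : QPol) : Bdd (dirQ * mulL q - mulL q * dirQ) := by
  rw [comm_dirQ_mulL, Fin.sum_univ_three]
  exact (((bdd_mulL _).mul (bdd_mulR _)).add ((bdd_mulL _).mul (bdd_mulR _))).add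
    ((bdd_mulL _).mul (bdd_mulR _))

theorem bdd_dia {H : Type*} [NormedAddCommGroup H] [InnerProductSpace ℝ H] {A : Module.End ℝ H}
    (h : Bdd A) : Bdd (dia A) := bdd_bmat h Bdd.zero Bdd.zero h

theorem goodOp_mulL (q : QPol) : GoodOp opS (dia (mulL q)) (dia (mulL (star q))) where
  adj := isAdj_dia (isAdj_mulL q)
  bdd := bdd_dia (bdd_mulL q)
  bdd' := bdd_dia (bdd_mulL _)
  comm := by
    have h := bdd_bmat (bdd_comm_opφ q) ((bdd_comm_opθ q).sub (bdd_comm_dirQ q))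
      ((bdd_comm_opθ q).add (bdd_comm_dirQ q)) (bdd_comm_opφ q).neg
    convert h using 1
    simp only [opS, dirac, dia, bmat_mul, bmat_sub]
    congr 1 <;> simp [mul_sub, sub_mul, mul_add, add_mul] <;> abel

theorem dia_mulL_mul (p q : QPol) : dia (mulL (p * q)) = dia (mulL p) * dia (mulL q) := by
  rw [mulL_mul]; simp [dia, bmat_mul]

theorem dia_mulL_one : dia (mulL (1 : QPol)) = 1 := by rw [dia, mulL_one, bmat_one]

theorem goodInv_mulL {q : QPol} {c : ℝ} (hc : 0 < c) (h : ∀ g, c ^ 2 ≤ lenSq q g) :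
    GoodInv opS (dia (mulL q)) (dia (mulL (star q))) :=
  ⟨goodOp_mulL q, c, hc, (bddBelow_mulL hc.le h).diag hc.le (bddBelow_mulL hc.le h),
    have h' := bddBelow_mulL (q := star q) hc.le (by simpa only [lenSq_star] using h)
    h'.diag hc.le h'⟩

end Multiplication

section Rotation

/-- The automorphism `z + w j ↦ z + (c + s i) w j`. -/
def rotQ (c s : Pol) (q : QPol) : QPol :=
  qmk q.re q.imI (c * q.imJ - s * q.imK) (c * q.imK + s * q.imJ)

theorem rotQ_star (c s : Pol) (q : QPol) : rotQ c s (star q) = star (rotQ c s q) := by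
  ext1 <;> simp [rotQ] <;> ring

theorem lenSq_rotQ {c s : Pol} (h : c * c + s * s = 1) (q : QPol) :
    lenSq (rotQ c s q) = lenSq q := by
  simp only [lenSq_eq, rotQ, qmk_re, qmk_imI, qmk_imJ, qmk_imK]
  linear_combination (q.imJ * q.imJ + q.imK * q.imK) * h

def rotθ (q : QPol) : QPol := rotQ (coord 0) (coord 1) q
def rotφ (q : QPol) : QPol := rotQ (coord 2) (coord 3) q

theorem coord_sq_θ' : coord 0 * coord 0 + coord 1 * coord 1 = 1 := by
  have := coord_sq_θ; simpa [Fin.sum_univ_two, sq] using this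
theorem coord_sq_φ' : coord 2 * coord 2 + coord 3 * coord 3 = 1 := by
  have := coord_sq_φ; simpa [Fin.sum_univ_two, sq] using this

theorem opθ_rotθ {q : QPol} (h : opθ q = 0) :
    opθ (rotθ q) = (1 / 2 : ℝ) • (imUnit Pol 0 * rotθ q - rotθ q * imUnit Pol 0) := by
  have h1 : derivθ q.re = 0 := congrArg (fun f : QPol => f.re) h
  have h2 : derivθ q.imI = 0 := congrArg (fun f : QPol => f.imI) h
  have h3 : derivθ q.imJ = 0 := congrArg (fun f : QPol => f.imJ) h
  have h4 : derivθ q.imK = 0 := congrArg (fun f : QPol => f.imK) h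
  have e : ∀ a b : Pol, a = (1 / 2 : ℝ) • b ↔ 2 * a = b := fun a b => by
    constructor
    · rintro rfl
      simp [Algebra.smul_def, ← mul_assoc, ← map_ofNat (algebraMap ℝ Pol) 2, ← map_mul]
    · rintro rfl
      simp [Algebra.smul_def, ← mul_assoc, ← map_ofNat (algebraMap ℝ Pol) 2, ← map_mul]
  ext1
  · simp [opθ, rotθ, rotQ, imUnit, h1]
  · simp [opθ, rotθ, rotQ, imUnit, h2]
  · rw [Quaternion.imJ_smul, e]
    simp [opθ, rotθ, rotQ, imUnit, h3, h4, derivθ_coord]; ring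
  · rw [Quaternion.imK_smul, e]
    simp [opθ, rotθ, rotQ, imUnit, h3, h4, derivθ_coord]; ring

theorem opφ_rotφ {q : QPol} (h : opφ q = 0) :
    opφ (rotφ q) = (1 / 2 : ℝ) • (imUnit Pol 0 * rotφ q - rotφ q * imUnit Pol 0) := by
  have h1 : derivφ q.re = 0 := congrArg (fun f : QPol => f.re) h
  have h2 : derivφ q.imI = 0 := congrArg (fun f : QPol => f.imI) h
  have h3 : derivφ q.imJ = 0 := congrArg (fun f : QPol => f.imJ) h
  have h4 : derivφ q.imK = 0 := congrArg (fun f : QPol => f.imK) h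
  have e : ∀ a b : Pol, a = (1 / 2 : ℝ) • b ↔ 2 * a = b := fun a b => by
    constructor
    · rintro rfl
      simp [Algebra.smul_def, ← mul_assoc, ← map_ofNat (algebraMap ℝ Pol) 2, ← map_mul]
    · rintro rfl
      simp [Algebra.smul_def, ← mul_assoc, ← map_ofNat (algebraMap ℝ Pol) 2, ← map_mul]
  ext1
  · simp [opφ, rotφ, rotQ, imUnit, h1]
  · simp [opφ, rotφ, rotQ, imUnit, h2]
  · rw [Quaternion.imJ_smul, e]
    simp [opφ, rotφ, rotQ, imUnit, h3, h4, derivφ_coord]; ring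
  · rw [Quaternion.imK_smul, e]
    simp [opφ, rotφ, rotQ, imUnit, h3, h4, derivφ_coord]; ring

end Rotation

section Trivialization

/-- Left multiplication by `i`. -/
def opI : Module.End ℝ QPol := mulL (imUnit Pol 0)

theorem skew_opI : IsSkew opI := by
  have := isAdj_mulL (imUnit Pol 0)
  rw [star_imUnit] at this
  have e : mulL (-imUnit Pol 0) = -opI := by ext1 f; simp [opI]
  rwa [e] at this

theorem bdd_opI : Bdd opI := bdd_mulL _

theorem lenSq_imUnit (a : Fin 3) : lenSq (imUnit Pol a) = 1 := by
  fin_cases a <;> simp [lenSq_eq, imUnit]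

theorem norm_opI (v : QPol) : ‖opI v‖ = ‖v‖ := by
  rw [← sq_eq_sq₀ (norm_nonneg _) (norm_nonneg _), QPol.norm_sq_eq, QPol.norm_sq_eq, opI,
    LinearMap.mulLeft_apply, lenSq_mul, lenSq_imUnit, one_mul]

theorem commute_opI_dirQ : Commute opI dirQ := by
  have h := fun a =>
    (commute_compMap_mulL (derivQ a) (compMap_deriv_imUnit (derivQ a) 0)).symm.mul_right
    (commute_mulL_mulR (imUnit Pol 0) (imUnit Pol a))
  rw [dirQ, Fin.sum_univ_three]
  exact (((h 0).add_right (h 1)).add_right (h 2)).sub_right (Commute.one_right _)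

theorem commute_opI_opθ : Commute opI opθ :=
  (commute_compMap_mulL derivθ (compMap_deriv_imUnit _ 0)).symm
theorem commute_opI_opφ : Commute opI opφ :=
  (commute_compMap_mulL derivφ (compMap_deriv_imUnit _ 0)).symm

theorem diracData_φ : DiracData (opφ - (1 / 2 : ℝ) • opI) opθ dirQ where
  skew_b := isSkew_opφ.sub (skew_opI.smul _)
  skew_a := isSkew_opθ
  symm_D := symm_dirQ
  comm_ba := commute_opφ_opθ.sub_left (commute_opI_opθ.smul_left _)
  comm_bD := commute_opφ_dirQ.sub_left (commute_opI_dirQ.smul_left _)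
  comm_aD := commute_opθ_dirQ

theorem diracData_θ : DiracData opφ (opθ - (1 / 2 : ℝ) • opI) dirQ where
  skew_b := isSkew_opφ
  skew_a := isSkew_opθ.sub (skew_opI.smul _)
  symm_D := symm_dirQ
  comm_ba := commute_opφ_opθ.sub_right (commute_opI_opφ.symm.smul_right _)
  comm_bD := commute_opφ_dirQ
  comm_aD := commute_opθ_dirQ.sub_left (commute_opI_dirQ.smul_left _)

theorem half_of_sq {H : Type*} [NormedAddCommGroup H] [InnerProductSpace ℝ H] {A : Module.End ℝ H}
    (h : ∀ v, ‖v‖ ^ 2 ≤ 4 * ‖A v‖ ^ 2) : BddBelow' (1 / 2) A := fun v => by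
  rw [← sq_le_sq₀ (by positivity) (norm_nonneg _), mul_pow]; linarith [h v]

theorem bddBelow_φ : BddBelow' (1 / 2) (opφ - (1 / 2 : ℝ) • opI) := half_of_sq fun v => by
  have := norm_sq_half_twist isSkew_opφ commute_opI_opφ.symm (fun v => (norm_opI v).le)
    (compMap_kernel_decomp exists_kernel_decomp_φ) v
  rwa [norm_opI] at this

theorem bddBelow_θ : BddBelow' (1 / 2) (opθ - (1 / 2 : ℝ) • opI) := half_of_sq fun v => by
  have := norm_sq_half_twist isSkew_opθ commute_opI_opθ.symm (fun v => (norm_opI v).le)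
    (compMap_kernel_decomp exists_kernel_decomp_θ) v
  rwa [norm_opI] at this

theorem commute_twist (D : Derivation ℝ Pol Pol) {q : QPol} (h : compMap D.toLinearMap q =
    (1 / 2 : ℝ) • (imUnit Pol 0 * q - q * imUnit Pol 0)) :
    Commute (compMap D.toLinearMap - (1 / 2 : ℝ) • opI) (mulL q) := by
  rw [Commute, SemiconjBy, sub_mul, mul_sub, compMap_mulL, h]
  ext1 f
  simp [opI, mul_assoc, sub_mul, smul_sub]
  abel

theorem smul_couple_dia {H : Type*} [NormedAddCommGroup H] [InnerProductSpace ℝ H] (s : ℝ)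
    (P P' : Module.End ℝ H) :
    s • couple (dia P) (dia P') = couple (dia (s • P)) (dia (s • P')) := by
  ext v : 1; apply Dbl.ext' <;> apply Dbl.ext' <;> simp [couple, dia]

variable {R R' : Module.End ℝ (Dbl QPol)}

theorem trivialize_φ {q : QPol} (hq : opφ q = 0) (hq' : opφ (star q) = 0)
    (hl : lenSq q = 1) (hR : GoodInv opS R R') :
    QRel filtG (bmat (dia (mulL (rotφ q))) 0 0 R) (bmat (dia (mulL (star (rotφ q)))) 0 0 R')
      (bmat 1 0 0 R) (bmat 1 0 0 R') := by
  have hs : ∀ s : ℝ, ∀ {P P'}, IsAdj P P' → Commute (opφ - (1 / 2 : ℝ) • opI) P →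
      Commute (opφ - (1 / 2 : ℝ) • opI) P' →
      BddBelow' (1 / 2) (gradOp (dirac (opφ - (1 / 2 : ℝ) • opI) opθ dirQ) +
        s • couple (dia P) (dia P')) := fun s P P' h h1 h2 => by
    rw [smul_couple_dia]
    exact diracData_φ.couple_gap_b (h.smul s) (h1.smul_right s) (h2.smul_right s) (by norm_num)
      bddBelow_φ
  refine QRel.trivialize skew_opS diracData_φ.skew ?_ (goodInv_mulL one_pos fun g => ?_) hR
    (by norm_num : (0 : ℝ) < 1 / 2) (fun s =>
      hs s (isAdj_mulL _) (commute_twist derivφ (opφ_rotφ hq)) ?_)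
    (fun s => ?_)
  · convert bdd_bmat (bdd_opI.smul (-(1 / 2))) Bdd.zero Bdd.zero (bdd_opI.smul (1 / 2)) using 1
    simp [opS, dirac, bmat_sub]
  · rw [rotφ, lenSq_rotQ coord_sq_φ', hl]; simp
  · rw [rotφ, ← rotQ_star]; exact commute_twist derivφ (opφ_rotφ hq')
  · have := hs s IsAdj.one (Commute.one_right _) (Commute.one_right _)
    rwa [dia, bmat_one] at this

theorem trivialize_θ {q : QPol} (hq : opθ q = 0) (hq' : opθ (star q) = 0)
    (hl : lenSq q = 1) (hR : GoodInv opS R R') :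
    QRel filtG (bmat (dia (mulL (rotθ q))) 0 0 R) (bmat (dia (mulL (star (rotθ q)))) 0 0 R')
      (bmat 1 0 0 R) (bmat 1 0 0 R') := by
  have hs : ∀ s : ℝ, ∀ {P P'}, IsAdj P P' → Commute (opθ - (1 / 2 : ℝ) • opI) P →
      Commute (opθ - (1 / 2 : ℝ) • opI) P' →
      BddBelow' (1 / 2) (gradOp (dirac opφ (opθ - (1 / 2 : ℝ) • opI) dirQ) +
        s • couple (dia P) (dia P')) := fun s P P' h h1 h2 => by
    rw [smul_couple_dia]
    exact diracData_θ.couple_gap_a (h.smul s) (h1.smul_right s) (h2.smul_right s) (by norm_num)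
      bddBelow_θ
  refine QRel.trivialize skew_opS diracData_θ.skew ?_ (goodInv_mulL one_pos fun g => ?_) hR
    (by norm_num : (0 : ℝ) < 1 / 2) (fun s =>
      hs s (isAdj_mulL _) (commute_twist derivθ (opθ_rotθ hq)) ?_)
    (fun s => ?_)
  · convert bdd_bmat Bdd.zero (bdd_opI.smul (-(1 / 2))) (bdd_opI.smul (-(1 / 2))) Bdd.zero using 1
    simp [opS, dirac, bmat_sub]
  · rw [rotθ, lenSq_rotQ coord_sq_θ', hl]; simp
  · rw [rotθ, ← rotQ_star]; exact commute_twist derivθ (opθ_rotθ hq')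
  · have := hs s IsAdj.one (Commute.one_right _) (Commute.one_right _)
    rwa [dia, bmat_one] at this

end Trivialization

section Clutching

/-- The tautological unit quaternion. -/
def unitQ : QPol := qmk (coord 4) (coord 5) (coord 6) (coord 7)
/-- The commutator-type element `x ρ_θ(x)⁻¹`. -/
def innerQ : QPol := unitQ * rotθ (star unitQ)
/-- The iterated clutching function. -/
def clutchQ : QPol := rotφ (star innerQ) * innerQ

theorem lenSq_unitQ : lenSq unitQ = 1 := by
  simpa [lenSq_eq, unitQ] using coord_sq_Q

theorem lenSq_innerQ : lenSq innerQ = 1 := by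
  rw [innerQ, lenSq_mul, rotθ, lenSq_rotQ coord_sq_θ, lenSq_star, lenSq_unitQ, mul_one]

theorem star_mul_of_lenSq {q : QPol} (h : lenSq q = 1) : star q * q = 1 := by
  have h' := lenSq_eq q
  rw [h] at h'
  ext1 <;> simp
  · linear_combination -h'
  all_goals ring

theorem mul_star_of_lenSq {q : QPol} (h : lenSq q = 1) : q * star q = 1 := by
  have := star_mul_of_lenSq (q := star q) (by rw [lenSq_star, h])
  rwa [star_star] at this

theorem opθ_unitQ : opθ unitQ = 0 := by ext1 <;> simp [opθ, unitQ, derivθ_coord]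
theorem opφ_unitQ : opφ unitQ = 0 := by ext1 <;> simp [opφ, unitQ, derivφ_coord]
theorem opθ_star {q : QPol} (h : opθ q = 0) : opθ (star q) = 0 := by
  rw [opθ, compMap_deriv_star]; change star (opθ q) = 0; rw [h, star_zero]
theorem opφ_star {q : QPol} (h : opφ q = 0) : opφ (star q) = 0 := by
  rw [opφ, compMap_deriv_star]; change star (opφ q) = 0; rw [h, star_zero]

theorem opφ_rotθ {q : QPol} (h : opφ q = 0) : opφ (rotθ q) = 0 := by
  have h1 : derivφ q.re = 0 := congrArg (fun f : QPol => f.re) h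
  have h2 : derivφ q.imI = 0 := congrArg (fun f : QPol => f.imI) h
  have h3 : derivφ q.imJ = 0 := congrArg (fun f : QPol => f.imJ) h
  have h4 : derivφ q.imK = 0 := congrArg (fun f : QPol => f.imK) h
  ext1 <;> simp [opφ, rotθ, rotQ, h1, h2, h3, h4, derivφ_coord]

theorem opφ_innerQ : opφ innerQ = 0 := by
  have := compMap_deriv_mul derivφ unitQ (rotθ (star unitQ))
  change opφ innerQ = opφ _ * _ + _ * opφ _ at this
  rw [this, opφ_unitQ, opφ_rotθ (opφ_star opφ_unitQ), zero_mul, mul_zero, add_zero]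

/-- The sum of the operators `f ↦ e f e` over the imaginary units `e`. -/
def opE : Module.End ℝ QPol := ∑ a, mulL (imUnit Pol a) * mulR (imUnit Pol a)

section
variable (f : QPol)
theorem opE_re : (opE f).re = -3 * f.re := by
  simp [opE, Fin.sum_univ_three, imUnit]; ring
theorem opE_imI : (opE f).imI = f.imI := by
  simp [opE, Fin.sum_univ_three, imUnit]
theorem opE_imJ : (opE f).imJ = f.imJ := by
  simp [opE, Fin.sum_univ_three, imUnit]
theorem opE_imK : (opE f).imK = f.imK := by
  simp [opE, Fin.sum_univ_three, imUnit]
end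

theorem symm_opE : IsAdj opE opE := fun u v => by
  have h : ∀ f : Pol, -3 * f = (-3 : ℝ) • f := fun f => by
    rw [Algebra.smul_def, map_neg, map_ofNat]
  simp only [QPol.inner_def, opE_re, opE_imI, opE_imJ, opE_imK, h, real_inner_smul_left,
    real_inner_smul_right]

theorem bdd_opE : Bdd opE := by
  rw [opE, Fin.sum_univ_three]
  exact (((bdd_mulL _).mul (bdd_mulR _)).add ((bdd_mulL _).mul (bdd_mulR _))).add
    ((bdd_mulL _).mul (bdd_mulR _))

theorem commute_compMap_opE (D : Derivation ℝ Pol Pol) :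
    Commute (compMap D.toLinearMap) opE := by
  have h := fun a => (commute_compMap_mulL D (compMap_deriv_imUnit D a)).mul_right
    (commute_compMap_mulR D a)
  rw [opE, Fin.sum_univ_three]
  exact ((h 0).add_right (h 1)).add_right (h 2)

theorem opX_unitQ (a : Fin 3) : opX a unitQ = imUnit Pol a * unitQ := by
  fin_cases a <;> ext1 <;> simp [opX, unitQ, imUnit, derivQ_coord]

/-- The conjugate of `dirQ` by `unitQ`. -/
def dirQ' : Module.End ℝ QPol := dirQ - opE

theorem mulL_unitQ_dirQ : mulL unitQ * dirQ = dirQ' * mulL unitQ := by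
  have h := comm_dirQ_mulL unitQ
  have e : ∑ a, mulL (opX a unitQ) * mulR (imUnit Pol a) = opE * mulL unitQ := by
    rw [opE, Finset.sum_mul]
    refine Finset.sum_congr rfl fun a _ => ?_
    rw [opX_unitQ, mulL_mul, mul_assoc, (commute_mulL_mulR unitQ _).eq, ← mul_assoc]
  rw [dirQ', sub_mul, ← e, ← h]; abel

theorem diracData' : DiracData opφ opθ dirQ' :=
  ⟨isSkew_opφ, isSkew_opθ, symm_dirQ.sub symm_opE, commute_opφ_opθ,
    commute_opφ_dirQ.sub_right (commute_compMap_opE _),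
    commute_opθ_dirQ.sub_right (commute_compMap_opE _)⟩

theorem norm_mulL_of_lenSq {q : QPol} (h : lenSq q = 1) (f : QPol) : ‖q * f‖ = ‖f‖ := by
  rw [← sq_eq_sq₀ (norm_nonneg _) (norm_nonneg _), QPol.norm_sq_eq, QPol.norm_sq_eq,
    lenSq_mul, h, one_mul]

theorem bddBelow_dirQ : BddBelow' 1 dirQ := fun v => by
  rw [one_mul, ← sq_le_sq₀ (norm_nonneg _) (norm_nonneg _), inner_compMap_factorQ]
  have : 0 ≤ ⟪v, compMap factorQ.T v⟫ := by
    rw [QPol.inner_def]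
    simp only [compMap_re, compMap_imI, compMap_imJ, compMap_imK]
    have h := factorQ.inner_T_nonneg
    linarith [h v.re, h v.imI, h v.imJ, h v.imK]
  linarith

theorem bddBelow_dirQ' : BddBelow' 1 dirQ' := fun v => by
  have h : v = unitQ * (star unitQ * v) := by
    rw [← mul_assoc, mul_star_of_lenSq lenSq_unitQ, one_mul]
  have e : dirQ' v = unitQ * dirQ (star unitQ * v) := by
    conv_lhs => rw [h]
    exact (congrArg (fun A : Module.End ℝ QPol => A (star unitQ * v)) mulL_unitQ_dirQ).symm
  rw [e, norm_mulL_of_lenSq lenSq_unitQ, ← norm_mulL_of_lenSq (q := star unitQ)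
    (by rw [lenSq_star, lenSq_unitQ]) v]
  exact bddBelow_dirQ _

theorem DiracData.bddBelow {Y : Type*} [NormedAddCommGroup Y] [InnerProductSpace ℝ Y]
    {b a D : Module.End ℝ Y} (h : DiracData b a D) (hD : BddBelow' 1 D) :
    BddBelow' 1 (dirac b a D) := fun v => by
  rw [one_mul, ← sq_le_sq₀ (norm_nonneg _) (norm_nonneg _), h.norm_sq, Dbl.norm_sq]
  have h1 := hD v.fst
  have h2 := hD v.snd
  rw [one_mul] at h1 h2
  have h1 := pow_le_pow_left₀ (norm_nonneg _) h1 2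
  have h2 := pow_le_pow_left₀ (norm_nonneg _) h2 2
  nlinarith [sq_nonneg ‖b v.fst‖, sq_nonneg ‖a v.fst‖, sq_nonneg ‖b v.snd‖, sq_nonneg ‖a v.snd‖]

/-- A trivialization of the clutching function relates the two Dirac operators. -/
theorem rel_of_clutch
    (h : QRel filtG (bmat (dia (mulL clutchQ)) 0 0 1) (bmat (dia (mulL (star clutchQ))) 0 0 1)
      (bmat 1 0 0 1) (bmat 1 0 0 1)) :
    filtG.Rel 0 (bmat 0 0 0 (bmat 0 0 0 (opS - dirac opφ opθ dirQ'))) := by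
  have u : ∀ {q : QPol}, lenSq q = 1 → GoodInv opS (dia (mulL q)) (dia (mulL (star q))) :=
    fun hq => goodInv_mulL one_pos fun g => by rw [hq]; simp
  have hx := u lenSq_unitQ
  have hk := u lenSq_innerQ
  have lz : lenSq (rotθ (star unitQ)) = 1 := by
    rw [rotθ, lenSq_rotQ coord_sq_θ, lenSq_star, lenSq_unitQ]
  have hz := u lz
  have lw : lenSq (rotφ (star innerQ)) = 1 := by
    rw [rotφ, lenSq_rotQ coord_sq_φ, lenSq_star, lenSq_innerQ]
  have hw := u lw
  have hS := skew_opS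
  have s1 := QRel.split (SF := filtG) hS hw hk
  rw [← dia_mulL_mul, ← dia_mulL_mul, ← star_mul] at s1
  have s2 := trivialize_φ (opφ_star opφ_innerQ) (by rw [star_star]; exact opφ_innerQ)
    (by rw [lenSq_star, lenSq_innerQ]) hk
  have s3 := QRel.swap (SF := filtG) hS GoodInv.one hk
  have s4 := QRel.split (SF := filtG) hS hx hz
  rw [← dia_mulL_mul, ← dia_mulL_mul, ← star_mul] at s4
  have s5 := QRel.swap (SF := filtG) hS hx hz
  have s6 := trivialize_θ (opθ_star opθ_unitQ) (by rw [star_star]; exact opθ_unitQ)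
    (by rw [lenSq_star, lenSq_unitQ]) hx
  have chain := ((((h.symm.trans s1).trans s2).trans s3).trans s4).trans (s5.trans s6)
  refine rel_of_QRel_one hS diracData'.skew ?_ hx ?_ one_pos (diracData.bddBelow bddBelow_dirQ)
    (diracData'.bddBelow bddBelow_dirQ') chain
  · have e : opS - dirac opφ opθ dirQ' = bmat 0 (-opE) opE 0 := by
      simp only [opS, dirac, dirQ', bmat_sub]
      congr 1 <;> abel
    rw [e]
    exact bdd_bmat Bdd.zero bdd_opE.neg bdd_opE Bdd.zero
  · have c1 := commute_compMap_mulL derivφ opφ_unitQ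
    have c2 := commute_compMap_mulL derivθ opθ_unitQ
    have c1 : opφ * mulL unitQ = mulL unitQ * opφ := c1.eq
    have c2 : opθ * mulL unitQ = mulL unitQ * opθ := c2.eq
    simp only [opS, dirac, dia, bmat_mul]
    congr 1 <;> simp only [mul_zero, zero_mul, add_zero, zero_add, mul_sub, sub_mul, mul_add,
      add_mul, c1, c2, mulL_unitQ_dirQ, mul_neg, neg_mul, neg_zero, sub_zero]

end Clutching

section Deformation

/-- Right translation on quaternion-valued functions. -/
def opJ : Module.End ℝ QPol := compMap transI.toLinearMap
/-- The antipodal map on quaternion-valued functions. -/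
def opPar : Module.End ℝ QPol := opJ * opJ
/-- A skew operator whose square is minus the projection to the odd functions. -/
def opN : Module.End ℝ QPol := (1 / 2 : ℝ) • (opJ - opJ * opPar)

theorem opPar_opPar (f : QPol) : opPar (opPar f) = f := by
  ext1 <;> exact parity_parity _

theorem inner_opJ (f h : QPol) : ⟪opJ f, opJ h⟫ = ⟪f, h⟫ := by
  simp only [QPol.inner_def, opJ, compMap_re, compMap_imI, compMap_imJ, compMap_imK,
    AlgHom.toLinearMap_apply, inner_transI]

theorem norm_opJ (f : QPol) : ‖opJ f‖ = ‖f‖ := by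
  rw [← sq_eq_sq₀ (norm_nonneg _) (norm_nonneg _), ← real_inner_self_eq_norm_sq,
    ← real_inner_self_eq_norm_sq, inner_opJ]

theorem opN_apply (f : QPol) : opN f = (1 / 2 : ℝ) • (opJ f - opJ (opPar f)) := rfl

theorem isAdj_opJ : IsAdj opJ (opJ * opPar) := fun u v => by
  conv_lhs => rw [← opPar_opPar v]
  exact inner_opJ _ _

theorem isSkew_opN : IsSkew opN := by
  have h := (isAdj_opJ.sub isAdj_opJ.symm).smul (1 / 2)
  have e : (1 / 2 : ℝ) • (opJ * opPar - opJ) = -opN := by rw [opN]; module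
  rwa [e] at h

theorem norm_opN_le (f : QPol) : ‖opN f‖ ≤ ‖f‖ := by
  have h1 := norm_sub_le (opJ f) (opJ (opPar f))
  have h2 : ‖opPar f‖ = ‖f‖ := by rw [opPar, Module.End.mul_apply, norm_opJ, norm_opJ]
  rw [norm_opJ, norm_opJ, h2] at h1
  rw [opN_apply, norm_smul, Real.norm_of_nonneg (by norm_num)]
  linarith

theorem commute_opN_of {A : Module.End ℝ QPol} (h : Commute A opJ) : Commute A opN :=
  (h.sub_right (h.mul_right (h.mul_right h))).smul_right _
theorem commute_opPar_of {A : Module.End ℝ QPol} (h : Commute A opJ) : Commute A opPar :=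
  h.mul_right h

theorem derivθ_transI (f : Pol) : derivθ (transI f) = transI (derivθ f) := flowθ.deriv_transI f
theorem derivφ_transI (f : Pol) : derivφ (transI f) = transI (derivφ f) := flowφ.deriv_transI f
theorem derivQ_transI (a : Fin 3) (f : Pol) : derivQ a (transI f) = transI (derivQ a f) :=
  (flowQ a).deriv_transI f

theorem commute_opθ_opJ : Commute opθ opJ := commute_compMap (LinearMap.ext derivθ_transI)
theorem commute_opφ_opJ : Commute opφ opJ := commute_compMap (LinearMap.ext derivφ_transI)

theorem commute_dirQ_opJ : Commute dirQ opJ := by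
  ext1 f
  ext1 <;> simp only [Module.End.mul_apply, dirQ_re, dirQ_imI, dirQ_imJ, dirQ_imK, opJ, compMap_re,
    compMap_imI, compMap_imJ, compMap_imK, AlgHom.toLinearMap_apply, derivQ_transI] <;> simp

theorem commute_opE_opJ : Commute opE opJ := by
  ext1 f
  ext1 <;> simp only [Module.End.mul_apply, opE_re, opE_imI, opE_imJ, opE_imK, opJ, compMap_re,
    compMap_imI, compMap_imJ, compMap_imK, AlgHom.toLinearMap_apply] <;> simp
  rw [map_ofNat]

/-- The orthogonal projection to the constant `1`. -/
def projOne : Module.End ℝ QPol where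
  toFun f := ⟪(1 : QPol), f⟫ • 1
  map_add' f h := by rw [inner_add_right, add_smul]
  map_smul' c f := by rw [real_inner_smul_right, mul_smul]; rfl

theorem projOne_apply (f : QPol) : projOne f = ⟪(1 : QPol), f⟫ • 1 := rfl

theorem symm_projOne : IsAdj projOne projOne := fun u v => by
  rw [projOne_apply, projOne_apply, real_inner_smul_left, real_inner_smul_right,
    real_inner_comm u, mul_comm]

theorem opJ_one : opJ 1 = 1 := by ext1 <;> simp [opJ]

theorem commute_projOne_opJ : Commute projOne opJ := by
  ext1 f
  simp only [Module.End.mul_apply, projOne_apply, map_smul, opJ_one]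
  congr 1
  conv_lhs => rw [← opJ_one]
  exact inner_opJ _ _

theorem compMap_deriv_one (D : Derivation ℝ Pol Pol) : compMap D.toLinearMap 1 = 0 := by
  ext1 <;> simp

theorem commute_projOne_of {A : Module.End ℝ QPol} (hA : IsSkew A) (h : A 1 = 0) :
    Commute A projOne := by
  ext1 f
  rw [Module.End.mul_apply, Module.End.mul_apply, projOne_apply, projOne_apply, map_smul, h,
    smul_zero, real_inner_comm, hA.inner, h, inner_zero_right, neg_zero, zero_smul]

theorem norm_one_QPol : ‖(1 : QPol)‖ ^ 2 = 1 := by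
  rw [QPol.norm_sq_eq, show lenSq 1 = 1 by simp [lenSq_eq], meanLM_apply]
  exact mean_const 1

theorem dirQ_one : dirQ 1 = -1 := by
  ext1 <;> simp [dirQ_re, dirQ_imI, dirQ_imJ, dirQ_imK]

/-- The interpolation between the perturbed and the conjugated Dirac operator. -/
def dirPath (s : ℝ) : Module.End ℝ QPol := dirQ - s • opE + (2 * (1 - s)) • projOne

theorem symm_dirPath (s : ℝ) : IsAdj (dirPath s) (dirPath s) :=
  (symm_dirQ.sub (symm_opE.smul _)).add (symm_projOne.smul _)

theorem commute_dirPath_opJ (s : ℝ) : Commute (dirPath s) opJ :=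
  (commute_dirQ_opJ.sub_left (commute_opE_opJ.smul_left _)).add_left
    (commute_projOne_opJ.smul_left _)

theorem diracData_path (m s : ℝ) : DiracData opφ (opθ - m • opN) (dirPath s) where
  skew_b := isSkew_opφ
  skew_a := isSkew_opθ.sub (isSkew_opN.smul _)
  symm_D := symm_dirPath s
  comm_ba := commute_opφ_opθ.sub_right ((commute_opN_of commute_opφ_opJ).smul_right _)
  comm_bD := ((commute_opφ_dirQ.sub_right ((commute_compMap_opE _).smul_right _)).add_right
    ((commute_projOne_of isSkew_opφ (compMap_deriv_one _)).smul_right _))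
  comm_aD := ((commute_opθ_dirQ.sub_right ((commute_compMap_opE _).smul_right _)).add_right
    ((commute_projOne_of isSkew_opθ (compMap_deriv_one _)).smul_right _)).sub_left
    ((commute_opN_of (commute_dirPath_opJ s)).symm.smul_left _)

section Invariance
variable {p q r : ℕ}
theorem opJ_mem : ∀ f ∈ quatSub (Fil p q r), opJ f ∈ quatSub (Fil p q r) :=
  compMap_mem (transI_Fil p q r)
theorem opPar_mem : ∀ f ∈ quatSub (Fil p q r), opPar f ∈ quatSub (Fil p q r) :=
  fun f hf => opJ_mem _ (opJ_mem f hf)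
theorem opN_mem : ∀ f ∈ quatSub (Fil p q r), opN f ∈ quatSub (Fil p q r) :=
  fun f hf => Submodule.smul_mem _ _ (sub_mem (opJ_mem f hf) (opJ_mem _ (opPar_mem f hf)))
theorem opE_mem : ∀ f ∈ quatSub (Fil p q r), opE f ∈ quatSub (Fil p q r) := fun f hf => by
  have h : ∀ a, (mulL (imUnit Pol a) * mulR (imUnit Pol a)) f ∈ quatSub (Fil p q r) := fun a =>
    mulL_imUnit_mem a _ _ (mulR_imUnit_mem a _ f hf)
  rw [opE, Fin.sum_univ_three]
  exact add_mem (add_mem (h 0) (h 1)) (h 2)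

theorem one_mem_Fil : (1 : Pol) ∈ Fil p q r := by
  have h : ∀ (B : PolFactor) (p : ℕ), (1 : Pol) ∈ B.C ^ p := fun B p =>
    one_le_pow B p (Submodule.mem_one.2 ⟨1, by simp⟩)
  have := Submodule.mul_mem_mul (h factorθ p) (Submodule.mul_mem_mul (h factorφ q) (h factorQ r))
  simpa [Fil] using this

theorem one_mem_quatSub : (1 : QPol) ∈ quatSub (Fil p q r) :=
  ⟨by simpa using one_mem_Fil, by simp, by simp, by simp⟩

theorem projOne_mem (f : QPol) : projOne f ∈ quatSub (Fil p q r) :=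
  Submodule.smul_mem _ _ one_mem_quatSub

theorem dirPath_mem (s : ℝ) : ∀ f ∈ quatSub (Fil p q r), dirPath s f ∈ quatSub (Fil p q r) :=
  fun f hf => add_mem (sub_mem (dirQ_mem p q r f hf) (Submodule.smul_mem _ _ (opE_mem f hf)))
    (Submodule.smul_mem _ _ (projOne_mem f))
end Invariance

theorem opJ_of_mem {p q : ℕ} {f : QPol} (hf : f ∈ quatSub (Fil p q 0)) : opJ f = f := by
  have h : ∀ x ∈ Fil p q 0, transI x = x := fun x hx => by
    rw [Fil_eq_Q, pow_zero, one_mul] at hx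
    exact transI_factorθφ p q x hx
  obtain ⟨h1, h2, h3, h4⟩ := hf
  ext1
  exacts [h _ h1, h _ h2, h _ h3, h _ h4]

theorem dirQ_of_mem {p q : ℕ} {f : QPol} (hf : f ∈ quatSub (Fil p q 0)) : dirQ f = -f := by
  have h : ∀ a, ∀ x ∈ Fil p q 0, derivQ a x = 0 := fun a x hx => by
    rw [Fil_eq_Q, pow_zero, one_mul] at hx
    exact derivQ_zero a p q x hx
  obtain ⟨h1, h2, h3, h4⟩ := hf
  ext1 <;> simp [dirQ_re, dirQ_imI, dirQ_imJ, dirQ_imK, h _ _ h1, h _ _ h2, h _ _ h3, h _ _ h4]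

theorem norm_opE_le (f : QPol) : ‖opE f‖ ^ 2 ≤ 9 * ‖f‖ ^ 2 := by
  have h : -3 * f.re = (-3 : ℝ) • f.re := by rw [Algebra.smul_def, map_neg, map_ofNat]
  rw [QPol.norm_sq, QPol.norm_sq, opE_re, opE_imI, opE_imJ, opE_imK, h, norm_smul, mul_pow]
  norm_num
  nlinarith [sq_nonneg ‖f.imI‖, sq_nonneg ‖f.imJ‖, sq_nonneg ‖f.imK‖]

theorem dirQ_lower {M : ℕ} {f : QPol} (hf : f ∈ quatSub (Fil M M M)) (he : opPar f = f)
    (h : ∀ e ∈ quatSub (Fil M M 0), ⟪e, f⟫ = 0) : 9 * ‖f‖ ^ 2 ≤ ‖dirQ f‖ ^ 2 := by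
  obtain ⟨o1, o2, o3, o4⟩ := orth_quatSub h
  obtain ⟨h1, h2, h3, h4⟩ := hf
  have e1 : parity f.re = f.re := congrArg (fun f : QPol => f.re) he
  have e2 : parity f.imI = f.imI := congrArg (fun f : QPol => f.imI) he
  have e3 : parity f.imJ = f.imJ := congrArg (fun f : QPol => f.imJ) he
  have e4 : parity f.imK = f.imK := congrArg (fun f : QPol => f.imK) he
  have := even_lower e1 h1 o1
  have := even_lower e2 h2 o2
  have := even_lower e3 h3 o3
  have := even_lower e4 h4 o4
  rw [inner_compMap_factorQ, QPol.norm_sq, QPol.inner_def]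
  simp only [compMap_re, compMap_imI, compMap_imJ, compMap_imK]
  linarith

theorem eq_zero_of_const {M : ℕ} {s : ℝ} (hs : 0 ≤ s) {f : QPol}
    (hf : f ∈ quatSub (Fil M M 0)) (hb : opφ f = 0) (ha : opθ f = 0) (hD : dirPath s f = 0) :
    f = 0 := by
  have hD : -f - s • opE f + (2 * (1 - s)) • projOne f = 0 := by rw [← dirQ_of_mem hf]; exact hD
  have zero_of : ∀ x : Pol, -x - s • x = 0 → x = 0 := fun x hx => by
    have : (-1 - s) • x = 0 := by rw [← hx]; module
    exact (smul_eq_zero.1 this).resolve_left (by linarith)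
  have hre : derivQ 0 f.re = 0 ∧ derivQ 1 f.re = 0 ∧ derivQ 2 f.re = 0 := by
    have h : ∀ a, ∀ x ∈ Fil M M 0, derivQ a x = 0 := fun a x hx => by
      rw [Fil_eq_Q, pow_zero, one_mul] at hx
      exact derivQ_zero a M M x hx
    exact ⟨h 0 _ hf.1, h 1 _ hf.1, h 2 _ hf.1⟩
  have hθ : derivθ f.re = 0 := congrArg (fun f : QPol => f.re) ha
  have hφ : derivφ f.re = 0 := congrArg (fun f : QPol => f.re) hb
  obtain ⟨c, hc⟩ := eq_const_of_lapP_eq_zero (f := f.re) (by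
    simp [lapP_apply, Fin.sum_univ_three, hre.1, hre.2.1, hre.2.2, hθ, hφ])
  have hin : ⟪(1 : QPol), f⟫ = c := by
    rw [QPol.inner_eq, star_one, one_mul, hc]
    exact mean_const c
  have i1 := congrArg (fun f : QPol => f.imI) hD
  have i2 := congrArg (fun f : QPol => f.imJ) hD
  have i3 := congrArg (fun f : QPol => f.imK) hD
  have i0 := congrArg (fun f : QPol => f.re) hD
  simp only [projOne_apply, hin, Quaternion.re_add, Quaternion.re_sub, Quaternion.re_neg,
    Quaternion.re_smul, opE_re, hc, Quaternion.re_one, Quaternion.re_zero] at i0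
  ext1
  · rw [hc]
    have e : algebraMap ℝ Pol (-c + 3 * s * c + 2 * (1 - s) * c) = 0 := by
      rw [← i0]; simp [Algebra.smul_def, map_ofNat]; ring
    have : (algebraMap ℝ Pol (-c + 3 * s * c + 2 * (1 - s) * c)) 1 = 0 := by rw [e]; rfl
    have : -c + 3 * s * c + 2 * (1 - s) * c = 0 := this
    have : (1 + s) * c = 0 := by linarith
    rw [(mul_eq_zero.1 this).resolve_left (by linarith)]; simp
  · exact zero_of _ (by simpa [opE_imI, projOne_apply] using i1)
  · exact zero_of _ (by simpa [opE_imJ, projOne_apply] using i2)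
  · exact zero_of _ (by simpa [opE_imK, projOne_apply] using i3)

end Deformation

section Injectivity
variable {M : ℕ} {m s : ℝ} {f : QPol}

theorem eq_zero_of_odd (hms : s = 0 ∨ m = 1 / 2) (ho : opPar f = -f)
    (ha : (opθ - m • opN) f = 0) (hD : dirPath s f = 0) : f = 0 := by
  rcases hms with rfl | rfl
  · have h1 : ⟪(1 : QPol), f⟫ = 0 := by
      have : ⟪(1 : QPol), opPar f⟫ = ⟪(1 : QPol), f⟫ := by
        conv_lhs => rw [← opJ_one]
        rw [opPar, Module.End.mul_apply, inner_opJ]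
        conv_lhs => rw [← opJ_one]
        rw [inner_opJ]
      rw [ho, inner_neg_right] at this
      linarith
    have h2 : dirQ f = 0 := by
      have : dirQ f - (0 : ℝ) • opE f + (2 * (1 - 0) : ℝ) • projOne f = 0 := hD
      rwa [projOne_apply, h1, zero_smul, zero_smul, smul_zero, add_zero, sub_zero] at this
    have := bddBelow_dirQ f
    rw [h2, norm_zero, one_mul] at this
    exact norm_le_zero_iff.1 this
  · have h := norm_sq_half_twist isSkew_opθ (commute_opN_of commute_opθ_opJ) norm_opN_le
      (compMap_kernel_decomp exists_kernel_decomp_θ) f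
    have e : opN f = opJ f := by
      rw [opN_apply, ho, map_neg]
      module
    rw [ha, e, norm_opJ, norm_zero] at h
    exact norm_le_zero_iff.1 (by nlinarith [norm_nonneg f])

theorem eq_zero_of_even (hs : 0 ≤ s) (hs1 : s < 1) (hf : f ∈ quatSub (Fil M M M))
    (he : opPar f = f) (hb : opφ f = 0) (ha : opθ f = 0) (hD : dirPath s f = 0) : f = 0 := by
  obtain ⟨f₀, h₀, f₁, rfl, ho⟩ := exists_orth_decomp (quatSub (Fil M M 0)) f
  have key : ∀ {A A' : Module.End ℝ QPol}, IsAdj A' A →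
      (∀ g ∈ quatSub (Fil M M 0), A g ∈ quatSub (Fil M M 0)) →
      (∀ g ∈ quatSub (Fil M M 0), A' g ∈ quatSub (Fil M M 0)) →
      A (f₀ + f₁) = 0 → A f₀ = 0 ∧ A f₁ = 0 := fun {A A'} hA h h' hz => by
    rw [map_add] at hz
    have h1 : ⟪A f₀, A f₁⟫ = 0 := by
      have e : ⟪A' (A f₀), f₁⟫ = ⟪A f₀, A f₁⟫ := hA _ _
      rw [← e]
      exact ho _ (h' _ (h _ h₀))
    have h2 : A f₀ = -A f₁ := eq_neg_of_add_eq_zero_left hz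
    rw [h2, inner_neg_left, neg_eq_zero, inner_self_eq_zero] at h1
    exact ⟨by rw [h2, h1, neg_zero], h1⟩
  have hf₁ : f₁ ∈ quatSub (Fil M M M) :=
    (Submodule.add_mem_iff_right _
      (quatSub_mono (Fil_mono le_rfl le_rfl (Nat.zero_le M)) h₀)).1 hf
  have he₁ : opPar f₁ = f₁ := by
    have h : opPar f₀ = f₀ := by
      rw [opPar, Module.End.mul_apply, opJ_of_mem h₀, opJ_of_mem h₀]
    rw [map_add, h] at he
    exact add_left_cancel he
  have hb' := key isSkew_opφ.symm (opφ_mem M M 0) (fun g hg => neg_mem (opφ_mem M M 0 g hg)) hb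
  have ha' := key isSkew_opθ.symm (opθ_mem M M 0) (fun g hg => neg_mem (opθ_mem M M 0 g hg)) ha
  have hD' := key (symm_dirPath s) (dirPath_mem s) (dirPath_mem s) hD
  have z₀ := eq_zero_of_const hs h₀ hb'.1 ha'.1 hD'.1
  have z₁ : f₁ = 0 := by
    have h1 : dirQ f₁ - s • opE f₁ + (2 * (1 - s)) • projOne f₁ = 0 := hD'.2
    rw [projOne_apply, ho 1 one_mem_quatSub, zero_smul, smul_zero, add_zero, sub_eq_zero] at h1
    have h2 := dirQ_lower hf₁ he₁ ho
    rw [h1, norm_smul, mul_pow, Real.norm_of_nonneg hs] at h2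
    have h3 := norm_opE_le f₁
    have h4 : s ^ 2 * ‖opE f₁‖ ^ 2 ≤ s ^ 2 * (9 * ‖f₁‖ ^ 2) := by gcongr
    have h5 : (1 - s ^ 2) * ‖f₁‖ ^ 2 ≤ 0 := by nlinarith
    have h6 : 0 < 1 - s ^ 2 := by nlinarith
    have h7 : ‖f₁‖ ^ 2 ≤ 0 := by
      by_contra hc
      push Not at hc
      nlinarith [mul_pos h6 hc]
    exact norm_eq_zero.1 (by nlinarith [norm_nonneg f₁])
  rw [z₀, z₁, add_zero]

theorem eq_zero_of_path (hs : s ∈ Icc (0 : ℝ) 1) (hms : s = 0 ∨ m = 1 / 2 ∨ s = 1)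
    (hf : f ∈ quatSub (Fil M M M)) (hb : opφ f = 0) (ha : (opθ - m • opN) f = 0)
    (hD : dirPath s f = 0) : f = 0 := by
  rcases hs.2.eq_or_lt with rfl | hs1
  · have h := bddBelow_dirQ' f
    have e : dirQ' f = 0 := by
      have h1 : dirQ f - (1 : ℝ) • opE f + (2 * (1 - 1) : ℝ) • projOne f = 0 := hD
      rwa [sub_self, mul_zero, zero_smul, add_zero, one_smul] at h1
    rw [e, norm_zero, one_mul] at h
    exact norm_le_zero_iff.1 h
  have hms : s = 0 ∨ m = 1 / 2 := by
    rcases hms with h | h | h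
    exacts [Or.inl h, Or.inr h, absurd h hs1.ne]
  have comm : ∀ {A : Module.End ℝ QPol}, Commute A opPar → A f = 0 → A (opPar f) = 0 :=
    fun {A} hA h => by
      have : A (opPar f) = opPar (A f) := congrArg (fun f' : Module.End ℝ QPol => f' f) hA.eq
      rw [this, h, map_zero]
  have cb := comm (commute_opPar_of commute_opφ_opJ) hb
  have cN : Commute opN opJ := (commute_opN_of (Commute.refl opJ)).symm
  have ca := comm (commute_opPar_of (commute_opθ_opJ.sub_left (cN.smul_left m))) ha
  have cD := comm (commute_opPar_of (commute_dirPath_opJ s)) hD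
  have ho : f - opPar f = 0 := eq_zero_of_odd hms
    (by rw [map_sub, opPar_opPar, neg_sub]) (by rw [map_sub, ha, ca, sub_zero])
    (by rw [map_sub, hD, cD, sub_zero])
  have he : opPar f = f := (sub_eq_zero.1 ho).symm
  refine eq_zero_of_even hs.1 hs1 hf he hb ?_ hD
  have hN : opN f = 0 := by rw [opN_apply, he, sub_self, smul_zero]
  have : opθ f - m • opN f = 0 := ha
  rwa [hN, smul_zero, sub_zero] at this

end Injectivity

section Contradiction

/-- The family of block operators joining the conjugated operator to a reflected one. -/
def fullOp (m s : ℝ) : Module.End ℝ (Dbl (Dbl (Dbl QPol))) :=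
  bmat (dia opS) 0 0 (bmat (-opS) 0 0 (-dirac opφ (opθ - m • opN) (dirPath s)))

theorem isSkew_diag {H : Type*} [NormedAddCommGroup H] [InnerProductSpace ℝ H]
    {A B : Module.End ℝ H} (hA : IsSkew A) (hB : IsSkew B) : IsSkew (bmat A 0 0 B) := by
  simpa using isSkew_bmat hA (IsAdj.zero (H := H)) hB

theorem isSkew_fullOp (m s : ℝ) : IsSkew (fullOp m s) :=
  isSkew_diag (isSkew_diag skew_opS skew_opS)
    (isSkew_diag skew_opS.neg (diracData_path m s).skew.neg)

theorem nondeg_of_injOn {H : Type*} [NormedAddCommGroup H] [InnerProductSpace ℝ H]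
    {V : Submodule ℝ H} {A : Module.End ℝ H} (hA : ∀ v ∈ V, A v ∈ V)
    (h : ∀ v ∈ V, A v = 0 → v = 0) : Nondeg (formOn V A) := fun v hv =>
  Subtype.ext (h v v.2 (inner_self_eq_zero.1 (hv ⟨A v, hA v v.2⟩)))

theorem dirac_mem {Y : Type*} [NormedAddCommGroup Y] [InnerProductSpace ℝ Y]
    {V : Submodule ℝ Y} {b a D : Module.End ℝ Y} (hb : ∀ v ∈ V, b v ∈ V)
    (ha : ∀ v ∈ V, a v ∈ V) (hD : ∀ v ∈ V, D v ∈ V) :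
    ∀ v ∈ dblSub V, dirac b a D v ∈ dblSub V :=
  bmat_mem_dblSub hb (fun v hv => sub_mem (ha v hv) (hD v hv))
    (fun v hv => add_mem (ha v hv) (hD v hv)) (fun v hv => neg_mem (hb v hv))

theorem opS_eq_zero {v : Dbl QPol} (h : opS v = 0) : v = 0 := by
  have := diracData.bddBelow bddBelow_dirQ v
  rw [show dirac opφ opθ dirQ v = 0 from h, norm_zero, one_mul] at this
  exact norm_le_zero_iff.1 this

theorem dirac_path_eq_zero {M : ℕ} {m s : ℝ} (hs : s ∈ Icc (0 : ℝ) 1)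
    (hms : s = 0 ∨ m = 1 / 2 ∨ s = 1) {v : Dbl QPol} (hv : v ∈ dblSub (quatSub (Fil M M M)))
    (h : dirac opφ (opθ - m • opN) (dirPath s) v = 0) : v = 0 := by
  have e := (diracData_path m s).norm_sq v
  rw [h, norm_zero] at e
  have z : ∀ g : QPol, ‖g‖ ^ 2 ≤ 0 → g = 0 := fun g hg =>
    norm_eq_zero.1 (by nlinarith [norm_nonneg g])
  have n := fun g : QPol => sq_nonneg ‖g‖
  have n1 := n (opφ v.fst)
  have n2 := n (opφ v.snd)
  have n3 := n ((opθ - m • opN) v.fst)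
  have n4 := n ((opθ - m • opN) v.snd)
  have n5 := n (dirPath s v.fst)
  have n6 := n (dirPath s v.snd)
  exact Dbl.ext'
    (eq_zero_of_path hs hms hv.1 (z _ (by linarith)) (z _ (by linarith)) (z _ (by linarith)))
    (eq_zero_of_path hs hms hv.2 (z _ (by linarith)) (z _ (by linarith)) (z _ (by linarith)))

theorem nondeg_fullOp {m s : ℝ} (hs : s ∈ Icc (0 : ℝ) 1) (hms : s = 0 ∨ m = 1 / 2 ∨ s = 1)
    (N : ℕ) : Nondeg (formOn (filtG.F N) (fullOp m s)) := by
  refine nondeg_of_injOn (V := dblSub (dblSub (dblSub (quatSub (Fil N N N))))) ?_ ?_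
  · have h1 : ∀ v ∈ dblSub (quatSub (Fil N N N)), opS v ∈ dblSub (quatSub (Fil N N N)) :=
      dirac_mem (opφ_mem N N N) (opθ_mem N N N) (dirQ_mem N N N)
    have h2 := dirac_mem (opφ_mem N N N)
      (a := opθ - m • opN) (fun v hv => sub_mem (opθ_mem N N N v hv)
        (Submodule.smul_mem _ _ (opN_mem v hv))) (dirPath_mem s)
    exact bmat_mem_dblSub (bmat_mem_dblSub h1 (by simp) (by simp) h1) (by simp) (by simp)
      (bmat_mem_dblSub (fun v hv => neg_mem (h1 v hv)) (by simp) (by simp)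
        (fun v hv => neg_mem (h2 v hv)))
  · intro v hv h
    have e1 : opS v.fst.fst = 0 := by
      simpa [fullOp, dia] using congrArg (fun w : Dbl (Dbl (Dbl QPol)) => w.fst.fst) h
    have e2 : opS v.fst.snd = 0 := by
      simpa [fullOp, dia] using congrArg (fun w : Dbl (Dbl (Dbl QPol)) => w.fst.snd) h
    have e3 : opS v.snd.fst = 0 := by
      simpa [fullOp, dia] using congrArg (fun w : Dbl (Dbl (Dbl QPol)) => w.snd.fst) h
    have e4 : dirac opφ (opθ - m • opN) (dirPath s) v.snd.snd = 0 := by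
      simpa [fullOp] using congrArg (fun w : Dbl (Dbl (Dbl QPol)) => w.snd.snd) h
    exact Dbl.ext' (Dbl.ext' (opS_eq_zero e1) (opS_eq_zero e2))
      (Dbl.ext' (opS_eq_zero e3) (dirac_path_eq_zero hs hms hv.2.2 e4))

theorem fullOp_segment (m s m' s' t : ℝ) : (1 - t) • fullOp m s + t • fullOp m' s' =
    fullOp ((1 - t) * m + t * m') ((1 - t) * s + t * s') := by
  ext v : 1
  apply Dbl.ext' <;> apply Dbl.ext' <;> apply Dbl.ext' <;>
    simp [fullOp, dia, dirac, dirPath] <;> module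

theorem cong_fullOp (N : ℕ) :
    Cong (formOn (filtG.F N) (fullOp 0 0)) (formOn (filtG.F N) (fullOp 0 1)) := by
  have leg : ∀ m s m' s' : ℝ, (∀ t ∈ Icc (0 : ℝ) 1,
      (1 - t) * s + t * s' ∈ Icc (0 : ℝ) 1 ∧ ((1 - t) * s + t * s' = 0 ∨
        (1 - t) * m + t * m' = 1 / 2 ∨ (1 - t) * s + t * s' = 1)) →
      Cong (formOn (filtG.F N) (fullOp m s)) (formOn (filtG.F N) (fullOp m' s')) :=
    fun m s m' s' h => filtG.cong_segment N (isSkew_fullOp m s) (isSkew_fullOp m' s')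
      fun t ht => by
        rw [fullOp_segment]
        exact nondeg_fullOp (h t ht).1 (h t ht).2 N
  refine (leg 0 0 (1 / 2) 0 fun t _ => ?_).trans
    ((leg (1 / 2) 0 (1 / 2) 1 fun t ht => ?_).trans (leg (1 / 2) 1 0 1 fun t _ => ?_))
  · exact ⟨by norm_num, Or.inl (by ring)⟩
  · exact ⟨by simpa using ht, Or.inr (Or.inl (by ring))⟩
  · exact ⟨by norm_num, Or.inr (Or.inr (by ring))⟩

/-- A unit vector in the last summand. -/
def lastUnit : Dbl (Dbl (Dbl QPol)) := Dbl.mk 0 (Dbl.mk 0 (Dbl.mk 1 0))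

theorem inner_lastUnit (v : Dbl (Dbl (Dbl QPol))) :
    ⟪lastUnit, v⟫ = ⟪(1 : QPol), v.snd.snd.fst⟫ := by
  simp [lastUnit]

/-- The reflection in the last unit vector. -/
def reflLast (v : Dbl (Dbl (Dbl QPol))) : Dbl (Dbl (Dbl QPol)) :=
  v + (-2 * ⟪lastUnit, v⟫) • lastUnit

theorem reflLast_eq (v : Dbl (Dbl (Dbl QPol))) : reflLast v = Dbl.mk v.fst
    (Dbl.mk v.snd.fst (Dbl.mk (v.snd.snd.fst - (2 : ℝ) • projOne v.snd.snd.fst)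
      v.snd.snd.snd)) := by
  rw [reflLast, inner_lastUnit]
  apply Dbl.ext'
  · simp [lastUnit]
  apply Dbl.ext'
  · simp [lastUnit]
  apply Dbl.ext'
  · simp [lastUnit, projOne_apply]
    module
  · simp [lastUnit]

theorem norm_lastUnit : ⟪lastUnit, lastUnit⟫ = 1 := by
  rw [inner_lastUnit]
  exact (real_inner_self_eq_norm_sq (1 : QPol)).trans norm_one_QPol

theorem inner_reflLast (u v : Dbl (Dbl (Dbl QPol))) : ⟪reflLast u, reflLast v⟫ = ⟪u, v⟫ := by
  simp only [reflLast, inner_add_left, inner_add_right, real_inner_smul_left,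
    real_inner_smul_right, norm_lastUnit, real_inner_comm lastUnit]
  ring

theorem fullOp_reflLast (v : Dbl (Dbl (Dbl QPol))) :
    fullOp 0 0 (reflLast v) = reflLast (gradOp (dia opS) v) := by
  have sk : ∀ {A : Module.End ℝ QPol}, IsSkew A → A 1 = 0 →
      ∀ f, A (projOne f) = 0 ∧ projOne (A f) = 0 := fun {A} hA h f => by
    have e : A (projOne f) = projOne (A f) :=
      congrArg (fun B : Module.End ℝ QPol => B f) (commute_projOne_of hA h).eq
    have e1 : A (projOne f) = 0 := by rw [projOne_apply, map_smul, h, smul_zero]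
    exact ⟨e1, by rw [← e, e1]⟩
  have hb := sk isSkew_opφ (compMap_deriv_one _)
  have ha := sk isSkew_opθ (compMap_deriv_one _)
  have hd1 : ∀ f, dirQ (projOne f) = -projOne f := fun f => by
    rw [projOne_apply, map_smul, dirQ_one, smul_neg]
  have hd2 : ∀ f, projOne (dirQ f) = -projOne f := fun f => by
    rw [projOne_apply, ← symm_dirQ, dirQ_one, inner_neg_left, neg_smul, projOne_apply]
  have hp : ∀ f, projOne (projOne f) = projOne f := fun f => by
    rw [projOne_apply f, map_smul, projOne_apply 1, real_inner_self_eq_norm_sq, norm_one_QPol,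
      one_smul]
  rw [reflLast_eq, reflLast_eq]
  apply Dbl.ext'
  · simp [fullOp, gradOp]
  apply Dbl.ext'
  · simp [fullOp, gradOp, dia]
  apply Dbl.ext'
  · simp [fullOp, gradOp, dia, opS, dirac, dirPath, hb, ha, hd2]
    module
  · simp [fullOp, gradOp, dia, opS, dirac, dirPath, ha, hd1, hp]
    module

theorem exists_reflection {H : Type*} [NormedAddCommGroup H] [InnerProductSpace ℝ H]
    {V : Submodule ℝ H} [FiniteDimensional ℝ V] {e : H} (he : e ∈ V) (h1 : ⟪e, e⟫ = 1) :
    ∃ R : V →ₗ[ℝ] V, LinearMap.det R = -1 ∧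
      ∀ v : V, ((R v : V) : H) = (v : H) + (-2 * ⟪e, (v : H)⟫) • e := by
  let φ : Module.Dual ℝ V := (-2 : ℝ) • (innerₗ H e ∘ₗ V.subtype)
  refine ⟨LinearMap.transvection φ ⟨e, he⟩, ?_, fun v => rfl⟩
  rw [LinearMap.transvection.det]
  change (1 : ℝ) + -2 * ⟪e, e⟫ = -1
  rw [h1]; norm_num

theorem lastUnit_mem (N : ℕ) : lastUnit ∈ filtG.F N := by
  change lastUnit ∈ dblSub (dblSub (dblSub (quatSub (Fil N N N))))
  exact ⟨zero_mem _, zero_mem _, one_mem_quatSub, zero_mem _⟩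

theorem not_rel_opS :
    ¬ filtG.Rel 0 (bmat 0 0 0 (bmat 0 0 0 (opS - dirac opφ opθ dirQ'))) := fun h => by
  obtain ⟨N, hN⟩ := h.exists
  have e1 : gradOp (dia opS) + bmat 0 0 0 (bmat 0 0 0 (opS - dirac opφ opθ dirQ')) =
      fullOp 0 1 := by
    ext v : 1
    apply Dbl.ext' <;> apply Dbl.ext' <;> apply Dbl.ext' <;>
      simp [fullOp, gradOp, dia, dirac, dirPath, dirQ', opS] <;> module
  rw [e1, add_zero] at hN
  obtain ⟨g, hg, hg'⟩ := (hN.trans (cong_fullOp N).symm)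
  obtain ⟨R, hdet, hR⟩ := exists_reflection (lastUnit_mem N) norm_lastUnit
  have hdet' : 0 < LinearMap.det (g ∘ₗ R) := by
    refine det_pos_of_preserves (formOn_skew (filtG.F N) filtG.skew) ?_ _ fun u v => ?_
    · have := nondeg_of_injOn (V := filtG.F N) (filtG.inv N) fun v _ h => ?_
      · exact this
      · have z : ∀ w : Dbl QPol, opS w = 0 → w = 0 := fun w => opS_eq_zero
        apply Dbl.ext' <;> apply Dbl.ext' <;> apply z
        · simpa [gradOp, dia] using congrArg (fun w : Dbl (Dbl (Dbl QPol)) => w.fst.fst) h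
        · simpa [gradOp, dia] using congrArg (fun w : Dbl (Dbl (Dbl QPol)) => w.fst.snd) h
        · simpa [gradOp, dia] using congrArg (fun w : Dbl (Dbl (Dbl QPol)) => w.snd.fst) h
        · simpa [gradOp, dia] using congrArg (fun w : Dbl (Dbl (Dbl QPol)) => w.snd.snd) h
    · rw [LinearMap.comp_apply, LinearMap.comp_apply, ← hg', formOn_apply, formOn_apply, hR, hR]
      exact (congrArg _ (fullOp_reflLast v)).trans (inner_reflLast _ _)
  rw [LinearMap.det_comp, hdet] at hdet'
  linarith

theorem not_qrel_clutch :
    ¬ QRel filtG (bmat (dia (mulL clutchQ)) 0 0 1) (bmat (dia (mulL (star clutchQ))) 0 0 1)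
      (bmat 1 0 0 1) (bmat 1 0 0 1) := fun h => not_rel_opS (rel_of_clutch h)

end Contradiction

end DiracOperators

section SphereMaps

open scoped Quaternion unitInterval

section Approximation

/-- Polynomial functions as continuous functions. -/
def polToCont : Pol →ₐ[ℝ] C(TorusQuat, ℝ) where
  toFun f := ⟨f, f.continuous⟩
  map_one' := rfl
  map_mul' _ _ := rfl
  map_zero' := rfl
  map_add' _ _ := rfl
  commutes' _ := rfl

theorem coord_separates {g h : TorusQuat} (H : ∀ i, coord i g = coord i h) : g = h := by
  refine Prod.ext (Subtype.ext (Complex.ext (H 0) (H 1)))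
    (Prod.ext (Subtype.ext (Complex.ext (H 2) (H 3))) (Subtype.ext ?_))
  exact Quaternion.ext _ _ (H 4) (H 5) (H 6) (H 7)

theorem exists_pol_near (f : C(TorusQuat, ℝ)) {ε : ℝ} (hε : 0 < ε) :
    ∃ p : Pol, ∀ g, |p g - f g| < ε := by
  obtain ⟨⟨_, p, rfl⟩, h⟩ := ContinuousMap.exists_mem_subalgebra_near_continuous_of_separatesPoints
    polToCont.range (fun g h hgh => by
      by_contra! hc
      refine hgh (coord_separates fun i => ?_)
      exact hc (coord i) ⟨polToCont (coord i), ⟨coord i, rfl⟩, rfl⟩) f f.continuous ε hε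
  exact ⟨p, h⟩

/-- Evaluation of a quaternion-valued polynomial. -/
def evalQ (q : QPol) (g : TorusQuat) : ℍ[ℝ] := qmk (q.re g) (q.imI g) (q.imJ g) (q.imK g)

theorem lenSq_apply (q : QPol) (g : TorusQuat) : lenSq q g = ‖evalQ q g‖ ^ 2 := by
  rw [sq, ← Quaternion.normSq_eq_norm_mul_self, Quaternion.normSq_def', lenSq_eq]
  simp [evalQ]; ring

theorem evalQ_segment (t : ℝ) (p q : QPol) (g : TorusQuat) :
    evalQ ((1 - t) • p + t • q) g = (1 - t) • evalQ p g + t • evalQ q g := by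
  ext <;> simp [evalQ]

theorem norm_le_of_components {q : ℍ[ℝ]} {ε : ℝ} (h1 : |q.re| ≤ ε) (h2 : |q.imI| ≤ ε)
    (h3 : |q.imJ| ≤ ε) (h4 : |q.imK| ≤ ε) : ‖q‖ ≤ 2 * ε := by
  have h0 : 0 ≤ ε := (abs_nonneg _).trans h1
  rw [← sq_le_sq₀ (norm_nonneg _) (by positivity), sq, ← Quaternion.normSq_eq_norm_mul_self,
    Quaternion.normSq_def']
  have := sq_le_sq' (abs_le.1 h1).1 (abs_le.1 h1).2
  have := sq_le_sq' (abs_le.1 h2).1 (abs_le.1 h2).2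
  have := sq_le_sq' (abs_le.1 h3).1 (abs_le.1 h3).2
  have := sq_le_sq' (abs_le.1 h4).1 (abs_le.1 h4).2
  nlinarith

theorem exists_qpol_near (f : C(TorusQuat, ℍ[ℝ])) {ε : ℝ} (hε : 0 < ε) :
    ∃ q : QPol, ∀ g, ‖evalQ q g - f g‖ ≤ ε := by
  have h : 0 < ε / 2 := by positivity
  obtain ⟨a, ha⟩ := exists_pol_near ⟨_, Quaternion.continuous_re.comp f.continuous⟩ h
  obtain ⟨b, hb⟩ := exists_pol_near ⟨_, Quaternion.continuous_imI.comp f.continuous⟩ h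
  obtain ⟨c, hc⟩ := exists_pol_near ⟨_, Quaternion.continuous_imJ.comp f.continuous⟩ h
  obtain ⟨d, hd⟩ := exists_pol_near ⟨_, Quaternion.continuous_imK.comp f.continuous⟩ h
  refine ⟨qmk a b c d, fun g => ?_⟩
  have := norm_le_of_components (q := evalQ (qmk a b c d) g - f g) (ε := ε / 2)
    (by simpa [evalQ] using (ha g).le) (by simpa [evalQ] using (hb g).le)
    (by simpa [evalQ] using (hc g).le) (by simpa [evalQ] using (hd g).le)
  linarith

/-- The coupling by a quaternion-valued polynomial. -/
abbrev clutchOp (q : QPol) : Module.End ℝ (Dbl (Dbl QPol)) := bmat (dia (mulL q)) 0 0 1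

/-- Couplings by two polynomials are equivalent. -/
def PolRel (p q : QPol) : Prop :=
  QRel filtG (clutchOp p) (clutchOp (star p)) (clutchOp q) (clutchOp (star q))

theorem clutchOp_segment (t : ℝ) (p q : QPol) :
    (1 - t) • clutchOp p + t • clutchOp q = clutchOp ((1 - t) • p + t • q) := by
  ext v : 1
  apply Dbl.ext' <;> apply Dbl.ext' <;> simp [clutchOp, dia, add_mul] <;> module

theorem bddBelow_clutchOp {c : ℝ} (hc : 0 < c) {q : QPol} (h : ∀ g, c ≤ ‖evalQ q g‖) :
    BddBelow' (min c 1) (clutchOp q) := by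
  have h1 : BddBelow' c (mulL q) := bddBelow_mulL hc.le fun g => by
    rw [lenSq_apply]; exact pow_le_pow_left₀ hc.le (h g) 2
  refine BddBelow'.diag (lt_min hc one_pos).le ((h1.diag hc.le h1).mono (min_le_left _ _))
    (BddBelow'.one.mono (min_le_right _ _))

theorem norm_evalQ_star (q : QPol) (g : TorusQuat) : ‖evalQ (star q) g‖ = ‖evalQ q g‖ := by
  rw [← sq_eq_sq₀ (norm_nonneg _) (norm_nonneg _), ← lenSq_apply, ← lenSq_apply, lenSq_star]

theorem polRel_of_segment {c : ℝ} (hc : 0 < c) {p q : QPol}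
    (h : ∀ t ∈ Icc (0 : ℝ) 1, ∀ g, c ≤ ‖(1 - t) • evalQ p g + t • evalQ q g‖) : PolRel p q := by
  have hb : ∀ t ∈ Icc (0 : ℝ) 1, ∀ g, c ≤ ‖evalQ ((1 - t) • p + t • q) g‖ := fun t ht g => by
    rw [evalQ_segment]; exact h t ht g
  refine QRel.of_segment (isSkew_dia skew_opS) ((goodOp_mulL p).blk .one)
    ((goodOp_mulL q).blk .one) (lt_min hc one_pos) (fun t ht => ?_) (fun t ht => ?_)
  · rw [clutchOp_segment]; exact bddBelow_clutchOp hc (hb t ht)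
  · rw [clutchOp_segment]
    refine bddBelow_clutchOp hc fun g => ?_
    have e : (1 - t) • star p + t • star q = star ((1 - t) • p + t • q) := by
      ext1 <;> simp [add_comm]
    rw [e, norm_evalQ_star]; exact hb t ht g

theorem polRel_of_near {δ : ℝ} (hδ : 0 < δ) {f : TorusQuat → ℍ[ℝ]} (hf : ∀ g, δ ≤ ‖f g‖)
    {p q : QPol} (hp : ∀ g, ‖evalQ p g - f g‖ ≤ δ / 2) (hq : ∀ g, ‖evalQ q g - f g‖ ≤ δ / 2) :
    PolRel p q := by
  refine polRel_of_segment (half_pos hδ) fun t ht g => ?_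
  have e : f g = ((1 - t) • evalQ p g + t • evalQ q g) -
      ((1 - t) • (evalQ p g - f g) + t • (evalQ q g - f g)) := by module
  have h1 : ‖(1 - t) • (evalQ p g - f g) + t • (evalQ q g - f g)‖ ≤ δ / 2 := by
    refine (norm_add_le _ _).trans ?_
    rw [norm_smul, norm_smul, Real.norm_of_nonneg ht.1, Real.norm_of_nonneg (sub_nonneg.2 ht.2)]
    nlinarith [hp g, hq g, ht.1, ht.2]
  have h2 := hf g
  rw [e] at h2
  linarith [norm_sub_le ((1 - t) • evalQ p g + t • evalQ q g)
    ((1 - t) • (evalQ p g - f g) + t • (evalQ q g - f g))]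

/-- A homotopy through nowhere vanishing maps gives equivalent couplings. -/
theorem polRel_of_homotopy {K : C(I × TorusQuat, ℍ[ℝ])} (hK : ∀ z, K z ≠ 0) {p q : QPol}
    (hp : ∀ g, evalQ p g = K (0, g)) (hq : ∀ g, evalQ q g = K (1, g)) : PolRel p q := by
  obtain ⟨δ, hδ, hlow⟩ : ∃ δ > 0, ∀ z, δ ≤ ‖K z‖ := by
    obtain ⟨z, -, hz⟩ := isCompact_univ.exists_isMinOn (univ_nonempty (α := I × TorusQuat))
      (K.continuous.norm.continuousOn)
    exact ⟨‖K z‖, norm_pos_iff.2 (hK z), fun w => hz (mem_univ w)⟩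
  have huc := CompactSpace.uniformContinuous_of_continuous K.continuous
  obtain ⟨η, hη, hKη⟩ := Metric.uniformContinuous_iff.1 huc (δ / 4) (by positivity)
  obtain ⟨n, hn⟩ := exists_nat_one_div_lt hη
  have happ : ∀ t : I, ∃ r : QPol, ∀ g, ‖evalQ r g - K (t, g)‖ ≤ δ / 4 := fun t =>
    exists_qpol_near (K.comp ⟨fun g => (t, g), by fun_prop⟩) (by positivity)
  let τ : ℕ → I := fun k => Set.projIcc 0 1 zero_le_one ((k : ℝ) / (n + 1))
  have hstep : ∀ k g, ‖K (τ (k + 1), g) - K (τ k, g)‖ ≤ δ / 4 := fun k g => by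
    rw [← dist_eq_norm]
    refine (hKη ?_).le
    rw [Prod.dist_eq, dist_self, max_eq_left dist_nonneg]
    refine lt_of_le_of_lt ((LipschitzWith.projIcc zero_le_one).dist_le_mul _ _) ?_
    rw [NNReal.coe_one, one_mul, Real.dist_eq, ← sub_div, Nat.cast_succ, add_sub_cancel_left,
      abs_of_pos (by positivity)]
    exact hn
  have chain : ∀ k, ∀ r : QPol, (∀ g, ‖evalQ r g - K (τ k, g)‖ ≤ δ / 4) → PolRel p r := by
    intro k
    induction k with
    | zero =>
      intro r hr
      have h0 : τ 0 = 0 := by simp [τ]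
      rw [h0] at hr
      refine polRel_of_near hδ (fun g => hlow (0, g)) (fun g => ?_) fun g =>
        (hr g).trans (by linarith)
      rw [hp, sub_self, norm_zero]; positivity
    | succ k ih =>
      intro r hr
      obtain ⟨r', hr'⟩ := happ (τ k)
      refine (ih r' hr').trans (polRel_of_near hδ (fun g => hlow (τ k, g))
        (fun g => (hr' g).trans (by linarith)) fun g => ?_)
      linarith [norm_sub_le_norm_sub_add_norm_sub (evalQ r g) (K (τ (k + 1), g)) (K (τ k, g)),
        hr g, hstep k g]
  refine chain (n + 1) q fun g => ?_
  have h1 : τ (n + 1) = 1 := by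
    simp only [τ]
    rw [Nat.cast_succ, div_self (by positivity)]
    exact Set.projIcc_of_right_le (zero_le_one' ℝ) le_rfl
  rw [h1, hq, sub_self, norm_zero]; positivity

end Approximation

section ClutchingMap

/-- Rotation of the second complex coordinate of a quaternion. -/
def rotH (c : ℂ) (q : ℍ[ℝ]) : ℍ[ℝ] :=
  qmk q.re q.imI (c.re * q.imJ - c.im * q.imK) (c.re * q.imK + c.im * q.imJ)

/-- The iterated commutator-type map. -/
def clutch (c d : ℂ) (x : ℍ[ℝ]) : ℍ[ℝ] :=
  rotH d (star (x * rotH c (star x))) * (x * rotH c (star x))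

theorem evalQ_mul (p q : QPol) (g : TorusQuat) : evalQ (p * q) g = evalQ p g * evalQ q g := by
  ext <;> simp [evalQ]

theorem evalQ_star (p : QPol) (g : TorusQuat) : evalQ (star p) g = star (evalQ p g) := by
  ext <;> simp [evalQ]

theorem evalQ_rotθ (p : QPol) (g : TorusQuat) : evalQ (rotθ p) g = rotH g.1 (evalQ p g) := by
  ext <;> simp [evalQ, rotθ, rotQ, rotH, coord_apply, coordFun]

theorem evalQ_rotφ (p : QPol) (g : TorusQuat) : evalQ (rotφ p) g = rotH g.2.1 (evalQ p g) := by
  ext <;> simp [evalQ, rotφ, rotQ, rotH, coord_apply, coordFun]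

theorem evalQ_unitQ (g : TorusQuat) : evalQ unitQ g = g.2.2 := by
  ext <;> simp [evalQ, unitQ, coord_apply, coordFun]

theorem evalQ_clutchQ (g : TorusQuat) : evalQ clutchQ g = clutch g.1 g.2.1 g.2.2 := by
  rw [clutchQ, evalQ_mul, evalQ_rotφ, evalQ_star, innerQ, evalQ_mul, evalQ_rotθ, evalQ_star,
    evalQ_unitQ, clutch]

theorem clutch_one : clutch 1 1 1 = 1 := by
  have h : rotH 1 1 = 1 := by ext <;> simp [rotH]
  rw [clutch, star_one, h, mul_one, star_one, h, mul_one]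

theorem clutch_not_null {K : C(I × TorusQuat, ℍ[ℝ])} (hK : ∀ z, K z ≠ 0)
    (h0 : ∀ g, K (0, g) = clutch g.1 g.2.1 g.2.2) (h1 : ∀ g, K (1, g) = K (1, 1)) : False := by
  let K' : C(I × TorusQuat, ℍ[ℝ]) := ⟨fun z => K z * (K (z.1, 1))⁻¹, K.continuous.mul
    (Continuous.inv₀ (by fun_prop) fun z => hK _)⟩
  have h := polRel_of_homotopy (K := K') (p := clutchQ) (q := 1)
    (fun z => mul_ne_zero (hK z) (inv_ne_zero (hK _))) (fun g => ?_) (fun g => ?_)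
  · unfold PolRel at h
    refine not_qrel_clutch ?_
    have e : clutchOp 1 = bmat 1 0 0 1 := by rw [clutchOp, dia_mulL_one]
    rwa [star_one, e] at h
  · change _ = K (0, g) * (K (0, 1))⁻¹
    rw [evalQ_clutchQ, h0, h0 1]
    have : clutch ((1 : TorusQuat).1) ((1 : TorusQuat).2.1) ((1 : TorusQuat).2.2) = 1 := by
      simpa using clutch_one
    rw [this, inv_one, mul_one]
  · change _ = K (1, g) * (K (1, 1))⁻¹
    rw [h1 g, mul_inv_cancel₀ (hK _)]
    ext <;> simp [evalQ]

end ClutchingMap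

section ClutchFormula

/-- The imaginary unit `i` and the embedding of complex numbers in the quaternions. -/
def embC (u : ℂ) : ℍ[ℝ] := qmk u.re u.im 0 0

theorem rotH_mul {d : ℂ} (hd : ‖d‖ = 1) (p q : ℍ[ℝ]) : rotH d (p * q) = rotH d p * rotH d q := by
  have h : d.re * d.re + d.im * d.im = 1 := by
    have := Complex.sq_norm d
    rw [hd, Complex.normSq_apply] at this; linarith
  ext
  · simp [rotH]; linear_combination (p.imJ * q.imJ + p.imK * q.imK) * h
  · simp [rotH]; linear_combination (p.imK * q.imJ - p.imJ * q.imK) * h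
  · simp [rotH]; ring
  · simp [rotH]; ring

theorem rotH_one (d : ℂ) : rotH d 1 = 1 := by ext <;> simp [rotH]

theorem rotH_embC (d u : ℂ) : rotH d (embC u) = embC u := by ext <;> simp [rotH, embC]

theorem norm_rotH {d : ℂ} (hd : ‖d‖ = 1) (q : ℍ[ℝ]) : ‖rotH d q‖ = ‖q‖ := by
  have h : d.re * d.re + d.im * d.im = 1 := by
    have := Complex.sq_norm d
    rw [hd, Complex.normSq_apply] at this; linarith
  rw [← sq_eq_sq₀ (norm_nonneg _) (norm_nonneg _), sq, sq, ← Quaternion.normSq_eq_norm_mul_self,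
    ← Quaternion.normSq_eq_norm_mul_self, Quaternion.normSq_def', Quaternion.normSq_def']
  simp only [rotH, qmk_re, qmk_imI, qmk_imJ, qmk_imK]
  linear_combination (q.imJ * q.imJ + q.imK * q.imK) * h

theorem qmk_eq_smul (a b c d : ℝ) : (qmk a b c d : ℍ[ℝ]) =
    a • qmk 1 0 0 0 + b • qmk 0 1 0 0 + c • qmk 0 0 1 0 + d • qmk 0 0 0 1 := by
  ext <;> simp

theorem Continuous.qmk {X : Type*} [TopologicalSpace X] {a b c d : X → ℝ} (ha : Continuous a)
    (hb : Continuous b) (hc : Continuous c) (hd : Continuous d) :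
    Continuous fun x => (_root_.qmk (a x) (b x) (c x) (d x) : ℍ[ℝ]) := by
  have e : (fun x => (_root_.qmk (a x) (b x) (c x) (d x) : ℍ[ℝ])) = fun x =>
    a x • _root_.qmk 1 0 0 0 + b x • _root_.qmk 0 1 0 0 + c x • _root_.qmk 0 0 1 0 +
      d x • _root_.qmk 0 0 0 1 := funext fun x => qmk_eq_smul _ _ _ _
  rw [e]; fun_prop

theorem continuous_rotH : Continuous fun p : ℂ × ℍ[ℝ] => rotH p.1 p.2 := by
  have h0 : Continuous fun p : ℂ × ℍ[ℝ] => p.2.re := Quaternion.continuous_re.comp continuous_snd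
  have h1 : Continuous fun p : ℂ × ℍ[ℝ] => p.2.imI := Quaternion.continuous_imI.comp continuous_snd
  have h2 : Continuous fun p : ℂ × ℍ[ℝ] => p.2.imJ := Quaternion.continuous_imJ.comp continuous_snd
  have h3 : Continuous fun p : ℂ × ℍ[ℝ] => p.2.imK := Quaternion.continuous_imK.comp continuous_snd
  simp only [rotH]
  have h4 : Continuous fun p : ℂ × ℍ[ℝ] => p.1.re := Complex.continuous_re.comp continuous_fst
  have h5 : Continuous fun p : ℂ × ℍ[ℝ] => p.1.im := Complex.continuous_im.comp continuous_fst
  exact h0.qmk h1 ((h4.mul h2).sub (h5.mul h3)) ((h4.mul h3).add (h5.mul h2))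

/-- The clutching map in terms of the image of the Hopf map. -/
def hopfClutch (c d : ℂ) (v : ℍ[ℝ]) : ℍ[ℝ] :=
  ((1 + c.re) / 2) • 1 + (c.im / 2) • (v - rotH d v) - ((1 - c.re) / 2) • (rotH d v * v)

/-- The Hopf map. -/
def hopf (x : ℍ[ℝ]) : ℍ[ℝ] := x * embC Complex.I * star x

theorem exists_sqrt_circle {c : ℂ} (hc : ‖c‖ = 1) : ∃ u : ℂ, u.re ^ 2 + u.im ^ 2 = 1 ∧
    c.re = u.re ^ 2 - u.im ^ 2 ∧ c.im = 2 * u.re * u.im := by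
  obtain ⟨u, hu⟩ := IsAlgClosed.exists_pow_nat_eq c (n := 2) (by norm_num)
  have h1 : ‖u‖ = 1 := by
    have : ‖u‖ ^ 2 = 1 := by rw [← norm_pow, hu, hc]
    exact (pow_eq_one_iff_of_nonneg (norm_nonneg _) two_ne_zero).1 this
  refine ⟨u, ?_, ?_, ?_⟩
  · have := Complex.sq_norm u
    rw [h1, Complex.normSq_apply] at this; linarith
  · rw [← hu, sq, Complex.mul_re]; ring
  · rw [← hu, sq, Complex.mul_im]; ring

theorem hopfClutch_eq {u c : ℂ} (h : u.re ^ 2 + u.im ^ 2 = 1) (h1 : c.re = u.re ^ 2 - u.im ^ 2)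
    (h2 : c.im = 2 * u.re * u.im) (d : ℂ) (v : ℍ[ℝ]) :
    hopfClutch c d v = (u.re • 1 - u.im • rotH d v) * (u.re • 1 + u.im • v) := by
  have e1 : (1 + c.re) / 2 = u.re ^ 2 := by linarith
  have e2 : (1 - c.re) / 2 = u.im ^ 2 := by linarith
  have e3 : c.im / 2 = u.re * u.im := by linarith
  rw [hopfClutch, e1, e2, e3]
  simp only [sub_mul, mul_add, smul_mul_assoc, mul_smul_comm, one_mul, mul_one]
  module

theorem norm_add_imag {v : ℍ[ℝ]} (hv : ‖v‖ = 1) (hre : v.re = 0) {a b : ℝ}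
    (h : a ^ 2 + b ^ 2 = 1) : ‖a • (1 : ℍ[ℝ]) + b • v‖ = 1 := by
  have hv' : v.imI ^ 2 + v.imJ ^ 2 + v.imK ^ 2 = 1 := by
    have := Quaternion.normSq_eq_norm_mul_self v
    rw [hv, Quaternion.normSq_def', hre] at this; linarith
  rw [← sq_eq_sq₀ (norm_nonneg _) zero_le_one, sq, ← Quaternion.normSq_eq_norm_mul_self,
    Quaternion.normSq_def']
  simp [hre]
  linear_combination h + b ^ 2 * hv'

theorem norm_hopfClutch {c d : ℂ} {v : ℍ[ℝ]} (hc : ‖c‖ = 1) (hd : ‖d‖ = 1) (hv : ‖v‖ = 1)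
    (hre : v.re = 0) : ‖hopfClutch c d v‖ = 1 := by
  obtain ⟨u, h, h1, h2⟩ := exists_sqrt_circle hc
  rw [hopfClutch_eq h h1 h2, norm_mul, norm_add_imag hv hre h, mul_one, sub_eq_add_neg, ← neg_smul]
  exact norm_add_imag ((norm_rotH hd v).trans hv) (by simpa [rotH] using hre) (by linarith)

theorem mul_self_imag {v : ℍ[ℝ]} (hv : ‖v‖ = 1) (hre : v.re = 0) : v * v = -1 := by
  have hv' : v.imI ^ 2 + v.imJ ^ 2 + v.imK ^ 2 = 1 := by
    have := Quaternion.normSq_eq_norm_mul_self v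
    rw [hv, Quaternion.normSq_def', hre] at this; linarith
  ext
  · simp [hre]; linear_combination -hv'
  all_goals simp [hre]; try ring

theorem hopfClutch_one_left (d : ℂ) (v : ℍ[ℝ]) : hopfClutch 1 d v = 1 := by
  simp [hopfClutch]

theorem hopfClutch_of_fixed {c d : ℂ} {v : ℍ[ℝ]} (hv : ‖v‖ = 1) (hre : v.re = 0)
    (hf : rotH d v = v) : hopfClutch c d v = 1 := by
  rw [hopfClutch, hf, mul_self_imag hv hre, sub_self, smul_zero, add_zero, smul_neg, sub_neg_eq_add,
    ← add_smul]
  rw [show (1 + c.re) / 2 + (1 - c.re) / 2 = 1 by ring, one_smul]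

theorem rotH_one_left (v : ℍ[ℝ]) : rotH 1 v = v := by ext <;> simp [rotH]

theorem norm_embC (u : ℂ) : ‖embC u‖ = ‖u‖ := by
  rw [← sq_eq_sq₀ (norm_nonneg _) (norm_nonneg _), sq, ← Quaternion.normSq_eq_norm_mul_self,
    Quaternion.normSq_def', Complex.sq_norm, Complex.normSq_apply]
  simp [embC]; ring

theorem norm_hopf {x : ℍ[ℝ]} (hx : ‖x‖ = 1) : ‖hopf x‖ = 1 := by
  rw [hopf, norm_mul, norm_mul, norm_star, hx, norm_embC, Complex.norm_I]; norm_num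

theorem hopf_re (x : ℍ[ℝ]) : (hopf x).re = 0 := by simp [hopf, embC]; ring

theorem rotH_clutch {c d : ℂ} (hc : ‖c‖ = 1) (hd : ‖d‖ = 1) {x : ℍ[ℝ]} (hx : ‖x‖ = 1) :
    rotH c (hopfClutch c d (hopf x)) = clutch c d x := by
  obtain ⟨u, h, h1, h2⟩ := exists_sqrt_circle hc
  have hrot : ∀ q, rotH c q = embC u * q * star (embC u) := fun q => by
    ext
    · simp [rotH, embC]; linear_combination -q.re * h
    · simp [rotH, embC]; linear_combination -q.imI * h
    · simp [rotH, embC, h1, h2]; ring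
    · simp [rotH, embC, h1, h2]; ring
  have hxx : x * star x = 1 := by
    rw [Quaternion.self_mul_star, Quaternion.normSq_eq_norm_mul_self, hx]; simp
  have hU : embC u = u.re • 1 + u.im • embC Complex.I := by ext <;> simp [embC]
  have hE : x * embC u * star x = u.re • 1 + u.im • hopf x := by
    rw [hU, mul_add, add_mul, mul_smul_comm, mul_one, smul_mul_assoc, hxx, mul_smul_comm,
      smul_mul_assoc, hopf]
  have hs : star (hopf x) = -hopf x := by
    ext <;> simp [hopf_re]
  have hlin : ∀ (a b : ℝ) (p q : ℍ[ℝ]), rotH d (a • p + b • q) = a • rotH d p + b • rotH d q :=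
    fun a b p q => by ext <;> simp [rotH] <;> ring
  have hk : x * rotH c (star x) = (u.re • 1 + u.im • hopf x) * star (embC u) := by
    rw [hrot, ← hE]; simp only [mul_assoc]
  rw [clutch, hk, star_mul, star_star, rotH_mul hd, rotH_embC, hrot, hopfClutch_eq h h1 h2]
  have e : rotH d (star (u.re • 1 + u.im • hopf x)) = u.re • 1 - u.im • rotH d (hopf x) := by
    rw [star_add, Quaternion.star_smul, Quaternion.star_smul, star_one, hs, smul_neg, ← neg_smul,
      hlin, rotH_one, neg_smul, sub_eq_add_neg]
  rw [e]
  simp only [mul_assoc]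

end ClutchFormula

section Gadgets

/-- The scale of the support of the clutching data. -/
def cutDelta : ℝ := 1 / 400

/-- A smooth cutoff, positive exactly on `(-δ, δ)`. -/
def cutPhase (t : ℝ) : ℝ := Real.smoothTransition (cutDelta ^ 2 - t ^ 2)

theorem phase_den_pos (t : ℝ) : 0 < t ^ 2 + cutPhase t ^ 2 := by
  rcases eq_or_ne t 0 with rfl | h
  · have : 0 < cutPhase 0 := Real.smoothTransition.pos_of_pos (by norm_num [cutDelta])
    positivity
  · positivity

/-- A smooth loop `ℝ → S¹` of degree one, constant outside `(-δ, δ)`. -/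
def phase (t : ℝ) : ℂ :=
  ⟨(t ^ 2 - cutPhase t ^ 2) / (t ^ 2 + cutPhase t ^ 2),
    2 * t * cutPhase t / (t ^ 2 + cutPhase t ^ 2)⟩

theorem norm_phase (t : ℝ) : ‖phase t‖ = 1 := by
  rw [← sq_eq_sq₀ (norm_nonneg _) zero_le_one, Complex.sq_norm, Complex.normSq_apply, phase]
  have := (phase_den_pos t).ne'
  field_simp
  ring

theorem phase_of_le {t : ℝ} (h : cutDelta ≤ |t|) : phase t = 1 := by
  have h0 : cutPhase t = 0 := Real.smoothTransition.zero_of_nonpos (by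
    rw [sub_nonpos, ← sq_abs t]
    exact pow_le_pow_left₀ (by norm_num [cutDelta]) h 2)
  have ht : t ≠ 0 := by
    rintro rfl
    norm_num [cutDelta] at h
  refine Complex.ext ?_ ?_
  · simp [phase, h0, ht]
  · simp [phase, h0]

theorem phase_zero : phase 0 = -1 := by
  have : cutPhase 0 ≠ 0 := (Real.smoothTransition.pos_of_pos (by norm_num [cutDelta])).ne'
  refine Complex.ext ?_ ?_
  · simp [phase, this]
  · simp [phase]

theorem phase_im_mul_nonneg (t : ℝ) : 0 ≤ (phase t).im * t := by
  have h : 0 ≤ cutPhase t := Real.smoothTransition.nonneg _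
  have e : (phase t).im * t = 2 * t ^ 2 * cutPhase t / (t ^ 2 + cutPhase t ^ 2) := by
    simp only [phase]; ring
  rw [e]; positivity

theorem contDiff_cutPhase : ContDiff ℝ 1 cutPhase := by
  unfold cutPhase
  exact (Real.smoothTransition.contDiff (n := 1)).comp (by fun_prop)

theorem contDiff_phase_re : ContDiff ℝ 1 fun t => (phase t).re := by
  have := contDiff_cutPhase
  simp only [phase]
  exact ContDiff.div (by fun_prop) (by fun_prop) fun t => (phase_den_pos t).ne'

theorem contDiff_phase_im : ContDiff ℝ 1 fun t => (phase t).im := by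
  have := contDiff_cutPhase
  simp only [phase]
  exact ContDiff.div (by fun_prop) (by fun_prop) fun t => (phase_den_pos t).ne'

/-- A smooth map from imaginary to nonzero quaternions, real outside a small ball. -/
def bubble (a b c : ℝ) : ℍ[ℝ] :=
  let n := a ^ 2 + b ^ 2 + c ^ 2
  let k := Real.smoothTransition (cutDelta - n)
  qmk (n - cutDelta / 2) (k * a) (k * b) (k * c)

theorem bubble_ne_zero (a b c : ℝ) : bubble a b c ≠ 0 := by
  intro h
  have h0 := congrArg (·.re) h
  have h1 := congrArg (·.imI) h
  have h2 := congrArg (·.imJ) h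
  have h3 := congrArg (·.imK) h
  simp only [bubble, qmk_re, qmk_imI, qmk_imJ, qmk_imK, Quaternion.re_zero, Quaternion.imI_zero,
    Quaternion.imJ_zero, Quaternion.imK_zero] at h0 h1 h2 h3
  have hn : a ^ 2 + b ^ 2 + c ^ 2 = cutDelta / 2 := by linarith
  have hk : 0 < Real.smoothTransition (cutDelta - (a ^ 2 + b ^ 2 + c ^ 2)) :=
    Real.smoothTransition.pos_of_pos (by rw [hn]; norm_num [cutDelta])
  have e1 := (mul_eq_zero.1 h1).resolve_left hk.ne'
  have e2 := (mul_eq_zero.1 h2).resolve_left hk.ne'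
  have e3 := (mul_eq_zero.1 h3).resolve_left hk.ne'
  rw [e1, e2, e3] at hn
  norm_num [cutDelta] at hn

/-- The normalised bubble. -/
def bubbleU (a b c : ℝ) : ℍ[ℝ] := ‖bubble a b c‖⁻¹ • bubble a b c

theorem norm_bubbleU (a b c : ℝ) : ‖bubbleU a b c‖ = 1 := by
  rw [bubbleU, norm_smul, norm_inv, norm_norm, inv_mul_cancel₀]
  exact norm_ne_zero_iff.2 (bubble_ne_zero a b c)

theorem norm_qmk_real (t : ℝ) : ‖(qmk t 0 0 0 : ℍ[ℝ])‖ = |t| := by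
  rw [← Real.norm_eq_abs, ← Quaternion.norm_coe]
  congr 1

theorem bubbleU_of_le {a b c : ℝ} (h : cutDelta ≤ a ^ 2 + b ^ 2 + c ^ 2) : bubbleU a b c = 1 := by
  have hk : Real.smoothTransition (cutDelta - (a ^ 2 + b ^ 2 + c ^ 2)) = 0 :=
    Real.smoothTransition.zero_of_nonpos (by linarith)
  have hd : 0 < cutDelta := by norm_num [cutDelta]
  have e : bubble a b c = qmk (a ^ 2 + b ^ 2 + c ^ 2 - cutDelta / 2) 0 0 0 := by
    ext <;> simp [bubble, hk]
  have hp : 0 < a ^ 2 + b ^ 2 + c ^ 2 - cutDelta / 2 := by linarith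
  rw [bubbleU, e, norm_qmk_real, abs_of_pos hp]
  ext <;> simp [hp.ne']

theorem bubbleU_zero : bubbleU 0 0 0 = -1 := by
  have e : bubble 0 0 0 = qmk (-(cutDelta / 2)) 0 0 0 := by
    ext <;> simp [bubble]
  have hd : 0 < cutDelta := by norm_num [cutDelta]
  rw [bubbleU, e, norm_qmk_real, abs_neg, abs_of_pos (half_pos hd)]
  ext <;> simp [hd.ne']

theorem exists_bubbleU_im (a b c : ℝ) : ∃ r : ℝ, 0 ≤ r ∧ (bubbleU a b c).imI = r * a ∧
    (bubbleU a b c).imJ = r * b ∧ (bubbleU a b c).imK = r * c := by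
  refine ⟨‖bubble a b c‖⁻¹ * Real.smoothTransition (cutDelta - (a ^ 2 + b ^ 2 + c ^ 2)),
    mul_nonneg (by positivity) (Real.smoothTransition.nonneg _), ?_, ?_, ?_⟩ <;>
  simp [bubbleU, bubble, mul_assoc]

theorem ContDiff.qmk {X : Type*} [NormedAddCommGroup X] [NormedSpace ℝ X] {a b c d : X → ℝ}
    (ha : ContDiff ℝ 1 a) (hb : ContDiff ℝ 1 b) (hc : ContDiff ℝ 1 c) (hd : ContDiff ℝ 1 d) :
    ContDiff ℝ 1 fun x => (_root_.qmk (a x) (b x) (c x) (d x) : ℍ[ℝ]) := by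
  have e : (fun x => (_root_.qmk (a x) (b x) (c x) (d x) : ℍ[ℝ])) = fun x =>
    a x • _root_.qmk 1 0 0 0 + b x • _root_.qmk 0 1 0 0 + c x • _root_.qmk 0 0 1 0 +
      d x • _root_.qmk 0 0 0 1 := funext fun x => qmk_eq_smul _ _ _ _
  rw [e]; fun_prop

theorem contDiff_quat_re : ContDiff ℝ 1 fun q : ℍ[ℝ] => q.re :=
  (LinearMap.toContinuousLinearMap (⟨⟨fun q : ℍ[ℝ] => q.re, fun _ _ => rfl⟩, fun _ _ => by simp⟩ :
    ℍ[ℝ] →ₗ[ℝ] ℝ)).contDiff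

theorem contDiff_quat_imI : ContDiff ℝ 1 fun q : ℍ[ℝ] => q.imI :=
  (LinearMap.toContinuousLinearMap (⟨⟨fun q : ℍ[ℝ] => q.imI, fun _ _ => rfl⟩, fun _ _ => by simp⟩ :
    ℍ[ℝ] →ₗ[ℝ] ℝ)).contDiff

theorem contDiff_quat_imJ : ContDiff ℝ 1 fun q : ℍ[ℝ] => q.imJ :=
  (LinearMap.toContinuousLinearMap (⟨⟨fun q : ℍ[ℝ] => q.imJ, fun _ _ => rfl⟩, fun _ _ => by simp⟩ :
    ℍ[ℝ] →ₗ[ℝ] ℝ)).contDiff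

theorem contDiff_quat_imK : ContDiff ℝ 1 fun q : ℍ[ℝ] => q.imK :=
  (LinearMap.toContinuousLinearMap (⟨⟨fun q : ℍ[ℝ] => q.imK, fun _ _ => rfl⟩, fun _ _ => by simp⟩ :
    ℍ[ℝ] →ₗ[ℝ] ℝ)).contDiff

theorem contDiff_bubble : ContDiff ℝ 1 fun p : ℝ × ℝ × ℝ => bubble p.1 p.2.1 p.2.2 := by
  have h : ContDiff ℝ 1 fun p : ℝ × ℝ × ℝ =>
      Real.smoothTransition (cutDelta - (p.1 ^ 2 + p.2.1 ^ 2 + p.2.2 ^ 2)) :=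
    (Real.smoothTransition.contDiff (n := 1)).comp (by fun_prop)
  simp only [bubble]
  exact ContDiff.qmk (by fun_prop) (by fun_prop) (by fun_prop) (by fun_prop)

theorem contDiff_bubbleU : ContDiff ℝ 1 fun p : ℝ × ℝ × ℝ => bubbleU p.1 p.2.1 p.2.2 := by
  simp only [bubbleU]
  exact ((contDiff_bubble.norm ℝ fun p => bubble_ne_zero _ _ _).inv fun p =>
    norm_ne_zero_iff.2 (bubble_ne_zero _ _ _)).smul contDiff_bubble

theorem contDiff_hopf : ContDiff ℝ 1 hopf := by
  have : ContDiff ℝ 1 fun x : ℍ[ℝ] => star x := by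
    have e : (fun x : ℍ[ℝ] => star x) = fun x => qmk x.re (-x.imI) (-x.imJ) (-x.imK) := by
      funext x; ext <;> simp
    rw [e]
    exact contDiff_quat_re.qmk contDiff_quat_imI.neg contDiff_quat_imJ.neg contDiff_quat_imK.neg
  unfold hopf
  fun_prop

/-- The Hopf image of the bubble. -/
def bubbleS (a b c : ℝ) : ℍ[ℝ] := hopf (bubbleU a b c)

theorem contDiff_bubbleS : ContDiff ℝ 1 fun p : ℝ × ℝ × ℝ => bubbleS p.1 p.2.1 p.2.2 :=
  contDiff_hopf.comp contDiff_bubbleU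

theorem ContDiff.hopfClutch {X : Type*} [NormedAddCommGroup X] [NormedSpace ℝ X] {c d : X → ℂ}
    {v : X → ℍ[ℝ]} (hc : ContDiff ℝ 1 fun x => (c x).re) (hc' : ContDiff ℝ 1 fun x => (c x).im)
    (hd : ContDiff ℝ 1 fun x => (d x).re) (hd' : ContDiff ℝ 1 fun x => (d x).im)
    (hv : ContDiff ℝ 1 v) : ContDiff ℝ 1 fun x => _root_.hopfClutch (c x) (d x) (v x) := by
  have h0 := contDiff_quat_re.comp hv
  have h1 := contDiff_quat_imI.comp hv
  have h2 := contDiff_quat_imJ.comp hv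
  have h3 := contDiff_quat_imK.comp hv
  have hr : ContDiff ℝ 1 fun x => rotH (d x) (v x) :=
    h0.qmk h1 ((hd.mul h2).sub (hd'.mul h3)) ((hd.mul h3).add (hd'.mul h2))
  simp only [_root_.hopfClutch]
  fun_prop

/-- The clutching map in terms of the core coordinates. -/
def coreMap (r s a b c : ℝ) : ℍ[ℝ] := hopfClutch (phase r) (phase s) (bubbleS a b c)

theorem norm_bubbleS (a b c : ℝ) : ‖bubbleS a b c‖ = 1 := norm_hopf (norm_bubbleU a b c)

theorem bubbleS_re (a b c : ℝ) : (bubbleS a b c).re = 0 := hopf_re _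

theorem norm_coreMap (r s a b c : ℝ) : ‖coreMap r s a b c‖ = 1 :=
  norm_hopfClutch (norm_phase _) (norm_phase _) (norm_bubbleS _ _ _) (bubbleS_re _ _ _)

theorem coreMap_of_fst {r s a b c : ℝ} (h : cutDelta ≤ |r|) : coreMap r s a b c = 1 := by
  rw [coreMap, phase_of_le h, hopfClutch_one_left]

theorem coreMap_of_snd {r s a b c : ℝ} (h : cutDelta ≤ |s|) : coreMap r s a b c = 1 := by
  rw [coreMap, phase_of_le h]
  exact hopfClutch_of_fixed (norm_bubbleS _ _ _) (bubbleS_re _ _ _) (rotH_one_left _)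

theorem coreMap_of_ball {r s a b c : ℝ} (h : cutDelta ≤ a ^ 2 + b ^ 2 + c ^ 2) :
    coreMap r s a b c = 1 := by
  refine hopfClutch_of_fixed (norm_bubbleS _ _ _) (bubbleS_re _ _ _) ?_
  rw [bubbleS, bubbleU_of_le h, hopf, one_mul, star_one, mul_one, rotH_embC]

/-- The core map as a function of the two radial coordinates and the point of the two-sphere. -/
def coreSphere (p : ℝ × ℝ × ℍ[ℝ]) : ℍ[ℝ] := hopfClutch (phase p.1) (phase p.2.1) p.2.2

theorem contDiff_coreSphere : ContDiff ℝ 1 coreSphere :=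
  ContDiff.hopfClutch (contDiff_phase_re.comp contDiff_fst) (contDiff_phase_im.comp contDiff_fst)
    (contDiff_phase_re.comp (contDiff_fst.comp contDiff_snd))
    (contDiff_phase_im.comp (contDiff_fst.comp contDiff_snd)) (contDiff_snd.comp contDiff_snd)

end Gadgets

section Attaching

open Filter Topology

/-- All three coordinates lie in the sector `Re < -1/10`. -/
def InSector (w : ℂ × ℂ × ℂ) : Prop := w.1.re < -1 / 10 ∧ w.2.1.re < -1 / 10 ∧ w.2.2.re < -1 / 10

/-- The squared Euclidean norm on `ℂ³`. -/
def len3 (w : ℂ × ℂ × ℂ) : ℝ :=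
  Complex.normSq w.1 + Complex.normSq w.2.1 + Complex.normSq w.2.2

/-- The difference of the first two squared radii. -/
def radA (w : ℂ × ℂ × ℂ) : ℝ := Complex.normSq w.1 - Complex.normSq w.2.1

/-- The difference of the last two squared radii. -/
def radB (w : ℂ × ℂ × ℂ) : ℝ := Complex.normSq w.2.1 - Complex.normSq w.2.2

/-- The clutching map in the coordinates of `ℂ³`. -/
def coreC (w : ℂ × ℂ × ℂ) : ℍ[ℝ] := coreMap (radA w) (radB w) w.1.im w.2.1.im w.2.2.im

open Classical in
/-- The attaching map on (a neighbourhood of) the five-sphere, extended by `1`. -/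
def attach (w : ℂ × ℂ × ℂ) : ℍ[ℝ] := if InSector w then coreC w else 1

theorem norm_attach (w : ℂ × ℂ × ℂ) : ‖attach w‖ = 1 := by
  unfold attach; split_ifs
  · exact norm_coreMap _ _ _ _ _
  · exact norm_one

theorem continuous_len3 : Continuous len3 := by
  unfold len3
  have := Complex.continuous_normSq
  fun_prop

theorem isOpen_inSector : IsOpen {w | InSector w} := by
  unfold InSector
  have h1 : Continuous fun w : ℂ × ℂ × ℂ => w.1.re := Complex.continuous_re.comp continuous_fst
  have h2 : Continuous fun w : ℂ × ℂ × ℂ => w.2.1.re :=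
    Complex.continuous_re.comp (continuous_fst.comp continuous_snd)
  have h3 : Continuous fun w : ℂ × ℂ × ℂ => w.2.2.re :=
    Complex.continuous_re.comp (continuous_snd.comp continuous_snd)
  exact (isOpen_lt h1 continuous_const).inter ((isOpen_lt h2 continuous_const).inter
    (isOpen_lt h3 continuous_const))

theorem attach_eventuallyEq_coreC {w : ℂ × ℂ × ℂ} (h : InSector w) : attach =ᶠ[𝓝 w] coreC := by
  filter_upwards [isOpen_inSector.mem_nhds h] with u hu
  exact if_pos hu

/-- If the attaching map is not `1` at a point of the sector, the coordinates are small. -/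
theorem small_of_coreC_ne_one {w : ℂ × ℂ × ℂ} (h : coreC w ≠ 1) : |radA w| < cutDelta ∧
    |radB w| < cutDelta ∧ w.1.im ^ 2 + w.2.1.im ^ 2 + w.2.2.im ^ 2 < cutDelta := by
  by_contra! hc
  refine h ?_
  by_cases h1 : |radA w| < cutDelta
  · by_cases h2 : |radB w| < cutDelta
    · exact coreMap_of_ball (hc h1 h2)
    · exact coreMap_of_snd (not_lt.1 h2)
  · exact coreMap_of_fst (not_lt.1 h1)

theorem re_lt_of_coreC_ne_one {w : ℂ × ℂ × ℂ} (h : coreC w ≠ 1) (hs : InSector w)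
    (hl : 1 / 2 < len3 w) : w.1.re < -1 / 5 ∧ w.2.1.re < -1 / 5 ∧ w.2.2.re < -1 / 5 := by
  obtain ⟨h1, h2, h3⟩ := small_of_coreC_ne_one h
  obtain ⟨s1, s2, s3⟩ := hs
  rw [abs_lt] at h1 h2
  simp only [radA, radB, len3, Complex.normSq_apply, cutDelta] at *
  have i1 := sq_nonneg w.1.im
  have i2 := sq_nonneg w.2.1.im
  have i3 := sq_nonneg w.2.2.im
  refine ⟨?_, ?_, ?_⟩ <;> nlinarith

theorem attach_eventuallyEq_one {w : ℂ × ℂ × ℂ} (h : ¬ InSector w) (hl : 1 / 2 < len3 w) :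
    attach =ᶠ[𝓝 w] fun _ => 1 := by
  have h1 : Continuous fun w : ℂ × ℂ × ℂ => w.1.re := Complex.continuous_re.comp continuous_fst
  have h2 : Continuous fun w : ℂ × ℂ × ℂ => w.2.1.re :=
    Complex.continuous_re.comp (continuous_fst.comp continuous_snd)
  have h3 : Continuous fun w : ℂ × ℂ × ℂ => w.2.2.re :=
    Complex.continuous_re.comp (continuous_snd.comp continuous_snd)
  have ho : ∀ᶠ u in 𝓝 w, ¬ (u.1.re < -1 / 5 ∧ u.2.1.re < -1 / 5 ∧ u.2.2.re < -1 / 5) := by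
    by_cases e1 : w.1.re < -1 / 10
    · by_cases e2 : w.2.1.re < -1 / 10
      · have e3 : ¬ w.2.2.re < -1 / 10 := fun e3 => h ⟨e1, e2, e3⟩
        filter_upwards [(isOpen_lt continuous_const h3).mem_nhds
          (show (-1 / 5 : ℝ) < w.2.2.re by linarith)] with u hu hn
        exact absurd hn.2.2 (not_lt.2 (le_of_lt hu))
      · filter_upwards [(isOpen_lt continuous_const h2).mem_nhds
          (show (-1 / 5 : ℝ) < w.2.1.re by linarith)] with u hu hn
        exact absurd hn.2.1 (not_lt.2 (le_of_lt hu))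
    · filter_upwards [(isOpen_lt continuous_const h1).mem_nhds
          (show (-1 / 5 : ℝ) < w.1.re by linarith)] with u hu hn
      exact absurd hn.1 (not_lt.2 (le_of_lt hu))
  filter_upwards [ho, (isOpen_lt continuous_const continuous_len3).mem_nhds hl] with u hu hu'
  unfold attach
  split_ifs with hs
  · by_contra hne
    exact hu (re_lt_of_coreC_ne_one hne hs hu')
  · rfl

theorem contDiff_normSq : ContDiff ℝ 1 fun z : ℂ => Complex.normSq z := by
  simp only [Complex.normSq_apply]
  have h1 : ContDiff ℝ 1 Complex.re := Complex.reCLM.contDiff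
  have h2 : ContDiff ℝ 1 Complex.im := Complex.imCLM.contDiff
  fun_prop

theorem contDiff_radA : ContDiff ℝ 1 radA :=
  (contDiff_normSq.comp contDiff_fst).sub
    (contDiff_normSq.comp (contDiff_fst.comp contDiff_snd))

theorem contDiff_radB : ContDiff ℝ 1 radB :=
  (contDiff_normSq.comp (contDiff_fst.comp contDiff_snd)).sub
    (contDiff_normSq.comp (contDiff_snd.comp contDiff_snd))

/-- The two-sphere coordinate of a point of `ℂ³`. -/
def ballC (w : ℂ × ℂ × ℂ) : ℍ[ℝ] := bubbleS w.1.im w.2.1.im w.2.2.im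

theorem contDiff_ballC : ContDiff ℝ 1 ballC := by
  have h2 : ContDiff ℝ 1 Complex.im := Complex.imCLM.contDiff
  have : ContDiff ℝ 1 fun w : ℂ × ℂ × ℂ => (w.1.im, w.2.1.im, w.2.2.im) :=
    (h2.comp contDiff_fst).prodMk ((h2.comp (contDiff_fst.comp contDiff_snd)).prodMk
      (h2.comp (contDiff_snd.comp contDiff_snd)))
  have e : ballC = (fun p : ℝ × ℝ × ℝ => bubbleS p.1 p.2.1 p.2.2) ∘
    fun w : ℂ × ℂ × ℂ => (w.1.im, w.2.1.im, w.2.2.im) := rfl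
  rw [e]
  exact contDiff_bubbleS.comp this

theorem coreC_eq (w : ℂ × ℂ × ℂ) : coreC w = coreSphere (radA w, radB w, ballC w) := rfl

theorem contDiff_coreC : ContDiff ℝ 1 coreC :=
  (contDiff_coreSphere.comp (contDiff_radA.prodMk (contDiff_radB.prodMk contDiff_ballC)) :
    ContDiff ℝ 1 fun w => coreSphere (radA w, radB w, ballC w))

theorem contDiffAt_attach {w : ℂ × ℂ × ℂ} (hl : 1 / 2 < len3 w) : ContDiffAt ℝ 1 attach w := by
  by_cases h : InSector w
  · exact contDiff_coreC.contDiffAt.congr_of_eventuallyEq (attach_eventuallyEq_coreC h)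
  · exact contDiffAt_const.congr_of_eventuallyEq (attach_eventuallyEq_one h hl)

/-- The cutoff in the suspension coordinate. -/
def cutS (T : ℝ) : ℝ := Real.smoothTransition (9 / 100 - T ^ 2)

theorem susp_den_pos (T : ℝ) : 0 < T ^ 2 + cutS T ^ 2 := by
  rcases eq_or_ne T 0 with rfl | h
  · have : 0 < cutS 0 := Real.smoothTransition.pos_of_pos (by norm_num)
    positivity
  · positivity

/-- The cosine of the suspension angle. -/
def suspC (T : ℝ) : ℝ := -T / √(T ^ 2 + cutS T ^ 2)

/-- The sine of the suspension angle. -/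
def suspS (T : ℝ) : ℝ := cutS T / √(T ^ 2 + cutS T ^ 2)

theorem suspC_sq_add (T : ℝ) : suspC T ^ 2 + suspS T ^ 2 = 1 := by
  have := susp_den_pos T
  rw [suspC, suspS, div_pow, div_pow, Real.sq_sqrt this.le]
  field_simp

theorem contDiff_cutS : ContDiff ℝ 1 cutS := by
  unfold cutS
  exact (Real.smoothTransition.contDiff (n := 1)).comp (by fun_prop)

theorem contDiff_suspC : ContDiff ℝ 1 suspC := by
  have := contDiff_cutS
  unfold suspC
  exact ContDiff.div (by fun_prop) (ContDiff.sqrt (by fun_prop) fun T => (susp_den_pos T).ne')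
    fun T => (Real.sqrt_pos.2 (susp_den_pos T)).ne'

theorem contDiff_suspS : ContDiff ℝ 1 suspS := by
  have := contDiff_cutS
  unfold suspS
  exact ContDiff.div (by fun_prop) (ContDiff.sqrt (by fun_prop) fun T => (susp_den_pos T).ne')
    fun T => (Real.sqrt_pos.2 (susp_den_pos T)).ne'

theorem suspS_of_lt {T : ℝ} (h : 3 / 10 ≤ |T|) : suspS T = 0 := by
  have : cutS T = 0 := Real.smoothTransition.zero_of_nonpos (by nlinarith [sq_abs T])
  rw [suspS, this, zero_div]

theorem suspC_zero : suspC 0 = 0 := by simp [suspC]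

theorem suspS_zero : suspS 0 = 1 := by
  have h := suspC_sq_add 0
  rw [suspC_zero] at h
  have h2 : 0 ≤ suspS 0 := div_nonneg (Real.smoothTransition.nonneg _) (Real.sqrt_nonneg _)
  nlinarith

theorem suspC_nonneg {T : ℝ} (h : T ≤ 0) : 0 ≤ suspC T :=
  div_nonneg (by linarith) (Real.sqrt_nonneg _)

theorem suspC_nonpos {T : ℝ} (h : 0 ≤ T) : suspC T ≤ 0 :=
  div_nonpos_of_nonpos_of_nonneg (by linarith) (Real.sqrt_nonneg _)

/-- The point of the four-sphere with given suspension coordinates. -/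
def toFive (a : ℝ) (q : ℍ[ℝ]) : EucA 5 := !₂[a, q.re, q.imI, q.imJ, q.imK]

theorem toFive_norm_sq (a : ℝ) (q : ℍ[ℝ]) : ‖toFive a q‖ ^ 2 = a ^ 2 + ‖q‖ ^ 2 := by
  rw [EuclideanSpace.norm_sq_eq, sq ‖q‖, ← Quaternion.normSq_eq_norm_mul_self,
    Quaternion.normSq_def']
  simp [toFive, Fin.sum_univ_succ]
  ring

/-- `toFive` as a continuous linear map. -/
def toFiveL : ℝ × ℍ[ℝ] →L[ℝ] EucA 5 :=
  LinearMap.toContinuousLinearMap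
    { toFun := fun p => toFive p.1 p.2
      map_add' := fun p q => by
        ext i; fin_cases i <;> simp [toFive]
      map_smul' := fun c p => by
        ext i; fin_cases i <;> simp [toFive] }

/-- The suspension of the attaching map. -/
def suspMap (p : ℝ × ℂ × ℂ × ℂ) : EucA 5 := toFive (suspC p.1) (suspS p.1 • attach p.2)

theorem norm_suspMap (p : ℝ × ℂ × ℂ × ℂ) : ‖suspMap p‖ = 1 := by
  rw [← sq_eq_sq₀ (norm_nonneg _) zero_le_one, suspMap, toFive_norm_sq, norm_smul, norm_attach,
    mul_one, Real.norm_eq_abs, sq_abs, suspC_sq_add, one_pow]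

theorem suspMap_eventuallyEq_of_lt {p : ℝ × ℂ × ℂ × ℂ} (h : 3 / 10 < |p.1|) :
    suspMap =ᶠ[𝓝 p] fun p => toFive (suspC p.1) 0 := by
  filter_upwards [(isOpen_lt continuous_const (continuous_abs.comp continuous_fst)).mem_nhds h]
    with u hu
  rw [suspMap, suspS_of_lt (le_of_lt hu), zero_smul]

theorem suspMap_eventuallyEq_of_not {p : ℝ × ℂ × ℂ × ℂ} (h : ¬ InSector p.2)
    (hl : 1 / 2 < len3 p.2) : suspMap =ᶠ[𝓝 p] fun p => toFive (suspC p.1) (suspS p.1 • 1) := by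
  have := (continuous_snd (X := ℝ) (Y := ℂ × ℂ × ℂ)).continuousAt (x := p)
  filter_upwards [this.eventually (attach_eventuallyEq_one h hl)] with u hu
  rw [suspMap, hu]

theorem suspMap_eventuallyEq_of_inSector {p : ℝ × ℂ × ℂ × ℂ} (h : InSector p.2) :
    suspMap =ᶠ[𝓝 p] fun p => toFive (suspC p.1) (suspS p.1 • coreC p.2) := by
  have := (continuous_snd (X := ℝ) (Y := ℂ × ℂ × ℂ)).continuousAt (x := p)
  filter_upwards [this.eventually (attach_eventuallyEq_coreC h)] with u hu
  rw [suspMap, hu]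

theorem contDiffAt_suspMap {p : ℝ × ℂ × ℂ × ℂ} (h : 3 / 10 < |p.1| ∨ 1 / 2 < len3 p.2) :
    ContDiffAt ℝ 1 suspMap p := by
  have hc : ContDiff ℝ 1 fun p : ℝ × ℂ × ℂ × ℂ => suspC p.1 := contDiff_suspC.comp contDiff_fst
  have hs : ContDiff ℝ 1 fun p : ℝ × ℂ × ℂ × ℂ => suspS p.1 := contDiff_suspS.comp contDiff_fst
  rcases h with h | h
  · refine ContDiffAt.congr_of_eventuallyEq ?_ (suspMap_eventuallyEq_of_lt h)
    exact (toFiveL.contDiff.comp (hc.prodMk contDiff_const)).contDiffAt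
  · exact toFiveL.contDiff.contDiffAt.comp p (hc.contDiffAt.prodMk
      (hs.contDiffAt.smul ((contDiffAt_attach h).comp p contDiffAt_snd)))

end Attaching

section LineBundle

/-- The quaternionic coordinate of a point of `ℝ⁵`. -/
def quatOf (p : EucA 5) : ℍ[ℝ] := qmk (p 1) (p 2) (p 3) (p 4)

theorem toFive_quatOf (p : EucA 5) : toFive (p 0) (quatOf p) = p := by
  ext i; fin_cases i <;> simp [toFive, quatOf]

theorem quatOf_toFive (a : ℝ) (q : ℍ[ℝ]) : quatOf (toFive a q) = q := by
  ext <;> simp [toFive, quatOf]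

theorem toFive_zero (a : ℝ) (q : ℍ[ℝ]) : toFive a q 0 = a := by simp [toFive]

/-- The projection of `ℍ²` onto the quaternionic line corresponding to a point of `S⁴ = ℍP¹`. -/
def projH (p : EucA 5) (v : ℍ[ℝ] × ℍ[ℝ]) : ℍ[ℝ] × ℍ[ℝ] :=
  ((1 / 2 : ℝ) • ((1 + p 0) • v.1 + star (quatOf p) * v.2),
    (1 / 2 : ℝ) • (quatOf p * v.1 + (1 - p 0) • v.2))

theorem sq_add_normSq_of_mem {p : EucA 5} (hp : p ∈ usph 5) :
    p 0 ^ 2 + ‖quatOf p‖ ^ 2 = 1 := by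
  rw [← toFive_norm_sq, toFive_quatOf, mem_sphere_zero_iff_norm.1 hp, one_pow]

theorem star_mul_self_eq (q : ℍ[ℝ]) : star q * q = (‖q‖ ^ 2) • (1 : ℍ[ℝ]) := by
  rw [sq, ← Quaternion.normSq_eq_norm_mul_self, Quaternion.star_mul_self]
  ext <;> simp

theorem self_mul_star_eq (q : ℍ[ℝ]) : q * star q = (‖q‖ ^ 2) • (1 : ℍ[ℝ]) := by
  rw [sq, ← Quaternion.normSq_eq_norm_mul_self, Quaternion.self_mul_star]
  ext <;> simp

theorem projH_projH {p : EucA 5} (hp : p ∈ usph 5) (v : ℍ[ℝ] × ℍ[ℝ]) :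
    projH p (projH p v) = projH p v := by
  have h := sq_add_normSq_of_mem hp
  have h' : ‖quatOf p‖ ^ 2 = 1 - p 0 ^ 2 := by linarith
  have e1 := star_mul_self_eq (quatOf p)
  have e2 := self_mul_star_eq (quatOf p)
  rw [h'] at e1 e2
  have f1 : star (quatOf p) * (quatOf p * v.1) = (1 - p 0 ^ 2) • v.1 := by
    rw [← mul_assoc, e1, smul_mul_assoc, one_mul]
  have f2 : quatOf p * (star (quatOf p) * v.2) = (1 - p 0 ^ 2) • v.2 := by
    rw [← mul_assoc, e2, smul_mul_assoc, one_mul]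
  refine Prod.ext ?_ ?_
  · simp only [projH, mul_smul_comm, mul_add, f1]
    module
  · simp only [projH, mul_smul_comm, mul_add, f2]
    module

theorem norm_projH_sub_le (p p' : EucA 5) (v : ℍ[ℝ] × ℍ[ℝ]) :
    ‖projH p v - projH p' v‖ ≤ ‖p - p'‖ * ‖v‖ := by
  have hq : quatOf p - quatOf p' = quatOf (p - p') := by ext <;> simp [quatOf]
  have hn := toFive_norm_sq ((p - p') 0) (quatOf (p - p'))
  rw [toFive_quatOf] at hn
  have h0 : |p 0 - p' 0| ≤ ‖p - p'‖ := by
    refine abs_le_of_sq_le_sq ?_ (norm_nonneg _)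
    have : (p - p') 0 = p 0 - p' 0 := by simp
    rw [← this]; nlinarith [sq_nonneg ‖quatOf (p - p')‖]
  have h1 : ‖quatOf p - quatOf p'‖ ≤ ‖p - p'‖ := by
    rw [hq]
    refine le_of_sq_le_sq ?_ (norm_nonneg _)
    nlinarith [sq_nonneg ((p - p') 0)]
  have hv1 : ‖v.1‖ ≤ ‖v‖ := norm_fst_le v
  have hv2 : ‖v.2‖ ≤ ‖v‖ := norm_snd_le v
  have e1 : (projH p v - projH p' v).1 = (1 / 2 : ℝ) • ((p 0 - p' 0) • v.1 +
      star (quatOf p - quatOf p') * v.2) := by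
    simp only [projH, Prod.fst_sub, star_sub, sub_mul]; module
  have e2 : (projH p v - projH p' v).2 = (1 / 2 : ℝ) • ((quatOf p - quatOf p') * v.1 -
      (p 0 - p' 0) • v.2) := by
    simp only [projH, Prod.snd_sub, sub_mul]; module
  have b1 : ‖(p 0 - p' 0) • v.1‖ ≤ ‖p - p'‖ * ‖v‖ := by
    rw [norm_smul, Real.norm_eq_abs]; gcongr
  have b2 : ‖star (quatOf p - quatOf p') * v.2‖ ≤ ‖p - p'‖ * ‖v‖ := by
    rw [norm_mul, norm_star]; gcongr
  have b3 : ‖(quatOf p - quatOf p') * v.1‖ ≤ ‖p - p'‖ * ‖v‖ := by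
    rw [norm_mul]; gcongr
  have b4 : ‖(p 0 - p' 0) • v.2‖ ≤ ‖p - p'‖ * ‖v‖ := by
    rw [norm_smul, Real.norm_eq_abs]; gcongr
  refine max_le ?_ ?_
  · change ‖(projH p v - projH p' v).1‖ ≤ _
    rw [e1, norm_smul]
    have := norm_add_le ((p 0 - p' 0) • v.1) (star (quatOf p - quatOf p') * v.2)
    rw [Real.norm_of_nonneg (by norm_num)]
    linarith
  · change ‖(projH p v - projH p' v).2‖ ≤ _
    rw [e2, norm_smul]
    have := norm_sub_le ((quatOf p - quatOf p') * v.1) ((p 0 - p' 0) • v.2)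
    rw [Real.norm_of_nonneg (by norm_num)]
    linarith

/-- The pullback of the tautological quaternionic line bundle along `f` has a nowhere vanishing
section. -/
def HasLineSection {d : ℕ} (f : EucA d → EucA 5) : Prop :=
  ∃ v : EucA d → ℍ[ℝ] × ℍ[ℝ], ContinuousOn v (usph d) ∧
    ∀ x ∈ usph d, v x ≠ 0 ∧ projH (f x) (v x) = v x

theorem hasLineSection_const {d : ℕ} {y : EucA 5} (hy : y ∈ usph 5) :
    HasLineSection (d := d) fun _ => y := by
  have h : ∃ e, projH y e ≠ 0 := by
    by_contra! h
    have h1 := congrArg (fun v : ℍ[ℝ] × ℍ[ℝ] => v.1.re) (h (1, 0))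
    have h2 := congrArg (fun v : ℍ[ℝ] × ℍ[ℝ] => v.2.re) (h (0, 1))
    simp [projH] at h1 h2
    linarith
  obtain ⟨e, he⟩ := h
  exact ⟨fun _ => projH y e, continuousOn_const, fun x _ => ⟨he, projH_projH hy e⟩⟩

theorem continuous_quatOf : Continuous quatOf := by
  unfold quatOf
  exact Continuous.qmk (by fun_prop) (by fun_prop) (by fun_prop) (by fun_prop)

theorem continuousOn_projH {X : Type*} [TopologicalSpace X] {S : Set X} {f : X → EucA 5}
    {v : X → ℍ[ℝ] × ℍ[ℝ]} (hf : ContinuousOn f S) (hv : ContinuousOn v S) :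
    ContinuousOn (fun x => projH (f x) (v x)) S := by
  have h1 : ContinuousOn (fun x => quatOf (f x)) S := continuous_quatOf.comp_continuousOn hf
  have h2 : ContinuousOn (fun x => f x 0) S :=
    Continuous.comp_continuousOn (g := fun p : EucA 5 => p 0) (by fun_prop) hf
  have h3 : ContinuousOn (fun x => (v x).1) S := continuous_fst.comp_continuousOn hv
  have h4 : ContinuousOn (fun x => (v x).2) S := continuous_snd.comp_continuousOn hv
  have h5 : ContinuousOn (fun x => star (quatOf (f x))) S := continuous_star.comp_continuousOn h1
  unfold projH
  exact ((((continuousOn_const.add h2).smul h3).add (h5.mul h4)).const_smul (1 / 2 : ℝ)).prodMk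
    (((h1.mul h3).add ((continuousOn_const.sub h2).smul h4)).const_smul (1 / 2 : ℝ))

theorem HasLineSection.of_near {d : ℕ} {f g : EucA d → EucA 5} (hg : HasLineSection g)
    (hf : ContinuousOn f (usph d)) (hf' : MapsTo f (usph d) (usph 5))
    (h : ∀ x ∈ usph d, dist (f x) (g x) < 1) : HasLineSection f := by
  obtain ⟨v, hv, hv'⟩ := hg
  refine ⟨fun x => projH (f x) (v x), continuousOn_projH hf hv,
    fun x hx => ⟨fun h0 => ?_, projH_projH (hf' hx) _⟩⟩
  obtain ⟨h1, h2⟩ := hv' x hx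
  replace h0 : projH (f x) (v x) = 0 := h0
  have h3 := norm_projH_sub_le (f x) (g x) (v x)
  rw [h2, h0, zero_sub, norm_neg, ← dist_eq_norm] at h3
  have h4 := norm_pos_iff.2 h1
  nlinarith [h x hx]

theorem HasLineSection.of_homotopic {d : ℕ} {f g : EucA d → EucA 5} (hg : HasLineSection g)
    (h : FreelyHomotopic (usph 5) f g) : HasLineSection f := by
  obtain ⟨H, hc, hm, h0, h1⟩ := h
  have hcomp : IsCompact (Icc (0 : ℝ) 1 ×ˢ usph d) := isCompact_Icc.prod (isCompact_sphere _ _)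
  obtain ⟨δ, hδ, hu⟩ := Metric.uniformContinuousOn_iff.1
    (hcomp.uniformContinuousOn_of_continuous hc) 1 one_pos
  have hslice : ∀ t ∈ Icc (0 : ℝ) 1, ContinuousOn (H t) (usph d) := fun t ht =>
    hc.comp (Continuous.continuousOn (f := fun x : EucA d => (t, x)) (by fun_prop))
      fun x hx => ⟨ht, hx⟩
  have step : ∀ t ∈ Icc (0 : ℝ) 1, ∀ s ∈ Icc (0 : ℝ) 1, |t - s| < δ → HasLineSection (H s) →
      HasLineSection (H t) := fun t ht s hs hts hL =>
    hL.of_near (hslice t ht) (hm t ht) fun x hx => hu (t, x) ⟨ht, hx⟩ (s, x) ⟨hs, hx⟩ (by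
      simpa [Prod.dist_eq, Real.dist_eq] using hts)
  obtain ⟨n, hn⟩ := exists_nat_gt (1 / δ)
  have hn0 : 0 < (n : ℝ) := lt_trans (by positivity) hn
  have hgen : ∀ k : ℕ, k ≤ n → HasLineSection (H (1 - k / n)) := by
    intro k
    induction k with
    | zero =>
      intro _
      obtain ⟨v, hv, hv'⟩ := hg
      refine ⟨v, hv, fun x hx => ?_⟩
      have := h1 hx
      simp only [Nat.cast_zero, zero_div, sub_zero]
      rw [this]
      exact hv' x hx
    | succ k ih =>
      intro hk
      have hk' : ((k : ℝ) + 1) ≤ n := by exact_mod_cast hk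
      have hk0 : (0 : ℝ) ≤ k := k.cast_nonneg
      refine step _ ⟨?_, ?_⟩ _ ⟨?_, ?_⟩ ?_ (ih (by omega))
      · rw [sub_nonneg, div_le_one hn0]; push_cast; linarith
      · rw [sub_le_self_iff]; positivity
      · rw [sub_nonneg, div_le_one hn0]; linarith
      · rw [sub_le_self_iff]; positivity
      · have e : (1 - ((k + 1 : ℕ) : ℝ) / n) - (1 - k / n) = -(1 / n) := by
          push_cast; field_simp; ring
        rw [e, abs_neg, abs_of_pos (by positivity), div_lt_iff₀ hn0]
        rw [div_lt_iff₀ hδ] at hn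
        linarith
  have := hgen n le_rfl
  rw [div_self hn0.ne', sub_self] at this
  obtain ⟨v, hv, hv'⟩ := this
  refine ⟨v, hv, fun x hx => ?_⟩
  rw [← h0 hx]
  exact hv' x hx

end LineBundle

section Desuspension

/-- The coordinates `ℝ⁷ = ℝ × ℂ³`. -/
def splitSeven (X : EucA 7) : ℝ × ℂ × ℂ × ℂ := (X 6, ⟨X 0, X 1⟩, ⟨X 2, X 3⟩, ⟨X 4, X 5⟩)

/-- The inverse of `splitSeven`. -/
def mkSeven (s : ℝ) (w : ℂ × ℂ × ℂ) : EucA 7 :=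
  !₂[w.1.re, w.1.im, w.2.1.re, w.2.1.im, w.2.2.re, w.2.2.im, s]

theorem splitSeven_mkSeven (s : ℝ) (w : ℂ × ℂ × ℂ) : splitSeven (mkSeven s w) = (s, w) := rfl

theorem norm_sq_eq_len3 (X : EucA 7) : ‖X‖ ^ 2 = (splitSeven X).1 ^ 2 + len3 (splitSeven X).2 := by
  rw [EuclideanSpace.norm_sq_eq]
  simp [splitSeven, len3, Fin.sum_univ_succ, Complex.normSq_apply]
  ring

theorem mkSeven_norm_sq (s : ℝ) (w : ℂ × ℂ × ℂ) : ‖mkSeven s w‖ ^ 2 = s ^ 2 + len3 w := by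
  rw [norm_sq_eq_len3, splitSeven_mkSeven]

theorem len3_smul (r : ℝ) (w : ℂ × ℂ × ℂ) : len3 (r • w) = r ^ 2 * len3 w := by
  simp [len3, Complex.normSq_apply]; ring

theorem continuous_mkSeven : Continuous fun p : ℝ × ℂ × ℂ × ℂ => mkSeven p.1 p.2 := by
  have hr := Complex.continuous_re
  have hi := Complex.continuous_im
  have f1 : Continuous fun p : ℝ × ℂ × ℂ × ℂ => p.2.1 := by fun_prop
  have f2 : Continuous fun p : ℝ × ℂ × ℂ × ℂ => p.2.2.1 := by fun_prop
  have f3 : Continuous fun p : ℝ × ℂ × ℂ × ℂ => p.2.2.2 := by fun_prop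
  refine (PiLp.continuous_toLp 2 _).comp (continuous_pi fun i => ?_)
  fin_cases i
  exacts [hr.comp f1, hi.comp f1, hr.comp f2, hi.comp f2, hr.comp f3, hi.comp f3, continuous_fst]

theorem projH_toFive_eq {a : ℝ} {q : ℍ[ℝ]} {v : ℍ[ℝ] × ℍ[ℝ]} (h : projH (toFive a q) v = v) :
    star q * v.2 = (1 - a) • v.1 ∧ q * v.1 = (1 + a) • v.2 := by
  have h1 := congrArg Prod.fst h
  have h2 := congrArg Prod.snd h
  simp only [projH, quatOf_toFive, toFive_zero] at h1 h2
  constructor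
  · have : star q * v.2 = (2 : ℝ) • ((1 / 2 : ℝ) • ((1 + a) • v.1 + star q * v.2)) -
      (1 + a) • v.1 := by module
    rw [this, h1]; module
  · have : q * v.1 = (2 : ℝ) • ((1 / 2 : ℝ) • (q * v.1 + (1 - a) • v.2)) -
      (1 - a) • v.2 := by module
    rw [this, h2]; module

theorem exists_null_attach (h : HasLineSection fun X => suspMap (splitSeven X))
    {Q : TorusQuat → ℂ × ℂ × ℂ} (hQ : Continuous Q) (hl : ∀ g, len3 (Q g) = 1) :
    ∃ K : I × TorusQuat → ℍ[ℝ], Continuous K ∧ (∀ z, K z ≠ 0) ∧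
      (∀ g, K (0, g) = attach (Q g)) ∧ ∀ g, K (1, g) = K (1, 1) := by
  obtain ⟨v, hv, hv'⟩ := h
  have hmem : ∀ (t : ℝ), t ^ 2 ≤ 1 → ∀ g, mkSeven t (√(1 - t ^ 2) • Q g) ∈ usph 7 :=
      fun t ht g => by
    rw [usph, mem_sphere_zero_iff_norm, ← sq_eq_sq₀ (norm_nonneg _) zero_le_one, mkSeven_norm_sq,
      len3_smul, hl, Real.sq_sqrt (by linarith)]
    ring
  have hI : ∀ t : I, (t : ℝ) ^ 2 ≤ 1 := fun t => by nlinarith [t.2.1, t.2.2]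
  have hI' : ∀ t : I, (-(t : ℝ)) ^ 2 ≤ 1 := fun t => by nlinarith [t.2.1, t.2.2]
  have heq : ∀ (t : ℝ), t ^ 2 ≤ 1 → ∀ g, v (mkSeven t (√(1 - t ^ 2) • Q g)) ≠ 0 ∧
      star (suspS t • attach (√(1 - t ^ 2) • Q g)) * (v (mkSeven t (√(1 - t ^ 2) • Q g))).2 =
        (1 - suspC t) • (v (mkSeven t (√(1 - t ^ 2) • Q g))).1 ∧
      (suspS t • attach (√(1 - t ^ 2) • Q g)) * (v (mkSeven t (√(1 - t ^ 2) • Q g))).1 =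
        (1 + suspC t) • (v (mkSeven t (√(1 - t ^ 2) • Q g))).2 := fun t ht g =>
    ⟨(hv' _ (hmem t ht g)).1, projH_toFive_eq (hv' _ (hmem t ht g)).2⟩
  have hne2 : ∀ t : ℝ, t ^ 2 ≤ 1 → 0 ≤ t → ∀ g, (v (mkSeven t (√(1 - t ^ 2) • Q g))).2 ≠ 0 := by
    intro t ht h0 g hz
    obtain ⟨e0, e1, -⟩ := heq t ht g
    rw [hz, mul_zero, eq_comm, smul_eq_zero] at e1
    rcases e1 with e1 | e1
    · linarith [suspC_nonpos h0]
    · exact e0 (Prod.ext e1 hz)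
  have hne1 : ∀ t : ℝ, t ^ 2 ≤ 1 → t ≤ 0 → ∀ g, (v (mkSeven t (√(1 - t ^ 2) • Q g))).1 ≠ 0 := by
    intro t ht h0 g hz
    obtain ⟨e0, -, e1⟩ := heq t ht g
    rw [hz, mul_zero, eq_comm, smul_eq_zero] at e1
    rcases e1 with e1 | e1
    · linarith [suspC_nonneg h0]
    · exact e0 (Prod.ext hz e1)
  have hcont : ∀ e : ℝ, e ^ 2 = 1 → Continuous fun z : I × TorusQuat =>
      v (mkSeven (e * z.1) (√(1 - (e * (z.1 : ℝ)) ^ 2) • Q z.2)) := fun e he => by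
    refine hv.comp_continuous (continuous_mkSeven.comp (Continuous.prodMk ?_ ?_)) fun z => ?_
    · fun_prop
    · fun_prop
    · exact hmem _ (by rw [mul_pow, he, one_mul]; exact hI z.1) _
  have hm : ∀ z : I × TorusQuat, (v (mkSeven (-1 * z.1)
      (√(1 - (-1 * (z.1 : ℝ)) ^ 2) • Q z.2))).1 ≠ 0 := fun z =>
    hne1 _ (by rw [neg_one_mul]; exact hI' z.1) (by linarith [z.1.2.1]) _
  refine ⟨fun z => (v (mkSeven (1 * z.1) (√(1 - (1 * (z.1 : ℝ)) ^ 2) • Q z.2))).2 *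
    ((v (mkSeven (-1 * z.1) (√(1 - (-1 * (z.1 : ℝ)) ^ 2) • Q z.2))).1)⁻¹, ?_, ?_, ?_, ?_⟩
  · exact (continuous_snd.comp (hcont 1 (by norm_num))).mul
      ((continuous_fst.comp (hcont (-1) (by norm_num))).inv₀ hm)
  · intro z
    refine mul_ne_zero ?_ (inv_ne_zero (hm z))
    exact hne2 _ (by rw [one_mul]; exact hI z.1) (by linarith [z.1.2.1]) _
  · intro g
    have h1 := hm (0, g)
    obtain ⟨-, -, e⟩ := heq 0 (by norm_num) g
    simp only [Set.Icc.coe_zero, mul_zero] at h1 ⊢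
    rw [suspC_zero, suspS_zero] at e
    rw [mul_inv_eq_iff_eq_mul₀ h1]
    simpa using e.symm
  · intro g
    simp

end Desuspension

section TorusToSphere

/-- The denominator in the radial coordinates. -/
def radDen (g : TorusQuat) : ℝ := 6 + (g.1 : ℂ).im - (g.2.1 : ℂ).im

/-- The radius of the first coordinate. -/
def radius1 (g : TorusQuat) : ℝ := √(1 + (g.1 : ℂ).im / 2)

/-- The radius of the third coordinate. -/
def radius3 (g : TorusQuat) : ℝ := √(1 - (g.2.1 : ℂ).im / 2)

/-- A point at distance `R` of the origin in the left half plane, with imaginary part `R y / 2`. -/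
def leftPoint (R y : ℝ) : ℂ := ⟨-(R * √(1 - y ^ 2 / 4)), R * (y / 2)⟩

/-- The amount of shift to the right. -/
def shift (g : TorusQuat) : ℝ :=
  3 * (max (g.1 : ℂ).re 0 + max (g.2.1 : ℂ).re 0 + max (g.2.2 : ℍ[ℝ]).re 0)

/-- The unshifted map of the torus to `ℂ³`. -/
def preMap (g : TorusQuat) : ℂ × ℂ × ℂ :=
  (leftPoint (radius1 g) (g.2.2 : ℍ[ℝ]).imI, leftPoint 1 (g.2.2 : ℍ[ℝ]).imJ,
    leftPoint (radius3 g) (g.2.2 : ℍ[ℝ]).imK)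

/-- The shifted map of the torus to `ℂ³`. -/
def shiftMap (g : TorusQuat) : ℂ × ℂ × ℂ :=
  ((preMap g).1 + shift g, (preMap g).2.1 + shift g, (preMap g).2.2 + shift g)

/-- The map of the torus to the five-sphere. -/
def toSphere (g : TorusQuat) : ℂ × ℂ × ℂ := (√(len3 (shiftMap g)))⁻¹ • shiftMap g

theorem circle_sq (c : Circle) : (c : ℂ).re ^ 2 + (c : ℂ).im ^ 2 = 1 := by
  have := Complex.sq_norm (c : ℂ)
  rw [Circle.norm_coe, Complex.normSq_apply] at this; linarith

theorem unitQuat_sq (x : UnitQuat) : (x : ℍ[ℝ]).re ^ 2 + (x : ℍ[ℝ]).imI ^ 2 + (x : ℍ[ℝ]).imJ ^ 2 +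
    (x : ℍ[ℝ]).imK ^ 2 = 1 := by
  have := Quaternion.normSq_eq_norm_mul_self (x : ℍ[ℝ])
  rw [mem_sphere_zero_iff_norm.1 x.2, Quaternion.normSq_def'] at this; linarith

theorem normSq_leftPoint {R y : ℝ} (hy : y ^ 2 ≤ 1) : Complex.normSq (leftPoint R y) = R ^ 2 := by
  have : √(1 - y ^ 2 / 4) ^ 2 = 1 - y ^ 2 / 4 := Real.sq_sqrt (by linarith)
  simp only [Complex.normSq_apply, leftPoint]
  linear_combination R ^ 2 * this

theorem leftPoint_re_le {R y : ℝ} (hR : 0 ≤ R) (hy : y ^ 2 ≤ 1) :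
    (leftPoint R y).re ≤ -(17 / 20 * R) ∧ -R ≤ (leftPoint R y).re := by
  have h1 : (17 / 20 : ℝ) ≤ √(1 - y ^ 2 / 4) := Real.le_sqrt_of_sq_le (by linarith)
  have h2 : √(1 - y ^ 2 / 4) ≤ 1 := Real.sqrt_le_one.2 (by nlinarith)
  simp only [leftPoint]
  constructor <;> nlinarith

theorem abs_sub_le_of_box {a b x y : ℝ} (h1 : -(1 / 400) < a * a + x * x - (b * b + y * y))
    (h2 : a * a + x * x - (b * b + y * y) < 1 / 400) (h3 : x * x + y * y < 1 / 400)
    (h4 : a < -1 / 5) (h5 : b < -1 / 5) : |a - b| ≤ 1 / 80 := by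
  have hx := mul_self_nonneg x
  have hy := mul_self_nonneg y
  have h6 : (a - b) * (a + b) < 1 / 200 := by linarith
  have h7 : -(1 / 200) < (a - b) * (a + b) := by linarith
  rw [abs_le]
  constructor <;> by_contra! hc <;> nlinarith

theorem box_estimate {L m a b c x y z : ℝ} (hL : 0 < L) (hm : 0 ≤ m)
    (h1 : -(1 / 400) < a * a + x * x - (b * b + y * y))
    (h2 : a * a + x * x - (b * b + y * y) < 1 / 400) (h3 : x * x + y * y < 1 / 400)
    (ha : a < -1 / 5) (hb : b < -1 / 5) (hc : c < -1 / 5)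
    (hl : a * a + x * x + (b * b + y * y) + (c * c + z * z) = 1) :
    |(L * a - m) * (L * a - m) + L * x * (L * x) - ((L * b - m) * (L * b - m) + L * y * (L * y))| ≤
      ((L * a - m) * (L * a - m) + L * x * (L * x) + ((L * b - m) * (L * b - m) + L * y * (L * y)) +
        ((L * c - m) * (L * c - m) + L * z * (L * z))) / 40 ∧
    L ^ 2 ≤ (L * a - m) * (L * a - m) + L * x * (L * x) +
        ((L * b - m) * (L * b - m) + L * y * (L * y)) +
        ((L * c - m) * (L * c - m) + L * z * (L * z)) := by
  have hLm : 0 ≤ L * m := by positivity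
  have hN : (L * a - m) * (L * a - m) + L * x * (L * x) +
      ((L * b - m) * (L * b - m) + L * y * (L * y)) +
      ((L * c - m) * (L * c - m) + L * z * (L * z)) =
      L ^ 2 - 2 * (L * m) * (a + b + c) + 3 * m ^ 2 := by
    linear_combination L ^ 2 * hl
  have hA : (L * a - m) * (L * a - m) + L * x * (L * x) -
      ((L * b - m) * (L * b - m) + L * y * (L * y)) =
      L ^ 2 * (a * a + x * x - (b * b + y * y)) - 2 * (L * m) * (a - b) := by ring
  obtain ⟨k1, k2⟩ := abs_le.1 (abs_sub_le_of_box h1 h2 h3 ha hb)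
  rw [hN, hA]
  have t1 : 2 * (L * m) * (a + b + c) ≤ 2 * (L * m) * (-3 / 5) :=
    mul_le_mul_of_nonneg_left (by linarith) (by positivity)
  have t2 : L ^ 2 * (a * a + x * x - (b * b + y * y)) ≤ L ^ 2 * (1 / 400) :=
    mul_le_mul_of_nonneg_left h2.le (by positivity)
  have t3 : L ^ 2 * -(1 / 400) ≤ L ^ 2 * (a * a + x * x - (b * b + y * y)) :=
    mul_le_mul_of_nonneg_left h1.le (by positivity)
  have t4 : 2 * (L * m) * (a - b) ≤ 2 * (L * m) * (1 / 80) :=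
    mul_le_mul_of_nonneg_left k2 (by positivity)
  have t5 : 2 * (L * m) * -(1 / 80) ≤ 2 * (L * m) * (a - b) :=
    mul_le_mul_of_nonneg_left k1 (by positivity)
  have t6 := sq_nonneg m
  have t7 := sq_nonneg L
  refine ⟨abs_le.2 ⟨?_, ?_⟩, ?_⟩ <;> linarith

theorem neg_of_small_imag {x y : ℝ} (h : x ^ 2 + y = 1) (hy : y ≤ 1 / 2) (hx : x < 1 / 2) :
    x < 0 := by
  by_contra! hc
  nlinarith

theorem two_fifths_le_sq {r : ℝ} (h : 7 / 10 ≤ r) : 2 / 5 ≤ r ^ 2 := by nlinarith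

theorem sq_le_of_bounds {y : ℝ} (h1 : -(1 / 2) ≤ y) (h2 : y ≤ 1 / 2) : y ^ 2 ≤ 1 / 2 := by nlinarith

section
variable (g : TorusQuat)

theorem im_bounds : -1 ≤ (g.1 : ℂ).im ∧ (g.1 : ℂ).im ≤ 1 ∧ -1 ≤ (g.2.1 : ℂ).im ∧
    (g.2.1 : ℂ).im ≤ 1 := by
  have h1 := circle_sq g.1
  have h2 := circle_sq g.2.1
  refine ⟨?_, ?_, ?_, ?_⟩ <;> nlinarith [sq_nonneg (g.1 : ℂ).re, sq_nonneg (g.2.1 : ℂ).re]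

theorem imag_sq_le : (g.2.2 : ℍ[ℝ]).imI ^ 2 ≤ 1 ∧ (g.2.2 : ℍ[ℝ]).imJ ^ 2 ≤ 1 ∧
    (g.2.2 : ℍ[ℝ]).imK ^ 2 ≤ 1 := by
  have h := unitQuat_sq g.2.2
  refine ⟨?_, ?_, ?_⟩ <;> nlinarith [sq_nonneg (g.2.2 : ℍ[ℝ]).re, sq_nonneg (g.2.2 : ℍ[ℝ]).imI,
    sq_nonneg (g.2.2 : ℍ[ℝ]).imJ, sq_nonneg (g.2.2 : ℍ[ℝ]).imK]

theorem radius1_sq : radius1 g ^ 2 = 1 + (g.1 : ℂ).im / 2 :=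
  Real.sq_sqrt (by linarith [im_bounds g])

theorem radius3_sq : radius3 g ^ 2 = 1 - (g.2.1 : ℂ).im / 2 :=
  Real.sq_sqrt (by linarith [im_bounds g])

theorem radius_bounds : 7 / 10 ≤ radius1 g ∧ radius1 g ≤ 13 / 10 ∧ 7 / 10 ≤ radius3 g ∧
    radius3 g ≤ 13 / 10 := by
  obtain ⟨h1, h2, h3, h4⟩ := im_bounds g
  refine ⟨Real.le_sqrt_of_sq_le (by linarith), Real.sqrt_le_iff.2 ⟨by norm_num, by linarith⟩,
    Real.le_sqrt_of_sq_le (by linarith), Real.sqrt_le_iff.2 ⟨by norm_num, by linarith⟩⟩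

theorem radDen_bounds : 4 ≤ radDen g ∧ radDen g ≤ 8 := by
  have := im_bounds g
  unfold radDen
  constructor <;> linarith

theorem len3_preMap : len3 (preMap g) = radDen g / 2 := by
  obtain ⟨h1, h2, h3⟩ := imag_sq_le g
  simp only [len3, preMap, normSq_leftPoint h1, normSq_leftPoint h2, normSq_leftPoint h3,
    radius1_sq, radius3_sq, radDen]
  ring

theorem radA_preMap : radA (preMap g) = (g.1 : ℂ).im / 2 := by
  obtain ⟨h1, h2, h3⟩ := imag_sq_le g
  simp only [radA, preMap, normSq_leftPoint h1, normSq_leftPoint h2, radius1_sq]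
  ring

theorem radB_preMap : radB (preMap g) = (g.2.1 : ℂ).im / 2 := by
  obtain ⟨h1, h2, h3⟩ := imag_sq_le g
  simp only [radB, preMap, normSq_leftPoint h2, normSq_leftPoint h3, radius3_sq]
  ring

theorem shift_nonneg : 0 ≤ shift g := by
  unfold shift; positivity

theorem len3_shiftMap_pos : 0 < len3 (shiftMap g) := by
  have h0 : 0 ≤ len3 (shiftMap g) := by
    exact add_nonneg (add_nonneg (Complex.normSq_nonneg _) (Complex.normSq_nonneg _))
      (Complex.normSq_nonneg _)
  refine lt_of_le_of_ne h0 fun h => ?_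
  have n1 := Complex.normSq_nonneg (shiftMap g).1
  have n2 := Complex.normSq_nonneg (shiftMap g).2.1
  have n3 := Complex.normSq_nonneg (shiftMap g).2.2
  unfold len3 at h
  have z1 := Complex.normSq_eq_zero.1 (show Complex.normSq (shiftMap g).1 = 0 by linarith)
  have z2 := Complex.normSq_eq_zero.1 (show Complex.normSq (shiftMap g).2.1 = 0 by linarith)
  have z3 := Complex.normSq_eq_zero.1 (show Complex.normSq (shiftMap g).2.2 = 0 by linarith)
  obtain ⟨b1, b2, b3, b4⟩ := radius_bounds g
  have i1 := congrArg Complex.im z1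
  have i2 := congrArg Complex.im z2
  have i3 := congrArg Complex.im z3
  have r1 := congrArg Complex.re z1
  have r2 := congrArg Complex.re z2
  have r3 := congrArg Complex.re z3
  simp only [shiftMap, preMap, leftPoint, Complex.add_im, Complex.ofReal_im, Complex.zero_im,
    add_zero, Complex.add_re, Complex.ofReal_re, Complex.zero_re] at i1 i2 i3 r1 r2 r3
  have y1 : (g.2.2 : ℍ[ℝ]).imI = 0 := by
    rcases mul_eq_zero.1 i1 with h | h <;> linarith
  have y2 : (g.2.2 : ℍ[ℝ]).imJ = 0 := by linarith
  have y3 : (g.2.2 : ℍ[ℝ]).imK = 0 := by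
    rcases mul_eq_zero.1 i3 with h | h <;> linarith
  rw [y1] at r1
  rw [y2] at r2
  rw [y3] at r3
  norm_num at r1 r2 r3
  have q1 := radius1_sq g
  have q3 := radius3_sq g
  have hs : shift g = 1 := by linarith
  rw [show radius1 g = 1 by linarith] at q1
  rw [show radius3 g = 1 by linarith] at q3
  have c1 := circle_sq g.1
  have c2 := circle_sq g.2.1
  have c3 := unitQuat_sq g.2.2
  rw [show (g.1 : ℂ).im = 0 by linarith] at c1
  rw [show (g.2.1 : ℂ).im = 0 by linarith] at c2
  rw [y1, y2, y3] at c3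
  have aux : ∀ t : ℝ, t ^ 2 = 1 → max t 0 = 0 ∨ max t 0 = 1 := fun t ht => by
    rcases sq_eq_sq_iff_eq_or_eq_neg.1 (ht.trans (one_pow 2).symm) with h | h
    · right; rw [h]; norm_num
    · left; rw [h]; norm_num
  unfold shift at hs
  rcases aux _ (show (g.1 : ℂ).re ^ 2 = 1 by linarith) with e1 | e1 <;>
  rcases aux _ (show (g.2.1 : ℂ).re ^ 2 = 1 by linarith) with e2 | e2 <;>
  rcases aux _ (show (g.2.2 : ℍ[ℝ]).re ^ 2 = 1 by linarith) with e3 | e3 <;>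
  · rw [e1, e2, e3] at hs
    norm_num at hs

theorem len3_toSphere : len3 (toSphere g) = 1 := by
  have h := len3_shiftMap_pos g
  rw [toSphere, len3_smul, inv_pow, Real.sq_sqrt h.le, inv_mul_cancel₀ h.ne']

set_option maxHeartbeats 800000 in
theorem toSphere_small (h : attach (toSphere g) ≠ 1) : (g.1 : ℂ).re < 0 ∧ (g.2.1 : ℂ).re < 0 ∧
    (g.2.2 : ℍ[ℝ]).re < 0 := by
  have hs : InSector (toSphere g) := by
    by_contra hs
    exact h (if_neg hs)
  have hc : coreC (toSphere g) ≠ 1 := by rwa [attach, if_pos hs] at h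
  have hlen := len3_toSphere g
  obtain ⟨a1, a2, a3⟩ := small_of_coreC_ne_one hc
  obtain ⟨s1, s2, s3⟩ := re_lt_of_coreC_ne_one hc hs (by rw [hlen]; norm_num)
  obtain ⟨L, hL, hLw⟩ : ∃ L : ℝ, 0 < L ∧ L • toSphere g = shiftMap g := by
    have hL : 0 < √(len3 (shiftMap g)) := Real.sqrt_pos.2 (len3_shiftMap_pos g)
    exact ⟨_, hL, smul_inv_smul₀ hL.ne' _⟩
  have e1 : (preMap g).1 = L * (toSphere g).1 - shift g :=
    eq_sub_of_add_eq (congrArg (fun w : ℂ × ℂ × ℂ => w.1) hLw).symm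
  have e2 : (preMap g).2.1 = L * (toSphere g).2.1 - shift g :=
    eq_sub_of_add_eq (congrArg (fun w : ℂ × ℂ × ℂ => w.2.1) hLw).symm
  have e3 : (preMap g).2.2 = L * (toSphere g).2.2 - shift g :=
    eq_sub_of_add_eq (congrArg (fun w : ℂ × ℂ × ℂ => w.2.2) hLw).symm
  have hm := shift_nonneg g
  have hl := len3_preMap g
  have hA := radA_preMap g
  have hB := radB_preMap g
  obtain ⟨n1, n2⟩ := radDen_bounds g
  obtain ⟨b1, b2, b3, b4⟩ := radius_bounds g
  rw [abs_lt] at a1 a2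
  have p1 : -radius1 g ≤ (preMap g).1.re :=
    (leftPoint_re_le (R := radius1 g) (by linarith) (imag_sq_le g).1).2
  have q1 : radius1 g * ((g.2.2 : ℍ[ℝ]).imI / 2) = (preMap g).1.im := rfl
  have q2 : 1 * ((g.2.2 : ℍ[ℝ]).imJ / 2) = (preMap g).2.1.im := rfl
  have q3 : radius3 g * ((g.2.2 : ℍ[ℝ]).imK / 2) = (preMap g).2.2.im := rfl
  simp only [len3, radA, radB, e1, e2, e3, Complex.normSq_apply, Complex.sub_re, Complex.sub_im,
    Complex.re_ofReal_mul, Complex.im_ofReal_mul, Complex.ofReal_re, Complex.ofReal_im,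
    sub_zero, cutDelta] at a1 a2 a3 hl hA hB hlen p1 q1 q2 q3
  have i1 := sq_nonneg (toSphere g).1.im
  have i2 := sq_nonneg (toSphere g).2.1.im
  have i3 := sq_nonneg (toSphere g).2.2.im
  obtain ⟨k1, k3⟩ := box_estimate hL hm a1.1 a1.2 (by linarith) s1 s2 s3 hlen
  obtain ⟨k2, -⟩ := box_estimate hL hm a2.1 a2.2 (by linarith) s2 s3 s1 (z := (toSphere g).1.im)
    (by linarith)
  rw [hA, hl] at k1
  rw [hB] at k2
  rw [hl] at k3
  rw [abs_le] at k1 k2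
  have hP : shift g < 13 / 10 := by
    have := mul_pos hL (show 0 < -(toSphere g).1.re by linarith)
    linarith
  have hI : L ^ 2 * ((toSphere g).1.im ^ 2 + (toSphere g).2.1.im ^ 2 + (toSphere g).2.2.im ^ 2) ≤
      4 * (1 / 400) :=
    mul_le_mul (by linarith) a3.le (by linarith) (by norm_num)
  have hI' : radius1 g ^ 2 * (g.2.2 : ℍ[ℝ]).imI ^ 2 + (g.2.2 : ℍ[ℝ]).imJ ^ 2 +
      radius3 g ^ 2 * (g.2.2 : ℍ[ℝ]).imK ^ 2 ≤ 4 * (4 * (1 / 400)) := by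
    have r1 : radius1 g * (g.2.2 : ℍ[ℝ]).imI = 2 * (L * (toSphere g).1.im) := by linarith
    have r2 : (g.2.2 : ℍ[ℝ]).imJ = 2 * (L * (toSphere g).2.1.im) := by linarith
    have r3 : radius3 g * (g.2.2 : ℍ[ℝ]).imK = 2 * (L * (toSphere g).2.2.im) := by linarith
    rw [← mul_pow, ← mul_pow, r1, r2, r3]
    linarith
  have hsm := shift g
  have f1 : (g.1 : ℂ).re ≤ max (g.1 : ℂ).re 0 := le_max_left _ _
  have f2 : (g.2.1 : ℂ).re ≤ max (g.2.1 : ℂ).re 0 := le_max_left _ _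
  have f3 : (g.2.2 : ℍ[ℝ]).re ≤ max (g.2.2 : ℍ[ℝ]).re 0 := le_max_left _ _
  have f1' : 0 ≤ max (g.1 : ℂ).re 0 := le_max_right _ _
  have f2' : 0 ≤ max (g.2.1 : ℂ).re 0 := le_max_right _ _
  have f3' : 0 ≤ max (g.2.2 : ℍ[ℝ]).re 0 := le_max_right _ _
  unfold shift at hP
  have c1 := circle_sq g.1
  have c2 := circle_sq g.2.1
  have c3 := unitQuat_sq g.2.2
  have r1 : 2 / 5 * (g.2.2 : ℍ[ℝ]).imI ^ 2 ≤ radius1 g ^ 2 * (g.2.2 : ℍ[ℝ]).imI ^ 2 :=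
    mul_le_mul_of_nonneg_right (two_fifths_le_sq b1) (sq_nonneg _)
  have r3 : 2 / 5 * (g.2.2 : ℍ[ℝ]).imK ^ 2 ≤ radius3 g ^ 2 * (g.2.2 : ℍ[ℝ]).imK ^ 2 :=
    mul_le_mul_of_nonneg_right (two_fifths_le_sq b3) (sq_nonneg _)
  have j2 := sq_nonneg (g.2.2 : ℍ[ℝ]).imJ
  refine ⟨neg_of_small_imag (y := (g.1 : ℂ).im ^ 2) (by linarith) ?_ (by linarith),
    neg_of_small_imag (y := (g.2.1 : ℂ).im ^ 2) (by linarith) ?_ (by linarith),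
    neg_of_small_imag (y := (g.2.2 : ℍ[ℝ]).imI ^ 2 + (g.2.2 : ℍ[ℝ]).imJ ^ 2 +
      (g.2.2 : ℍ[ℝ]).imK ^ 2) (by linarith) (by linarith) (by linarith)⟩
  · exact sq_le_of_bounds (by linarith) (by linarith)
  · exact sq_le_of_bounds (by linarith) (by linarith)

theorem preMap_re_le : (preMap g).1.re ≤ -(1 / 2) ∧ (preMap g).2.1.re ≤ -(1 / 2) ∧
    (preMap g).2.2.re ≤ -(1 / 2) := by
  obtain ⟨b1, b2, b3, b4⟩ := radius_bounds g
  obtain ⟨i1, i2, i3⟩ := imag_sq_le g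
  have h1 : (preMap g).1.re ≤ _ := (leftPoint_re_le (by linarith) i1).1
  have h2 : (preMap g).2.1.re ≤ _ := (leftPoint_re_le zero_le_one i2).1
  have h3 : (preMap g).2.2.re ≤ _ := (leftPoint_re_le (by linarith) i3).1
  refine ⟨?_, ?_, ?_⟩ <;> linarith

theorem toSphere_of_nonpos (h1 : (g.1 : ℂ).re ≤ 0) (h2 : (g.2.1 : ℂ).re ≤ 0)
    (h3 : (g.2.2 : ℍ[ℝ]).re ≤ 0) : toSphere g = (√(radDen g / 2))⁻¹ • preMap g := by
  have hm : shift g = 0 := by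
    rw [shift, max_eq_right h1, max_eq_right h2, max_eq_right h3]; norm_num
  have e : shiftMap g = preMap g := by simp [shiftMap, hm]
  rw [toSphere, e, len3_preMap]

theorem inSector_toSphere (h1 : (g.1 : ℂ).re ≤ 0) (h2 : (g.2.1 : ℂ).re ≤ 0)
    (h3 : (g.2.2 : ℍ[ℝ]).re ≤ 0) : InSector (toSphere g) := by
  obtain ⟨n1, n2⟩ := radDen_bounds g
  obtain ⟨p1, p2, p3⟩ := preMap_re_le g
  have hL : 0 < √(radDen g / 2) := Real.sqrt_pos.2 (by linarith)
  have hL2 : √(radDen g / 2) ≤ 2 := Real.sqrt_le_iff.2 ⟨by norm_num, by linarith⟩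
  have key : ∀ t : ℝ, t ≤ -(1 / 2) → (√(radDen g / 2))⁻¹ * t < -1 / 10 := fun t ht => by
    rw [inv_mul_lt_iff₀ hL]; linarith
  rw [toSphere_of_nonpos g h1 h2 h3]
  refine ⟨?_, ?_, ?_⟩
  · simpa using key _ p1
  · simpa using key _ p2
  · simpa using key _ p3

end

end TorusToSphere

section NotNull

section Segment
variable {E : Type*} [NormedAddCommGroup E] [NormedSpace ℝ E]

/-- The point at time `t` on the segment from `a` to `b`, normalised. -/
def unitSegment (t : ℝ) (a b : E) : E := ‖(1 - t) • a + t • b‖⁻¹ • ((1 - t) • a + t • b)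

theorem segment_ne_zero {t : ℝ} (h0 : 0 ≤ t) (h1 : t ≤ 1) {a b : E} (ha : ‖a‖ = 1) (hb : ‖b‖ = 1)
    (hab : a ≠ -b) : (1 - t) • a + t • b ≠ 0 := fun h => by
  have e := eq_neg_of_add_eq_zero_left h
  have hn := congrArg norm e
  rw [norm_neg, norm_smul, norm_smul, ha, hb, Real.norm_of_nonneg h0,
    Real.norm_of_nonneg (sub_nonneg.2 h1)] at hn
  have ht : t = 1 / 2 := by linarith
  rw [ht, ← smul_neg, sub_half] at e
  exact hab (smul_right_injective E (one_half_pos (α := ℝ)).ne' e)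

theorem norm_unitSegment {t : ℝ} (h0 : 0 ≤ t) (h1 : t ≤ 1) {a b : E} (ha : ‖a‖ = 1) (hb : ‖b‖ = 1)
    (hab : a ≠ -b) : ‖unitSegment t a b‖ = 1 := by
  rw [unitSegment, norm_smul, norm_inv, norm_norm,
    inv_mul_cancel₀ (norm_ne_zero_iff.2 (segment_ne_zero h0 h1 ha hb hab))]

theorem unitSegment_zero {a : E} (b : E) (ha : ‖a‖ = 1) : unitSegment 0 a b = a := by
  simp [unitSegment, ha]

theorem unitSegment_one (a : E) {b : E} (hb : ‖b‖ = 1) : unitSegment 1 a b = b := by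
  simp [unitSegment, hb]

theorem continuous_unitSegment {X : Type*} [TopologicalSpace X] {a b : X → E} (ha : Continuous a)
    (hb : Continuous b) (ha' : ∀ x, ‖a x‖ = 1) (hb' : ∀ x, ‖b x‖ = 1) (hab : ∀ x, a x ≠ -b x) :
    Continuous fun p : I × X => unitSegment (p.1 : ℝ) (a p.2) (b p.2) := by
  have h : Continuous fun p : I × X => (1 - (p.1 : ℝ)) • a p.2 + (p.1 : ℝ) • b p.2 := by fun_prop
  exact (h.norm.inv₀ fun p => norm_ne_zero_iff.2
    (segment_ne_zero p.1.2.1 p.1.2.2 (ha' _) (hb' _) (hab _))).smul h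

end Segment

section Coordinates

theorem continuous_circle_re : Continuous fun c : Circle => (c : ℂ).re :=
  Complex.continuous_re.comp continuous_subtype_val

theorem continuous_circle_im : Continuous fun c : Circle => (c : ℂ).im :=
  Complex.continuous_im.comp continuous_subtype_val

theorem continuous_radDen : Continuous radDen := by
  have h1 : Continuous fun g : TorusQuat => (g.1 : ℂ).im := continuous_circle_im.comp continuous_fst
  have h2 : Continuous fun g : TorusQuat => (g.2.1 : ℂ).im :=
    continuous_circle_im.comp (continuous_fst.comp continuous_snd)
  exact (continuous_const.add h1).sub h2

theorem continuous_unitQuat_coord : Continuous (fun g : TorusQuat => (g.2.2 : ℍ[ℝ]).re) ∧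
    Continuous (fun g : TorusQuat => (g.2.2 : ℍ[ℝ]).imI) ∧
    Continuous (fun g : TorusQuat => (g.2.2 : ℍ[ℝ]).imJ) ∧
    Continuous (fun g : TorusQuat => (g.2.2 : ℍ[ℝ]).imK) := by
  have h : Continuous fun g : TorusQuat => (g.2.2 : ℍ[ℝ]) :=
    continuous_subtype_val.comp (continuous_snd.comp continuous_snd)
  exact ⟨Quaternion.continuous_re.comp h, Quaternion.continuous_imI.comp h,
    Quaternion.continuous_imJ.comp h, Quaternion.continuous_imK.comp h⟩

theorem Complex.continuous_mk {X : Type*} [TopologicalSpace X] {a b : X → ℝ} (ha : Continuous a)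
    (hb : Continuous b) : Continuous fun x => (⟨a x, b x⟩ : ℂ) := by
  have e : (fun x => (⟨a x, b x⟩ : ℂ)) = fun x => (a x : ℂ) + (b x : ℂ) * Complex.I := by
    funext x; exact Complex.mk_eq_add_mul_I _ _
  rw [e]; fun_prop

theorem continuous_leftPoint {X : Type*} [TopologicalSpace X] {a b : X → ℝ} (ha : Continuous a)
    (hb : Continuous b) : Continuous fun x => leftPoint (a x) (b x) :=
  Complex.continuous_mk (by fun_prop) (by fun_prop)

theorem continuous_preMap : Continuous preMap := by
  obtain ⟨-, hI, hJ, hK⟩ := continuous_unitQuat_coord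
  have h1 : Continuous radius1 := by
    have h1 : Continuous fun g : TorusQuat => (g.1 : ℂ).im :=
      continuous_circle_im.comp continuous_fst
    exact Real.continuous_sqrt.comp (continuous_const.add (h1.div_const 2))
  have h3 : Continuous radius3 := by
    have h2 : Continuous fun g : TorusQuat => (g.2.1 : ℂ).im :=
      continuous_circle_im.comp (continuous_fst.comp continuous_snd)
    exact Real.continuous_sqrt.comp (continuous_const.sub (h2.div_const 2))
  exact (continuous_leftPoint h1 hI).prodMk ((continuous_leftPoint continuous_const hJ).prodMk
    (continuous_leftPoint h3 hK))

theorem continuous_shift : Continuous shift := by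
  have h1 : Continuous fun g : TorusQuat => (g.1 : ℂ).re := continuous_circle_re.comp continuous_fst
  have h2 : Continuous fun g : TorusQuat => (g.2.1 : ℂ).re :=
    continuous_circle_re.comp (continuous_fst.comp continuous_snd)
  exact continuous_const.mul (((h1.max continuous_const).add (h2.max continuous_const)).add
    (continuous_unitQuat_coord.1.max continuous_const))

theorem continuous_toSphere : Continuous toSphere := by
  have hs : Continuous fun g => (shift g : ℂ) := Complex.continuous_ofReal.comp continuous_shift
  have hp := continuous_preMap
  have h : Continuous shiftMap := (hp.fst.add hs).prodMk ((hp.snd.fst.add hs).prodMk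
    (hp.snd.snd.add hs))
  have hl : Continuous fun g => len3 (shiftMap g) := by
    have hn := Complex.continuous_normSq
    exact ((hn.comp h.fst).add (hn.comp h.snd.fst)).add (hn.comp h.snd.snd)
  exact ((Real.continuous_sqrt.comp hl).inv₀ fun g =>
    (Real.sqrt_pos.2 (len3_shiftMap_pos g)).ne').smul h

end Coordinates

/-- The phase of the first coordinate. -/
def phase1 (g : TorusQuat) : ℂ :=
  if (g.1 : ℂ).re ≤ 0 then phase ((g.1 : ℂ).im / radDen g) else 1

/-- The phase of the second coordinate. -/
def phase2 (g : TorusQuat) : ℂ :=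
  if (g.2.1 : ℂ).re ≤ 0 then phase ((g.2.1 : ℂ).im / radDen g) else 1

/-- The scaling factor of the unshifted map. -/
def preScale (g : TorusQuat) : ℝ := (√(radDen g / 2))⁻¹

/-- The unit quaternion of the third coordinate. -/
def bubble3 (g : TorusQuat) : ℍ[ℝ] :=
  if (g.2.2 : ℍ[ℝ]).re ≤ 0 then bubbleU (preScale g * (preMap g).1.im)
    (preScale g * (preMap g).2.1.im) (preScale g * (preMap g).2.2.im) else 1

theorem preScale_bounds (g : TorusQuat) : 1 / 2 ≤ preScale g := by
  obtain ⟨n1, n2⟩ := radDen_bounds g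
  have hL : 0 < √(radDen g / 2) := Real.sqrt_pos.2 (by linarith)
  have hL2 : √(radDen g / 2) ≤ 2 := Real.sqrt_le_iff.2 ⟨by norm_num, by linarith⟩
  rw [preScale, le_inv_comm₀ (by norm_num) hL]
  linarith

theorem exists_preMap_im (g : TorusQuat) : ∃ b1 b2 b3 : ℝ, (1 / 8 ≤ b1 ∧ 1 / 8 ≤ b2 ∧ 1 / 8 ≤ b3) ∧
    preScale g * (preMap g).1.im = b1 * (g.2.2 : ℍ[ℝ]).imI ∧
    preScale g * (preMap g).2.1.im = b2 * (g.2.2 : ℍ[ℝ]).imJ ∧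
    preScale g * (preMap g).2.2.im = b3 * (g.2.2 : ℍ[ℝ]).imK := by
  have hs := preScale_bounds g
  obtain ⟨h1, -, h3, -⟩ := radius_bounds g
  refine ⟨preScale g * (radius1 g / 2), preScale g * (1 / 2), preScale g * (radius3 g / 2),
    ⟨?_, ?_, ?_⟩, ?_, ?_, ?_⟩
  · nlinarith
  · nlinarith
  · nlinarith
  all_goals simp only [preMap, leftPoint]; ring

theorem phase_div_radDen_of_re {c : Circle} (g : TorusQuat) (h : (c : ℂ).re = 0) :
    phase ((c : ℂ).im / radDen g) = 1 := by
  obtain ⟨n1, n2⟩ := radDen_bounds g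
  have hc := circle_sq c
  have h1 : |(c : ℂ).im| = 1 := by
    rw [← sq_eq_sq₀ (abs_nonneg _) zero_le_one, sq_abs]; rw [h] at hc; linarith
  refine phase_of_le ?_
  rw [abs_div, h1, abs_of_pos (by linarith : 0 < radDen g), le_div_iff₀ (by linarith), cutDelta]
  linarith

theorem continuous_phase : Continuous phase :=
  Complex.continuous_mk contDiff_phase_re.continuous contDiff_phase_im.continuous

theorem radDen_ne_zero (g : TorusQuat) : radDen g ≠ 0 := by
  have := radDen_bounds g; intro h; linarith

theorem continuous_phase1 : Continuous phase1 := by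
  have h1 : Continuous fun g : TorusQuat => (g.1 : ℂ).re := continuous_circle_re.comp continuous_fst
  have h2 : Continuous fun g : TorusQuat => (g.1 : ℂ).im := continuous_circle_im.comp continuous_fst
  exact Continuous.if_le (continuous_phase.comp (h2.div continuous_radDen radDen_ne_zero))
    continuous_const h1 continuous_const fun g hg => phase_div_radDen_of_re g hg

theorem continuous_phase2 : Continuous phase2 := by
  have h1 : Continuous fun g : TorusQuat => (g.2.1 : ℂ).re :=
    continuous_circle_re.comp (continuous_fst.comp continuous_snd)
  have h2 : Continuous fun g : TorusQuat => (g.2.1 : ℂ).im :=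
    continuous_circle_im.comp (continuous_fst.comp continuous_snd)
  exact Continuous.if_le (continuous_phase.comp (h2.div continuous_radDen radDen_ne_zero))
    continuous_const h1 continuous_const fun g hg => phase_div_radDen_of_re g hg

theorem continuous_bubble3 : Continuous bubble3 := by
  have hs : Continuous preScale := (Real.continuous_sqrt.comp (continuous_radDen.div_const 2)).inv₀
    fun g => (Real.sqrt_pos.2 (by linarith [radDen_bounds g])).ne'
  have hp := continuous_preMap
  have hi := Complex.continuous_im
  have hu : Continuous fun p : ℝ × ℝ × ℝ => bubbleU p.1 p.2.1 p.2.2 := contDiff_bubbleU.continuous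
  have hm : Continuous fun g => (preScale g * (preMap g).1.im, preScale g * (preMap g).2.1.im,
      preScale g * (preMap g).2.2.im) :=
    (hs.mul (hi.comp hp.fst)).prodMk ((hs.mul (hi.comp hp.snd.fst)).prodMk
      (hs.mul (hi.comp hp.snd.snd)))
  have e : (fun g => bubbleU (preScale g * (preMap g).1.im) (preScale g * (preMap g).2.1.im)
      (preScale g * (preMap g).2.2.im)) = (fun p : ℝ × ℝ × ℝ => bubbleU p.1 p.2.1 p.2.2) ∘
      fun g => (preScale g * (preMap g).1.im, preScale g * (preMap g).2.1.im,
        preScale g * (preMap g).2.2.im) := rfl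
  have hum := hu.comp hm
  rw [← e] at hum
  refine Continuous.if_le hum continuous_const continuous_unitQuat_coord.1
    continuous_const fun g hg => bubbleU_of_le ?_
  obtain ⟨b1, b2, b3, ⟨h1, h2, h3⟩, e1, e2, e3⟩ := exists_preMap_im g
  simp only [e1, e2, e3, cutDelta, mul_pow]
  have hx := unitQuat_sq g.2.2
  rw [hg] at hx
  have key : ∀ {b : ℝ} (x : ℝ), 1 / 8 ≤ b → 1 / 64 * x ^ 2 ≤ b ^ 2 * x ^ 2 := fun x hb =>
    mul_le_mul_of_nonneg_right (by nlinarith) (sq_nonneg x)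
  linarith [key (g.2.2 : ℍ[ℝ]).imI h1, key (g.2.2 : ℍ[ℝ]).imJ h2, key (g.2.2 : ℍ[ℝ]).imK h3]

theorem norm_phase1 (g : TorusQuat) : ‖phase1 g‖ = 1 := by
  unfold phase1; split_ifs
  exacts [norm_phase _, norm_one]

theorem norm_phase2 (g : TorusQuat) : ‖phase2 g‖ = 1 := by
  unfold phase2; split_ifs
  exacts [norm_phase _, norm_one]

theorem norm_bubble3 (g : TorusQuat) : ‖bubble3 g‖ = 1 := by
  unfold bubble3; split_ifs
  exacts [norm_bubbleU _ _ _, norm_one]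

theorem phase_ne_neg {c : Circle} {r : ℝ} (hr : 0 < r) :
    (if (c : ℂ).re ≤ 0 then phase ((c : ℂ).im / r) else 1) ≠ -(c : ℂ) := by
  split_ifs with h <;> intro he
  · have h1 := phase_im_mul_nonneg ((c : ℂ).im / r)
    have h0 : (c : ℂ).im = 0 := by
      rw [he, Complex.neg_im, ← mul_div_assoc] at h1
      have := (le_div_iff₀ hr).1 h1
      rw [zero_mul] at this
      nlinarith [sq_nonneg (c : ℂ).im]
    rw [h0, zero_div, phase_zero, neg_inj] at he
    rw [← he, Complex.one_re] at h
    linarith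
  · have := congrArg Complex.re he
    rw [Complex.one_re, Complex.neg_re] at this
    linarith

theorem phase1_ne (g : TorusQuat) : phase1 g ≠ -(g.1 : ℂ) :=
  phase_ne_neg (by linarith [radDen_bounds g])

theorem phase2_ne (g : TorusQuat) : phase2 g ≠ -(g.2.1 : ℂ) :=
  phase_ne_neg (by linarith [radDen_bounds g])

theorem bubble3_ne (g : TorusQuat) : bubble3 g ≠ -(g.2.2 : ℍ[ℝ]) := by
  unfold bubble3
  split_ifs with h <;> intro he
  · obtain ⟨b1, b2, b3, ⟨h1, h2, h3⟩, e1, e2, e3⟩ := exists_preMap_im g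
    rw [e1, e2, e3] at he
    obtain ⟨r, hr, i1, i2, i3⟩ := exists_bubbleU_im (b1 * (g.2.2 : ℍ[ℝ]).imI)
      (b2 * (g.2.2 : ℍ[ℝ]).imJ) (b3 * (g.2.2 : ℍ[ℝ]).imK)
    rw [he] at i1 i2 i3
    have key : ∀ {b x : ℝ}, 1 / 8 ≤ b → -x = r * (b * x) → x = 0 := fun {b x} hb hx => by
      have h0 : 0 ≤ r * b := mul_nonneg hr (by linarith)
      have : (r * b + 1) * x = 0 := by linarith
      exact (mul_eq_zero.1 this).resolve_left (by linarith)
    have z1 := key h1 i1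
    have z2 := key h2 i2
    have z3 := key h3 i3
    rw [z1, z2, z3, mul_zero, mul_zero, mul_zero, bubbleU_zero, neg_inj] at he
    rw [← he, Quaternion.re_one] at h
    linarith
  · have := congrArg (fun q : ℍ[ℝ] => q.re) he
    simp only [Quaternion.re_one, Quaternion.re_neg] at this
    linarith

theorem hopf_one : hopf 1 = embC Complex.I := by simp [hopf]

theorem attach_toSphere (g : TorusQuat) :
    attach (toSphere g) = hopfClutch (phase1 g) (phase2 g) (hopf (bubble3 g)) := by
  by_cases h1 : (g.1 : ℂ).re ≤ 0
  · by_cases h2 : (g.2.1 : ℂ).re ≤ 0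
    · by_cases h3 : (g.2.2 : ℍ[ℝ]).re ≤ 0
      · have hr : 0 ≤ radDen g / 2 := by linarith [radDen_bounds g]
        have hd := radDen_ne_zero g
        have hA : ∀ (r : ℝ) w, radA (r • w) = r ^ 2 * radA w := fun r w => by
          simp only [radA, Prod.smul_fst, Prod.smul_snd, Complex.normSq_apply, Complex.smul_re,
            Complex.smul_im, smul_eq_mul]
          ring
        have hB : ∀ (r : ℝ) w, radB (r • w) = r ^ 2 * radB w := fun r w => by
          simp only [radB, Prod.smul_fst, Prod.smul_snd, Complex.normSq_apply, Complex.smul_re,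
            Complex.smul_im, smul_eq_mul]
          ring
        have eA : radA (toSphere g) = (g.1 : ℂ).im / radDen g := by
          rw [toSphere_of_nonpos g h1 h2 h3, hA, radA_preMap, inv_pow, Real.sq_sqrt hr]
          field_simp
        have eB : radB (toSphere g) = (g.2.1 : ℂ).im / radDen g := by
          rw [toSphere_of_nonpos g h1 h2 h3, hB, radB_preMap, inv_pow, Real.sq_sqrt hr]
          field_simp
        rw [attach, if_pos (inSector_toSphere g h1 h2 h3), coreC, eA, eB, phase1, if_pos h1, phase2,
          if_pos h2, bubble3, if_pos h3, toSphere_of_nonpos g h1 h2 h3, coreMap, bubbleS]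
        simp only [Prod.smul_fst, Prod.smul_snd, Complex.smul_im, smul_eq_mul, preScale]
      · rw [bubble3, if_neg h3, hopfClutch_of_fixed (norm_hopf norm_one) (hopf_re _)
          (by rw [hopf_one, rotH_embC])]
        by_contra hne
        exact h3 (toSphere_small g hne).2.2.le
    · rw [phase2, if_neg h2, hopfClutch_of_fixed (norm_hopf (norm_bubble3 g)) (hopf_re _)
        (rotH_one_left _)]
      by_contra hne
      exact h2 (toSphere_small g hne).2.1.le
  · rw [phase1, if_neg h1, hopfClutch_one_left]
    by_contra hne
    exact h1 (toSphere_small g hne).1.le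

theorem continuous_hopfClutch {X : Type*} [TopologicalSpace X] {c d : X → ℂ} {v : X → ℍ[ℝ]}
    (hc : Continuous c) (hd : Continuous d) (hv : Continuous v) :
    Continuous fun x => hopfClutch (c x) (d x) (v x) := by
  have hr : Continuous fun x => rotH (d x) (v x) := continuous_rotH.comp (hd.prodMk hv)
  have h1 : Continuous fun x => (c x).re := Complex.continuous_re.comp hc
  have h2 : Continuous fun x => (c x).im := Complex.continuous_im.comp hc
  unfold hopfClutch
  fun_prop

theorem continuous_hopf : Continuous hopf := contDiff_hopf.continuous

/-- The homotopy from the attaching map to the model clutching map. -/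
theorem exists_homotopy_attach : ∃ K : I × TorusQuat → ℍ[ℝ], Continuous K ∧ (∀ z, K z ≠ 0) ∧
    (∀ g, K (0, g) = attach (toSphere g)) ∧
    ∀ g, K (1, g) = hopfClutch g.1 g.2.1 (hopf g.2.2) := by
  have n1 : ∀ g : TorusQuat, ‖(g.1 : ℂ)‖ = 1 := fun g => Circle.norm_coe _
  have n2 : ∀ g : TorusQuat, ‖(g.2.1 : ℂ)‖ = 1 := fun g => Circle.norm_coe _
  have n3 : ∀ g : TorusQuat, ‖(g.2.2 : ℍ[ℝ])‖ = 1 := fun g => mem_sphere_zero_iff_norm.1 g.2.2.2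
  have h1 := continuous_unitSegment continuous_phase1 (continuous_subtype_val.comp continuous_fst)
    norm_phase1 n1 phase1_ne
  have h2 := continuous_unitSegment continuous_phase2
    (continuous_subtype_val.comp (continuous_fst.comp continuous_snd)) norm_phase2 n2 phase2_ne
  have h3 := continuous_unitSegment continuous_bubble3
    (continuous_subtype_val.comp (continuous_snd.comp continuous_snd)) norm_bubble3 n3 bubble3_ne
  refine ⟨fun p => hopfClutch (unitSegment (p.1 : ℝ) (phase1 p.2) p.2.1)
    (unitSegment (p.1 : ℝ) (phase2 p.2) p.2.2.1)
    (hopf (unitSegment (p.1 : ℝ) (bubble3 p.2) p.2.2.2)),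
    continuous_hopfClutch h1 h2 (continuous_hopf.comp h3), fun p => ?_, fun g => ?_, fun g => ?_⟩
  · refine norm_ne_zero_iff.1 ?_
    rw [norm_hopfClutch (norm_unitSegment p.1.2.1 p.1.2.2 (norm_phase1 _) (n1 _) (phase1_ne _))
      (norm_unitSegment p.1.2.1 p.1.2.2 (norm_phase2 _) (n2 _) (phase2_ne _))
      (norm_hopf (norm_unitSegment p.1.2.1 p.1.2.2 (norm_bubble3 _) (n3 _) (bubble3_ne _)))
      (hopf_re _)]
    exact one_ne_zero
  · rw [attach_toSphere]
    simp only [Set.Icc.coe_zero, unitSegment_zero _ (norm_phase1 g),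
      unitSegment_zero _ (norm_phase2 g), unitSegment_zero _ (norm_bubble3 g)]
  · simp only [Set.Icc.coe_one, unitSegment_one _ (n1 g), unitSegment_one _ (n2 g),
      unitSegment_one _ (n3 g)]

theorem not_hasLineSection_suspMap : ¬ HasLineSection fun X => suspMap (splitSeven X) := fun h => by
  obtain ⟨K₀, c₀, z₀, a₀, b₀⟩ := exists_null_attach h continuous_toSphere len3_toSphere
  obtain ⟨K₁, c₁, z₁, a₁, b₁⟩ := exists_homotopy_attach
  let f : C(TorusQuat, {q : ℍ[ℝ] // q ≠ 0}) := ⟨fun g => ⟨K₁ (1, g), z₁ _⟩, by fun_prop⟩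
  let m : C(TorusQuat, {q : ℍ[ℝ] // q ≠ 0}) := ⟨fun g => ⟨K₁ (0, g), z₁ _⟩, by fun_prop⟩
  let l : C(TorusQuat, {q : ℍ[ℝ] // q ≠ 0}) := ⟨fun g => ⟨K₀ (1, g), z₀ _⟩, by fun_prop⟩
  have H₁ : ContinuousMap.Homotopy m f :=
    ⟨⟨fun p => ⟨K₁ p, z₁ p⟩, by fun_prop⟩, fun g => rfl, fun g => rfl⟩
  have H₀ : ContinuousMap.Homotopy m l :=
    ⟨⟨fun p => ⟨K₀ p, z₀ p⟩, by fun_prop⟩, fun g => Subtype.ext ((a₀ g).trans (a₁ g).symm),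
      fun g => rfl⟩
  let H := H₁.symm.trans H₀
  have hrot : ∀ (c : Circle) {q : ℍ[ℝ]}, q ≠ 0 → rotH c q ≠ 0 := fun c q hq => by
    rwa [← norm_ne_zero_iff, norm_rotH (Circle.norm_coe c), norm_ne_zero_iff]
  have cH : Continuous fun z : I × TorusQuat => (H z : ℍ[ℝ]) :=
    continuous_subtype_val.comp H.continuous
  have cH' : Continuous fun z : I × TorusQuat => (H (z.1, 1) : ℍ[ℝ]) :=
    cH.comp (continuous_fst.prodMk continuous_const)
  have cc : Continuous fun z : I × TorusQuat => ((z.2.1 : Circle) : ℂ) :=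
    continuous_subtype_val.comp (continuous_fst.comp continuous_snd)
  refine clutch_not_null (K := ⟨fun z => rotH z.2.1 ((H z : ℍ[ℝ]) * (H (z.1, 1) : ℍ[ℝ])⁻¹),
    continuous_rotH.comp (cc.prodMk (cH.mul (cH'.inv₀ fun z => (H _).2)))⟩)
    (fun z => hrot _ (mul_ne_zero (H _).2 (inv_ne_zero (H _).2))) (fun g => ?_) (fun g => ?_)
  · have e : ∀ g, (H (0, g) : ℍ[ℝ]) = hopfClutch g.1 g.2.1 (hopf g.2.2) := fun g => by
      rw [H.apply_zero]; exact b₁ g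
    have e1 : (H (0, 1) : ℍ[ℝ]) = 1 := (e 1).trans (hopfClutch_one_left _ _)
    simp only [ContinuousMap.coe_mk]
    rw [e1, inv_one, mul_one, e, rotH_clutch (Circle.norm_coe _) (Circle.norm_coe _)
      (mem_sphere_zero_iff_norm.1 g.2.2.2)]
  · have e : ∀ g, (H (1, g) : ℍ[ℝ]) = K₀ (1, 1) := fun g => by
      rw [H.apply_one]; exact b₀ g
    simp only [ContinuousMap.coe_mk]
    rw [e, e, mul_inv_cancel₀ (z₀ _), rotH_one, rotH_one]

end NotNull

section FourVolume

variable {E F : Type*} [NormedAddCommGroup E] [InnerProductSpace ℝ E]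
  [NormedAddCommGroup F] [InnerProductSpace ℝ F]

theorem abs_det_gram_le {n : ℕ} (w : Fin n → F) :
    |(Matrix.of fun i j => ⟪w i, w j⟫).det| ≤ n.factorial * (∏ i, ‖w i‖) ^ 2 := by
  rw [Matrix.det_apply]
  refine (Finset.abs_sum_le_sum_abs _ _).trans ?_
  have h : ∀ τ ∈ (Finset.univ : Finset (Equiv.Perm (Fin n))),
      |Equiv.Perm.sign τ • ∏ i, (Matrix.of fun i j => ⟪w i, w j⟫) (τ i) i| ≤
        (∏ i, ‖w i‖) ^ 2 := fun τ _ => by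
    rw [Units.smul_def, zsmul_eq_mul, abs_mul, ← Int.cast_abs,
      Int.isUnit_iff_abs_eq.1 (Units.isUnit _),
      Int.cast_one, one_mul, Finset.abs_prod, sq]
    nth_rw 1 [← Equiv.prod_comp τ fun i => ‖w i‖]
    rw [← Finset.prod_mul_distrib]
    exact Finset.prod_le_prod (fun _ _ => abs_nonneg _) fun i _ => abs_real_inner_le_norm _ _
  refine (Finset.sum_le_card_nsmul _ _ _ h).trans ?_
  rw [Finset.card_univ, Fintype.card_perm, Fintype.card_fin, nsmul_eq_mul]

theorem det_gram_eq [FiniteDimensional ℝ F] {n : ℕ} (B : EucA n →ₗ[ℝ] F)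
    (b : OrthonormalBasis (Fin n) ℝ (EucA n)) :
    (Matrix.of fun i j => ⟪B (b i), B (b j)⟫).det = LinearMap.det (LinearMap.adjoint B ∘ₗ B) := by
  rw [← LinearMap.det_toMatrix b.toBasis]
  congr 1
  ext i j
  rw [LinearMap.toMatrix_apply, b.coe_toBasis, b.coe_toBasis_repr_apply, b.repr_apply_apply,
    LinearMap.comp_apply, LinearMap.adjoint_inner_right, Matrix.of_apply]

theorem exists_unit_of_not_injective {H : Type*} [AddCommGroup H] [Module ℝ H] {L : E →ₗ[ℝ] H}
    (h : ¬ Function.Injective L) : ∃ u, ‖u‖ = 1 ∧ L u = 0 := by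
  rw [← LinearMap.ker_eq_bot, Submodule.eq_bot_iff] at h
  push Not at h
  obtain ⟨u, hu, h0⟩ := h
  have hn : ‖u‖ ≠ 0 := norm_ne_zero_iff.2 h0
  refine ⟨‖u‖⁻¹ • u, ?_, ?_⟩
  · rw [norm_smul, norm_inv, norm_norm, inv_mul_cancel₀ hn]
  · rw [map_smul, LinearMap.mem_ker.1 hu, smul_zero]

theorem finrank_quaternion_eq : Module.finrank ℝ (EucA 4) = Module.finrank ℝ ℍ[ℝ] := by
  rw [finrank_euclideanSpace_fin, Quaternion.finrank_eq_four]

theorem exists_orthonormalBasis_kernels (W h : EucA 4 →ₗ[ℝ] ℍ[ℝ]) {c v : ℍ[ℝ]} (hc : ‖c‖ = 1)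
    (hv : ‖v‖ = 1) (hre : v.re = 0) (hW : ∀ u, ⟪c, W u⟫ = 0) (hh : ∀ u, ⟪v, h u⟫ = 0)
    (hh' : ∀ u, (h u).re = 0) :
    ∃ b : OrthonormalBasis (Fin 4) ℝ (EucA 4), W (b 0) = 0 ∧ h (b 1) = 0 := by
  obtain ⟨w₀, n₀, k₀⟩ := exists_unit_of_not_injective (L := W) fun hi => by
    obtain ⟨u, hu⟩ := (LinearMap.injective_iff_surjective_of_finrank_eq_finrank
      finrank_quaternion_eq).1 hi c
    have := hW u
    rw [hu, real_inner_self_eq_norm_sq, hc] at this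
    norm_num at this
  obtain ⟨w₁, n₁, k₁⟩ := exists_unit_of_not_injective
    (L := h + (innerₛₗ ℝ w₀).smulRight v) fun hi => by
    obtain ⟨u, hu⟩ := (LinearMap.injective_iff_surjective_of_finrank_eq_finrank
      finrank_quaternion_eq).1 hi 1
    have := congrArg (fun q : ℍ[ℝ] => q.re) hu
    simp [hh', hre] at this
  rw [LinearMap.add_apply, LinearMap.smulRight_apply, innerₛₗ_apply_apply] at k₁
  have h01 : ⟪w₀, w₁⟫ = 0 := by
    have := congrArg (fun q : ℍ[ℝ] => ⟪v, q⟫) k₁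
    simpa [inner_add_right, hh, inner_smul_right, hv, real_inner_self_eq_norm_sq] using this
  rw [h01, zero_smul, add_zero] at k₁
  have ho : Orthonormal ℝ (({0, 1} : Set (Fin 4)).domRestrict ![w₀, w₁, 0, 0]) := by
    constructor
    · rintro ⟨i, hi⟩
      rcases hi with rfl | rfl
      · exact n₀
      · exact n₁
    · rintro ⟨i, hi⟩ ⟨j, hj⟩ hij
      rcases hi with rfl | rfl <;> rcases hj with rfl | rfl
      · exact absurd rfl hij
      · exact h01
      · exact (real_inner_comm _ _).trans h01
      · exact absurd rfl hij
  obtain ⟨b, hb⟩ := ho.exists_orthonormalBasis_extension_of_card_eq (by simp)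
  refine ⟨b, ?_, ?_⟩
  · rw [hb 0 (by simp)]; exact k₀
  · rw [hb 1 (by simp)]; exact k₁

/-- A bound for the `4`-dilation of a linear map which is small on the kernels of two linear maps
of rank at most three and two. -/
theorem lamNorm_four_le [FiniteDimensional ℝ F] (A : E →ₗ[ℝ] F) (W h : E →ₗ[ℝ] ℍ[ℝ]) {c v : ℍ[ℝ]}
    (hc : ‖c‖ = 1) (hv : ‖v‖ = 1) (hre : v.re = 0) (hW : ∀ u, ⟪c, W u⟫ = 0)
    (hh : ∀ u, ⟪v, h u⟫ = 0) (hh' : ∀ u, (h u).re = 0) {α β γ : ℝ} (hα : 0 ≤ α) (hβ : 0 ≤ β)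
    (hγ : 0 ≤ γ) (hA : ∀ u, W u = 0 → ‖A u‖ ≤ α * ‖u‖) (hB : ∀ u, h u = 0 → ‖A u‖ ≤ β * ‖u‖)
    (hC : ∀ u, ‖A u‖ ≤ γ * ‖u‖) : lamNorm 4 A ≤ 5 * (α * β * γ ^ 2) := by
  refine Real.iSup_le (fun ⟨f, hf⟩ => ?_) (by positivity)
  let Φ : EucA 4 →ₗ[ℝ] E := (EuclideanSpace.basisFun (Fin 4) ℝ).toBasis.constr ℝ f
  have hΦ : ∀ i, Φ (EuclideanSpace.basisFun (Fin 4) ℝ i) = f i := fun i => by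
    rw [← (EuclideanSpace.basisFun (Fin 4) ℝ).coe_toBasis]
    exact Module.Basis.constr_basis _ _ _ _
  have hΦn : ∀ u, ‖Φ u‖ = ‖u‖ := fun u => by
    let Ψ := Φ.isometryOfOrthonormal (v := (EuclideanSpace.basisFun (Fin 4) ℝ).toBasis) (by
      rw [OrthonormalBasis.coe_toBasis]; exact OrthonormalBasis.orthonormal _) (by
      convert hf using 1
      funext i
      exact Module.Basis.constr_basis _ _ _ _)
    exact Ψ.norm_map u
  obtain ⟨b, b0, b1⟩ := exists_orthonormalBasis_kernels (W ∘ₗ Φ) (h ∘ₗ Φ) hc hv hre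
    (fun u => hW _) (fun u => hh _) fun u => hh' _
  have e := (det_gram_eq (A ∘ₗ Φ) (EuclideanSpace.basisFun (Fin 4) ℝ)).trans
    (det_gram_eq (A ∘ₗ Φ) b).symm
  simp only [LinearMap.comp_apply, hΦ] at e
  have hn : ∀ i, ‖Φ (b i)‖ = 1 := fun i => by rw [hΦn, b.norm_eq_one]
  have p0 : ‖A (Φ (b 0))‖ ≤ α := by simpa [hn] using hA _ b0
  have p1 : ‖A (Φ (b 1))‖ ≤ β := by simpa [hn] using hB _ b1
  have p2 : ‖A (Φ (b 2))‖ ≤ γ := by simpa [hn] using hC (Φ (b 2))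
  have p3 : ‖A (Φ (b 3))‖ ≤ γ := by simpa [hn] using hC (Φ (b 3))
  have hp : ∏ i, ‖A (Φ (b i))‖ ≤ α * β * γ ^ 2 := by
    rw [Fin.prod_univ_four, sq, ← mul_assoc]
    gcongr
  refine Real.sqrt_le_iff.2 ⟨by positivity, ?_⟩
  rw [e]
  have h4 := (le_abs_self _).trans (abs_det_gram_le fun i => A (Φ (b i)))
  refine h4.trans ?_
  have : (∏ i, ‖A (Φ (b i))‖) ^ 2 ≤ (α * β * γ ^ 2) ^ 2 :=
    pow_le_pow_left₀ (Finset.prod_nonneg fun _ _ => norm_nonneg _) hp 2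
  have hf : ((Nat.factorial 4 : ℕ) : ℝ) = 24 := by norm_num [Nat.factorial]
  rw [hf]
  nlinarith [sq_nonneg (α * β * γ ^ 2)]

/-- A linear map of rank at most one has vanishing `4`-dilation. -/
theorem lamNorm_four_of_rank_one [FiniteDimensional ℝ E] [FiniteDimensional ℝ F] (A : E →ₗ[ℝ] F)
    (l : E →ₗ[ℝ] ℝ) (h : ∀ u, l u = 0 → A u = 0) : lamNorm 4 A ≤ 0 := by
  have hi : ‖(qmk 0 1 0 0 : ℍ[ℝ])‖ = 1 := by
    rw [← sq_eq_sq₀ (norm_nonneg _) zero_le_one, sq, ← Quaternion.normSq_eq_norm_mul_self,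
      Quaternion.normSq_def']
    simp
  have hk : ∀ t : ℝ, t • (qmk 0 0 1 0 : ℍ[ℝ]) = 0 → t = 0 := fun t ht => by
    simpa using congrArg (fun q : ℍ[ℝ] => q.imJ) ht
  have hA : ∀ u, (l.smulRight (qmk 0 0 1 0 : ℍ[ℝ])) u = 0 → ‖A u‖ ≤ 0 * ‖u‖ := fun u hu => by
    rw [h u (hk _ hu), norm_zero, zero_mul]
  have hin : ∀ u, ⟪(qmk 0 1 0 0 : ℍ[ℝ]), (l.smulRight (qmk 0 0 1 0 : ℍ[ℝ])) u⟫ = 0 := fun u => by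
    simp [Quaternion.inner_def]
  have := lamNorm_four_le A (l.smulRight (qmk 0 0 1 0)) (l.smulRight (qmk 0 0 1 0))
    hi hi (by simp) hin hin (fun u => by simp) le_rfl le_rfl
    (norm_nonneg (LinearMap.toContinuousLinearMap A)) hA hA
    fun u => (LinearMap.toContinuousLinearMap A).le_opNorm u
  simpa using this

end FourVolume

section Twist

open Filter Topology

/-- The angle of a point of the left half plane from the negative real axis, cut off near the
imaginary axis. -/
def cutArg (z : ℂ) : ℝ := Real.smoothTransition ((-(1 / 20) - z.re) * 20) * (Complex.log (-z)).im

theorem contDiff_cutArg : ContDiff ℝ 1 cutArg := by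
  rw [contDiff_iff_contDiffAt]
  intro z
  by_cases h : z.re < 0
  · have hl : ContDiffAt ℝ 1 (fun z : ℂ => Complex.log (-z)) z :=
      ((Complex.contDiffAt_log
        (Complex.mem_slitPlane_iff.2 (Or.inl (by simpa using h)))).restrict_scalars ℝ).comp z contDiffAt_id.neg
    have hr : ContDiffAt ℝ 1 (fun z : ℂ => Real.smoothTransition ((-(1 / 20) - z.re) * 20)) z :=
      (Real.smoothTransition.contDiff.comp
        ((contDiff_const.sub Complex.reCLM.contDiff).mul contDiff_const)).contDiffAt
    exact hr.mul (Complex.imCLM.contDiff.contDiffAt.comp z hl)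
  · refine (contDiffAt_const (c := (0 : ℝ))).congr_of_eventuallyEq ?_
    have : -(1 / 20) < z.re := by linarith
    filter_upwards [(isOpen_lt continuous_const Complex.continuous_re).mem_nhds this] with w hw
    have hw' : -(1 / 20) < w.re := hw
    rw [cutArg, Real.smoothTransition.zero_of_nonpos (by linarith), zero_mul]

theorem abs_cutArg_le (z : ℂ) : |cutArg z| ≤ 4 := by
  rw [cutArg, abs_mul, Complex.log_im, abs_of_nonneg (Real.smoothTransition.nonneg _)]
  have h1 := Complex.abs_arg_le_pi (-z)
  have h2 := Real.pi_le_four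
  have h3 := Real.smoothTransition.le_one ((-(1 / 20) - z.re) * 20)
  have h4 := abs_nonneg (Complex.arg (-z))
  nlinarith [Real.smoothTransition.nonneg ((-(1 / 20) - z.re) * 20)]

theorem cutArg_eventuallyEq {z : ℂ} (h : z.re < -1 / 10) :
    cutArg =ᶠ[𝓝 z] fun z => (Complex.log (-z)).im := by
  filter_upwards [(isOpen_lt Complex.continuous_re continuous_const).mem_nhds h] with w hw
  have hw' : w.re < -1 / 10 := hw
  rw [cutArg, Real.smoothTransition.one_of_one_le (by linarith), one_mul]

/-- A coordinate rotated by the angle `k * T`. -/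
def twistZ (k T : ℝ) (z : ℂ) : ℂ := z * Complex.exp (((k * T : ℝ) : ℂ) * Complex.I)

/-- The height corrected by the angle of a rotated coordinate. -/
def twistT (r k T : ℝ) (z : ℂ) : ℝ := T - r / k * cutArg (twistZ (r * k) T z)

theorem norm_twistZ (k T : ℝ) (z : ℂ) : ‖twistZ k T z‖ = ‖z‖ := by
  rw [twistZ, norm_mul, Complex.norm_exp_ofReal_mul_I, mul_one]

theorem normSq_twistZ (k T : ℝ) (z : ℂ) : Complex.normSq (twistZ k T z) = Complex.normSq z := by
  rw [Complex.normSq_eq_norm_sq, norm_twistZ, Complex.normSq_eq_norm_sq]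

theorem twistZ_zero (T : ℝ) (z : ℂ) : twistZ 0 T z = z := by simp [twistZ]

theorem twistT_zero (k T : ℝ) (z : ℂ) : twistT 0 k T z = T := by simp [twistT]

theorem abs_twistT_sub_le {r k : ℝ} (hr : |r| ≤ 1) (hk : 0 < k) (T : ℝ) (z : ℂ) :
    |twistT r k T z - T| ≤ 4 / k := by
  have h := abs_cutArg_le (twistZ (r * k) T z)
  rw [twistT, sub_sub_cancel_left, abs_neg, abs_mul, abs_div, abs_of_pos hk]
  calc |r| / k * |cutArg (twistZ (r * k) T z)| ≤ 1 / k * 4 := by gcongr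
    _ = 4 / k := by ring

section
variable {X : Type*} [NormedAddCommGroup X] [NormedSpace ℝ X] {z : X → ℂ}

theorem ContDiff.twistZ {k T : X → ℝ} (hk : ContDiff ℝ 1 k) (hT : ContDiff ℝ 1 T)
    (hz : ContDiff ℝ 1 z) : ContDiff ℝ 1 fun x => twistZ (k x) (T x) (z x) := by
  have h : ContDiff ℝ 1 fun x => ((k x * T x : ℝ) : ℂ) :=
    Complex.ofRealCLM.contDiff.comp (hk.mul hT)
  have he : ContDiff ℝ 1 Complex.exp := (Complex.contDiff_exp (𝕜 := ℂ)).restrict_scalars ℝ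
  exact hz.mul (he.comp (h.mul contDiff_const))

theorem ContDiff.twistT {r T : X → ℝ} (k : ℝ) (hr : ContDiff ℝ 1 r) (hT : ContDiff ℝ 1 T)
    (hz : ContDiff ℝ 1 z) : ContDiff ℝ 1 fun x => twistT (r x) k (T x) (z x) :=
  hT.sub ((hr.div_const k).mul (contDiff_cutArg.comp ((hr.mul contDiff_const).twistZ hT hz)))

theorem hasFDerivAt_twistZ {T : X → ℝ} {T' : X →L[ℝ] ℝ} {z' : X →L[ℝ] ℂ} {x : X}
    (hT : HasFDerivAt T T' x) (hz : HasFDerivAt z z' x) (k : ℝ) :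
    ∃ D : X →L[ℝ] ℂ, HasFDerivAt (fun x => twistZ k (T x) (z x)) D x ∧
      ∀ u, D u = (z' u + z x * (k * T' u : ℝ) * Complex.I) *
        Complex.exp (((k * T x : ℝ) : ℂ) * Complex.I) := by
  have h1 : HasFDerivAt (fun x => ((k * T x : ℝ) : ℂ)) (Complex.ofRealCLM.comp (k • T')) x :=
    (Complex.ofRealCLM.hasFDerivAt (x := k * T x)).comp x (hT.const_mul k)
  have h2 := hz.mul ((h1.mul_const Complex.I).cexp)
  refine ⟨_, h2, fun u => ?_⟩
  simp
  ring

theorem twist_step {T : X → ℝ} {T' : X →L[ℝ] ℝ} {z' : X →L[ℝ] ℂ} {x : X}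
    (hT : HasFDerivAt T T' x) (hz : HasFDerivAt z z' x) {k : ℝ} (hk : 0 < k)
    (hs : (twistZ k (T x) (z x)).re < -1 / 10) :
    (∃ D : X →L[ℝ] ℂ, HasFDerivAt (fun x => twistZ k (T x) (z x)) D x ∧
      ∀ u, ‖D u‖ ≤ ‖z' u‖ + ‖z x‖ * (k * |T' u|)) ∧
    ∃ D : X →L[ℝ] ℝ, HasFDerivAt (fun x => twistT 1 k (T x) (z x)) D x ∧
      ∀ u, |D u| ≤ 10 / k * ‖z' u‖ := by
  obtain ⟨D, hD, hD'⟩ := hasFDerivAt_twistZ hT hz k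
  refine ⟨⟨D, hD, fun u => ?_⟩, ?_⟩
  · rw [hD', norm_mul, Complex.norm_exp_ofReal_mul_I, mul_one]
    refine (norm_add_le _ _).trans_eq ?_
    rw [norm_mul, norm_mul, Complex.norm_I, mul_one, Complex.norm_real, Real.norm_eq_abs, abs_mul,
      abs_of_pos hk]
  · have hz10 : 1 / 10 ≤ ‖z x‖ := by
      rw [← norm_twistZ k (T x) (z x)]
      have := (abs_le.1 (Complex.abs_re_le_norm (twistZ k (T x) (z x)))).1
      linarith
    have hz0 : z x ≠ 0 := norm_pos_iff.1 (by linarith)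
    have hl : HasFDerivAt (fun x => Complex.log (-twistZ k (T x) (z x)))
        ((-twistZ k (T x) (z x))⁻¹ • -D) x := by
      have hm : -twistZ k (T x) (z x) ∈ Complex.slitPlane :=
        Complex.mem_slitPlane_iff.2 (Or.inl (by rw [Complex.neg_re]; linarith))
      exact ((Complex.hasDerivAt_log hm).comp_hasFDerivAt x hD.neg)
    have hc : HasFDerivAt (fun x => cutArg (twistZ k (T x) (z x)))
        (Complex.imCLM.comp ((-twistZ k (T x) (z x))⁻¹ • -D)) x := by
      have he : (fun x => cutArg (twistZ k (T x) (z x))) =ᶠ[𝓝 x]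
          fun x => (Complex.log (-twistZ k (T x) (z x))).im :=
        hD.continuousAt.eventually (cutArg_eventuallyEq hs)
      exact (Complex.imCLM.hasFDerivAt.comp x hl).congr_of_eventuallyEq he
    have hf := hT.sub (hc.const_mul (1 / k))
    refine ⟨T' - (1 / k) • Complex.imCLM.comp ((-twistZ k (T x) (z x))⁻¹ • -D), ?_, fun u => ?_⟩
    · refine hf.congr_of_eventuallyEq (Eventually.of_forall fun y => ?_)
      simp only [twistT, one_mul]; rfl
    · have hexp := Complex.exp_ne_zero (((k * T x : ℝ) : ℂ) * Complex.I)
      have e : (-twistZ k (T x) (z x))⁻¹ * -(D u) = z' u / z x + (k * T' u : ℝ) * Complex.I := by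
        rw [hD', twistZ]
        field_simp
      have e2 : (T' - (1 / k) • Complex.imCLM.comp ((-twistZ k (T x) (z x))⁻¹ • -D)) u =
          -(1 / k * (z' u / z x).im) := by
        have : (T' - (1 / k) • Complex.imCLM.comp ((-twistZ k (T x) (z x))⁻¹ • -D)) u =
            T' u - 1 / k * ((-twistZ k (T x) (z x))⁻¹ * -(D u)).im := rfl
        rw [this, e, Complex.add_im, Complex.im_ofReal_mul, Complex.I_im]
        field_simp
        ring
      rw [e2, abs_neg, abs_mul, abs_of_pos (by positivity : 0 < 1 / k)]
      have h1 := Complex.abs_im_le_norm (z' u / z x)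
      rw [norm_div] at h1
      have h2 : ‖z' u‖ / ‖z x‖ ≤ ‖z' u‖ / (1 / 10) :=
        div_le_div_of_nonneg_left (norm_nonneg _) (by norm_num) hz10
      calc 1 / k * |(z' u / z x).im| ≤ 1 / k * (‖z' u‖ / (1 / 10)) := by
            gcongr; exact h1.trans h2
        _ = 10 / k * ‖z' u‖ := by ring

end

end Twist

section FullTwist

open Filter Topology

/-- The successive twists of the three coordinates. -/
def fullTwist (r k : ℝ) (p : ℝ × ℂ × ℂ × ℂ) : ℝ × ℂ × ℂ × ℂ :=
  let t₁ := twistT r k p.1 p.2.1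
  let t₂ := twistT r (k ^ 2) t₁ p.2.2.1
  (twistT r (k ^ 3) t₂ p.2.2.2, twistZ (r * k) p.1 p.2.1, twistZ (r * k ^ 2) t₁ p.2.2.1,
    twistZ (r * k ^ 3) t₂ p.2.2.2)

theorem fullTwist_zero (k : ℝ) (p : ℝ × ℂ × ℂ × ℂ) : fullTwist 0 k p = p := by
  simp [fullTwist, twistT_zero, twistZ_zero]

theorem len3_fullTwist (r k : ℝ) (p : ℝ × ℂ × ℂ × ℂ) : len3 (fullTwist r k p).2 = len3 p.2 := by
  simp only [fullTwist, len3, normSq_twistZ]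

theorem radA_fullTwist (r k : ℝ) (p : ℝ × ℂ × ℂ × ℂ) : radA (fullTwist r k p).2 = radA p.2 := by
  simp only [fullTwist, radA, normSq_twistZ]

theorem radB_fullTwist (r k : ℝ) (p : ℝ × ℂ × ℂ × ℂ) : radB (fullTwist r k p).2 = radB p.2 := by
  simp only [fullTwist, radB, normSq_twistZ]

theorem abs_fullTwist_sub_le {r k : ℝ} (hr : |r| ≤ 1) (hk : 200 ≤ k) (p : ℝ × ℂ × ℂ × ℂ) :
    |(fullTwist r k p).1 - p.1| ≤ 1 / 10 := by
  have key : ∀ K : ℝ, 200 ≤ K → ∀ T z, |twistT r K T z - T| ≤ 1 / 50 := fun K hK T z =>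
    (abs_twistT_sub_le hr (by linarith) T z).trans (by
      rw [div_le_iff₀ (by linarith)]; linarith)
  have h2 : 200 ≤ k ^ 2 := by nlinarith
  have h3 : 200 ≤ k ^ 3 := by nlinarith
  have e1 := abs_le.1 (key k hk p.1 p.2.1)
  have e2 := abs_le.1 (key _ h2 (twistT r k p.1 p.2.1) p.2.2.1)
  have e3 := abs_le.1 (key _ h3 (twistT r (k ^ 2) (twistT r k p.1 p.2.1) p.2.2.1) p.2.2.2)
  rw [fullTwist, abs_le]
  constructor <;> linarith [e1.1, e1.2, e2.1, e2.2, e3.1, e3.2]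

/-- The `ℂ³` coordinates on `ℝ⁷`. -/
def coordC (i j : Fin 7) : EucA 7 →L[ℝ] ℂ :=
  Complex.equivRealProdCLM.symm.toContinuousLinearMap.comp
    ((EuclideanSpace.proj (𝕜 := ℝ) i).prod (EuclideanSpace.proj (𝕜 := ℝ) j))

theorem norm_splitSeven_le (X : EucA 7) : |(splitSeven X).1| ≤ ‖X‖ ∧ ‖(splitSeven X).2.1‖ ≤ ‖X‖ ∧
    ‖(splitSeven X).2.2.1‖ ≤ ‖X‖ ∧ ‖(splitSeven X).2.2.2‖ ≤ ‖X‖ := by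
  have h := norm_sq_eq_len3 X
  simp only [len3, Complex.normSq_eq_norm_sq] at h
  have h0 := sq_nonneg (splitSeven X).1
  have h1 := sq_nonneg ‖(splitSeven X).2.1‖
  have h2 := sq_nonneg ‖(splitSeven X).2.2.1‖
  have h3 := sq_nonneg ‖(splitSeven X).2.2.2‖
  refine ⟨abs_le_of_sq_le_sq (by linarith) (norm_nonneg _),
    (sq_le_sq₀ (norm_nonneg _) (norm_nonneg _)).1 (by linarith),
    (sq_le_sq₀ (norm_nonneg _) (norm_nonneg _)).1 (by linarith),
    (sq_le_sq₀ (norm_nonneg _) (norm_nonneg _)).1 (by linarith)⟩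

theorem contDiff_fullTwist (k : ℝ) :
    ContDiff ℝ 1 fun q : ℝ × EucA 7 => fullTwist q.1 k (splitSeven q.2) := by
  have hr : ContDiff ℝ 1 fun q : ℝ × EucA 7 => q.1 := contDiff_fst
  have hs : ContDiff ℝ 1 fun q : ℝ × EucA 7 => (splitSeven q.2).1 :=
    (EuclideanSpace.proj (𝕜 := ℝ) 6 : EucA 7 →L[ℝ] ℝ).contDiff.comp contDiff_snd
  have h1 : ContDiff ℝ 1 fun q : ℝ × EucA 7 => (splitSeven q.2).2.1 :=
    (coordC 0 1).contDiff.comp contDiff_snd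
  have h2 : ContDiff ℝ 1 fun q : ℝ × EucA 7 => (splitSeven q.2).2.2.1 :=
    (coordC 2 3).contDiff.comp contDiff_snd
  have h3 : ContDiff ℝ 1 fun q : ℝ × EucA 7 => (splitSeven q.2).2.2.2 :=
    (coordC 4 5).contDiff.comp contDiff_snd
  have t1 := hr.twistT k hs h1
  have t2 := hr.twistT (k ^ 2) t1 h2
  have t3 := hr.twistT (k ^ 3) t2 h3
  exact t3.prodMk (((hr.mul contDiff_const).twistZ hs h1).prodMk
    (((hr.mul contDiff_const).twistZ t1 h2).prodMk ((hr.mul contDiff_const).twistZ t2 h3)))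

theorem fullTwist_good {r k : ℝ} (hr : |r| ≤ 1) (hk : 200 ≤ k) {X : EucA 7}
    (hX : 7 / 10 < ‖X‖ ^ 2) : 3 / 10 < |(fullTwist r k (splitSeven X)).1| ∨
      1 / 2 < len3 (fullTwist r k (splitSeven X)).2 := by
  rw [len3_fullTwist]
  by_contra! h
  obtain ⟨h1, h2⟩ := h
  have h3 := abs_fullTwist_sub_le hr hk (splitSeven X)
  rw [norm_sq_eq_len3] at hX
  rw [abs_le] at h1 h3
  nlinarith [h1.1, h1.2, h3.1, h3.2]

/-- The cutoff near the sphere. -/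
def radialCut (X : EucA 7) : ℝ := Real.smoothTransition (8 * (‖X‖ ^ 2 - 3 / 4))

theorem contDiff_radialCut : ContDiff ℝ 1 radialCut :=
  Real.smoothTransition.contDiff.comp
    (contDiff_const.mul ((contDiff_norm_sq ℝ).sub contDiff_const))

/-- The twisted suspension, extended to the ambient space. -/
def twistedMap (k : ℝ) (X : EucA 7) : EucA 5 :=
  radialCut X • suspMap (fullTwist 1 k (splitSeven X))

theorem contDiff_fullTwist_one (k : ℝ) :
    ContDiff ℝ 1 fun X : EucA 7 => fullTwist 1 k (splitSeven X) :=
  (contDiff_fullTwist k).comp (contDiff_const.prodMk contDiff_id)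

theorem contDiff_twistedMap {k : ℝ} (hk : 200 ≤ k) : ContDiff ℝ 1 (twistedMap k) := by
  rw [contDiff_iff_contDiffAt]
  intro X
  by_cases h : 7 / 10 < ‖X‖ ^ 2
  · have hc : ContDiffAt ℝ 1 (fun X => suspMap (fullTwist 1 k (splitSeven X))) X :=
      ContDiffAt.comp (f := fun X : EucA 7 => fullTwist 1 k (splitSeven X)) (g := suspMap) X
        (contDiffAt_suspMap (fullTwist_good (r := 1) abs_one.le hk h))
        (contDiff_fullTwist_one k).contDiffAt
    exact contDiff_radialCut.contDiffAt.smul hc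
  · refine (contDiffAt_const (c := (0 : EucA 5))).congr_of_eventuallyEq ?_
    have h' : ‖X‖ ^ 2 < 3 / 4 := by linarith
    filter_upwards [(isOpen_lt (continuous_norm.pow 2) continuous_const).mem_nhds h'] with Y hY
    have hY' : ‖Y‖ ^ 2 < 3 / 4 := hY
    rw [twistedMap, radialCut, Real.smoothTransition.zero_of_nonpos (by linarith), zero_smul]

theorem twistedMap_eventuallyEq (k : ℝ) {x : EucA 7} (hx : ‖x‖ = 1) :
    twistedMap k =ᶠ[𝓝 x] fun X => suspMap (fullTwist 1 k (splitSeven X)) := by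
  have h' : 7 / 8 < ‖x‖ ^ 2 := by rw [hx]; norm_num
  filter_upwards [(isOpen_lt continuous_const (continuous_norm.pow 2)).mem_nhds h'] with Y hY
  have hY' : 7 / 8 < ‖Y‖ ^ 2 := hY
  rw [twistedMap, radialCut, Real.smoothTransition.one_of_one_le (by linarith), one_smul]

theorem mapsTo_twistedMap (k : ℝ) : MapsTo (twistedMap k) (usph 7) (usph 5) := fun x hx => by
  rw [usph, mem_sphere_zero_iff_norm] at hx ⊢
  rw [(twistedMap_eventuallyEq k hx).eq_of_nhds, norm_suspMap]

theorem not_sphereNullhomotopic_twistedMap {k : ℝ} (hk : 200 ≤ k) :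
    ¬ SphereNullhomotopic (twistedMap k) := by
  rintro ⟨y, hy, h⟩
  have hL : HasLineSection (twistedMap k) := (hasLineSection_const hy).of_homotopic h
  refine not_hasLineSection_suspMap (hL.of_homotopic
    ⟨fun t X => suspMap (fullTwist t k (splitSeven X)), fun q hq => ?_, fun t _ X _ => ?_,
      fun X _ => ?_, fun X hX => ?_⟩)
  · have hn : ‖q.2‖ = 1 := mem_sphere_zero_iff_norm.1 hq.2
    have hg := fullTwist_good (r := q.1) (X := q.2) (abs_le.2 ⟨by linarith [hq.1.1], hq.1.2⟩) hk
      (by rw [hn]; norm_num)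
    exact (ContinuousAt.comp (f := fun q : ℝ × EucA 7 => fullTwist q.1 k (splitSeven q.2))
      (contDiffAt_suspMap hg).continuousAt
      (contDiff_fullTwist k).continuous.continuousAt).continuousWithinAt
  · rw [usph, mem_sphere_zero_iff_norm, norm_suspMap]
  · simp only [fullTwist_zero]
  · rw [(twistedMap_eventuallyEq k (mem_sphere_zero_iff_norm.1 hX)).eq_of_nhds]

theorem twist_sector_estimate {k : ℝ} (hk : 1 ≤ k) {x : EucA 7} (hx : ‖x‖ = 1)
    (hs : InSector (fullTwist 1 k (splitSeven x)).2) :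
    ∃ (T' : EucA 7 →L[ℝ] ℝ) (Z' : EucA 7 →L[ℝ] ℂ × ℂ × ℂ),
      HasFDerivAt (fun X => (fullTwist 1 k (splitSeven X)).1) T' x ∧
      HasFDerivAt (fun X => (fullTwist 1 k (splitSeven X)).2) Z' x ∧
      (∀ u, |T' u| ≤ 10 / k ^ 3 * ‖u‖) ∧ ∀ u, ‖Z' u‖ ≤ 11 * k * ‖u‖ := by
  have hk0 : 0 < k := by linarith
  obtain ⟨s1, s2, s3⟩ := hs
  simp only [fullTwist, one_mul] at s1 s2 s3
  obtain ⟨n0, n1, n2, n3⟩ := norm_splitSeven_le x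
  rw [hx] at n0 n1 n2 n3
  obtain ⟨⟨A₁, hA₁, bA₁⟩, D₁, hD₁, bD₁⟩ := twist_step
    (T := fun X => (splitSeven X).1) (z := fun X => (splitSeven X).2.1)
    (EuclideanSpace.proj (𝕜 := ℝ) 6 : EucA 7 →L[ℝ] ℝ).hasFDerivAt (coordC 0 1).hasFDerivAt hk0 s1
  obtain ⟨⟨A₂, hA₂, bA₂⟩, D₂, hD₂, bD₂⟩ := twist_step (z := fun X => (splitSeven X).2.2.1)
    hD₁ (coordC 2 3).hasFDerivAt (pow_pos hk0 2) s2
  obtain ⟨⟨A₃, hA₃, bA₃⟩, D₃, hD₃, bD₃⟩ := twist_step (z := fun X => (splitSeven X).2.2.2)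
    hD₂ (coordC 4 5).hasFDerivAt (pow_pos hk0 3) s3
  refine ⟨D₃, A₁.prod (A₂.prod A₃), ?_, ?_, fun u => ?_, fun u => ?_⟩
  · simpa only [fullTwist] using hD₃
  · simpa only [fullTwist, one_mul] using hA₁.prodMk (hA₂.prodMk hA₃)
  · exact (bD₃ u).trans (mul_le_mul_of_nonneg_left (norm_splitSeven_le u).2.2.2 (by positivity))
  · obtain ⟨m0, m1, m2, m3⟩ := norm_splitSeven_le u
    have hu := norm_nonneg u
    have hku : ‖u‖ ≤ k * ‖u‖ := le_mul_of_one_le_left hu hk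
    have key : ∀ {a b c m t : ℝ}, a ≤ m + b * (c * t) → m ≤ ‖u‖ → b ≤ 1 → c * t ≤ 10 * (k * ‖u‖) →
        0 ≤ c * t → a ≤ 11 * k * ‖u‖ := fun {a b c m t} h1 h2 h3 h4 h5 => by
      have : b * (c * t) ≤ 1 * (c * t) := mul_le_mul_of_nonneg_right h3 h5
      linarith
    refine norm_prod_le_iff.2 ⟨?_, norm_prod_le_iff.2 ⟨?_, ?_⟩⟩
    · refine key (bA₁ u) m1 n1 ?_ (by positivity)
      have : k * |(splitSeven u).1| ≤ k * ‖u‖ := mul_le_mul_of_nonneg_left m0 hk0.le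
      have h2 : 0 ≤ k * ‖u‖ := by positivity
      exact this.trans (by linarith)
    · refine key (bA₂ u) m2 n2 ?_ (by positivity)
      calc k ^ 2 * |D₁ u| ≤ k ^ 2 * (10 / k * ‖u‖) := by
            gcongr
            exact (bD₁ u).trans (mul_le_mul_of_nonneg_left m1 (by positivity))
        _ = 10 * (k * ‖u‖) := by field_simp
    · refine key (bA₃ u) m3 n3 ?_ (by positivity)
      calc k ^ 3 * |D₂ u| ≤ k ^ 3 * (10 / k ^ 2 * ‖u‖) := by
            gcongr
            exact (bD₂ u).trans (mul_le_mul_of_nonneg_left m2 (by positivity))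
        _ = 10 * (k * ‖u‖) := by field_simp

end FullTwist

section DilationBound

open Filter Topology

/-- A map factoring to first order through the line has vanishing `4`-dilation. -/
theorem lamNorm_four_of_factor {F : EucA 7 → EucA 5} {x : EucA 7} {g : ℝ → EucA 5}
    {T : EucA 7 → ℝ} (hg : ContDiff ℝ 1 g) (hT : ContDiff ℝ 1 T) (h : F =ᶠ[𝓝 x] fun X => g (T X))
    (S : Submodule ℝ (EucA 7)) : lamNorm 4 ((fderiv ℝ F x).toLinearMap ∘ₗ S.subtype) ≤ 0 := by
  have hg' := ((hg.differentiable one_ne_zero) (T x)).hasFDerivAt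
  have hT' := ((hT.differentiable one_ne_zero) x).hasFDerivAt
  have hF : fderiv ℝ F x = (fderiv ℝ g (T x)).comp (fderiv ℝ T x) :=
    (hg'.comp x hT' |>.congr_of_eventuallyEq h).fderiv
  refine lamNorm_four_of_rank_one _ ((fderiv ℝ T x).toLinearMap ∘ₗ S.subtype) fun u hu => ?_
  have hu' : fderiv ℝ T x u = 0 := hu
  have e : ((fderiv ℝ F x).toLinearMap ∘ₗ S.subtype) u = fderiv ℝ F x u := rfl
  rw [e, hF, ContinuousLinearMap.comp_apply, hu', map_zero]

theorem exists_bound_fderiv {E F : Type*} [NormedAddCommGroup E] [NormedSpace ℝ E] [ProperSpace E]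
    [NormedAddCommGroup F] [NormedSpace ℝ F] {f : E → F} (hf : ContDiff ℝ 1 f) :
    ∃ C : ℝ, ∀ x : E, ‖x‖ ≤ 2 → ∀ u, ‖fderiv ℝ f x u‖ ≤ C * ‖u‖ := by
  obtain ⟨C, hC⟩ := (isCompact_closedBall (0 : E) 2).exists_bound_of_continuousOn
    (hf.continuous_fderiv one_ne_zero).continuousOn
  exact ⟨C, fun x hx u => (fderiv ℝ f x).le_of_opNorm_le (hC x (mem_closedBall_zero_iff.2 hx)) u⟩

theorem lamNorm_four_comp_le {E F : Type*} [NormedAddCommGroup E] [InnerProductSpace ℝ E]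
    [NormedAddCommGroup F] [InnerProductSpace ℝ F] [FiniteDimensional ℝ F]
    (G : ℝ × ℍ[ℝ] →L[ℝ] F) (D : ℝ × ℝ × ℍ[ℝ] →L[ℝ] ℍ[ℝ]) (T a b : E →L[ℝ] ℝ) (V : E →L[ℝ] ℍ[ℝ])
    (S : Submodule ℝ E) {c v : ℍ[ℝ]} (hc : ‖c‖ = 1) (hv : ‖v‖ = 1) (hre : v.re = 0)
    (hW : ∀ u, ⟪c, D (a u, b u, V u)⟫ = 0) (hV : ∀ u, ⟪v, V u⟫ = 0) (hV' : ∀ u, (V u).re = 0)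
    {C k : ℝ} (hC : 1 ≤ C) (hk : 1 ≤ k) (hG : ∀ p, ‖G p‖ ≤ C * ‖p‖) (hD : ∀ p, ‖D p‖ ≤ C * ‖p‖)
    (ha : ∀ u, ‖a u‖ ≤ C * ‖u‖) (hb : ∀ u, ‖b u‖ ≤ C * ‖u‖)
    (hT : ∀ u, ‖T u‖ ≤ 10 / k ^ 3 * ‖u‖) (hVn : ∀ u, ‖V u‖ ≤ C * (11 * k * ‖u‖)) :
    lamNorm 4 ((G.comp (T.prod (D.comp (a.prod (b.prod V))))).toLinearMap ∘ₗ S.subtype) ≤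
      60500 * C ^ 10 / k := by
  have hk0 : 0 < k := by linarith
  have hC0 : 0 < C := by linarith
  have hT' : ∀ u, ‖T u‖ ≤ 10 * ‖u‖ := fun u => (hT u).trans (mul_le_mul_of_nonneg_right
    (div_le_self (by norm_num) (one_le_pow₀ hk)) (norm_nonneg u))
  have c2 : 1 ≤ C ^ 2 := one_le_pow₀ hC
  have key := lamNorm_four_le
    ((G.comp (T.prod (D.comp (a.prod (b.prod V))))).toLinearMap ∘ₗ S.subtype)
    ((D.comp (a.prod (b.prod V))).toLinearMap ∘ₗ S.subtype) (V.toLinearMap ∘ₗ S.subtype)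
    hc hv hre (fun u => hW u) (fun u => hV u) (fun u => hV' u)
    (α := C * (10 / k ^ 3)) (β := 10 * C ^ 3) (γ := 11 * C ^ 3 * k)
    (by positivity) (by positivity) (by positivity) (fun u hu => ?_) (fun u hu => ?_) fun u => ?_
  · refine key.trans (le_of_eq ?_)
    field_simp
    ring
  · have hu' : D (a u, b u, V u) = 0 := hu
    change ‖G (T u, D (a u, b u, V u))‖ ≤ C * (10 / k ^ 3) * ‖(u : E)‖
    rw [hu', mul_assoc]
    refine (hG _).trans (mul_le_mul_of_nonneg_left ?_ hC0.le)
    exact norm_prod_le_iff.2 ⟨hT u, by rw [norm_zero]; positivity⟩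
  · have hu' : V u = 0 := hu
    have n := norm_nonneg (u : E)
    change ‖G (T u, D (a u, b u, V u))‖ ≤ 10 * C ^ 3 * ‖(u : E)‖
    have h1 : ‖D (a u, b u, V u)‖ ≤ C * (C * ‖(u : E)‖) :=
      (hD _).trans (mul_le_mul_of_nonneg_left (norm_prod_le_iff.2
        ⟨ha u, norm_prod_le_iff.2 ⟨hb u, by rw [hu', norm_zero]; positivity⟩⟩) hC0.le)
    have h3 : ‖(u : E)‖ ≤ C ^ 2 * ‖(u : E)‖ := le_mul_of_one_le_left n c2
    calc ‖G (T u, D (a u, b u, V u))‖ ≤ C * (10 * C ^ 2 * ‖(u : E)‖) :=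
          (hG _).trans (mul_le_mul_of_nonneg_left (norm_prod_le_iff.2
            ⟨(hT' u).trans (by linarith), h1.trans (by linarith)⟩) hC0.le)
      _ = 10 * C ^ 3 * ‖(u : E)‖ := by ring
  · have n := norm_nonneg (u : E)
    change ‖G (T u, D (a u, b u, V u))‖ ≤ 11 * C ^ 3 * k * ‖(u : E)‖
    have h0 : ‖(u : E)‖ ≤ k * ‖(u : E)‖ := le_mul_of_one_le_left n hk
    have h4 : C * ‖(u : E)‖ ≤ C * (11 * k * ‖(u : E)‖) :=
      mul_le_mul_of_nonneg_left (by linarith) hC0.le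
    have h1 : ‖D (a u, b u, V u)‖ ≤ C * (C * (11 * k * ‖(u : E)‖)) :=
      (hD _).trans (mul_le_mul_of_nonneg_left (norm_prod_le_iff.2
        ⟨(ha u).trans h4, norm_prod_le_iff.2 ⟨(hb u).trans h4, hVn u⟩⟩) hC0.le)
    have h3 : k * ‖(u : E)‖ ≤ C ^ 2 * (k * ‖(u : E)‖) :=
      le_mul_of_one_le_left (by positivity) c2
    calc ‖G (T u, D (a u, b u, V u))‖ ≤ C * (11 * C ^ 2 * (k * ‖(u : E)‖)) :=
          (hG _).trans (mul_le_mul_of_nonneg_left (norm_prod_le_iff.2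
            ⟨(hT' u).trans (by linarith), h1.trans (by linarith)⟩) hC0.le)
      _ = 11 * C ^ 3 * k * ‖(u : E)‖ := by ring

/-- The derivative of a map of constant norm is orthogonal to the map. -/
theorem inner_eq_zero_of_norm_const {E F : Type*} [NormedAddCommGroup E] [NormedSpace ℝ E]
    [NormedAddCommGroup F] [InnerProductSpace ℝ F] {f : E → F} {f' : E →L[ℝ] F} {x : E}
    (hf : HasFDerivAt f f' x) (h : ∀ y, ‖f y‖ = 1) (u : E) : ⟪f x, f' u⟫ = 0 := by
  have h1 := hf.norm_sq
  have h2 : HasFDerivAt (fun y => ‖f y‖ ^ 2) (0 : E →L[ℝ] ℝ) x := by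
    simp only [h]
    exact hasFDerivAt_const _ _
  have := DFunLike.congr_fun (h1.unique h2) u
  simpa using this

theorem contDiff_splitSeven : ContDiff ℝ 1 splitSeven := by
  have h : ContDiff ℝ 1 fun X : EucA 7 => fullTwist 0 0 (splitSeven X) :=
    (contDiff_fullTwist 0).comp (contDiff_const.prodMk contDiff_id)
  simpa only [fullTwist_zero] using h

/-- The suspension coordinates of the target. -/
def suspPoint (p : ℝ × ℍ[ℝ]) : EucA 5 := toFive (suspC p.1) (suspS p.1 • p.2)

theorem contDiff_suspPoint : ContDiff ℝ 1 suspPoint :=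
  toFiveL.contDiff.comp ((contDiff_suspC.comp contDiff_fst).prodMk
    ((contDiff_suspS.comp contDiff_fst).smul contDiff_snd))

theorem exists_lamNorm_twistedMap_le : ∃ C : ℝ, 1 ≤ C ∧ ∀ k : ℝ, 200 ≤ k → ∀ x : EucA 7, ‖x‖ = 1 →
    ∀ S : Submodule ℝ (EucA 7), lamNorm 4 ((fderiv ℝ (twistedMap k) x).toLinearMap ∘ₗ S.subtype) ≤
      60500 * C ^ 10 / k := by
  have hA : ContDiff ℝ 1 fun X => radA (splitSeven X).2 :=
    contDiff_radA.comp (contDiff_snd.comp contDiff_splitSeven)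
  have hB : ContDiff ℝ 1 fun X => radB (splitSeven X).2 :=
    contDiff_radB.comp (contDiff_snd.comp contDiff_splitSeven)
  obtain ⟨C₁, h₁⟩ := exists_bound_fderiv contDiff_suspPoint
  obtain ⟨C₂, h₂⟩ := exists_bound_fderiv contDiff_coreSphere
  obtain ⟨C₃, h₃⟩ := exists_bound_fderiv contDiff_ballC
  obtain ⟨C₄, h₄⟩ := exists_bound_fderiv hA
  obtain ⟨C₅, h₅⟩ := exists_bound_fderiv hB
  obtain ⟨C, hC⟩ : ∃ C, C ∈ upperBounds {1, C₁, C₂, C₃, C₄, C₅} :=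
    (Set.toFinite ({1, C₁, C₂, C₃, C₄, C₅} : Set ℝ)).bddAbove
  have c0 : 1 ≤ C := hC (by simp)
  have c1 : C₁ ≤ C := hC (by simp)
  have c2 : C₂ ≤ C := hC (by simp)
  have c3 : C₃ ≤ C := hC (by simp)
  have c4 : C₄ ≤ C := hC (by simp)
  have c5 : C₅ ≤ C := hC (by simp)
  refine ⟨C, c0, fun k hk x hx S => ?_⟩
  have hk1 : 1 ≤ k := by linarith
  have hpos : 0 ≤ 60500 * C ^ 10 / k := by positivity
  have hΘ := contDiff_fullTwist_one k
  have hΘ1 : ContDiff ℝ 1 fun X : EucA 7 => (fullTwist 1 k (splitSeven X)).1 :=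
    contDiff_fst.comp hΘ
  have hev := twistedMap_eventuallyEq k hx
  have hcont := hΘ.continuous.continuousAt (x := x)
  rcases fullTwist_good (r := 1) abs_one.le hk (X := x) (by rw [hx]; norm_num) with h | h
  · refine (lamNorm_four_of_factor (g := fun T => toFive (suspC T) 0)
      (toFiveL.contDiff.comp (contDiff_suspC.prodMk contDiff_const)) hΘ1
      (hev.trans (hcont.eventually (suspMap_eventuallyEq_of_lt h))) S).trans hpos
  by_cases hs : InSector (fullTwist 1 k (splitSeven x)).2
  swap
  · refine (lamNorm_four_of_factor (g := fun T => toFive (suspC T) (suspS T • 1))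
      (toFiveL.contDiff.comp (contDiff_suspC.prodMk (contDiff_suspS.smul contDiff_const))) hΘ1
      (hev.trans (hcont.eventually (suspMap_eventuallyEq_of_not hs h))) S).trans hpos
  obtain ⟨T', Z', hT, hZ, bT, bZ⟩ := twist_sector_estimate hk1 hx hs
  obtain ⟨n0, n1, n2, n3⟩ := norm_splitSeven_le x
  rw [hx] at n0 n1 n2 n3
  set ζ := (fullTwist 1 k (splitSeven x)).2 with hζ
  have m1 : ‖ζ.1‖ ≤ 1 := by rw [hζ]; simpa only [fullTwist, norm_twistZ] using n1
  have m2 : ‖ζ.2.1‖ ≤ 1 := by rw [hζ]; simpa only [fullTwist, norm_twistZ] using n2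
  have m3 : ‖ζ.2.2‖ ≤ 1 := by rw [hζ]; simpa only [fullTwist, norm_twistZ] using n3
  have mζ : ‖ζ‖ ≤ 2 := norm_prod_le_iff.2
    ⟨by linarith, norm_prod_le_iff.2 ⟨by linarith, by linarith⟩⟩
  have hV := (contDiff_ballC.differentiable one_ne_zero ζ).hasFDerivAt.comp x hZ
  have hA' := (hA.differentiable one_ne_zero x).hasFDerivAt
  have hB' := (hB.differentiable one_ne_zero x).hasFDerivAt
  have nball : ∀ w, ‖ballC w‖ = 1 := fun w => norm_bubbleS _ _ _
  have nc : ‖coreC ζ‖ = 1 := norm_coreMap _ _ _ _ _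
  set P : ℝ × ℝ × ℍ[ℝ] := (radA (splitSeven x).2, radB (splitSeven x).2, ballC ζ) with hP
  have hradA : ∀ X, radA (fullTwist 1 k (splitSeven X)).2 = radA (splitSeven X).2 := fun X =>
    radA_fullTwist 1 k _
  have hradB : ∀ X, radB (fullTwist 1 k (splitSeven X)).2 = radB (splitSeven X).2 := fun X =>
    radB_fullTwist 1 k _
  have hcP : coreC ζ = coreSphere P := by rw [coreC_eq, hζ, hradA, hradB]
  have hPn : ‖P‖ ≤ 2 := by
    have q : ∀ z : ℂ, ‖z‖ ≤ 1 → 0 ≤ Complex.normSq z ∧ Complex.normSq z ≤ 1 := fun z hz => by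
      rw [Complex.normSq_eq_norm_sq]
      exact ⟨sq_nonneg _, pow_le_one₀ (norm_nonneg _) hz⟩
    have q1 := q _ n1
    have q2 := q _ n2
    have q3 := q _ n3
    refine norm_prod_le_iff.2 ⟨?_, norm_prod_le_iff.2 ⟨?_, ?_⟩⟩
    · rw [Real.norm_eq_abs]
      exact abs_le.2 ⟨by simp only [hP, radA]; linarith, by simp only [hP, radA]; linarith⟩
    · rw [Real.norm_eq_abs]
      exact abs_le.2 ⟨by simp only [hP, radB]; linarith, by simp only [hP, radB]; linarith⟩
    · exact (nball ζ).le.trans (by norm_num)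
  have hW : HasFDerivAt (fun X => coreC (fullTwist 1 k (splitSeven X)).2)
      ((fderiv ℝ coreSphere P).comp ((fderiv ℝ (fun X => radA (splitSeven X).2) x).prod
        ((fderiv ℝ (fun X => radB (splitSeven X).2) x).prod ((fderiv ℝ ballC ζ).comp Z')))) x := by
    have := (contDiff_coreSphere.differentiable one_ne_zero P).hasFDerivAt.comp x
      (hA'.prodMk (hB'.prodMk hV))
    refine this.congr_of_eventuallyEq (Eventually.of_forall fun X => ?_)
    simp only [Function.comp_apply, coreC_eq, hradA, hradB]
  have hTn : ‖((fullTwist 1 k (splitSeven x)).1, coreC ζ)‖ ≤ 2 := by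
    have := abs_fullTwist_sub_le (r := 1) abs_one.le hk (splitSeven x)
    refine norm_prod_le_iff.2 ⟨?_, nc.le.trans (by norm_num)⟩
    rw [abs_le] at this n0
    rw [Real.norm_eq_abs]
    exact abs_le.2 ⟨by linarith [this.1, n0.1], by linarith [this.2, n0.2]⟩
  have hF : HasFDerivAt (twistedMap k) _ x :=
    (HasFDerivAt.comp (g := suspPoint) x (contDiff_suspPoint.differentiable one_ne_zero
      ((fullTwist 1 k (splitSeven x)).1, coreC ζ)).hasFDerivAt
        (hT.prodMk hW)).congr_of_eventuallyEq
      (hev.trans (hcont.eventually (suspMap_eventuallyEq_of_inSector hs)))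
  rw [hF.fderiv]
  have up : ∀ {c t n : ℝ}, c ≤ C → 0 ≤ n → t ≤ c * n → t ≤ C * n := fun h1 h2 h3 =>
    h3.trans (mul_le_mul_of_nonneg_right h1 h2)
  refine lamNorm_four_comp_le _ _ _ _ _ _ S nc (nball ζ) (bubbleS_re _ _ _)
    (fun u => inner_eq_zero_of_norm_const hW (fun X => norm_coreMap _ _ _ _ _) u)
    (fun u => inner_eq_zero_of_norm_const hV (fun X => nball _) u) (fun u => ?_) c0 hk1
    (fun p => up c1 (norm_nonneg p) (h₁ _ hTn p)) (fun p => up c2 (norm_nonneg p) (h₂ _ hPn p))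
    (fun u => up c4 (norm_nonneg u) (h₄ x (hx.le.trans (by norm_num)) u))
    (fun u => up c5 (norm_nonneg u) (h₅ x (hx.le.trans (by norm_num)) u)) bT fun u => ?_
  · have hi : ∀ q : ℍ[ℝ], innerSL ℝ (1 : ℍ[ℝ]) q = q.re := fun q => by
      simp [Quaternion.inner_def]
    have hr := ((innerSL ℝ (1 : ℍ[ℝ])).hasFDerivAt (x := ballC ζ)).comp x hV
    have h0 : HasFDerivAt (innerSL ℝ (1 : ℍ[ℝ]) ∘ (ballC ∘ fun X =>
        (fullTwist 1 k (splitSeven X)).2)) (0 : EucA 7 →L[ℝ] ℝ) x := by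
      have : (innerSL ℝ (1 : ℍ[ℝ]) ∘ (ballC ∘ fun X : EucA 7 =>
          (fullTwist 1 k (splitSeven X)).2)) = fun _ => 0 := funext fun X =>
        (hi _).trans (bubbleS_re _ _ _)
      rw [this]
      exact hasFDerivAt_const _ _
    exact (hi _).symm.trans (DFunLike.congr_fun (hr.unique h0) u)
  · exact (up c3 (norm_nonneg _) (h₃ ζ mζ (Z' u))).trans
      (mul_le_mul_of_nonneg_left (bZ u) (by linarith))

theorem exists_twistedMap_dilation_lt {ε : ℝ} (hε : 0 < ε) :
    ∃ k : ℝ, 200 ≤ k ∧ kDilation 4 (twistedMap k) < ε := by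
  obtain ⟨C, hC, h⟩ := exists_lamNorm_twistedMap_le
  have hp : 0 ≤ 60500 * C ^ 10 := by positivity
  refine ⟨200 + 60500 * C ^ 10 / ε, le_add_of_nonneg_right (by positivity), ?_⟩
  have hk : 0 < 200 + 60500 * C ^ 10 / ε := by positivity
  refine lt_of_le_of_lt (Real.iSup_le (fun x => h _ (le_add_of_nonneg_right (by positivity)) x
    (mem_sphere_zero_iff_norm.1 x.2) _) (by positivity)) ?_
  rw [div_lt_iff₀ hk, mul_add, mul_div_cancel₀ _ hε.ne']
  linarith

end DilationBound

end SphereMaps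

/-- For every `ε > 0` there exists a homotopically non-trivial `C¹` map from `S^6` to
`S^4` with `4`-dilation less than `ε`.  (The class of such a map is the non-trivial element of `π₆(S⁴) ≅ ℤ/2`, a double suspension of a class in `π₄(S²)`.)
(`S^6 = usph 7 ⊆ ℝ^7`, `S^4 = usph 5 ⊆ ℝ^5`; a `C¹` map of spheres is
represented by a `C¹` ambient map sending the unit sphere to the unit sphere.) -/
theorem nontrivial_small_4dilation_S6_S4 :
    ∀ ε : ℝ, 0 < ε →
      ∃ F : EucA 7 → EucA 5,
        ContDiff ℝ 1 F ∧
        MapsTo F (usph 7) (usph 5) ∧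
        ¬ SphereNullhomotopic F ∧
        kDilation 4 F < ε := by
  intro ε hε
  obtain ⟨k, hk, h⟩ := exists_twistedMap_dilation_lt hε
  exact ⟨twistedMap k, contDiff_twistedMap hk, mapsTo_twistedMap k,
    not_sphereNullhomotopic_twistedMap hk, h⟩
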